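/- Let d ≥ 1, p ∈ (1,2], let L = (1/2)∑_{i,j} a_{ij}(x) ∂²/∂x_i∂x_j + ∑_i b_i(x) ∂/∂x_i with a_{ij}, b_i locally Hölder continuous, a symmetric and strictly elliptic, and let α₁, α₂, β₁, β₂ : ℝ^d → ℝ be locally Hölder continuous with β₁ ≤ β₂ pointwise, β₂ bounded from above, and 0 < α₂(x) ≤ α₁(x) for all x. If the only continuous nonnegative function u : ℝ^d × [0,∞) → ℝ that is twice continuously differentiable in x and once in t on ℝ^d × (0,∞), satisfies ∂u/∂t = Lu + β₂(x)u − α₂(x)u^p there, and satisfies u(·,0) = 0, is u ≡ 0, then the same uniqueness holds with β₂ replaced by β₁ and α₂ replaced by α₁. -/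

import Mathlib

open Set

/-- The `i`-th partial derivative of a function on `ℝ^d`. -/
noncomputable def pd {d : ℕ} (i : Fin d) (f : EuclideanSpace ℝ (Fin d) → ℝ)
    (x : EuclideanSpace ℝ (Fin d)) : ℝ :=
  fderiv ℝ f x (EuclideanSpace.single i 1)

/-- `f` is locally Hölder continuous. -/
def LocHolder {d : ℕ} (f : EuclideanSpace ℝ (Fin d) → ℝ) : Prop :=
  ∀ K : Set (EuclideanSpace ℝ (Fin d)), IsCompact K →
    ∃ κ C : ℝ, 0 < κ ∧ κ ≤ 1 ∧ 0 ≤ C ∧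
      ∀ x ∈ K, ∀ y ∈ K, |f x - f y| ≤ C * ‖x - y‖ ^ κ

/-- The only nonnegative classical solution of `u_t = Lu + βu − αu^p` with zero
initial data (where `L = (1/2)∑ a_{ij}∂_i∂_j + ∑ b_i ∂_i`) is `u ≡ 0`. -/
def UniqueZeroSol {d : ℕ} (a : Fin d → Fin d → EuclideanSpace ℝ (Fin d) → ℝ)
    (b : Fin d → EuclideanSpace ℝ (Fin d) → ℝ)
    (β α : EuclideanSpace ℝ (Fin d) → ℝ) (p : ℝ) : Prop :=
  ∀ u : EuclideanSpace ℝ (Fin d) → ℝ → ℝ,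
    ContinuousOn (fun q : EuclideanSpace ℝ (Fin d) × ℝ => u q.1 q.2)
      (univ ×ˢ Ici (0 : ℝ)) →
    (∀ x t, 0 ≤ t → 0 ≤ u x t) →
    (∀ t : ℝ, 0 < t → ContDiff ℝ 2 (fun x => u x t)) →
    (∀ x, ContDiffOn ℝ 1 (fun s => u x s) (Ioi (0 : ℝ))) →
    (∀ x t, 0 < t →
      deriv (fun s => u x s) t =
        (1 / 2) * ∑ i, ∑ j, a i j x * pd i (pd j (fun y => u y t)) x
          + ∑ i, b i x * pd i (fun y => u y t) x
          + β x * u x t - α x * u x t ^ p) →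
    (∀ x, u x 0 = 0) →
    ∀ x t, 0 ≤ t → u x t = 0

open MeasureTheory ProbabilityTheory Filter Topology

section Heat

set_option linter.unusedSectionVars false

variable {E : Type*} [NormedAddCommGroup E] [InnerProductSpace ℝ E] [FiniteDimensional ℝ E]
  [MeasurableSpace E] [BorelSpace E]
  {F : Type*} [NormedAddCommGroup F] [NormedSpace ℝ F]

/-- The heat semigroup `exp(tΔ/2)`. -/
noncomputable def heatP (t : ℝ) (f : E → F) (x : E) : F :=
  ∫ z, f (x + √t • z) ∂(stdGaussian E)

/-- The spatial derivative of the heat semigroup. -/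
noncomputable def heatD (t : ℝ) (f : E → F) (x : E) : E →L[ℝ] F :=
  (√t)⁻¹ • ∫ z, (innerSL ℝ z).smulRight (f (x + √t • z)) ∂(stdGaussian E)

variable (E) in
/-- A moment of the standard Gaussian measure. -/
noncomputable def gaussC : ℝ := ∫ z, (1 + ‖z‖) ^ 3 ∂(stdGaussian E)

lemma integrable_one_add_norm_pow : Integrable (fun z : E => (1 + ‖z‖) ^ 3) (stdGaussian E) := by
  have h : MemLp (id : E → E) 3 (stdGaussian E) := IsGaussian.memLp_id _ 3 (by simp)
  have h2 : MemLp (fun z : E => 1 + ‖z‖) 3 (stdGaussian E) :=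
    (memLp_const (1 : ℝ)).add h.norm
  have := h2.integrable_norm_pow (by norm_num)
  refine this.congr (Eventually.of_forall fun z => ?_)
  simp only [Real.norm_eq_abs]
  rw [abs_of_nonneg (by positivity)]

lemma gaussC_nonneg : 0 ≤ gaussC E := integral_nonneg fun z => by positivity

lemma one_le_gaussC : 1 ≤ gaussC E := by
  have h : ∫ _z : E, (1 : ℝ) ∂(stdGaussian E) ≤ gaussC E := by
    apply integral_mono (integrable_const _) integrable_one_add_norm_pow
    intro z
    exact one_le_pow₀ (by linarith [norm_nonneg z])
  simpa using h

lemma stdGaussian_eq_withDensity :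
    ∃ c : ℝ, 0 ≤ c ∧ stdGaussian E
      = (volume : Measure E).withDensity (fun z => ENNReal.ofReal (c * Real.exp (-‖z‖ ^ 2 / 2))) := by
  set I : ℝ := ∫ z : E, Real.exp (-(1 / 2) * ‖z‖ ^ 2) with hI
  have hIval : I = (Real.pi / (1 / 2)) ^ (Module.finrank ℝ E / 2 : ℝ) :=
    GaussianFourier.integral_rexp_neg_mul_sq_norm (by norm_num)
  have hIpos : 0 < I := by rw [hIval]; positivity
  have hitg : Integrable (fun z : E => Real.exp (-‖z‖ ^ 2 / 2)) := by
    by_contra h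
    have : I = 0 := by
      rw [hI]
      apply integral_undef
      convert h using 4
      ring
    exact hIpos.ne' this
  refine ⟨I⁻¹, by positivity, ?_⟩
  set ν := (volume : Measure E).withDensity
    (fun z => ENNReal.ofReal (I⁻¹ * Real.exp (-‖z‖ ^ 2 / 2))) with hν
  have hfin : IsFiniteMeasure ν := by
    apply isFiniteMeasure_withDensity_ofReal
    exact (hitg.const_mul _).2
  apply Measure.ext_of_charFun
  ext t
  rw [charFun_stdGaussian, charFun_apply, hν,
    integral_withDensity_eq_integral_toReal_smul (by fun_prop) (by simp)]
  have h1 : ∀ z : E, (ENNReal.ofReal (I⁻¹ * Real.exp (-‖z‖ ^ 2 / 2))).toReal •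
      Complex.exp (inner ℝ z t * Complex.I)
      = (I⁻¹ : ℂ) * Complex.exp (-(1 / 2 : ℂ) * ‖z‖ ^ 2 + Complex.I * inner ℝ t z) := by
    intro z
    rw [ENNReal.toReal_ofReal (by positivity), Complex.real_smul]
    push_cast
    rw [mul_assoc, ← Complex.exp_add, real_inner_comm]
    congr 2
    ring
  simp_rw [h1]
  rw [integral_const_mul, GaussianFourier.integral_cexp_neg_mul_sq_norm_add (by norm_num), hIval]
  have : (Complex.I ^ 2 * (‖t‖ : ℂ) ^ 2 / (4 * (1 / 2))) = - (‖t‖ : ℂ) ^ 2 / 2 := by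
    rw [Complex.I_sq]; ring
  rw [this]
  have h3 : (((Real.pi / (1 / 2)) ^ (Module.finrank ℝ E / 2 : ℝ) : ℝ) : ℂ)
      = ((Real.pi : ℂ) / (1 / 2)) ^ (Module.finrank ℝ E / 2 : ℂ) := by
    rw [Complex.ofReal_cpow (by positivity)]
    push_cast
    rfl
  rw [h3, ← mul_assoc, inv_mul_cancel₀, one_mul]
  rw [← h3]
  exact_mod_cast (hIval ▸ hIpos).ne'

variable {f : E → F} {M : ℝ}

lemma integrable_of_cont_bdd (hf : Continuous f) (hM : ∀ x, ‖f x‖ ≤ M) (x : E) (r : ℝ) :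
    Integrable (fun z => f (x + r • z)) (stdGaussian E) :=
  Integrable.of_bound (by fun_prop) M (Eventually.of_forall fun z => hM _)

lemma heatP_zero [CompleteSpace F] (f : E → F) : heatP 0 f = f := by
  ext x; simp [heatP]

lemma norm_heatP_le (hM : ∀ x, ‖f x‖ ≤ M) (t : ℝ) (x : E) : ‖heatP t f x‖ ≤ M := by
  have := norm_integral_le_of_norm_le_const (μ := stdGaussian E)
    (f := fun z => f (x + √t • z)) (C := M) (Eventually.of_forall fun z => hM _)
  simpa [heatP] using this

lemma integrable_smulRight (hf : Continuous f) (hM : ∀ x, ‖f x‖ ≤ M) (x : E) (r : ℝ) :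
    Integrable (fun z => (innerSL ℝ z).smulRight (f (x + r • z))) (stdGaussian E) := by
  have hM0 : 0 ≤ M := (norm_nonneg _).trans (hM 0)
  refine Integrable.mono' (integrable_one_add_norm_pow.mul_const M) ?_
    (Eventually.of_forall fun z => ?_)
  · have : ProperSpace E := FiniteDimensional.proper_real E
    have : SecondCountableTopologyEither E (E →L[ℝ] F) := ⟨Or.inl inferInstance⟩
    apply Continuous.aestronglyMeasurable
    exact (ContinuousLinearMap.smulRightL ℝ E F).continuous₂.comp
      ((innerSL ℝ).continuous.prodMk (hf.comp (by fun_prop)))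
  · rw [ContinuousLinearMap.norm_smulRight_apply, innerSL_apply_norm]
    apply mul_le_mul _ (hM _) (norm_nonneg _) (by positivity)
    nlinarith [norm_nonneg z, sq_nonneg ‖z‖, mul_nonneg (norm_nonneg z) (sq_nonneg ‖z‖)]

lemma norm_heatD_le_aux {t : ℝ} {g : E → ℝ} (x : E) {B : ℝ} 
    (hg : ∀ z, ‖z‖ * ‖f (x + √t • z)‖ ≤ g z) (hgi : ∫ z, g z ∂(stdGaussian E) ≤ B)
    (hgI : Integrable g (stdGaussian E)) :
    ‖heatD t f x‖ ≤ (√t)⁻¹ * B := by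
  rw [heatD, norm_smul, norm_inv, Real.norm_of_nonneg (Real.sqrt_nonneg t)]
  gcongr
  refine (norm_integral_le_of_norm_le hgI (Eventually.of_forall fun z => ?_)).trans hgi
  rw [ContinuousLinearMap.norm_smulRight_apply, innerSL_apply_norm]
  exact hg z

lemma norm_heatD_le (hM : ∀ x, ‖f x‖ ≤ M) (t : ℝ) (x : E) :
    ‖heatD t f x‖ ≤ (√t)⁻¹ * (gaussC E * M) := by
  have hM0 : 0 ≤ M := (norm_nonneg _).trans (hM 0)
  refine norm_heatD_le_aux x (g := fun z => (1 + ‖z‖) ^ 3 * M) (fun z => ?_) ?_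
    (integrable_one_add_norm_pow.mul_const M)
  · apply mul_le_mul _ (hM _) (norm_nonneg _) (by positivity)
    nlinarith [norm_nonneg z, sq_nonneg ‖z‖, mul_nonneg (norm_nonneg z) (sq_nonneg ‖z‖)]
  · rw [integral_mul_const, gaussC]

lemma integral_innerSL_smulRight [CompleteSpace F] (c : F) :
    ∫ z, (innerSL ℝ z).smulRight c ∂(stdGaussian E) = (0 : E →L[ℝ] F) := by
  have h : ∀ z : E, (innerSL ℝ z).smulRight c
      = ((ContinuousLinearMap.smulRightL ℝ E F).flip c ∘L (innerSL ℝ)) z := fun z => rfl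
  simp_rw [h]
  have h2 := ContinuousLinearMap.integral_comp_comm (μ := stdGaussian E) (φ := fun z : E => z)
    ((ContinuousLinearMap.smulRightL ℝ E F).flip c ∘L (innerSL ℝ)) IsGaussian.integrable_id
  rw [h2]
  have : ∫ z : E, z ∂(stdGaussian E) = 0 := integral_id_stdGaussian
  rw [this, map_zero]

lemma heatD_sub_const [CompleteSpace F] (hf : Continuous f) (hM : ∀ x, ‖f x‖ ≤ M) (t : ℝ) (x : E)
    (c : F) : heatD t f x = heatD t (fun y => f y - c) x := by
  rw [heatD, heatD]
  congr 1
  have : ∀ z : E, (innerSL ℝ z).smulRight (f (x + √t • z) - c)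
      = (innerSL ℝ z).smulRight (f (x + √t • z)) - (innerSL ℝ z).smulRight c := by
    intro z; ext v; simp [smul_sub]
  simp_rw [this]
  rw [integral_sub (integrable_smulRight hf hM x _), integral_innerSL_smulRight, sub_zero]
  exact integrable_smulRight (f := fun _ : E => c) continuous_const (fun _ => le_rfl) x 0

lemma norm_heatD_le_holder [CompleteSpace F] (hf : Continuous f) (hM : ∀ x, ‖f x‖ ≤ M) {κ H : ℝ}
    (hκ : 0 ≤ κ) (hκ1 : κ ≤ 1) (hH : ∀ x y, ‖f x - f y‖ ≤ H * ‖x - y‖ ^ κ) (hH0 : 0 ≤ H)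
    (t : ℝ) (x : E) :
    ‖heatD t f x‖ ≤ (√t)⁻¹ * (gaussC E * (H * √t ^ κ)) := by
  rw [heatD_sub_const hf hM t x (f x)]
  refine norm_heatD_le_aux x (g := fun z => (1 + ‖z‖) ^ 3 * (H * √t ^ κ)) (fun z => ?_) ?_
    (integrable_one_add_norm_pow.mul_const _)
  · have h1 := hH (x + √t • z) x
    rw [add_sub_cancel_left, norm_smul, Real.norm_of_nonneg (Real.sqrt_nonneg t),
      Real.mul_rpow (Real.sqrt_nonneg _) (norm_nonneg _)] at h1
    have h2 : ‖z‖ ^ κ ≤ 1 + ‖z‖ := by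
      calc ‖z‖ ^ κ ≤ (1 + ‖z‖) ^ κ :=
            Real.rpow_le_rpow (norm_nonneg _) (by linarith [norm_nonneg z]) hκ
        _ ≤ (1 + ‖z‖) ^ (1 : ℝ) :=
            Real.rpow_le_rpow_of_exponent_le (by linarith [norm_nonneg z]) hκ1
        _ = _ := Real.rpow_one _
    have hB : 0 ≤ H * √t ^ κ := by positivity
    calc ‖z‖ * ‖f (x + √t • z) - f x‖ ≤ ‖z‖ * ((1 + ‖z‖) * (H * √t ^ κ)) := by
          gcongr
          refine h1.trans ?_
          calc H * (√t ^ κ * ‖z‖ ^ κ) = ‖z‖ ^ κ * (H * √t ^ κ) := by ring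
            _ ≤ _ := by gcongr
      _ = (‖z‖ * (1 + ‖z‖)) * (H * √t ^ κ) := by ring
      _ ≤ _ := by
          gcongr
          nlinarith [norm_nonneg z, sq_nonneg ‖z‖, mul_nonneg (norm_nonneg z) (sq_nonneg ‖z‖)]
  · rw [integral_mul_const, gaussC]

lemma gauss_weight_bound {a w : ℝ} (ha : 0 ≤ a) (hw : w ≤ a + 1) (hw0 : 0 ≤ w) :
    Real.exp (-a ^ 2 / 2) * a ≤ 2 * Real.exp (-(1 / 8) * w ^ 2) := by
  have h1 : a ≤ Real.exp (a ^ 2 / 4) := by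
    have := Real.add_one_le_exp (a ^ 2 / 4)
    nlinarith [sq_nonneg (a / 2 - 1)]
  have h2 : Real.exp (1 / 4) ≤ 2 := by
    have := Real.exp_one_lt_d9
    have h4 : Real.exp (1 / 4) ≤ Real.exp 0.5 := Real.exp_le_exp.2 (by norm_num)
    have h5 : Real.exp 0.5 ^ 2 = Real.exp 1 := by rw [← Real.exp_nat_mul]; norm_num
    nlinarith [Real.exp_pos (0.5 : ℝ)]
  calc Real.exp (-a ^ 2 / 2) * a ≤ Real.exp (-a ^ 2 / 2) * Real.exp (a ^ 2 / 4) := by gcongr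
    _ = Real.exp (-a ^ 2 / 4) := by rw [← Real.exp_add]; ring_nf
    _ ≤ Real.exp (1 / 4 + -(1 / 8) * w ^ 2) := by
        apply Real.exp_le_exp.2
        nlinarith [sq_nonneg (a - 1)]
    _ = Real.exp (1 / 4) * Real.exp (-(1 / 8) * w ^ 2) := Real.exp_add _ _
    _ ≤ _ := by gcongr

lemma integrable_exp_eighth (b : E) :
    Integrable (fun z : E => Real.exp (-(1 / 8) * ‖z - b‖ ^ 2)) := by
  have h : Integrable (fun z : E => Real.exp (-(1 / 8) * ‖z‖ ^ 2)) := by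
    by_contra h
    have h1 := integral_undef h
    rw [GaussianFourier.integral_rexp_neg_mul_sq_norm (by norm_num)] at h1
    have : 0 < (Real.pi / (1 / 8)) ^ (Module.finrank ℝ E / 2 : ℝ) := by positivity
    exact this.ne' h1
  exact h.comp_sub_right b

lemma integral_stdGaussian_shift {c : ℝ} (hc : 0 ≤ c) (hγ : stdGaussian E
      = (volume : Measure E).withDensity (fun z => ENNReal.ofReal (c * Real.exp (-‖z‖ ^ 2 / 2))))
    (g : E → F) (k : E) : ∫ z, g z ∂(stdGaussian E)
      = ∫ z, (c * Real.exp (-‖z - k‖ ^ 2 / 2)) • g (z - k) := by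
  rw [hγ, integral_withDensity_eq_integral_toReal_smul (by fun_prop) (by simp),
    ← integral_sub_right_eq_self _ k]
  refine integral_congr_ae (Eventually.of_forall fun z => ?_)
  simp only
  rw [ENNReal.toReal_ofReal (by positivity)]

lemma hasFDerivAt_gauss_shift [CompleteSpace F] (hf : Continuous f) (hM : ∀ x, ‖f x‖ ≤ M) (h : E) :
    HasFDerivAt (fun k => ∫ z, f (k + z) ∂(stdGaussian E))
      (∫ z, (innerSL ℝ z).smulRight (f (h + z)) ∂(stdGaussian E)) h := by
  have hM0 : 0 ≤ M := (norm_nonneg _).trans (hM 0)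
  have : ProperSpace E := FiniteDimensional.proper_real E
  have : SecondCountableTopologyEither E (E →L[ℝ] F) := ⟨Or.inl inferInstance⟩
  obtain ⟨c, hc, hγ⟩ := stdGaussian_eq_withDensity (E := E)
  set ρ : E → ℝ := fun z => c * Real.exp (-‖z‖ ^ 2 / 2) with hρ
  have hρ0 : ∀ z, 0 ≤ ρ z := fun z => by positivity
  have key := fun (k : E) => integral_stdGaussian_shift hc hγ (fun z => f (k + z)) k
  have e1 : (fun k => ∫ z, f (k + z) ∂(stdGaussian E)) = fun k => ∫ z, ρ (z - k) • f z := by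
    ext k
    rw [key k]
    simp [hρ]
  have e2 : ∫ z, (innerSL ℝ z).smulRight (f (h + z)) ∂(stdGaussian E)
      = ∫ z, ρ (z - h) • (innerSL ℝ (z - h)).smulRight (f z) := by
    rw [integral_stdGaussian_shift hc hγ _ h]
    simp [hρ]
  rw [e1, e2]
  refine hasFDerivAt_integral_of_dominated_of_fderiv_le (s := Metric.ball h 1)
    (F' := fun k z => ρ (z - k) • (innerSL ℝ (z - k)).smulRight (f z))
    (bound := fun z => c * (2 * Real.exp (-(1 / 8) * ‖z - h‖ ^ 2)) * M)
    (Metric.ball_mem_nhds _ one_pos) ?_ ?_ ?_ ?_ ?_ ?_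
  · refine Eventually.of_forall fun k => Continuous.aestronglyMeasurable ?_
    fun_prop
  · have : Integrable (fun z : E => c * Real.exp (-(1/8) * ‖z - h‖ ^ 2) * M) :=
      ((integrable_exp_eighth h).const_mul c).mul_const M
    refine this.mono' (Continuous.aestronglyMeasurable (by fun_prop))
      (Eventually.of_forall fun z => ?_)
    rw [norm_smul, Real.norm_of_nonneg (hρ0 _)]
    gcongr
    · simp only [hρ]
      gcongr
      nlinarith [sq_nonneg ‖z - h‖]
    · exact hM _
  · apply Continuous.aestronglyMeasurable
    have h1 : Continuous fun z => (innerSL ℝ (z - h)).smulRight (f z) :=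
      (ContinuousLinearMap.smulRightL ℝ E F).continuous₂.comp
      (((innerSL ℝ).continuous.comp (by fun_prop)).prodMk hf)
    exact Continuous.smul (f := fun z => ρ (z - h)) (by fun_prop) h1
  · refine Eventually.of_forall fun z k hk => ?_
    rw [norm_smul, Real.norm_of_nonneg (hρ0 _), ContinuousLinearMap.norm_smulRight_apply,
      innerSL_apply_norm, ← mul_assoc]
    refine mul_le_mul (b := c * (2 * Real.exp (-(1 / 8) * ‖z - h‖ ^ 2))) ?_ (hM z)
      (norm_nonneg _) (by positivity)
    simp only [hρ]
    rw [mul_assoc]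
    refine mul_le_mul_of_nonneg_left ?_ hc
    refine gauss_weight_bound (a := ‖z - k‖) (w := ‖z - h‖) (norm_nonneg (z - k)) ?_
      (norm_nonneg (z - h))
    rw [Metric.mem_ball, dist_eq_norm] at hk
    calc ‖z - h‖ = ‖(z - k) + (k - h)‖ := by congr 1; abel
      _ ≤ _ := (norm_add_le _ _).trans (by linarith)
  · exact (((integrable_exp_eighth h).const_mul 2).const_mul c).mul_const M
  · refine Eventually.of_forall fun z k _ => ?_
    have h1 : HasFDerivAt (fun k : E => ‖z - k‖ ^ 2) (-(2 • innerSL ℝ (z - k))) k := by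
      have := ((hasFDerivAt_id k).const_sub z).norm_sq
      refine this.congr_fderiv ?_
      ext v
      simp
      ring
    have h2 : HasFDerivAt (fun k : E => ρ (z - k)) (ρ (z - k) • innerSL ℝ (z - k)) k := by
      have h3 := ((h1.const_mul (-1 / 2)).exp).const_mul c
      have e : (fun k : E => ρ (z - k)) = fun y => c * Real.exp (-1 / 2 * ‖z - y‖ ^ 2) := by
        ext y; simp only [hρ]; congr 2; ring
      rw [e]
      refine h3.congr_fderiv ?_
      ext v
      simp only [hρ, smul_apply, smul_eq_mul, neg_apply,
        innerSL_apply_apply, nsmul_eq_mul]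
      have e2 : -‖z - k‖ ^ 2 / 2 = -1 / 2 * ‖z - k‖ ^ 2 := by ring
      rw [e2]
      push_cast
      ring
    have h4 := h2.smul_const (f z)
    refine h4.congr_fderiv ?_
    ext v
    simp [smul_smul]

lemma hasFDerivAt_heatP [CompleteSpace F] (hf : Continuous f) (hM : ∀ x, ‖f x‖ ≤ M) {t : ℝ}
    (ht : 0 < t) (x : E) : HasFDerivAt (heatP t f) (heatD t f x) x := by
  have hs : 0 < √t := Real.sqrt_pos.2 ht
  have hs' : √t * (√t)⁻¹ = 1 := mul_inv_cancel₀ hs.ne'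
  have h := hasFDerivAt_gauss_shift (f := fun y => f (√t • y)) (by fun_prop) (fun y => hM _)
    ((√t)⁻¹ • x)
  have h2 : HasFDerivAt (fun y : E => (√t)⁻¹ • y) ((√t)⁻¹ • ContinuousLinearMap.id ℝ E) x :=
    (hasFDerivAt_id x).const_smul _
  have h3 := HasFDerivAt.comp x h h2
  convert h3 using 1
  · ext y
    simp [heatP, smul_add, smul_smul, hs']
  · rw [heatD]
    ext v
    simp [smul_add, smul_smul, hs']

end Heat

section Heat2

set_option linter.unusedSectionVars false

variable {E : Type*} [NormedAddCommGroup E] [InnerProductSpace ℝ E] [FiniteDimensional ℝ E]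
  [MeasurableSpace E] [BorelSpace E]
  {F : Type*} [NormedAddCommGroup F] [NormedSpace ℝ F]
variable {f : E → F} {M : ℝ}

lemma map_stdGaussian_prod {s t : ℝ} (hs : 0 ≤ s) (ht : 0 ≤ t) :
    ((stdGaussian E).prod (stdGaussian E)).map (fun p => √s • p.1 + √t • p.2)
      = (stdGaussian E).map (fun z => √(s + t) • z) := by
  have h1 : ((stdGaussian E).prod (stdGaussian E)).map (fun p => √s • p.1 + √t • p.2)
      = ((stdGaussian E).map (fun z => √s • z)) ∗ ((stdGaussian E).map (fun z => √t • z)) := by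
    rw [Measure.conv, Measure.map_prod_map _ _ (by fun_prop) (by fun_prop),
      Measure.map_map (by fun_prop) (by fun_prop)]
    rfl
  have hp1 : IsProbabilityMeasure ((stdGaussian E).map (fun z => √s • z)) :=
    Measure.isProbabilityMeasure_map (by fun_prop)
  have hp2 : IsProbabilityMeasure ((stdGaussian E).map (fun z => √t • z)) :=
    Measure.isProbabilityMeasure_map (by fun_prop)
  have hp3 : IsProbabilityMeasure ((stdGaussian E).map (fun z => √(s + t) • z)) :=
    Measure.isProbabilityMeasure_map (by fun_prop)
  rw [h1]
  apply Measure.ext_of_charFun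
  ext v
  rw [charFun_conv, charFun_map_smul, charFun_map_smul, charFun_map_smul, charFun_stdGaussian,
    charFun_stdGaussian, charFun_stdGaussian, ← Complex.exp_add]
  simp only [norm_smul, Real.norm_eq_abs, Complex.ofReal_mul]
  rw [abs_of_nonneg (Real.sqrt_nonneg _), abs_of_nonneg (Real.sqrt_nonneg _),
    abs_of_nonneg (Real.sqrt_nonneg _)]
  congr 1
  simp only [mul_pow, ← Complex.ofReal_pow, Real.sq_sqrt hs, Real.sq_sqrt ht,
    Real.sq_sqrt (add_nonneg hs ht)]
  push_cast
  ring

lemma heatP_heatP [CompleteSpace F] (hf : Continuous f) (hM : ∀ x, ‖f x‖ ≤ M) {s t : ℝ}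
    (hs : 0 ≤ s) (ht : 0 ≤ t) : heatP s (heatP t f) = heatP (s + t) f := by
  have : ProperSpace E := FiniteDimensional.proper_real E
  ext x
  have e : heatP (s + t) f x = ∫ y, f (x + y) ∂((stdGaussian E).map (fun z => √(s + t) • z)) := by
    rw [integral_map (by fun_prop) (Continuous.aestronglyMeasurable (by fun_prop))]
    rfl
  rw [e, ← map_stdGaussian_prod hs ht,
    integral_map (by fun_prop) (Continuous.aestronglyMeasurable (by fun_prop)),
    integral_prod]
  · simp only [heatP, add_assoc]
  · exact Integrable.of_bound (Continuous.aestronglyMeasurable (by fun_prop)) M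
      (Eventually.of_forall fun z => hM _)

lemma continuous_heatP_param {X : Type*} [TopologicalSpace X] [FirstCountableTopology X]
    {g : X → E → F} (hg : Continuous fun p : X × E => g p.1 p.2) (hM : ∀ p x, ‖g p x‖ ≤ M) 
    {τ : X → ℝ} (hτ : Continuous τ) {y : X → E} (hy : Continuous y) :
    Continuous fun p => heatP (τ p) (g p) (y p) := by
  have : ProperSpace E := FiniteDimensional.proper_real E
  refine continuous_of_dominated (bound := fun _ => M) ?_ ?_ (integrable_const _) ?_
  · intro p
    exact Continuous.aestronglyMeasurable
      (hg.comp (f := fun z => (p, y p + √(τ p) • z)) (by fun_prop))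
  · exact fun p => Eventually.of_forall fun z => hM _ _
  · refine Eventually.of_forall fun z => ?_
    exact hg.comp (f := fun p => (p, y p + √(τ p) • z)) (by fun_prop)

lemma continuous_heatD_param {X : Type*} [TopologicalSpace X] [FirstCountableTopology X]
    {g : X → E → F} (hg : Continuous fun p : X × E => g p.1 p.2) (hM : ∀ p x, ‖g p x‖ ≤ M)
    {τ : X → ℝ} (hτ : Continuous τ) (hτ0 : ∀ p, 0 < τ p) {y : X → E} (hy : Continuous y) :
    Continuous fun p => heatD (τ p) (g p) (y p) := by
  rcases isEmpty_or_nonempty X with hX | ⟨⟨p0⟩⟩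
  · exact continuous_of_const fun p => (hX.false p).elim
  have hM0 : 0 ≤ M := (norm_nonneg _).trans (hM p0 0)
  have : ProperSpace E := FiniteDimensional.proper_real E
  have : SecondCountableTopologyEither E (E →L[ℝ] F) := ⟨Or.inl inferInstance⟩
  refine Continuous.smul ((Real.continuous_sqrt.comp hτ).inv₀
    fun p => (Real.sqrt_pos.2 (hτ0 p)).ne') ?_
  refine continuous_of_dominated (bound := fun z => (1 + ‖z‖) ^ 3 * M) ?_ ?_
    (integrable_one_add_norm_pow.mul_const M) ?_
  · intro p
    apply Continuous.aestronglyMeasurable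
    exact (ContinuousLinearMap.smulRightL ℝ E F).continuous₂.comp
      ((innerSL ℝ).continuous.prodMk (hg.comp (f := fun z => (p, y p + √(τ p) • z)) (by fun_prop)))
  · refine fun p => Eventually.of_forall fun z => ?_
    rw [ContinuousLinearMap.norm_smulRight_apply, innerSL_apply_norm]
    apply mul_le_mul _ (hM _ _) (norm_nonneg _) (by positivity)
    nlinarith [norm_nonneg z, sq_nonneg ‖z‖, mul_nonneg (norm_nonneg z) (sq_nonneg ‖z‖)]
  · refine Eventually.of_forall fun z => ?_
    exact (ContinuousLinearMap.smulRightL ℝ E F).continuous₂.comp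
      (continuous_const.prodMk (hg.comp (f := fun p => (p, y p + √(τ p) • z)) (by fun_prop)))

lemma continuous_heatD (hf : Continuous f) (hM : ∀ x, ‖f x‖ ≤ M) {t : ℝ} (ht : 0 < t) :
    Continuous (heatD t f) := by
  have : ProperSpace E := FiniteDimensional.proper_real E
  exact continuous_heatD_param (X := E) (g := fun _ => f) (by fun_prop) (fun _ => hM)
    (τ := fun _ => t) continuous_const (fun _ => ht) continuous_id

lemma hasFDerivAt_heatP_of_hasFDerivAt [CompleteSpace F] {f' : E → E →L[ℝ] F} {M' : ℝ}
    (hM : ∀ x, ‖f x‖ ≤ M) (hf' : ∀ x, HasFDerivAt f (f' x) x) (hc : Continuous f')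
    (hM' : ∀ x, ‖f' x‖ ≤ M') (t : ℝ) (x : E) : HasFDerivAt (heatP t f) (heatP t f' x) x := by
  have : ProperSpace E := FiniteDimensional.proper_real E
  have : SecondCountableTopologyEither E (E →L[ℝ] F) := ⟨Or.inl inferInstance⟩
  have hf : Continuous f := continuous_iff_continuousAt.2 fun x => (hf' x).continuousAt
  refine hasFDerivAt_integral_of_dominated_of_fderiv_le (s := univ) (bound := fun _ => M')
    (F' := fun y z => f' (y + √t • z)) univ_mem ?_ ?_ ?_ ?_ (integrable_const _) ?_
  · exact Eventually.of_forall fun y => Continuous.aestronglyMeasurable (by fun_prop)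
  · exact integrable_of_cont_bdd hf hM x _
  · exact Continuous.aestronglyMeasurable (by fun_prop)
  · exact Eventually.of_forall fun z y _ => hM' _
  · refine Eventually.of_forall fun z y _ => ?_
    exact (hasFDerivAt_comp_add_right (f := f) (√t • z)).2 (hf' _)

lemma heatP_heatD [CompleteSpace F] (hf : Continuous f) (hM : ∀ x, ‖f x‖ ≤ M) {s t : ℝ}
    (hs : 0 ≤ s) (ht : 0 < t) (x : E) : heatD (s + t) f x = heatP s (heatD t f) x := by
  have h1 := hasFDerivAt_heatP hf hM (add_pos_of_nonneg_of_pos hs ht) x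
  rw [← heatP_heatP hf hM hs ht.le] at h1
  exact h1.unique (hasFDerivAt_heatP_of_hasFDerivAt (norm_heatP_le hM t)
    (hasFDerivAt_heatP hf hM ht) (continuous_heatD hf hM ht) (norm_heatD_le hM t) s x)

/-- The second spatial derivative of the heat semigroup. -/
noncomputable def heatH (t : ℝ) (f : E → F) (x : E) : E →L[ℝ] E →L[ℝ] F :=
  heatD (t / 2) (heatD (t / 2) f) x

lemma hasFDerivAt_heatD [CompleteSpace F] (hf : Continuous f) (hM : ∀ x, ‖f x‖ ≤ M) {t : ℝ}
    (ht : 0 < t) (x : E) : HasFDerivAt (heatD t f) (heatH t f x) x := by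
  have h2 : 0 < t / 2 := by linarith
  have e : heatD t f = heatP (t / 2) (heatD (t / 2) f) := by
    ext1 y
    rw [← heatP_heatD hf hM h2.le h2]
    congr 1; ring
  rw [e]
  exact hasFDerivAt_heatP (continuous_heatD hf hM h2) (norm_heatD_le hM _) h2 x

lemma heatD_sub_shift [CompleteSpace F] (hf : Continuous f) (hM : ∀ x, ‖f x‖ ≤ M) (t : ℝ)
    (x h : E) : heatD t f (x + h) - heatD t f x = heatD t (fun y => f (y + h) - f y) x := by
  rw [heatD, heatD, heatD, ← smul_sub, ← integral_sub (integrable_smulRight hf hM _ _)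
    (integrable_smulRight hf hM _ _)]
  congr 2
  ext1 z
  ext v
  simp [smul_sub, add_right_comm]

lemma norm_heatD_sub_le_lip [CompleteSpace F] (hf : Continuous f) (hM : ∀ x, ‖f x‖ ≤ M) {L : ℝ}
    (hL : ∀ x y, ‖f x - f y‖ ≤ L * ‖x - y‖) (t : ℝ) (x y : E) :
    ‖heatD t f x - heatD t f y‖ ≤ (√t)⁻¹ * (gaussC E * (L * ‖x - y‖)) := by
  have h := heatD_sub_shift hf hM t y (x - y)
  rw [add_sub_cancel] at h
  rw [h]
  refine norm_heatD_le (fun z => ?_) t y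
  simpa using hL (z + (x - y)) z

end Heat2

section Taylor

set_option linter.unusedSectionVars false

variable {E : Type*} [NormedAddCommGroup E] [NormedSpace ℝ E]
  {F : Type*} [NormedAddCommGroup F] [NormedSpace ℝ F]

lemma taylor_first {g : E → F} {g' : E → E →L[ℝ] F} {s : Set E} (hs : Convex ℝ s) {M κ : ℝ}
    (hκ : 0 ≤ κ) (hM : 0 ≤ M)
    (h1 : ∀ x ∈ s, HasFDerivAt g (g' x) x)
    (hH : ∀ x ∈ s, ∀ y ∈ s, ‖g' x - g' y‖ ≤ M * ‖x - y‖ ^ κ) {x y : E} (hx : x ∈ s) (hy : y ∈ s) :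
    ‖g y - g x - g' x (y - x)‖ ≤ M * ‖y - x‖ ^ κ * ‖y - x‖ := by
  have hseg : segment ℝ x y ⊆ s := hs.segment_subset hx hy
  have key := (convex_segment x y).norm_image_sub_le_of_norm_hasFDerivWithin_le
    (f := fun z => g z - g' x z) (f' := fun z => g' z - g' x) (C := M * ‖y - x‖ ^ κ)
    (fun z hz => ((h1 z (hseg hz)).sub (g' x).hasFDerivAt).hasFDerivWithinAt) (fun z hz => by
      refine (hH z (hseg hz) x hx).trans ?_
      have : ‖z - x‖ ≤ ‖y - x‖ := norm_sub_le_of_mem_segment hz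
      gcongr) (left_mem_segment ℝ x y) (right_mem_segment ℝ x y)
  convert key using 2
  rw [map_sub]; abel

lemma taylor_second {w : E → ℝ} {w' : E → E →L[ℝ] ℝ} {w'' : E → E →L[ℝ] E →L[ℝ] ℝ} {s : Set E}
    (hs : Convex ℝ s) {M κ : ℝ} (hκ : 0 ≤ κ) (hM : 0 ≤ M)
    (h0 : ∀ x ∈ s, HasFDerivAt w (w' x) x) (h1 : ∀ x ∈ s, HasFDerivAt w' (w'' x) x)
    (hH : ∀ x ∈ s, ∀ y ∈ s, ‖w'' x - w'' y‖ ≤ M * ‖x - y‖ ^ κ) {x v : E} (hx : x ∈ s)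
    (hy : x + v ∈ s) :
    |w (x + v) - w x - w' x v - 1 / 2 * w'' x v v| ≤ M * ‖v‖ ^ κ * ‖v‖ ^ 2 := by
  have hmem : ∀ τ ∈ Icc (0 : ℝ) 1, x + τ • v ∈ s := fun τ hτ => by
    apply hs.segment_subset hx hy
    rw [segment_eq_image']
    exact ⟨τ, hτ, by simp⟩
  have hd : ∀ τ ∈ Icc (0 : ℝ) 1, HasDerivAt
      (fun τ : ℝ => w (x + τ • v) - w x - τ * w' x v - τ ^ 2 * (1 / 2 * w'' x v v))
      (w' (x + τ • v) v - w' x v - w'' x (τ • v) v) τ := fun τ hτ => by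
    have hl : HasDerivAt (fun τ : ℝ => x + τ • v) v τ := by
      simpa using ((hasDerivAt_id τ).smul_const v).const_add x
    have ha := (h0 _ (hmem τ hτ)).comp_hasDerivAt τ hl
    have hb := ((ha.sub_const (w x)).sub ((hasDerivAt_id τ).mul_const (w' x v))).sub
      (((hasDerivAt_id τ).pow 2).mul_const (1 / 2 * w'' x v v))
    refine hb.congr_deriv ?_
    simp
    ring
  have key := norm_image_sub_le_of_norm_deriv_le_segment_01' (C := M * ‖v‖ ^ κ * ‖v‖ ^ 2)
    (fun τ hτ => (hd τ hτ).hasDerivWithinAt) (fun τ hτ => by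
      have hτ' : τ ∈ Icc (0 : ℝ) 1 := ⟨hτ.1, hτ.2.le⟩
      have h := taylor_first hs hκ hM h1 hH hx (hmem τ hτ')
      rw [add_sub_cancel_left] at h
      have hle : ‖τ • v‖ ≤ ‖v‖ := by
        rw [norm_smul, Real.norm_of_nonneg hτ.1]
        nlinarith [norm_nonneg v, hτ.2]
      calc _ = ‖(w' (x + τ • v) - w' x - w'' x (τ • v)) v‖ := rfl
        _ ≤ ‖w' (x + τ • v) - w' x - w'' x (τ • v)‖ * ‖v‖ := ContinuousLinearMap.le_opNorm _ _
        _ ≤ (M * ‖τ • v‖ ^ κ * ‖τ • v‖) * ‖v‖ := by gcongr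
        _ ≤ (M * ‖v‖ ^ κ * ‖v‖) * ‖v‖ := by gcongr
        _ = _ := by ring)
  simpa using key

lemma opNorm_le_of_symm_quad {F : Type*} [NormedAddCommGroup F] [InnerProductSpace ℝ F]
    {T : F →L[ℝ] F →L[ℝ] ℝ} (hT : ∀ u v, T u v = T v u) {B : ℝ}
    (hB : 0 ≤ B) (h : ∀ v, ‖v‖ = 1 → |T v v| ≤ B) : ‖T‖ ≤ B := by
  have hq : ∀ v, |T v v| ≤ B * ‖v‖ ^ 2 := fun v => by
    rcases eq_or_ne v 0 with rfl | hv
    · simp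
    · have hv' : ‖v‖ ≠ 0 := norm_ne_zero_iff.2 hv
      have := h (‖v‖⁻¹ • v) (by rw [norm_smul, norm_inv, norm_norm, inv_mul_cancel₀ hv'])
      simp only [map_smul, smul_apply, smul_eq_mul, abs_mul, abs_inv, abs_norm] at this
      have h2 : |T v v| = ‖v‖ ^ 2 * (‖v‖⁻¹ * (‖v‖⁻¹ * |T v v|)) := by field_simp
      rw [h2, mul_comm]
      gcongr
  have hu : ∀ u v : F, ‖u‖ = 1 → ‖v‖ = 1 → |T u v| ≤ B := fun u v hu hv => by
    have e : T u v = 1 / 4 * (T (u + v) (u + v) - T (u - v) (u - v)) := by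
      simp [hT v u]; ring
    have p := parallelogram_law_with_norm ℝ u v
    have h1 := hq (u + v)
    have h2 := hq (u - v)
    rw [hu, hv] at p
    rw [e, abs_mul, abs_of_pos (by norm_num : (0 : ℝ) < 1 / 4)]
    have h3 := abs_sub (T (u + v) (u + v)) (T (u - v) (u - v))
    have h4 : B * ‖u + v‖ ^ 2 + B * ‖u - v‖ ^ 2 = 4 * B := by
      have : ‖u + v‖ ^ 2 + ‖u - v‖ ^ 2 = 4 := by nlinarith
      rw [← mul_add, this]; ring
    linarith
  refine ContinuousLinearMap.opNorm_le_of_unit_norm hB fun u hu1 => ?_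
  refine ContinuousLinearMap.opNorm_le_of_unit_norm hB fun v hv1 => ?_
  exact hu u v hu1 hv1

lemma norm_fderiv_le_interp {w : E → ℝ} {w' : E → E →L[ℝ] ℝ} {w'' : E → E →L[ℝ] E →L[ℝ] ℝ}
    {s : Set E} (hs : Convex ℝ s) {M κ K ρ : ℝ} (hκ : 0 ≤ κ) (hM : 0 ≤ M)
    (h0 : ∀ x ∈ s, HasFDerivAt w (w' x) x) (h1 : ∀ x ∈ s, HasFDerivAt w' (w'' x) x)
    (hH : ∀ x ∈ s, ∀ y ∈ s, ‖w'' x - w'' y‖ ≤ M * ‖x - y‖ ^ κ) (hK : ∀ x ∈ s, |w x| ≤ K)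
    (hρ : 0 < ρ) {x : E} (hx : Metric.closedBall x ρ ⊆ s) :
    ‖w' x‖ ≤ K / ρ + M * ρ ^ κ * ρ := by
  have hxs : x ∈ s := hx (Metric.mem_closedBall_self hρ.le)
  have hK0 : 0 ≤ K := (abs_nonneg _).trans (hK x hxs)
  refine ContinuousLinearMap.opNorm_le_of_unit_norm (by positivity) fun v hv => ?_
  have hn : ‖ρ • v‖ = ρ := by rw [norm_smul, hv, mul_one, Real.norm_of_nonneg hρ.le]
  have hp : x + ρ • v ∈ s := hx (by simp [hn])
  have hm : x + -(ρ • v) ∈ s := hx (by simp [hn])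
  have t1 := taylor_second hs hκ hM h0 h1 hH hxs hp
  have t2 := taylor_second hs hκ hM h0 h1 hH hxs hm
  rw [norm_neg] at t2
  rw [hn] at t1 t2
  simp only [map_neg, neg_apply, neg_neg] at t2
  have k1 := abs_le.1 (hK _ hp)
  have k2 := abs_le.1 (hK _ hm)
  rw [abs_le] at t1 t2
  have e : w' x (ρ • v) = ρ * w' x v := by simp
  rw [e] at t1 t2
  have : |ρ * w' x v| ≤ K + M * ρ ^ κ * ρ ^ 2 := by
    rw [abs_le]; constructor <;> linarith
  rw [abs_mul, abs_of_pos hρ] at this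
  rw [Real.norm_eq_abs]
  calc |w' x v| = (ρ * |w' x v|) / ρ := by field_simp
    _ ≤ (K + M * ρ ^ κ * ρ ^ 2) / ρ := by gcongr
    _ = _ := by field_simp

lemma norm_fderiv_fderiv_le_interp {F : Type*} [NormedAddCommGroup F] [InnerProductSpace ℝ F]
    {w : F → ℝ} {w' : F → F →L[ℝ] ℝ} {w'' : F → F →L[ℝ] F →L[ℝ] ℝ}
    {s : Set F} (hs : Convex ℝ s) {M κ K ρ : ℝ} (hκ : 0 ≤ κ) (hM : 0 ≤ M)
    (h0 : ∀ x ∈ s, HasFDerivAt w (w' x) x) (h1 : ∀ x ∈ s, HasFDerivAt w' (w'' x) x)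
    (hH : ∀ x ∈ s, ∀ y ∈ s, ‖w'' x - w'' y‖ ≤ M * ‖x - y‖ ^ κ) (hK : ∀ x ∈ s, |w x| ≤ K)
    (hρ : 0 < ρ) {x : F} (hx : Metric.closedBall x ρ ⊆ s) :
    ‖w'' x‖ ≤ 4 * K / ρ ^ 2 + 2 * (M * ρ ^ κ) := by
  have hxs : x ∈ s := hx (Metric.mem_closedBall_self hρ.le)
  have hK0 : 0 ≤ K := (abs_nonneg _).trans (hK x hxs)
  have hev : ∀ᶠ y in 𝓝 x, HasFDerivAt w (w' y) y := by
    filter_upwards [Metric.closedBall_mem_nhds x hρ] with y hy using h0 y (hx hy)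
  refine opNorm_le_of_symm_quad
    (fun u v => second_derivative_symmetric_of_eventually hev (h1 x hxs) u v) (by positivity)
    fun v hv => ?_
  have hn : ‖ρ • v‖ = ρ := by rw [norm_smul, hv, mul_one, Real.norm_of_nonneg hρ.le]
  have hp : x + ρ • v ∈ s := hx (by simp [hn])
  have hm : x + -(ρ • v) ∈ s := hx (by simp [hn])
  have t1 := taylor_second hs hκ hM h0 h1 hH hxs hp
  have t2 := taylor_second hs hκ hM h0 h1 hH hxs hm
  rw [norm_neg] at t2
  rw [hn] at t1 t2
  simp only [map_neg, neg_apply, neg_neg] at t2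
  have k0 := abs_le.1 (hK _ hxs)
  have k1 := abs_le.1 (hK _ hp)
  have k2 := abs_le.1 (hK _ hm)
  rw [abs_le] at t1 t2
  have e : w'' x (ρ • v) (ρ • v) = ρ ^ 2 * w'' x v v := by simp; ring
  rw [e] at t1 t2
  have : |ρ ^ 2 * w'' x v v| ≤ 4 * K + 2 * (M * ρ ^ κ * ρ ^ 2) := by
    rw [abs_le]; constructor <;> linarith
  rw [abs_mul, abs_of_pos (by positivity : 0 < ρ ^ 2)] at this
  calc |w'' x v v| = (ρ ^ 2 * |w'' x v v|) / ρ ^ 2 := by field_simp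
    _ ≤ (4 * K + 2 * (M * ρ ^ κ * ρ ^ 2)) / ρ ^ 2 := by gcongr
    _ = _ := by field_simp

end Taylor

section Heat3

set_option linter.unusedSectionVars false

variable {E : Type*} [NormedAddCommGroup E] [InnerProductSpace ℝ E] [FiniteDimensional ℝ E]
  [MeasurableSpace E] [BorelSpace E]
  {F : Type*} [NormedAddCommGroup F] [NormedSpace ℝ F]
variable {f : E → F} {M : ℝ}

lemma norm_heatH_le [CompleteSpace F] (hf : Continuous f) (hM : ∀ x, ‖f x‖ ≤ M) {κ H : ℝ}
    (hκ : 0 ≤ κ) (hκ1 : κ ≤ 1) (hH : ∀ x y, ‖f x - f y‖ ≤ H * ‖x - y‖ ^ κ) (hH0 : 0 ≤ H)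
    {t : ℝ} (ht : 0 < t) (x : E) :
    ‖heatH t f x‖ ≤ 2 * gaussC E ^ 3 * H * t ^ (κ / 2 - 1) := by
  have h2 : 0 < t / 2 := by linarith
  have hC := one_le_gaussC (E := E)
  have h := norm_heatD_le (t := t / 2) (f := heatD (t / 2) f)
    (norm_heatD_le_holder hf hM hκ hκ1 hH hH0 _) x
  refine h.trans ?_
  have e : (√(t / 2))⁻¹ * ((√(t / 2))⁻¹ * √(t / 2) ^ κ) = (t / 2) ^ (κ / 2 - 1) := by
    rw [Real.sqrt_eq_rpow, ← Real.rpow_neg h2.le, ← Real.rpow_mul h2.le, ← Real.rpow_add h2,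
      ← Real.rpow_add h2]
    congr 1; ring
  have e2 : (t / 2) ^ (κ / 2 - 1) ≤ 2 * t ^ (κ / 2 - 1) := by
    rw [Real.div_rpow ht.le (by norm_num), div_eq_mul_inv, ← Real.rpow_neg (by norm_num), mul_comm]
    gcongr
    calc (2 : ℝ) ^ (-(κ / 2 - 1)) ≤ 2 ^ (1 : ℝ) := by
          apply Real.rpow_le_rpow_of_exponent_le <;> linarith
      _ = 2 := by norm_num
  calc _ = gaussC E ^ 2 * H * ((√(t / 2))⁻¹ * ((√(t / 2))⁻¹ * √(t / 2) ^ κ)) := by ring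
    _ ≤ gaussC E ^ 3 * H * (2 * t ^ (κ / 2 - 1)) := by
        rw [e]
        gcongr
        norm_num
    _ = _ := by ring

lemma norm_heatH_sub_le [CompleteSpace F] (hf : Continuous f) (hM : ∀ x, ‖f x‖ ≤ M) {κ H : ℝ}
    (hκ : 0 ≤ κ) (hκ1 : κ ≤ 1) (hH : ∀ x y, ‖f x - f y‖ ≤ H * ‖x - y‖ ^ κ) (hH0 : 0 ≤ H)
    {t : ℝ} (ht : 0 < t) (x y : E) :
    ‖heatH t f x - heatH t f y‖ ≤ 8 * gaussC E ^ 4 * H * t ^ ((κ - 3) / 2) * ‖x - y‖ := by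
  have h2 : 0 < t / 2 := by linarith
  have hC := one_le_gaussC (E := E)
  have hL : ∀ a b : E, ‖heatD (t / 2) f a - heatD (t / 2) f b‖
      ≤ (2 * gaussC E ^ 3 * H * (t / 2) ^ (κ / 2 - 1)) * ‖a - b‖ := fun a b =>
    convex_univ.norm_image_sub_le_of_norm_hasFDerivWithin_le (f' := fun x => heatH (t / 2) f x)
      (fun z _ => (hasFDerivAt_heatD hf hM h2 z).hasFDerivWithinAt)
      (fun z _ => norm_heatH_le hf hM hκ hκ1 hH hH0 h2 z) (mem_univ b) (mem_univ a)
  have h := norm_heatD_sub_le_lip (continuous_heatD hf hM h2) (norm_heatD_le hM _) hL (t / 2) x y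
  refine h.trans ?_
  have e : (√(t / 2))⁻¹ * (t / 2) ^ (κ / 2 - 1) = (t / 2) ^ ((κ - 3) / 2) := by
    rw [Real.sqrt_eq_rpow, ← Real.rpow_neg h2.le, ← Real.rpow_add h2]
    congr 1; ring
  have e2 : (t / 2) ^ ((κ - 3) / 2) ≤ 4 * t ^ ((κ - 3) / 2) := by
    rw [Real.div_rpow ht.le (by norm_num), div_eq_mul_inv, ← Real.rpow_neg (by norm_num), mul_comm]
    gcongr
    calc (2 : ℝ) ^ (-((κ - 3) / 2)) ≤ 2 ^ (2 : ℝ) := by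
          apply Real.rpow_le_rpow_of_exponent_le <;> linarith
      _ = 4 := by norm_num
  calc _ = 2 * gaussC E ^ 4 * H * ((√(t / 2))⁻¹ * (t / 2) ^ (κ / 2 - 1)) * ‖x - y‖ := by ring
    _ ≤ 2 * gaussC E ^ 4 * H * (4 * t ^ ((κ - 3) / 2)) * ‖x - y‖ := by
        rw [e]; gcongr
    _ = _ := by ring

lemma integrable_bilin (T : E →L[ℝ] E →L[ℝ] ℝ) :
    Integrable (fun z => T z z) (stdGaussian E) := by
  have : ProperSpace E := FiniteDimensional.proper_real E
  refine (integrable_one_add_norm_pow.const_mul ‖T‖).mono'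
    (Continuous.aestronglyMeasurable (by fun_prop)) (Eventually.of_forall fun z => ?_)
  calc ‖T z z‖ ≤ ‖T‖ * ‖z‖ * ‖z‖ := T.le_opNorm₂ z z
    _ = ‖T‖ * (‖z‖ * ‖z‖) := by ring
    _ ≤ _ := by
      gcongr
      nlinarith [norm_nonneg z, sq_nonneg ‖z‖, mul_nonneg (norm_nonneg z) (sq_nonneg ‖z‖)]

lemma integral_inner_mul_inner (u v : E) :
    ∫ z, inner ℝ u z * inner ℝ v z ∂(stdGaussian E) = inner ℝ u v := by
  have h := covarianceBilin_apply (μ := stdGaussian E) IsGaussian.memLp_two_id u v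
  rw [covarianceBilin_stdGaussian] at h
  have h0 : ∫ x, x ∂(stdGaussian E) = 0 := integral_id_stdGaussian
  simp only [id] at h
  rw [h0] at h
  have e : (innerSL ℝ u) v = inner ℝ u v := innerSL_apply_apply ℝ u v
  refine (Eq.trans ?_ h.symm).trans e
  simp

lemma integral_bilin {ι : Type*} [Fintype ι] (b : OrthonormalBasis ι ℝ E)
    (T : E →L[ℝ] E →L[ℝ] ℝ) : ∫ z, T z z ∂(stdGaussian E) = ∑ i, T (b i) (b i) := by
  classical
  have e : ∀ z : E, T z z = ∑ i, ∑ j, inner ℝ (b i) z * inner ℝ (b j) z * T (b i) (b j) := by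
    intro z
    conv_lhs => rw [← b.sum_repr' z]
    simp only [map_sum, map_smul, sum_apply, smul_apply, smul_eq_mul,
      Finset.mul_sum]
    rw [Finset.sum_comm]
    refine Finset.sum_congr rfl fun i _ => Finset.sum_congr rfl fun j _ => ?_
    ring
  have hitg : ∀ i j, Integrable (fun z => inner ℝ (b i) z * inner ℝ (b j) z * T (b i) (b j))
      (stdGaussian E) := fun i j => by
    have := (integrable_bilin ((innerSL ℝ (b i)).smulRight (innerSL ℝ (b j)))).mul_const
      (T (b i) (b j))
    simpa using this
  simp_rw [e]
  rw [integral_finsetSum _ fun i _ => integrable_finsetSum _ fun j _ => hitg i j]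
  refine Finset.sum_congr rfl fun i _ => ?_
  rw [integral_finsetSum _ fun j _ => hitg i j]
  simp_rw [integral_mul_const, integral_inner_mul_inner, b.inner_eq_ite]
  simp

lemma heatP_generator {ι : Type*} [Fintype ι] (b : OrthonormalBasis ι ℝ E)
    {w : E → ℝ} {w' : E → E →L[ℝ] ℝ} {w'' : E → E →L[ℝ] E →L[ℝ] ℝ}
    {M κ B : ℝ} (hκ : 0 ≤ κ) (hκ1 : κ ≤ 1) (hM : 0 ≤ M) (hB : ∀ x, ‖w x‖ ≤ B)
    (h0 : ∀ x, HasFDerivAt w (w' x) x) (h1 : ∀ x, HasFDerivAt w' (w'' x) x)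
    (hH : ∀ x y, ‖w'' x - w'' y‖ ≤ M * ‖x - y‖ ^ κ) {t : ℝ} (ht : 0 ≤ t) (x : E) :
    |heatP t w x - w x - t * (1 / 2 * ∑ i, w'' x (b i) (b i))|
      ≤ gaussC E * M * (√t ^ κ * t) := by
  have : ProperSpace E := FiniteDimensional.proper_real E
  have hw : Continuous w := continuous_iff_continuousAt.2 fun x => (h0 x).continuousAt
  have hl0 : ∫ z, w' x (√t • z) ∂(stdGaussian E) = 0 := by
    have h2 := ContinuousLinearMap.integral_comp_comm (μ := stdGaussian E) (φ := fun z : E => z)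
      (√t • w' x) IsGaussian.integrable_id
    have h3 : ∫ z : E, z ∂(stdGaussian E) = 0 := integral_id_stdGaussian
    rw [h3, map_zero] at h2
    simpa using h2
  have hli : Integrable (fun z => w' x (√t • z)) (stdGaussian E) := by
    simpa using ContinuousLinearMap.integrable_comp (√t • w' x)
      (IsGaussian.integrable_id (μ := stdGaussian E))
  have hq : ∀ z : E, 1 / 2 * w'' x (√t • z) (√t • z) = t * (1 / 2 * w'' x z z) := fun z => by
    simp only [map_smul, smul_apply, smul_eq_mul]
    calc _ = (√t * √t) * (1 / 2 * w'' x z z) := by ring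
      _ = _ := by rw [Real.mul_self_sqrt ht]
  have hqi : Integrable (fun z => 1 / 2 * w'' x (√t • z) (√t • z)) (stdGaussian E) := by
    simp_rw [hq]
    exact ((integrable_bilin _).const_mul _).const_mul _
  have hqe : ∫ z, 1 / 2 * w'' x (√t • z) (√t • z) ∂(stdGaussian E)
      = t * (1 / 2 * ∑ i, w'' x (b i) (b i)) := by
    simp_rw [hq]
    rw [integral_const_mul, integral_const_mul, integral_bilin b]
  have e : heatP t w x - w x - t * (1 / 2 * ∑ i, w'' x (b i) (b i))
      = ∫ z, (w (x + √t • z) - w x - w' x (√t • z) - 1 / 2 * w'' x (√t • z) (√t • z))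
        ∂(stdGaussian E) := by
    have i1 := integrable_of_cont_bdd hw hB x (√t)
    rw [integral_sub _ hqi, integral_sub _ hli, integral_sub i1 (integrable_const _), hl0, hqe]
    · simp [heatP]
    · exact i1.sub (integrable_const _)
    · exact (i1.sub (integrable_const _)).sub hli
  rw [e, ← Real.norm_eq_abs]
  have hI : ∫ z : E, (1 + ‖z‖) ^ 3 * (M * (√t ^ κ * t)) ∂(stdGaussian E)
      = gaussC E * M * (√t ^ κ * t) := by
    rw [integral_mul_const, gaussC]; ring
  rw [← hI]
  refine norm_integral_le_of_norm_le (integrable_one_add_norm_pow.mul_const _)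
    (Eventually.of_forall fun z => ?_)
  have hT := taylor_second convex_univ hκ hM (fun x _ => h0 x) (fun x _ => h1 x)
    (fun x _ y _ => hH x y) (mem_univ x) (mem_univ (x + √t • z))
  rw [Real.norm_eq_abs]
  refine hT.trans ?_
  rw [norm_smul, Real.norm_of_nonneg (Real.sqrt_nonneg t),
      Real.mul_rpow (Real.sqrt_nonneg _) (norm_nonneg _), mul_pow, Real.sq_sqrt ht]
  have h2 : ‖z‖ ^ κ ≤ 1 + ‖z‖ := by
    calc ‖z‖ ^ κ ≤ (1 + ‖z‖) ^ κ :=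
          Real.rpow_le_rpow (norm_nonneg _) (by linarith [norm_nonneg z]) hκ
      _ ≤ (1 + ‖z‖) ^ (1 : ℝ) :=
          Real.rpow_le_rpow_of_exponent_le (by linarith [norm_nonneg z]) hκ1
      _ = _ := Real.rpow_one _
  calc M * (√t ^ κ * ‖z‖ ^ κ) * (t * ‖z‖ ^ 2) = (‖z‖ ^ κ * ‖z‖ ^ 2) * (M * (√t ^ κ * t)) := by ring
    _ ≤ ((1 + ‖z‖) * (1 + ‖z‖) ^ 2) * (M * (√t ^ κ * t)) := by
        gcongr
        linarith
    _ = _ := by ring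

end Heat3

section Duh

set_option linter.unusedSectionVars false
set_option maxSynthPendingDepth 3

variable {E : Type*} [NormedAddCommGroup E] [InnerProductSpace ℝ E] [FiniteDimensional ℝ E]
  [MeasurableSpace E] [BorelSpace E]

lemma continuousOn_Ioi_of_forall {G : Type*} [TopologicalSpace G] {φ : ℝ → G}
    (h : ∀ ε : ℝ, 0 < ε → Continuous fun s : Ioi ε => φ s) : ContinuousOn φ (Ioi 0) := by
  intro s hs
  have hs' : (0 : ℝ) < s := hs
  have h1 : ContinuousOn φ (Ioi (s / 2)) := continuousOn_iff_continuous_domRestrict.2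
    (h (s / 2) (by linarith))
  exact (h1.continuousAt (Ioi_mem_nhds (by linarith))).continuousWithinAt

lemma integrableOn_exp_mul_rpow {r : ℝ} (hr : -1 < r) :
    IntegrableOn (fun s : ℝ => Real.exp (-s) * s ^ r) (Ioi 0) := by
  have := Real.GammaIntegral_convergent (s := r + 1) (by linarith)
  simpa using this

variable (E) in
/-- A constant dominating all the bounds for the resolvent of the heat operator. -/
noncomputable def duhC (κ : ℝ) : ℝ :=
  8 * gaussC E ^ 4 * (1 + (∫ s in Ioi (0 : ℝ), Real.exp (-s) * s ^ (-(1 / 2) : ℝ))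
    + (∫ s in Ioi (0 : ℝ), Real.exp (-s) * s ^ (κ / 2 - 1)) + 2 * (κ / 2)⁻¹ + 2 * (1 - κ)⁻¹)

lemma integral_exp_mul_rpow_nonneg (r : ℝ) :
    0 ≤ ∫ s in Ioi (0 : ℝ), Real.exp (-s) * s ^ r :=
  setIntegral_nonneg measurableSet_Ioi fun s hs => by
    have : (0 : ℝ) < s := hs
    positivity

variable {g : ℝ → E → ℝ} {κ M : ℝ}

/-- The data of the Duhamel integral at a fixed time. -/
structure DuhData (κ : ℝ) (g : ℝ → E → ℝ) (M : ℝ) : Prop where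
  κ_pos : 0 < κ
  κ_lt : κ < 1
  nonneg : 0 ≤ M
  cont : Continuous fun q : ℝ × E => g q.1 q.2
  bdd : ∀ s x, ‖g s x‖ ≤ M
  hol : ∀ s x y, ‖g s x - g s y‖ ≤ M * ‖x - y‖ ^ κ

/-- The Duhamel integral. -/
noncomputable def duh (g : ℝ → E → ℝ) (x : E) : ℝ :=
  ∫ s in Ioi (0 : ℝ), Real.exp (-s) • heatP s (g s) x

/-- The derivative of the Duhamel integral. -/
noncomputable def duhD (g : ℝ → E → ℝ) (x : E) : E →L[ℝ] ℝ :=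
  ∫ s in Ioi (0 : ℝ), Real.exp (-s) • heatD s (g s) x

/-- The second derivative of the Duhamel integral. -/
noncomputable def duhH (g : ℝ → E → ℝ) (x : E) : E →L[ℝ] E →L[ℝ] ℝ :=
  ∫ s in Ioi (0 : ℝ), Real.exp (-s) • heatH s (g s) x

namespace DuhData

lemma cont_slice (hg : DuhData κ g M) (s : ℝ) : Continuous (g s) :=
  hg.cont.comp (by fun_prop : Continuous fun x : E => (s, x))

lemma aesm_P (hg : DuhData κ g M) (x : E) :
    AEStronglyMeasurable (fun s => Real.exp (-s) • heatP s (g s) x)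
      (volume.restrict (Ioi 0)) := by
  refine Continuous.aestronglyMeasurable ?_
  exact Continuous.smul (f := fun s : ℝ => Real.exp (-s)) (by fun_prop) (continuous_heatP_param hg.cont hg.bdd continuous_id
    continuous_const)

lemma aesm_D (hg : DuhData κ g M) (x : E) :
    AEStronglyMeasurable (fun s => Real.exp (-s) • heatD s (g s) x)
      (volume.restrict (Ioi 0)) := by
  refine ContinuousOn.aestronglyMeasurable ?_ measurableSet_Ioi
  refine ContinuousOn.smul (f := fun s : ℝ => Real.exp (-s)) (by fun_prop) (continuousOn_Ioi_of_forall fun ε hε => ?_)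
  exact continuous_heatD_param (X := Ioi ε) (g := fun s => g s)
    (hg.cont.comp (f := fun q : Ioi ε × E => ((q.1 : ℝ), q.2)) (by fun_prop))
    (fun s => hg.bdd s) (τ := fun s => (s : ℝ)) (by fun_prop) (fun s => hε.trans s.2)
    continuous_const

lemma aesm_H (hg : DuhData κ g M) (x : E) :
    AEStronglyMeasurable (fun s => Real.exp (-s) • heatH s (g s) x)
      (volume.restrict (Ioi 0)) := by
  have : ProperSpace E := FiniteDimensional.proper_real E
  refine ContinuousOn.aestronglyMeasurable ?_ measurableSet_Ioi
  refine ContinuousOn.smul (f := fun s : ℝ => Real.exp (-s)) (by fun_prop) (continuousOn_Ioi_of_forall fun ε hε => ?_)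
  have hp : ∀ s : Ioi ε, 0 < (s : ℝ) / 2 := fun s => half_pos (hε.trans s.2)
  refine continuous_heatD_param (X := Ioi ε) (g := fun s => heatD (s / 2) (g s))
    (M := (√(ε / 2))⁻¹ * (gaussC E * M)) ?_ ?_ (τ := fun s => (s : ℝ) / 2) (by fun_prop) hp
    continuous_const
  · exact continuous_heatD_param (X := Ioi ε × E) (g := fun q => g q.1)
      (hg.cont.comp (f := fun q : (Ioi ε × E) × E => ((q.1.1 : ℝ), q.2)) (by fun_prop))
      (fun q => hg.bdd _) (τ := fun q => (q.1 : ℝ) / 2) (by fun_prop) (fun q => hp _)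
      continuous_snd
  · intro s y
    refine (norm_heatD_le (hg.bdd s) _ y).trans ?_
    have h1 : √(ε / 2) ≤ √(s / 2) := Real.sqrt_le_sqrt (by linarith [s.2.out])
    have h2 : 0 < √(ε / 2) := Real.sqrt_pos.2 (by linarith)
    have := hg.nonneg
    have := gaussC_nonneg (E := E)
    gcongr

lemma bound_P (hg : DuhData κ g M) (s : ℝ) (x : E) :
    ‖Real.exp (-s) • heatP s (g s) x‖ ≤ Real.exp (-s) * M := by
  rw [norm_smul, Real.norm_of_nonneg (Real.exp_pos _).le]
  gcongr
  exact norm_heatP_le (hg.bdd s) s x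

lemma bound_D (hg : DuhData κ g M) {s : ℝ} (hs : 0 < s) (x : E) :
    ‖Real.exp (-s) • heatD s (g s) x‖
      ≤ (Real.exp (-s) * s ^ (-(1 / 2) : ℝ)) * (gaussC E * M) := by
  rw [norm_smul, Real.norm_of_nonneg (Real.exp_pos _).le, mul_assoc]
  gcongr
  refine (norm_heatD_le (hg.bdd s) s x).trans_eq ?_
  rw [Real.sqrt_eq_rpow, ← Real.rpow_neg hs.le]

lemma bound_H (hg : DuhData κ g M) {s : ℝ} (hs : 0 < s) (x : E) :
    ‖Real.exp (-s) • heatH s (g s) x‖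
      ≤ (Real.exp (-s) * s ^ (κ / 2 - 1)) * (2 * gaussC E ^ 3 * M) := by
  rw [norm_smul, Real.norm_of_nonneg (Real.exp_pos _).le, mul_assoc]
  gcongr
  refine (norm_heatH_le (hg.cont_slice s) (hg.bdd s) hg.κ_pos.le hg.κ_lt.le (hg.hol s)
    hg.nonneg hs x).trans_eq ?_
  ring

lemma integrable_P (hg : DuhData κ g M) (x : E) :
    IntegrableOn (fun s => Real.exp (-s) • heatP s (g s) x) (Ioi 0) :=
  Integrable.mono' ((integrableOn_exp_neg_Ioi 0).mul_const M) (hg.aesm_P x)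
    (Eventually.of_forall fun s => hg.bound_P s x)

lemma integrable_D (hg : DuhData κ g M) (x : E) :
    IntegrableOn (fun s => Real.exp (-s) • heatD s (g s) x) (Ioi 0) :=
  Integrable.mono' ((integrableOn_exp_mul_rpow (by norm_num)).mul_const _) (hg.aesm_D x)
    ((ae_restrict_mem measurableSet_Ioi).mono fun s hs => hg.bound_D hs x)

lemma integrable_H (hg : DuhData κ g M) (x : E) :
    IntegrableOn (fun s => Real.exp (-s) • heatH s (g s) x) (Ioi 0) :=
  Integrable.mono' ((integrableOn_exp_mul_rpow (by linarith [hg.κ_pos])).mul_const _) (hg.aesm_H x)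
    ((ae_restrict_mem measurableSet_Ioi).mono fun s hs => hg.bound_H hs x)

lemma hasFDerivAt_duh (hg : DuhData κ g M) (x : E) : HasFDerivAt (duh g) (duhD g x) x := by
  refine hasFDerivAt_integral_of_dominated_of_fderiv_le (s := univ)
    (F' := fun y s => Real.exp (-s) • heatD s (g s) y)
    (bound := fun s => (Real.exp (-s) * s ^ (-(1 / 2) : ℝ)) * (gaussC E * M)) univ_mem
    (Eventually.of_forall hg.aesm_P) (hg.integrable_P x) (hg.aesm_D x)
    ((ae_restrict_mem measurableSet_Ioi).mono fun s hs y _ => hg.bound_D hs y)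
    ((integrableOn_exp_mul_rpow (by norm_num)).mul_const _)
    ((ae_restrict_mem measurableSet_Ioi).mono fun s hs y _ => ?_)
  exact (hasFDerivAt_heatP (hg.cont_slice s) (hg.bdd s) hs y).const_smul (Real.exp (-s))

lemma hasFDerivAt_duhD (hg : DuhData κ g M) (x : E) : HasFDerivAt (duhD g) (duhH g x) x := by
  refine hasFDerivAt_integral_of_dominated_of_fderiv_le (s := univ)
    (F' := fun y s => Real.exp (-s) • heatH s (g s) y)
    (bound := fun s => (Real.exp (-s) * s ^ (κ / 2 - 1)) * (2 * gaussC E ^ 3 * M)) univ_mem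
    (Eventually.of_forall hg.aesm_D) (hg.integrable_D x) (hg.aesm_H x)
    ((ae_restrict_mem measurableSet_Ioi).mono fun s hs y _ => hg.bound_H hs y)
    ((integrableOn_exp_mul_rpow (by linarith [hg.κ_pos])).mul_const _)
    ((ae_restrict_mem measurableSet_Ioi).mono fun s hs y _ => ?_)
  exact (hasFDerivAt_heatD (hg.cont_slice s) (hg.bdd s) hs y).const_smul (Real.exp (-s))

lemma duhC_parts (hκ : 0 < κ) (hκ1 : κ < 1) : 
    1 ≤ duhC E κ ∧
    (∫ s in Ioi (0 : ℝ), Real.exp (-s) * s ^ (-(1 / 2) : ℝ)) * gaussC E ≤ duhC E κ ∧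
    (∫ s in Ioi (0 : ℝ), Real.exp (-s) * s ^ (κ / 2 - 1)) * (2 * gaussC E ^ 3) ≤ duhC E κ ∧
    8 * gaussC E ^ 4 * (2 * (κ / 2)⁻¹ + 2 * (1 - κ)⁻¹) ≤ duhC E κ := by
  have hC := one_le_gaussC (E := E)
  have h1 := integral_exp_mul_rpow_nonneg (-(1 / 2))
  have h2 := integral_exp_mul_rpow_nonneg (κ / 2 - 1)
  have h3 : 0 < (κ / 2)⁻¹ := by positivity
  have h4 : 0 < (1 - κ)⁻¹ := inv_pos.2 (by linarith)
  have hC4 : 1 ≤ gaussC E ^ 4 := one_le_pow₀ hC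
  have hC41 : gaussC E ≤ gaussC E ^ 4 := le_self_pow₀ hC (by norm_num)
  have hC43 : gaussC E ^ 3 ≤ gaussC E ^ 4 := pow_le_pow_right₀ hC (by norm_num)
  have hC3 : 0 ≤ gaussC E ^ 3 := by positivity
  unfold duhC
  set a := ∫ s in Ioi (0 : ℝ), Real.exp (-s) * s ^ (-(1 / 2) : ℝ)
  set b := ∫ s in Ioi (0 : ℝ), Real.exp (-s) * s ^ (κ / 2 - 1)
  refine ⟨?_, ?_, ?_, ?_⟩
  · nlinarith
  · nlinarith [mul_le_mul_of_nonneg_left hC41 h1]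
  · nlinarith [mul_le_mul_of_nonneg_left hC43 h2]
  · nlinarith

lemma norm_duh_le (hg : DuhData κ g M) (x : E) : ‖duh g x‖ ≤ M := by
  have h := norm_integral_le_of_norm_le ((integrableOn_exp_neg_Ioi 0).mul_const M)
    (Eventually.of_forall fun s => hg.bound_P s x)
  refine h.trans_eq ?_
  rw [integral_mul_const, integral_exp_neg_Ioi_zero, one_mul]

lemma norm_duhD_le (hg : DuhData κ g M) (x : E) : ‖duhD g x‖ ≤ duhC E κ * M := by
  have h := norm_integral_le_of_norm_le
    ((integrableOn_exp_mul_rpow (r := -(1 / 2)) (by norm_num)).mul_const (gaussC E * M))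
    ((ae_restrict_mem measurableSet_Ioi).mono fun s hs => hg.bound_D hs x)
  refine h.trans ?_
  rw [integral_mul_const, ← mul_assoc]
  exact mul_le_mul_of_nonneg_right (duhC_parts hg.κ_pos hg.κ_lt).2.1 hg.nonneg

lemma norm_duhH_le (hg : DuhData κ g M) (x : E) : ‖duhH g x‖ ≤ duhC E κ * M := by
  have h := norm_integral_le_of_norm_le
    ((integrableOn_exp_mul_rpow (r := κ / 2 - 1) (by linarith [hg.κ_pos])).mul_const
      (2 * gaussC E ^ 3 * M))
    ((ae_restrict_mem measurableSet_Ioi).mono fun s hs => hg.bound_H hs x)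
  refine h.trans ?_
  rw [integral_mul_const, ← mul_assoc]
  exact mul_le_mul_of_nonneg_right (duhC_parts hg.κ_pos hg.κ_lt).2.2.1 hg.nonneg

lemma norm_duhH_sub_le (hg : DuhData κ g M) (x y : E) :
    ‖duhH g x - duhH g y‖ ≤ duhC E κ * M * ‖x - y‖ ^ κ := by
  rcases eq_or_ne x y with rfl | hxy
  · simp [Real.zero_rpow hg.κ_pos.ne']
  have hκ := hg.κ_pos
  have hκ1 := hg.κ_lt
  have hM := hg.nonneg
  have hC := one_le_gaussC (E := E)
  set ρ := ‖x - y‖ with hρ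
  have hρ0 : 0 < ρ := norm_pos_iff.2 (sub_ne_zero.2 hxy)
  set A := 8 * gaussC E ^ 4 * M with hA
  have hA0 : 0 ≤ A := by positivity
  have hρ2 : 0 < ρ ^ 2 := by positivity
  have e : duhH g x - duhH g y
      = ∫ s in Ioi (0 : ℝ), Real.exp (-s) • (heatH s (g s) x - heatH s (g s) y) := by
    rw [duhH, duhH, ← integral_sub (hg.integrable_H x) (hg.integrable_H y)]
    simp only [smul_sub]
  have hitg : IntegrableOn (fun s => Real.exp (-s) • (heatH s (g s) x - heatH s (g s) y))
      (Ioi 0) := by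
    simpa only [smul_sub, Pi.sub_def] using (hg.integrable_H x).sub (hg.integrable_H y)
  have hb1 : ∀ s, 0 < s → ‖Real.exp (-s) • (heatH s (g s) x - heatH s (g s) y)‖
      ≤ s ^ (κ / 2 - 1) * A := fun s hs => by
    rw [norm_smul, Real.norm_of_nonneg (Real.exp_pos _).le]
    have h1 : Real.exp (-s) ≤ 1 := Real.exp_le_one_iff.2 (by linarith)
    have h2 := norm_heatH_le (hg.cont_slice s) (hg.bdd s) hκ.le hκ1.le (hg.hol s) hM hs
    have h3 := (norm_sub_le (heatH s (g s) x) (heatH s (g s) y)).trans (add_le_add (h2 x) (h2 y))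
    refine (mul_le_of_le_one_left (norm_nonneg _) h1).trans (h3.trans ?_)
    have hC43 : gaussC E ^ 3 ≤ gaussC E ^ 4 := pow_le_pow_right₀ hC (by norm_num)
    have hs' : 0 ≤ s ^ (κ / 2 - 1) := by positivity
    calc _ = 4 * gaussC E ^ 3 * M * s ^ (κ / 2 - 1) := by ring
      _ ≤ 8 * gaussC E ^ 4 * M * s ^ (κ / 2 - 1) := by
        gcongr
        norm_num
      _ = _ := by rw [hA]; ring
  have hb2 : ∀ s, 0 < s → ‖Real.exp (-s) • (heatH s (g s) x - heatH s (g s) y)‖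
      ≤ s ^ ((κ - 3) / 2) * (A * ρ) := fun s hs => by
    rw [norm_smul, Real.norm_of_nonneg (Real.exp_pos _).le]
    have h1 : Real.exp (-s) ≤ 1 := Real.exp_le_one_iff.2 (by linarith)
    have h2 := norm_heatH_sub_le (hg.cont_slice s) (hg.bdd s) hκ.le hκ1.le (hg.hol s) hM hs x y
    refine (mul_le_of_le_one_left (norm_nonneg _) h1).trans (h2.trans_eq ?_)
    ring
  have hsplit : Ioi (0 : ℝ) = Ioc 0 (ρ ^ 2) ∪ Ioi (ρ ^ 2) := (Ioc_union_Ioi_eq_Ioi hρ2.le).symm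
  have hi1 : IntegrableOn (fun s : ℝ => s ^ (κ / 2 - 1)) (Ioc 0 (ρ ^ 2)) :=
    (intervalIntegrable_iff_integrableOn_Ioc_of_le hρ2.le).1
      (intervalIntegral.intervalIntegrable_rpow' (by linarith))
  have hi2 : IntegrableOn (fun s : ℝ => s ^ ((κ - 3) / 2)) (Ioi (ρ ^ 2)) :=
    integrableOn_Ioi_rpow_of_lt (by linarith) hρ2
  have hv1 : ∫ s in Ioc 0 (ρ ^ 2), s ^ (κ / 2 - 1) = ρ ^ κ * (κ / 2)⁻¹ := by
    rw [← intervalIntegral.integral_of_le hρ2.le, integral_rpow (Or.inl (by linarith)),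
      Real.zero_rpow (by linarith), ← Real.rpow_natCast, ← Real.rpow_mul hρ0.le]
    rw [sub_zero, div_eq_mul_inv]
    congr 2
    · push_cast; ring
    · ring
  have hv2 : ∫ s in Ioi (ρ ^ 2), s ^ ((κ - 3) / 2) = ρ ^ (κ - 1) * (2 * (1 - κ)⁻¹) := by
    rw [integral_Ioi_rpow_of_lt (by linarith) hρ2, ← Real.rpow_natCast, ← Real.rpow_mul hρ0.le]
    have e1 : (((2 : ℕ) : ℝ) * ((κ - 3) / 2 + 1)) = κ - 1 := by push_cast; ring
    have e2 : (κ - 3) / 2 + 1 = -((1 - κ) / 2) := by ring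
    rw [e1, e2, neg_div_neg_eq, div_eq_mul_inv]
    congr 1
    rw [inv_div, div_eq_mul_inv]
  rw [e, hsplit, setIntegral_union (by simp) measurableSet_Ioi
    (hitg.mono_set Ioc_subset_Ioi_self) (hitg.mono_set (Ioi_subset_Ioi hρ2.le))]
  have k1 := norm_integral_le_of_norm_le (hi1.mul_const A)
    ((ae_restrict_mem measurableSet_Ioc).mono fun s hs => hb1 s hs.1)
  have k2 := norm_integral_le_of_norm_le (hi2.mul_const (A * ρ))
    ((ae_restrict_mem measurableSet_Ioi).mono fun s hs => hb2 s (hρ2.trans hs))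
  rw [integral_mul_const, hv1] at k1
  rw [integral_mul_const, hv2] at k2
  have hρκ : ρ ^ (κ - 1) * ρ = ρ ^ κ := by
    rw [← Real.rpow_add_one hρ0.ne']; congr 1; ring
  have hp := (duhC_parts (E := E) hκ hκ1).2.2.2
  have h3 : 0 < (κ / 2)⁻¹ := by positivity
  have h4 : 0 < (1 - κ)⁻¹ := inv_pos.2 (by linarith)
  refine (norm_add_le _ _).trans ((add_le_add k1 k2).trans ?_)
  calc _ = 8 * gaussC E ^ 4 * ((κ / 2)⁻¹ + 2 * (1 - κ)⁻¹) * M * ρ ^ κ := by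
        rw [← hρκ, hA]; ring
    _ ≤ 8 * gaussC E ^ 4 * (2 * (κ / 2)⁻¹ + 2 * (1 - κ)⁻¹) * M * ρ ^ κ := by
        gcongr; linarith
    _ ≤ _ := by gcongr

end DuhData

end Duh

section RightDeriv

lemma hasDerivWithinAt_Ici_zero_of_le {A ω : ℝ → ℝ} {a : ℝ}
    (hω : Tendsto ω (𝓝[≥] 0) (𝓝 0)) (h : ∀ h, 0 ≤ h → |A h - A 0 - h * a| ≤ ω h * h) :
    HasDerivWithinAt A a (Ici 0) 0 := by
  rw [hasDerivWithinAt_iff_isLittleO, Asymptotics.isLittleO_iff]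
  intro c hc
  filter_upwards [hω.eventually (gt_mem_nhds hc), self_mem_nhdsWithin] with r hr hr0
  have hr0' : (0 : ℝ) ≤ r := hr0
  simp only [sub_zero, smul_eq_mul, Real.norm_eq_abs, abs_of_nonneg hr0']
  exact (h r hr0').trans (by gcongr)

lemma hasDerivWithinAt_Ici_integral_diag {φ : ℝ → ℝ → ℝ}
    (hφ : Continuous fun q : ℝ × ℝ => φ q.1 q.2) :
    HasDerivWithinAt (fun h => ∫ s in (0 : ℝ)..h, φ h s) (φ 0 0) (Ici 0) 0 := by
  rw [hasDerivWithinAt_iff_isLittleO, Asymptotics.isLittleO_iff]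
  intro c hc
  have h1 := (hφ.tendsto ((0 : ℝ), (0 : ℝ))).eventually (Metric.ball_mem_nhds _ hc)
  obtain ⟨δ, hδ, hb⟩ := Metric.eventually_nhds_iff.1 h1
  filter_upwards [self_mem_nhdsWithin, mem_nhdsWithin_of_mem_nhds (Metric.ball_mem_nhds 0 hδ)]
    with r hr hrδ
  have hr0 : (0 : ℝ) ≤ r := hr
  have hrδ' : r < δ := by simpa [abs_of_nonneg hr0] using hrδ
  have hcont : Continuous (φ r) := hφ.comp (by fun_prop : Continuous fun s : ℝ => (r, s))
  have e : (∫ s in (0 : ℝ)..r, φ r s) - (∫ s in (0 : ℝ)..0, φ 0 s) - (r - 0) • φ 0 0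
      = ∫ s in (0 : ℝ)..r, (φ r s - φ 0 0) := by
    rw [intervalIntegral.integral_sub (hcont.intervalIntegrable _ _) (by simp)]
    simp
  rw [e]
  refine (intervalIntegral.norm_integral_le_of_norm_le_const (C := c) fun s hs => ?_).trans_eq
    (by simp)
  rw [uIoc_of_le hr0] at hs
  have h2 := hb (y := (r, s)) (by
    rw [Prod.dist_eq, max_lt_iff]
    simp only [Real.dist_eq, sub_zero, abs_of_nonneg hr0, abs_of_pos hs.1]
    exact ⟨hrδ', hs.2.trans_lt hrδ'⟩)
  exact (le_of_lt (by simpa [Real.dist_eq] using h2))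

lemma hasDerivAt_of_hasDerivWithinAt_Ici {u g : ℝ → ℝ} (hu : Continuous u) (hg : Continuous g)
    (h : ∀ t, HasDerivWithinAt u (g t) (Ici t) t) (t : ℝ) : HasDerivAt u (g t) t := by
  set v : ℝ → ℝ := fun t => u t - ∫ s in (0 : ℝ)..t, g s with hv
  have hI : ∀ t, HasDerivAt (fun t => ∫ s in (0 : ℝ)..t, g s) (g t) t := fun t =>
    (hg.integral_hasStrictDerivAt 0 t).hasDerivAt
  have hv0 : ∀ t, HasDerivWithinAt v 0 (Ici t) t := fun t => by
    exact ((h t).sub (hI t).hasDerivWithinAt).congr_deriv (sub_self _)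
  have hvc : Continuous v :=
    hu.sub (continuous_iff_continuousAt.2 fun t => (hI t).continuousAt)
  have hc : ∀ a b, a ≤ b → v b = v a := fun a b hab =>
    constant_of_has_deriv_right_zero hvc.continuousOn (fun x _ => hv0 x) b ⟨hab, le_rfl⟩
  have hc0 : ∀ t, v t = v 0 := fun t => by
    rcases le_total t 0 with h | h
    · exact (hc _ _ h).symm
    · exact hc _ _ h
  have e : u = fun t => v 0 + ∫ s in (0 : ℝ)..t, g s := by
    ext t
    rw [← hc0 t]; simp [hv]
  rw [e]
  exact (hI t).const_add _

end RightDeriv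

section Cls

set_option linter.unusedSectionVars false
set_option maxSynthPendingDepth 3

variable {E : Type*} [NormedAddCommGroup E] [InnerProductSpace ℝ E] [FiniteDimensional ℝ E]

/-- The spatial derivative of a function of space and time. -/
noncomputable def D1 (u : E → ℝ → ℝ) (x : E) (t : ℝ) : E →L[ℝ] ℝ := fderiv ℝ (fun y => u y t) x

/-- The second spatial derivative of a function of space and time. -/
noncomputable def D2 (u : E → ℝ → ℝ) (x : E) (t : ℝ) : E →L[ℝ] E →L[ℝ] ℝ :=
  fderiv ℝ (fun y => D1 u y t) x

variable (E) in
/-- Half the trace of a bilinear form: `lapF (D²u) = ½Δu`. -/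
noncomputable def lapF : (E →L[ℝ] E →L[ℝ] ℝ) →L[ℝ] ℝ :=
  (1 / 2 : ℝ) • ∑ i, (ContinuousLinearMap.apply ℝ ℝ (stdOrthonormalBasis ℝ E i)) ∘L
    (ContinuousLinearMap.apply ℝ (E →L[ℝ] ℝ) (stdOrthonormalBasis ℝ E i))

lemma lapF_apply (T : E →L[ℝ] E →L[ℝ] ℝ) : lapF E T
    = 1 / 2 * ∑ i, T (stdOrthonormalBasis ℝ E i) (stdOrthonormalBasis ℝ E i) := by
  simp [lapF]

/-- Bounded right-hand sides, Hölder continuous in space, continuous in time. -/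
structure XC (κ : ℝ) (f : E → ℝ → ℝ) (M : ℝ) : Prop where
  cont : ∀ x, Continuous (f x)
  bdd : ∀ x t, |f x t| ≤ M
  hol : ∀ x y t, |f x t - f y t| ≤ M * ‖x - y‖ ^ κ
  zero : ∀ x t, t ≤ 0 → f x t = 0

/-- Bounded functions with bounded and Hölder continuous second spatial derivatives. -/
structure YC (κ : ℝ) (u : E → ℝ → ℝ) (M : ℝ) : Prop where
  d1 : ∀ x t, HasFDerivAt (fun y => u y t) (D1 u x t) x
  d2 : ∀ x t, HasFDerivAt (fun y => D1 u y t) (D2 u x t) x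
  b0 : ∀ x t, |u x t| ≤ M
  b1 : ∀ x t, ‖D1 u x t‖ ≤ M
  b2 : ∀ x t, ‖D2 u x t‖ ≤ M
  h2 : ∀ x y t, ‖D2 u x t - D2 u y t‖ ≤ M * ‖x - y‖ ^ κ
  lip : ∀ x t s, |u x t - u x s| ≤ M * |t - s|
  zero : ∀ x t, t ≤ 0 → u x t = 0

lemma D1_eq {u : E → ℝ → ℝ} {u' : E → ℝ → E →L[ℝ] ℝ}
    (h : ∀ x t, HasFDerivAt (fun y => u y t) (u' x t) x) : D1 u = u' := by
  ext1 x; ext1 t; exact (h x t).fderiv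

lemma D2_eq {u : E → ℝ → ℝ} {u' : E → ℝ → E →L[ℝ] ℝ} {u'' : E → ℝ → E →L[ℝ] E →L[ℝ] ℝ}
    (h : ∀ x t, HasFDerivAt (fun y => u y t) (u' x t) x)
    (h' : ∀ x t, HasFDerivAt (fun y => u' y t) (u'' x t) x) : D2 u = u'' := by
  ext1 x; ext1 t
  rw [D2, D1_eq h]; exact (h' x t).fderiv

lemma continuous_of_hol_of_cont {κ M : ℝ} (hκ : 0 < κ) {G : Type*} [NormedAddCommGroup G]
    {f : E → ℝ → G} (hc : ∀ x, Continuous (f x))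
    (hh : ∀ x y t, ‖f x t - f y t‖ ≤ M * ‖x - y‖ ^ κ) :
    Continuous fun q : E × ℝ => f q.1 q.2 := by
  rw [continuous_iff_continuousAt]
  rintro ⟨x, t⟩
  rw [ContinuousAt, tendsto_iff_norm_sub_tendsto_zero]
  have h1 : Tendsto (fun q : E × ℝ => M * ‖q.1 - x‖ ^ κ + ‖f x q.2 - f x t‖) (𝓝 (x, t)) (𝓝 0) := by
    have : Continuous fun q : E × ℝ => M * ‖q.1 - x‖ ^ κ + ‖f x q.2 - f x t‖ := by
      have h3 : Continuous fun q : E × ℝ => f x q.2 := (hc x).comp continuous_snd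
      have h4 : Continuous fun q : E × ℝ => ‖q.1 - x‖ ^ κ :=
        (by fun_prop : Continuous fun q : E × ℝ => ‖q.1 - x‖).rpow_const fun _ => Or.inr hκ.le
      exact (h4.const_mul M).add (h3.sub continuous_const).norm
    have h2 := this.tendsto (x, t)
    simpa [Real.zero_rpow hκ.ne'] using h2
  refine squeeze_zero (fun q => norm_nonneg _) (fun q => ?_) h1
  calc ‖f q.1 q.2 - f x t‖ = ‖(f q.1 q.2 - f x q.2) + (f x q.2 - f x t)‖ := by congr 1; abel
    _ ≤ _ := (norm_add_le _ _).trans (add_le_add (hh _ _ _) le_rfl)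

lemma XC.continuous {κ M : ℝ} (hκ : 0 < κ) {f : E → ℝ → ℝ} (hf : XC κ f M) :
    Continuous fun q : E × ℝ => f q.1 q.2 :=
  continuous_of_hol_of_cont hκ hf.cont hf.hol

variable [MeasurableSpace E] [BorelSpace E]

lemma XC.duhData {κ M : ℝ} (hκ : 0 < κ) (hκ1 : κ < 1) {f : E → ℝ → ℝ} (hf : XC κ f M) (t : ℝ) :
    DuhData κ (fun s y => f y (t - s)) M where
  κ_pos := hκ
  κ_lt := hκ1
  nonneg := (abs_nonneg _).trans (hf.bdd 0 0)
  cont := (hf.continuous hκ).comp (by fun_prop : Continuous fun q : ℝ × E => (q.2, t - q.1))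
  bdd s x := hf.bdd _ _
  hol s x y := hf.hol _ _ _

/-- The solution of `u_t = ½Δu - u + f`. -/
noncomputable def duhS (f : E → ℝ → ℝ) (x : E) (t : ℝ) : ℝ := duh (fun s y => f y (t - s)) x

variable {κ M : ℝ} {f : E → ℝ → ℝ}

lemma D1_duhS (hκ : 0 < κ) (hκ1 : κ < 1) (hf : XC κ f M) :
    D1 (duhS f) = fun x t => duhD (fun s y => f y (t - s)) x :=
  D1_eq fun x t => (hf.duhData hκ hκ1 t).hasFDerivAt_duh x

lemma D2_duhS (hκ : 0 < κ) (hκ1 : κ < 1) (hf : XC κ f M) :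
    D2 (duhS f) = fun x t => duhH (fun s y => f y (t - s)) x :=
  D2_eq (fun x t => (hf.duhData hκ hκ1 t).hasFDerivAt_duh x)
    (fun x t => (hf.duhData hκ hκ1 t).hasFDerivAt_duhD x)

lemma continuous_duhS (hκ : 0 < κ) (hκ1 : κ < 1) (hf : XC κ f M) (x : E) :
    Continuous (duhS f x) := by
  refine continuous_of_dominated (bound := fun s => Real.exp (-s) * M)
    (fun t => (hf.duhData hκ hκ1 t).aesm_P x)
    (fun t => Eventually.of_forall fun s => (hf.duhData hκ hκ1 t).bound_P s x)
    ((integrableOn_exp_neg_Ioi 0).mul_const M) (Eventually.of_forall fun s => ?_)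
  refine Continuous.const_smul ?_ (Real.exp (-s))
  exact continuous_heatP_param (X := ℝ) (g := fun t y => f y (t - s)) (M := M)
    ((hf.continuous hκ).comp (by fun_prop : Continuous fun q : ℝ × E => (q.2, q.1 - s)))
    (fun t y => hf.bdd _ _) (τ := fun _ => s) (by fun_prop) (by fun_prop)

lemma continuous_duhH (hκ : 0 < κ) (hκ1 : κ < 1) (hf : XC κ f M) (x : E) :
    Continuous (fun t => duhH (fun s y => f y (t - s)) x) := by
  have : ProperSpace E := FiniteDimensional.proper_real E
  refine continuous_of_dominated
    (bound := fun s => (Real.exp (-s) * s ^ (κ / 2 - 1)) * (2 * gaussC E ^ 3 * M))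
    (fun t => (hf.duhData hκ hκ1 t).aesm_H x)
    (fun t => (ae_restrict_mem measurableSet_Ioi).mono fun s hs =>
      (hf.duhData hκ hκ1 t).bound_H hs x)
    ((integrableOn_exp_mul_rpow (by linarith)).mul_const _)
    ((ae_restrict_mem measurableSet_Ioi).mono fun s hs => ?_)
  refine Continuous.const_smul ?_ (Real.exp (-s))
  have hs2 : 0 < s / 2 := half_pos hs
  refine continuous_heatD_param (X := ℝ) (g := fun t => heatD (s / 2) (fun y => f y (t - s)))
    ?_ (fun t y => norm_heatD_le (M := M) (fun z => hf.bdd _ _) _ y) (τ := fun _ => s / 2)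
    (by fun_prop) (fun _ => hs2) (by fun_prop)
  exact continuous_heatD_param (X := ℝ × E) (g := fun q y => f y (q.1 - s)) (M := M)
    ((hf.continuous hκ).comp
      (by fun_prop : Continuous fun q : (ℝ × E) × E => (q.2, q.1.1 - s)))
    (fun t y => hf.bdd _ _) (τ := fun _ => s / 2) (by fun_prop) (fun _ => hs2) continuous_snd

lemma duhS_add (hκ : 0 < κ) (hκ1 : κ < 1) (hf : XC κ f M) (x : E) (t : ℝ) {h : ℝ} (hh : 0 ≤ h) :
    duhS f x (t + h) = Real.exp (-h) * heatP h (fun y => duhS f y t) x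
      + ∫ s in (0 : ℝ)..h, Real.exp (-s) * heatP s (fun y => f y (t + h - s)) x := by
  have hg := hf.duhData hκ hκ1 t
  have hg' := hf.duhData hκ hκ1 (t + h)
  have e0 : duhS f x (t + h)
      = (∫ s in Ioc 0 h, Real.exp (-s) • heatP s (fun y => f y (t + h - s)) x)
        + ∫ s in Ioi h, Real.exp (-s) • heatP s (fun y => f y (t + h - s)) x := by
    rw [duhS, duh, ← Ioc_union_Ioi_eq_Ioi hh, setIntegral_union (by simp) measurableSet_Ioi]
    · exact (hg'.integrable_P x).mono_set Ioc_subset_Ioi_self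
    · exact (hg'.integrable_P x).mono_set (Ioi_subset_Ioi hh)
  have e1 : ∫ s in Ioi h, Real.exp (-s) • heatP s (fun y => f y (t + h - s)) x
      = ∫ s in Ioi (0 : ℝ), Real.exp (-(s + h)) • heatP (s + h) (fun y => f y (t - s)) x := by
    have := (measurePreserving_add_right (volume : Measure ℝ) h).setIntegral_preimage_emb
      (measurableEmbedding_addRight h)
      (fun s => Real.exp (-s) • heatP s (fun y => f y (t + h - s)) x) (Ioi h)
    rw [← this]
    have hp : (fun s => s + h) ⁻¹' Ioi h = Ioi 0 := by ext s; simp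
    rw [hp]
    refine integral_congr_ae (Eventually.of_forall fun s => ?_)
    simp only
    congr 3
    ext y
    congr 1
    ring
  have e2 : heatP h (fun y => duhS f y t) x
      = ∫ s in Ioi (0 : ℝ), Real.exp (-s) • heatP (s + h) (fun y => f y (t - s)) x := by
    unfold heatP
    simp only [duhS, duh]
    rw [integral_integral_swap]
    · refine integral_congr_ae ((ae_restrict_mem measurableSet_Ioi).mono fun s hs => ?_)
      simp only
      rw [integral_smul]
      congr 1
      have := heatP_heatP (hg.cont_slice s) (hg.bdd s) hh (le_of_lt hs)
      rw [add_comm h s] at this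
      exact congrFun this x
    · have hi : Integrable (fun q : E × ℝ => (1 : ℝ) * (Real.exp (-q.2) * M))
          ((stdGaussian E).prod (volume.restrict (Ioi 0))) :=
        (integrable_const (1 : ℝ)).mul_prod ((integrableOn_exp_neg_Ioi 0).mul_const M)
      refine hi.mono' ?_ (Eventually.of_forall fun q => ?_)
      · have : ProperSpace E := FiniteDimensional.proper_real E
        refine Continuous.aestronglyMeasurable ?_
        refine Continuous.smul (f := fun q : E × ℝ => Real.exp (-q.2)) (by fun_prop) ?_
        exact continuous_heatP_param (X := E × ℝ) (g := fun q y => f y (t - q.2)) (M := M)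
          ((hf.continuous hκ).comp
            (by fun_prop : Continuous fun q : (E × ℝ) × E => (q.2, t - q.1.2)))
          (fun q y => hf.bdd _ _) (τ := fun q => q.2) (by fun_prop) (by fun_prop)
      · rw [one_mul]
        exact hg.bound_P q.2 _
  rw [e0, e1, e2, intervalIntegral.integral_of_le hh, ← integral_const_mul, add_comm]
  congr 1
  refine integral_congr_ae (Eventually.of_forall fun s => ?_)
  simp only [smul_eq_mul]
  rw [← mul_assoc, ← Real.exp_add]
  congr 2
  ring

lemma hasDerivAt_duhS (hκ : 0 < κ) (hκ1 : κ < 1) (hf : XC κ f M) (x : E) (t : ℝ) :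
    HasDerivAt (duhS f x) (lapF E (D2 (duhS f) x t) - duhS f x t + f x t) t := by
  have hM : 0 ≤ M := (abs_nonneg _).trans (hf.bdd 0 0)
  have hC : 0 ≤ gaussC E := gaussC_nonneg
  have hC2 : 0 ≤ duhC E κ := zero_le_one.trans (DuhData.duhC_parts hκ hκ1).1
  refine hasDerivAt_of_hasDerivWithinAt_Ici (continuous_duhS hκ hκ1 hf x)
    (g := fun t => lapF E (D2 (duhS f) x t) - duhS f x t + f x t) ?_ ?_ t
  · rw [D2_duhS hκ hκ1 hf]
    exact (((lapF E).continuous.comp (continuous_duhH hκ hκ1 hf x)).sub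
      (continuous_duhS hκ hκ1 hf x)).add (hf.cont x)
  intro t
  have hg := hf.duhData hκ hκ1 t
  have hA : HasDerivWithinAt (fun h => heatP h (fun y => duhS f y t) x)
      (lapF E (D2 (duhS f) x t)) (Ici 0) 0 := by
    refine hasDerivWithinAt_Ici_zero_of_le
      (ω := fun h => gaussC E * (duhC E κ * M) * √h ^ κ) ?_ fun h hh => ?_
    · have hc : Continuous fun h : ℝ => gaussC E * (duhC E κ * M) * √h ^ κ :=
        ((Real.continuous_sqrt.rpow_const fun _ => Or.inr hκ.le)).const_mul _
      have := hc.tendsto 0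
      simp only [Real.sqrt_zero, Real.zero_rpow hκ.ne', mul_zero] at this
      exact this.mono_left nhdsWithin_le_nhds
    · have := heatP_generator (stdOrthonormalBasis ℝ E) hκ.le hκ1.le (by positivity)
        (hg.norm_duh_le) hg.hasFDerivAt_duh hg.hasFDerivAt_duhD (hg.norm_duhH_sub_le) hh x
      rw [D2_duhS hκ hκ1 hf, lapF_apply]
      simp only [heatP_zero]
      refine this.trans_eq ?_
      ring
  have hE : HasDerivWithinAt (fun h : ℝ => Real.exp (-h)) (-1) (Ici 0) 0 := by
    have := ((hasDerivAt_neg (0 : ℝ)).exp).hasDerivWithinAt (s := Ici 0)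
    simpa using this
  have hB := hasDerivWithinAt_Ici_integral_diag
    (φ := fun h s => Real.exp (-s) * heatP s (fun y => f y (t + h - s)) x) (by
      refine Continuous.mul (by fun_prop) ?_
      exact continuous_heatP_param (X := ℝ × ℝ) (g := fun q y => f y (t + q.1 - q.2)) (M := M)
          ((hf.continuous hκ).comp
            (by fun_prop : Continuous fun q : (ℝ × ℝ) × E => (q.2, t + q.1.1 - q.1.2)))
          (fun q y => hf.bdd _ _) (τ := fun q => q.2) (by fun_prop) (by fun_prop))
  have hS := (hE.mul hA).add hB
  have hS2 : HasDerivWithinAt (fun h => duhS f x (t + h))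
      (lapF E (D2 (duhS f) x t) - duhS f x t + f x t) (Ici 0) 0 := by
    refine (hS.congr_of_mem (fun h hh => ?_) self_mem_Ici).congr_deriv ?_
    · exact duhS_add hκ hκ1 hf x t hh
    · simp [heatP_zero]
      ring
  have hl : HasDerivWithinAt (fun τ : ℝ => τ - t) 1 (Ici t) t :=
    ((hasDerivAt_id t).sub_const t).hasDerivWithinAt
  have hS3 := HasDerivWithinAt.scomp (h := fun τ : ℝ => τ - t) (h' := 1) (s := Ici t) (t' := Ici 0)
    (g₁ := fun h => duhS f x (t + h)) t (by simpa using hS2) hl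
    (fun τ hτ => by simpa using hτ)
  simpa [Function.comp_def] using hS3

theorem duhS_YC (hκ : 0 < κ) (hκ1 : κ < 1) (hf : XC κ f M) :
    YC κ (duhS f) ((‖lapF E‖ + 2) * duhC E κ * M) := by
  have hM : 0 ≤ M := (abs_nonneg _).trans (hf.bdd 0 0)
  have hC2 : 1 ≤ duhC E κ := (DuhData.duhC_parts hκ hκ1).1
  have hl := norm_nonneg (lapF E)
  have h1 : M ≤ duhC E κ * M := le_mul_of_one_le_left hM hC2
  have h2 : duhC E κ * M ≤ (‖lapF E‖ + 2) * duhC E κ * M := by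
    have : 0 ≤ duhC E κ * M := by positivity
    nlinarith
  have hd := fun t => hf.duhData hκ hκ1 t
  have hb2 : ∀ x t, ‖D2 (duhS f) x t‖ ≤ duhC E κ * M := fun x t => by
    rw [D2_duhS hκ hκ1 hf]; exact (hd t).norm_duhH_le x
  refine ⟨fun x t => ?_, fun x t => ?_, fun x t => ?_, fun x t => ?_, fun x t => ?_,
    fun x y t => ?_, fun x t s => ?_, fun x t ht => ?_⟩
  · rw [D1_duhS hκ hκ1 hf]; exact (hd t).hasFDerivAt_duh x
  · rw [D1_duhS hκ hκ1 hf, D2_duhS hκ hκ1 hf]; exact (hd t).hasFDerivAt_duhD x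
  · exact ((hd t).norm_duh_le x).trans (h1.trans h2)
  · rw [D1_duhS hκ hκ1 hf]; exact ((hd t).norm_duhD_le x).trans h2
  · exact (hb2 x t).trans h2
  · rw [D2_duhS hκ hκ1 hf]
    refine ((hd t).norm_duhH_sub_le x y).trans ?_
    gcongr
  · have := convex_univ.norm_image_sub_le_of_norm_hasDerivWithin_le (f := duhS f x)
      (C := (‖lapF E‖ + 2) * duhC E κ * M)
      (fun τ _ => (hasDerivAt_duhS hκ hκ1 hf x τ).hasDerivWithinAt) (fun τ _ => by
        have k1 := (lapF E).le_opNorm (D2 (duhS f) x τ)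
        have k2 : ‖lapF E‖ * ‖D2 (duhS f) x τ‖ ≤ ‖lapF E‖ * (duhC E κ * M) := by
          gcongr; exact hb2 x τ
        have k3 := (hd τ).norm_duh_le x
        have k4 := hf.bdd x τ
        calc _ ≤ ‖lapF E (D2 (duhS f) x τ)‖ + ‖duhS f x τ‖ + ‖f x τ‖ :=
              (norm_add_le _ _).trans (add_le_add (norm_sub_le _ _) le_rfl)
          _ ≤ ‖lapF E‖ * (duhC E κ * M) + M + M :=
              add_le_add (add_le_add (k1.trans k2) k3) k4
          _ ≤ _ := by nlinarith) (mem_univ s) (mem_univ t)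
    simpa using this
  · rw [duhS, duh]
    have : ∀ s ∈ Ioi (0 : ℝ), Real.exp (-s) • heatP s (fun y => f y (t - s)) x = 0 :=
      fun s hs => by
        have hs' : (0 : ℝ) < s := hs
        have e : ∀ y, f y (t - s) = 0 := fun y => hf.zero y _ (by linarith)
        simp [heatP, e]
    rw [setIntegral_congr_fun measurableSet_Ioi this]
    simp

end Cls

section MaxPrinciple

set_option linter.unusedSectionVars false
set_option maxSynthPendingDepth 3

variable {E : Type*} [NormedAddCommGroup E] [InnerProductSpace ℝ E] [FiniteDimensional ℝ E]

lemma nonneg_of_isLocalMin_of_hasDerivAt {φ φ' : ℝ → ℝ} {a : ℝ}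
    (h1 : ∀ᶠ s in 𝓝 0, HasDerivAt φ (φ' s) s) (h2 : HasDerivAt φ' a 0)
    (hm : IsLocalMin φ 0) : 0 ≤ a := by
  by_contra! ha
  have e1 : deriv φ =ᶠ[𝓝 0] φ' := h1.mono fun s hs => hs.deriv
  have h0 : deriv φ 0 = 0 := hm.deriv_eq_zero
  have h3 : deriv (deriv φ) 0 = a := (h2.congr_of_eventuallyEq e1).deriv
  have hM := isLocalMax_of_deriv_deriv_neg (f := φ) (x₀ := 0) (by rwa [h3]) h0
    h1.self_of_nhds.continuousAt
  have hc : φ =ᶠ[𝓝 0] fun _ => φ 0 := by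
    filter_upwards [hm, hM] with s hs hs' using le_antisymm hs' hs
  have h4 : deriv φ =ᶠ[𝓝 0] fun _ => 0 := by
    filter_upwards [hc.deriv] with s hs
    rw [hs]; simp
  rw [h4.deriv_eq] at h3
  simp at h3
  exact ha.ne h3.symm

lemma IsLocalMin.second_order {w : E → ℝ} {w' : E → E →L[ℝ] ℝ} {w'' : E →L[ℝ] E →L[ℝ] ℝ} {x : E}
    (h1 : ∀ᶠ y in 𝓝 x, HasFDerivAt w (w' y) y) (h2 : HasFDerivAt w' w'' x)
    (hm : IsLocalMin w x) : w' x = 0 ∧ ∀ v, 0 ≤ w'' v v := by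
  refine ⟨hm.hasFDerivAt_eq_zero h1.self_of_nhds, fun v => ?_⟩
  have hl : ∀ s : ℝ, HasDerivAt (fun s : ℝ => x + s • v) v s := fun s => by
    simpa using ((hasDerivAt_id s).smul_const v).const_add x
  have hl0 : Tendsto (fun s : ℝ => x + s • v) (𝓝 0) (𝓝 x) := by
    simpa using (hl 0).continuousAt.tendsto
  refine nonneg_of_isLocalMin_of_hasDerivAt (φ := fun s : ℝ => w (x + s • v))
    (φ' := fun s => w' (x + s • v) v) ?_ ?_ ?_
  · filter_upwards [hl0.eventually h1] with s hs
    exact hs.comp_hasDerivAt s (hl s)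
  · have h2' : HasFDerivAt w' w'' (x + (0 : ℝ) • v) := by simpa using h2
    exact ((ContinuousLinearMap.apply ℝ ℝ v).hasFDerivAt (x := w' (x + (0 : ℝ) • v))).comp_hasDerivAt
      (0 : ℝ) (h2'.comp_hasDerivAt (0 : ℝ) (hl 0))
  · have := hl0.eventually hm
    simpa [IsLocalMin, IsMinFilter] using this

theorem pos_of_no_contact {z : E → ℝ → ℝ} {c : E} {R T : ℝ}
    (hc : ContinuousOn (fun q : E × ℝ => z q.1 q.2) (Metric.closedBall c R ×ˢ Icc 0 T))
    (h0 : ∀ x ∈ Metric.closedBall c R, 0 < z x 0)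
    (hb : ∀ x ∈ Metric.sphere c R, ∀ t ∈ Icc 0 T, 0 < z x t)
    (hi : ∀ x ∈ Metric.ball c R, ∀ t, 0 < t → t ≤ T → z x t = 0 →
      IsLocalMin (fun y => z y t) x → ∃ z', HasDerivAt (z x) z' t ∧ 0 < z') :
    ∀ x ∈ Metric.closedBall c R, ∀ t ∈ Icc 0 T, 0 < z x t := by
  have : ProperSpace E := FiniteDimensional.proper_real E
  by_contra! hcon
  obtain ⟨x1, hx1, t1, ht1, hz1⟩ := hcon
  have hK : IsCompact (Metric.closedBall c R ×ˢ Icc (0 : ℝ) T) :=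
    (isCompact_closedBall c R).prod isCompact_Icc
  have hS : IsCompact ((Metric.closedBall c R ×ˢ Icc (0 : ℝ) T) ∩
      (fun q : E × ℝ => z q.1 q.2) ⁻¹' Iic 0) := by
    refine hK.of_isClosed_subset ?_ inter_subset_left
    exact hc.preimage_isClosed_of_isClosed hK.isClosed isClosed_Iic
  obtain ⟨⟨x, t⟩, ⟨⟨hx, ht⟩, hz⟩, hmin⟩ := hS.exists_isMinOn ⟨(x1, t1), ⟨hx1, ht1⟩, hz1⟩
    (f := Prod.snd) continuous_snd.continuousOn
  simp only [mem_preimage, mem_Iic] at hx ht hz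
  have hpos : ∀ y ∈ Metric.closedBall c R, ∀ s, 0 ≤ s → s < t → 0 < z y s := by
    intro y hy s hs hst
    by_contra! h
    exact absurd (hmin (a := (y, s)) ⟨⟨hy, hs, hst.le.trans ht.2⟩, h⟩) (not_le.2 hst)
  have ht0 : 0 < t := by
    rcases ht.1.lt_or_eq with h | h
    · exact h
    · rw [← h] at hz
      exact absurd hz (not_le.2 (h0 x hx))
  have hlim : ∀ y ∈ Metric.closedBall c R, Tendsto (z y) (𝓝[<] t) (𝓝 (z y t)) := by
    intro y hy
    have h1 : ContinuousWithinAt (fun s => z y s) (Icc 0 T) t :=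
      (hc (y, t) ⟨hy, ht⟩).comp (f := fun s : ℝ => (y, s)) (t := Metric.closedBall c R ×ˢ Icc 0 T)
        (by fun_prop) (fun s hs => ⟨hy, hs⟩)
    refine h1.mono_left (nhdsWithin_le_of_mem ?_)
    filter_upwards [Ioo_mem_nhdsLT ht0] with s hs using ⟨hs.1.le, hs.2.le.trans ht.2⟩
  have hge : ∀ y ∈ Metric.closedBall c R, 0 ≤ z y t := fun y hy =>
    ge_of_tendsto (hlim y hy) (by
      filter_upwards [Ioo_mem_nhdsLT ht0] with s hs using (hpos y hy s hs.1.le hs.2).le)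
  have hz0 : z x t = 0 := le_antisymm hz (hge x hx)
  have hxb : x ∈ Metric.ball c R := by
    rcases (Metric.mem_closedBall.1 hx).lt_or_eq with h | h
    · exact h
    · exact absurd hz (not_le.2 (hb x h t ht))
  obtain ⟨z', hd, hz'⟩ := hi x hxb t ht0 ht.2 hz0 (by
    filter_upwards [Metric.isOpen_ball.mem_nhds hxb] with y hy
    rw [hz0]; exact hge y (Metric.ball_subset_closedBall hy))
  have hsl := hd.hasDerivWithinAt (s := Iio t)
  rw [hasDerivWithinAt_iff_tendsto_slope' (by simp)] at hsl
  refine absurd (le_of_tendsto hsl (b := 0) ?_) (not_le.2 hz')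
  filter_upwards [Ioo_mem_nhdsLT ht0] with s hs
  rw [slope_def_field, hz0, sub_zero]
  exact div_nonpos_of_nonneg_of_nonpos (hpos x hx s hs.1.le hs.2).le (by linarith [hs.2])

/-- Twice differentiability in space at a point, with first derivatives nearby. -/
structure C2At (u : E → ℝ → ℝ) (x : E) (t : ℝ) : Prop where
  d1 : ∀ᶠ y in 𝓝 x, HasFDerivAt (fun y => u y t) (D1 u y t) y
  d2 : HasFDerivAt (fun y => D1 u y t) (D2 u x t) x

lemma D2_congr {u : E → ℝ → ℝ} {x : E} {t : ℝ} {w : E → E →L[ℝ] ℝ} {w2 : E →L[ℝ] E →L[ℝ] ℝ}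
    (h1 : ∀ᶠ y in 𝓝 x, HasFDerivAt (fun y => u y t) (w y) y) (h2 : HasFDerivAt w w2 x) :
    C2At u x t ∧ D1 u x t = w x ∧ D2 u x t = w2 := by
  have e : (fun y => D1 u y t) =ᶠ[𝓝 x] w := h1.mono fun y hy => hy.fderiv
  have h3 : HasFDerivAt (fun y => D1 u y t) w2 x := h2.congr_of_eventuallyEq e
  have h4 : D2 u x t = w2 := h3.fderiv
  refine ⟨⟨?_, by rwa [h4]⟩, e.self_of_nhds, h4⟩
  filter_upwards [h1] with y hy
  have : D1 u y t = w y := hy.fderiv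
  rwa [this]

lemma C2At.add_smul {u v : E → ℝ → ℝ} {x : E} {t : ℝ} (hu : C2At u x t) (hv : C2At v x t) (a : ℝ) :
    C2At (fun x t => u x t + a * v x t) x t ∧
    D1 (fun x t => u x t + a * v x t) x t = D1 u x t + a • D1 v x t ∧
    D2 (fun x t => u x t + a * v x t) x t = D2 u x t + a • D2 v x t := by
  refine D2_congr (u := fun x t => u x t + a * v x t)
    (w := fun y => D1 u y t + a • D1 v y t) ?_ (hu.d2.add (hv.d2.const_smul a))
  filter_upwards [hu.d1, hv.d1] with y h1 h2
  exact h1.add (h2.const_smul a)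

lemma C2At.sub {u v : E → ℝ → ℝ} {x : E} {t : ℝ} (hu : C2At u x t) (hv : C2At v x t) :
    C2At (fun x t => u x t - v x t) x t ∧
    D1 (fun x t => u x t - v x t) x t = D1 u x t - D1 v x t ∧
    D2 (fun x t => u x t - v x t) x t = D2 u x t - D2 v x t := by
  simpa [sub_eq_add_neg] using hu.add_smul hv (-1)

/-- `u` is a subsolution of `u_t = A D²u + B Du + F(x,t,u)` at a point. -/
structure SubAt (A : E → (E →L[ℝ] E →L[ℝ] ℝ) →L[ℝ] ℝ) (B : E → (E →L[ℝ] ℝ) →L[ℝ] ℝ)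
    (F : E → ℝ → ℝ → ℝ) (u : E → ℝ → ℝ) (x : E) (t : ℝ) : Prop where
  c2 : C2At u x t
  le : ∃ u', HasDerivAt (u x) u' t ∧ u' ≤ A x (D2 u x t) + B x (D1 u x t) + F x t (u x t)

/-- `u` is a supersolution of `u_t = A D²u + B Du + F(x,t,u)` at a point. -/
structure SuperAt (A : E → (E →L[ℝ] E →L[ℝ] ℝ) →L[ℝ] ℝ) (B : E → (E →L[ℝ] ℝ) →L[ℝ] ℝ)
    (F : E → ℝ → ℝ → ℝ) (u : E → ℝ → ℝ) (x : E) (t : ℝ) : Prop where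
  c2 : C2At u x t
  ge : ∃ u', HasDerivAt (u x) u' t ∧ A x (D2 u x t) + B x (D1 u x t) + F x t (u x t) ≤ u'

variable {A : E → (E →L[ℝ] E →L[ℝ] ℝ) →L[ℝ] ℝ} {B : E → (E →L[ℝ] ℝ) →L[ℝ] ℝ}
  {F : E → ℝ → ℝ → ℝ}

/-- The comparison principle on a cylinder. -/
theorem comparison {u v : E → ℝ → ℝ} {c : E} {R T M : ℝ}
    (hA : ∀ x ∈ Metric.ball c R, ∀ T : E →L[ℝ] E →L[ℝ] ℝ, (∀ v, 0 ≤ T v v) → 0 ≤ A x T)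
    (hF : ∀ x ∈ Metric.ball c R, ∀ t, 0 < t → t ≤ T → v x t ≤ u x t →
      F x t (u x t) - F x t (v x t) ≤ M * (u x t - v x t))
    (hu : ContinuousOn (fun q : E × ℝ => u q.1 q.2) (Metric.closedBall c R ×ˢ Icc 0 T))
    (hv : ContinuousOn (fun q : E × ℝ => v q.1 q.2) (Metric.closedBall c R ×ˢ Icc 0 T))
    (h0 : ∀ x ∈ Metric.closedBall c R, u x 0 ≤ v x 0)
    (hb : ∀ x ∈ Metric.sphere c R, ∀ t ∈ Icc 0 T, u x t ≤ v x t)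
    (hsub : ∀ x ∈ Metric.ball c R, ∀ t, 0 < t → t ≤ T → SubAt A B F u x t)
    (hsup : ∀ x ∈ Metric.ball c R, ∀ t, 0 < t → t ≤ T → SuperAt A B F v x t) :
    ∀ x ∈ Metric.closedBall c R, ∀ t ∈ Icc 0 T, u x t ≤ v x t := by
  have key : ∀ ε : ℝ, 0 < ε → ∀ x ∈ Metric.closedBall c R, ∀ t ∈ Icc 0 T,
      0 < v x t - u x t + ε * Real.exp ((M + 1) * t) := by
    intro ε hε
    have hpe : ∀ t, 0 < ε * Real.exp ((M + 1) * t) := fun t => by positivity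
    refine pos_of_no_contact (z := fun x t => v x t - u x t + ε * Real.exp ((M + 1) * t))
      ?_ (fun x hx => ?_) (fun x hx t ht => ?_) ?_
    · exact (hv.sub hu).add (by fun_prop)
    · have := h0 x hx; have := hpe 0; linarith
    · have := hb x hx t ht; have := hpe t; linarith
    · intro x hx t ht htT hz hm
      obtain ⟨cu, u', hu', hule⟩ := hsub x hx t ht htT
      obtain ⟨cv, v', hv', hvge⟩ := hsup x hx t ht htT
      obtain ⟨cc, e1, e2⟩ := cv.sub cu
      have hm' : IsLocalMin (fun y => v y t - u y t) x := by
        filter_upwards [hm] with y hy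
        simpa using hy
      obtain ⟨m1, m2⟩ := hm'.second_order cc.d1 cc.d2
      rw [e1] at m1
      rw [e2] at m2
      have hAn := hA x hx _ m2
      rw [map_sub] at hAn
      have hB0 : B x (D1 v x t) = B x (D1 u x t) := by rw [sub_eq_zero.1 m1]
      have hlt := hpe t
      have hFF := hF x hx t ht htT (by linarith)
      have hd := (hv'.sub hu').add (((hasDerivAt_id t).const_mul (M + 1)).exp.const_mul ε)
      refine ⟨_, hd, ?_⟩
      simp only [id, mul_one]
      have e3 : u x t - v x t = ε * Real.exp ((M + 1) * t) := by linarith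
      rw [e3] at hFF
      have e4 : ε * (Real.exp ((M + 1) * t) * (M + 1)) = (M + 1) * (ε * Real.exp ((M + 1) * t)) := by
        ring
      rw [e4]
      nlinarith
  intro x hx t ht
  refine le_of_forall_pos_le_add fun δ hδ => ?_
  have hp := Real.exp_pos ((M + 1) * t)
  have := key (δ / Real.exp ((M + 1) * t)) (by positivity) x hx t ht
  rw [div_mul_cancel₀ _ hp.ne'] at this
  linarith

variable (E) in
/-- The inner product as a real bilinear map. -/
noncomputable def inS : E →L[ℝ] E →L[ℝ] ℝ := innerSL ℝ

@[simp] lemma inS_apply (v w : E) : inS E v w = inner ℝ v w := rfl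

/-- Space derivatives of radial functions. -/
lemma D2_radial {g g1 : ℝ → ℝ → ℝ} {g2 : ℝ} {c x : E} {t : ℝ}
    (h1 : ∀ᶠ q in 𝓝 (‖x - c‖ ^ 2), HasDerivAt (fun q => g q t) (g1 q t) q)
    (h2 : HasDerivAt (fun q => g1 q t) g2 (‖x - c‖ ^ 2)) :
    C2At (fun x t => g (‖x - c‖ ^ 2) t) x t ∧
    D1 (fun x t => g (‖x - c‖ ^ 2) t) x t = (2 * g1 (‖x - c‖ ^ 2) t) • inS E (x - c) ∧
    D2 (fun x t => g (‖x - c‖ ^ 2) t) x t = (2 * g1 (‖x - c‖ ^ 2) t) • inS E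
      + (4 * g2) • (inS E (x - c)).smulRight (inS E (x - c)) := by
  have hn : ∀ y, HasFDerivAt (fun y : E => ‖y - c‖ ^ 2) ((2 : ℝ) • inS E (y - c)) y := fun y => by
    have := ((hasFDerivAt_id y).sub_const c).norm_sq
    refine this.congr_fderiv ?_
    ext v; simp
  have hi : HasFDerivAt (fun y : E => inS E (y - c)) (inS E) x := by
    have := (inS E).hasFDerivAt.comp x ((hasFDerivAt_id x).sub_const c)
    exact this.congr_fderiv (by ext v; simp)
  have hcont : Tendsto (fun y : E => ‖y - c‖ ^ 2) (𝓝 x) (𝓝 (‖x - c‖ ^ 2)) :=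
    (hn x).continuousAt.tendsto
  refine D2_congr (u := fun x t => g (‖x - c‖ ^ 2) t)
    (w := fun y => (2 * g1 (‖y - c‖ ^ 2) t) • inS E (y - c)) ?_ ?_
  · filter_upwards [hcont.eventually h1] with y hy
    refine (hy.comp_hasFDerivAt y (hn y)).congr_fderiv ?_
    ext v; simp; ring
  · have h3 := ((h2.comp_hasFDerivAt x (hn x)).const_mul 2).smul hi
    refine h3.congr_fderiv ?_
    ext v w; simp; ring

end MaxPrinciple

section Coef

set_option linter.unusedSectionVars false
set_option maxSynthPendingDepth 3

variable {E : Type*} [NormedAddCommGroup E] [InnerProductSpace ℝ E] [FiniteDimensional ℝ E]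

/-- The bilinear form `(v', w') ↦ ⟪v, v'⟫⟪w, w'⟫`. -/
noncomputable def tens (v w : E) : E →L[ℝ] E →L[ℝ] ℝ := (inS E v).smulRight (inS E w)

@[simp] lemma tens_apply (v w x y : E) : tens v w x y = inner ℝ v x * inner ℝ w y := by
  simp [tens]

lemma norm_inS_apply_le (v : E) : ‖inS E v‖ ≤ ‖v‖ :=
  ContinuousLinearMap.opNorm_le_bound _ (norm_nonneg _) fun w => by
    simpa using norm_inner_le_norm (𝕜 := ℝ) v w

lemma norm_inS_le : ‖inS E‖ ≤ 1 :=
  ContinuousLinearMap.opNorm_le_bound _ zero_le_one fun w => by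
    simpa using norm_inS_apply_le w

lemma norm_tens_le (v w : E) : ‖tens v w‖ ≤ ‖v‖ * ‖w‖ := by
  rw [tens, ContinuousLinearMap.norm_smulRight_apply]
  gcongr <;> exact norm_inS_apply_le _

lemma tens_add_left (v v' w : E) : tens (v + v') w = tens v w + tens v' w := by
  ext x y; simp [inner_add_left, add_mul]

lemma tens_smul_left (c : ℝ) (v w : E) : tens (c • v) w = c • tens v w := by
  ext x y; simp [inner_smul_left, mul_assoc]

lemma tens_add_right (v w w' : E) : tens v (w + w') = tens v w + tens v w' := by
  ext x y; simp [inner_add_left, mul_add]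

lemma tens_smul_right (c : ℝ) (v w : E) : tens v (c • w) = c • tens v w := by
  ext x y; simp [inner_smul_left]; ring

/-- Bounded, Hölder continuous and uniformly elliptic coefficients on a set. -/
structure Coef (κ Λ : ℝ) (s : Set E) (A : E → (E →L[ℝ] E →L[ℝ] ℝ) →L[ℝ] ℝ)
    (B : E → (E →L[ℝ] ℝ) →L[ℝ] ℝ) : Prop where
  one : 1 ≤ Λ
  bA : ∀ x ∈ s, ‖A x‖ ≤ Λ
  hA : ∀ x ∈ s, ∀ y ∈ s, ‖A x - A y‖ ≤ Λ * ‖x - y‖ ^ κ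
  bB : ∀ x ∈ s, ‖B x‖ ≤ Λ
  hB : ∀ x ∈ s, ∀ y ∈ s, ‖B x - B y‖ ≤ Λ * ‖x - y‖ ^ κ
  symm : ∀ x ∈ s, ∀ v w, A x (tens v w) = A x (tens w v)
  ell : ∀ x ∈ s, ∀ v, ‖v‖ ^ 2 ≤ Λ * A x (tens v v)

variable {ι : Type*} [Fintype ι]

/-- The linear map sending `b i` to `w i • b' i`. -/
noncomputable def diagMap (w : ι → ℝ) (b b' : OrthonormalBasis ι ℝ E) : E →L[ℝ] E :=
  ∑ i, w i • (inS E (b i)).smulRight (b' i)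

lemma diagMap_apply (w : ι → ℝ) (b b' : OrthonormalBasis ι ℝ E) (x : E) :
    diagMap w b b' x = ∑ i, (w i * inner ℝ (b i) x) • b' i := by
  simp [diagMap, sum_apply, smul_smul]

lemma inner_diagMap (w : ι → ℝ) (b b' : OrthonormalBasis ι ℝ E) (x : E) (j : ι) :
    inner ℝ (b' j) (diagMap w b b' x) = w j * inner ℝ (b j) x := by
  classical
  rw [diagMap_apply, inner_sum, Finset.sum_eq_single j]
  · simp [inner_smul_right]
  · intro i _ hij
    simp [inner_smul_right, b'.inner_eq_ite, hij.symm]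
  · simp

lemma diagMap_basis (w : ι → ℝ) (b b' : OrthonormalBasis ι ℝ E) (j : ι) :
    diagMap w b b' (b j) = w j • b' j := by
  classical
  rw [diagMap_apply, Finset.sum_eq_single j]
  · simp
  · intro i _ hij
    simp [b.inner_eq_ite, hij]
  · simp

lemma norm_diagMap_le {w : ι → ℝ} (b b' : OrthonormalBasis ι ℝ E) {W : ℝ} (hW : 0 ≤ W)
    (hw : ∀ i, |w i| ≤ W) : ‖diagMap w b b'‖ ≤ W := by
  refine ContinuousLinearMap.opNorm_le_bound _ hW fun x => ?_
  refine le_of_sq_le_sq ?_ (by positivity)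
  rw [← b'.sum_sq_norm_inner_right, mul_pow, ← b.sum_sq_norm_inner_right x, Finset.mul_sum]
  refine Finset.sum_le_sum fun i _ => ?_
  rw [inner_diagMap, norm_mul, mul_pow]
  gcongr
  exact hw i

lemma diagMap_diagMap {w w' : ι → ℝ} (b b' : OrthonormalBasis ι ℝ E) (h : ∀ i, w' i * w i = 1)
    (x : E) : diagMap w' b' b (diagMap w b b' x) = x := by
  rw [diagMap_apply]
  conv_rhs => rw [← b.sum_repr' x]
  refine Finset.sum_congr rfl fun i _ => ?_
  rw [inner_diagMap, ← mul_assoc, h, one_mul]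

lemma bilin_eq_sum_tens (b : OrthonormalBasis ι ℝ E) (T : E →L[ℝ] E →L[ℝ] ℝ) :
    T = ∑ i, ∑ j, T (b i) (b j) • tens (b i) (b j) := by
  ext v w
  conv_lhs => rw [← b.sum_repr' v, ← b.sum_repr' w]
  simp only [map_sum, sum_apply, map_smul, smul_apply, smul_eq_mul, tens_apply, Finset.mul_sum]
  rw [Finset.sum_comm]
  refine Finset.sum_congr rfl fun i _ => Finset.sum_congr rfl fun j _ => by ring

variable {κ Λ : ℝ} {s : Set E} {A : E → (E →L[ℝ] E →L[ℝ] ℝ) →L[ℝ] ℝ}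
  {B : E → (E →L[ℝ] ℝ) →L[ℝ] ℝ}

/-- Pull-back of a bilinear form by a linear map. -/
noncomputable def pull (T : E →L[ℝ] E →L[ℝ] ℝ) (σ : E →L[ℝ] E) : E →L[ℝ] E →L[ℝ] ℝ :=
  T.bilinearComp σ σ

@[simp] lemma pull_apply (T : E →L[ℝ] E →L[ℝ] ℝ) (σ : E →L[ℝ] E) (v w : E) :
    pull T σ v w = T (σ v) (σ w) := rfl

lemma exists_diagonalization (hA : Coef κ Λ s A B) {x : E} (hx : x ∈ s) :
    ∃ (b : OrthonormalBasis (Fin (Module.finrank ℝ E)) ℝ E) (μ : Fin (Module.finrank ℝ E) → ℝ),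
      (∀ i, 1 ≤ Λ * μ i ∧ μ i ≤ Λ) ∧ ∀ T, A x T = ∑ i, μ i * T (b i) (b i) := by
  classical
  let e := stdOrthonormalBasis ℝ E
  let S : E →ₗ[ℝ] E :=
    { toFun := fun v => ∑ i, A x (tens v (e i)) • e i
      map_add' := fun v w => by simp [tens_add_left, add_smul, Finset.sum_add_distrib]
      map_smul' := fun c v => by simp [tens_smul_left, mul_smul, Finset.smul_sum] }
  have hS : ∀ v w, inner ℝ (S v) w = A x (tens v w) := fun v w => by
    have h1 : A x (tens v w) = ∑ i, inner ℝ (e i) w * A x (tens v (e i)) := by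
      let l : E →ₗ[ℝ] ℝ :=
        { toFun := fun w => A x (tens v w)
          map_add' := fun w w' => by simp [tens_add_right]
          map_smul' := fun c w => by simp [tens_smul_right] }
      have : l w = l (∑ i, inner ℝ (e i) w • e i) := by rw [e.sum_repr' w]
      rw [map_sum] at this
      simpa [l, tens_smul_right] using this
    rw [h1]
    simp only [S, LinearMap.coe_mk, AddHom.coe_mk, sum_inner, inner_smul_left]
    refine Finset.sum_congr rfl fun i _ => by simp [mul_comm]
  have hsym : S.IsSymmetric := fun v w => by
    rw [hS, real_inner_comm, hS, hA.symm x hx]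
  have hev : ∀ i j, A x (tens (hsym.eigenvectorBasis rfl i) (hsym.eigenvectorBasis rfl j))
      = if i = j then hsym.eigenvalues rfl i else 0 := fun i j => by
    rw [← hS, hsym.apply_eigenvectorBasis, inner_smul_left,
      (hsym.eigenvectorBasis rfl).inner_eq_ite]
    simp
  refine ⟨hsym.eigenvectorBasis rfl, hsym.eigenvalues rfl, fun i => ?_, fun T => ?_⟩
  · have h1 := hev i i
    rw [if_pos rfl] at h1
    have hn : ‖hsym.eigenvectorBasis rfl i‖ = 1 := (hsym.eigenvectorBasis rfl).norm_eq_one i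
    constructor
    · have := hA.ell x hx (hsym.eigenvectorBasis rfl i)
      rwa [h1, hn, one_pow] at this
    · rw [← h1]
      refine (le_abs_self _).trans (((A x).le_opNorm _).trans ?_)
      have h2 := norm_tens_le (hsym.eigenvectorBasis rfl i) (hsym.eigenvectorBasis rfl i)
      rw [hn, one_mul] at h2
      calc _ ≤ Λ * 1 := mul_le_mul (hA.bA x hx) h2 (norm_nonneg _) (zero_le_one.trans hA.one)
        _ = Λ := mul_one _
  · conv_lhs => rw [bilin_eq_sum_tens (hsym.eigenvectorBasis rfl) T]
    simp only [map_sum, map_smul, smul_eq_mul, hev]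
    simp [mul_comm]

lemma Coef.nonneg (hA : Coef κ Λ s A B) {x : E} (hx : x ∈ s) {T : E →L[ℝ] E →L[ℝ] ℝ}
    (hT : ∀ v, 0 ≤ T v v) : 0 ≤ A x T := by
  obtain ⟨b, μ, hμ, h⟩ := exists_diagonalization hA hx
  rw [h]
  refine Finset.sum_nonneg fun i _ => mul_nonneg ?_ (hT _)
  have := (hμ i).1
  have hΛ := hA.one
  by_contra! hc
  nlinarith

lemma Coef.exists_normalization (hA : Coef κ Λ s A B) {x : E} (hx : x ∈ s) :
    ∃ σ : E ≃L[ℝ] E, ‖(σ : E →L[ℝ] E)‖ ≤ 2 * Λ ∧ ‖(σ.symm : E →L[ℝ] E)‖ ≤ 2 * Λ ∧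
      ∀ T, A x T = lapF E (pull T σ) := by
  obtain ⟨b, μ, hμ, h⟩ := exists_diagonalization hA hx
  have hΛ := hA.one
  have hμ0 : ∀ i, 0 < μ i := fun i => by
    have := (hμ i).1
    by_contra! hc
    nlinarith
  let e := stdOrthonormalBasis ℝ E
  set w : Fin (Module.finrank ℝ E) → ℝ := fun i => Real.sqrt (2 * μ i)
  have hw0 : ∀ i, 0 < w i := fun i => Real.sqrt_pos.2 (by linarith [hμ0 i])
  have hw2 : ∀ i, w i * w i = 2 * μ i := fun i => Real.mul_self_sqrt (by linarith [hμ0 i])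
  refine ⟨ContinuousLinearEquiv.equivOfInverse (diagMap w e b) (diagMap (fun i => (w i)⁻¹) b e)
    (diagMap_diagMap _ _ fun i => inv_mul_cancel₀ (hw0 i).ne')
    (diagMap_diagMap _ _ fun i => mul_inv_cancel₀ (hw0 i).ne'), ?_, ?_, fun T => ?_⟩
  · refine norm_diagMap_le _ _ (by linarith) fun i => ?_
    rw [abs_of_pos (hw0 i)]
    refine le_of_sq_le_sq ?_ (by linarith)
    rw [sq, hw2]
    nlinarith [(hμ i).2]
  · refine norm_diagMap_le _ _ (by linarith) fun i => ?_
    rw [abs_of_pos (inv_pos.2 (hw0 i))]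
    rw [inv_le_comm₀ (hw0 i) (by linarith)]
    refine le_of_sq_le_sq ?_ (hw0 i).le
    rw [sq (w i), hw2]
    rw [inv_pow, inv_le_comm₀ (by positivity) (by linarith [hμ0 i])]
    have h3 := (hμ i).1
    rw [inv_le_iff_one_le_mul₀ (by linarith [hμ0 i])]
    nlinarith [hμ0 i, mul_pos (hμ0 i) (by linarith : 0 < Λ)]
  · rw [h, lapF_apply, Finset.mul_sum]
    refine Finset.sum_congr rfl fun i _ => ?_
    have : (ContinuousLinearEquiv.equivOfInverse (diagMap w e b) (diagMap (fun i => (w i)⁻¹) b e)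
        (diagMap_diagMap _ _ fun i => inv_mul_cancel₀ (hw0 i).ne')
        (diagMap_diagMap _ _ fun i => mul_inv_cancel₀ (hw0 i).ne') : E →L[ℝ] E) (e i) = w i • b i :=
      diagMap_basis w e b i
    rw [pull_apply, this]
    simp only [map_smul, smul_apply, smul_eq_mul]
    rw [← mul_assoc (w i), hw2]
    ring

end Coef

section LocalClass

set_option linter.unusedSectionVars false
set_option maxSynthPendingDepth 3

variable {E : Type*} [NormedAddCommGroup E] [InnerProductSpace ℝ E] [FiniteDimensional ℝ E]

/-- Functions on `s × ℝ` vanishing for `t ≤ 0`, Lipschitz in time, with bounded and Hölder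
continuous second spatial derivatives. -/
structure LC (κ : ℝ) (s : Set E) (u : E → ℝ → ℝ) (M : ℝ) : Prop where
  d1 : ∀ x ∈ s, ∀ t, HasFDerivAt (fun y => u y t) (D1 u x t) x
  d2 : ∀ x ∈ s, ∀ t, HasFDerivAt (fun y => D1 u y t) (D2 u x t) x
  b0 : ∀ x ∈ s, ∀ t, |u x t| ≤ M
  b1 : ∀ x ∈ s, ∀ t, ‖D1 u x t‖ ≤ M
  b2 : ∀ x ∈ s, ∀ t, ‖D2 u x t‖ ≤ M
  h2 : ∀ x ∈ s, ∀ y ∈ s, ∀ t, ‖D2 u x t - D2 u y t‖ ≤ M * ‖x - y‖ ^ κ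
  lip : ∀ x ∈ s, ∀ t t', |u x t - u x t'| ≤ M * |t - t'|
  zero : ∀ x ∈ s, ∀ t, t ≤ 0 → u x t = 0

variable {κ M N : ℝ} {s : Set E} {u v : E → ℝ → ℝ}

lemma YC.toLC (h : YC κ u M) : LC κ univ u M :=
  ⟨fun x _ => h.d1 x, fun x _ => h.d2 x, fun x _ => h.b0 x, fun x _ => h.b1 x, fun x _ => h.b2 x,
    fun x _ y _ => h.h2 x y, fun x _ => h.lip x, fun x _ => h.zero x⟩

lemma LC.mono (h : LC κ s u M) {s' : Set E} (hs : s' ⊆ s) (hM : M ≤ N) : LC κ s' u N where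
  d1 x hx := h.d1 x (hs hx)
  d2 x hx := h.d2 x (hs hx)
  b0 x hx t := (h.b0 x (hs hx) t).trans hM
  b1 x hx t := (h.b1 x (hs hx) t).trans hM
  b2 x hx t := (h.b2 x (hs hx) t).trans hM
  h2 x hx y hy t := (h.h2 x (hs hx) y (hs hy) t).trans (by gcongr)
  lip x hx t t' := (h.lip x (hs hx) t t').trans (by gcongr)
  zero x hx := h.zero x (hs hx)

lemma LC.c2At (h : LC κ s u M) (hs : IsOpen s) {x : E} (hx : x ∈ s) (t : ℝ) : C2At u x t :=
  ⟨by filter_upwards [hs.mem_nhds hx] with y hy using h.d1 y hy t, h.d2 x hx t⟩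

lemma LC.sub (hs : IsOpen s) (hu : LC κ s u M) (hv : LC κ s v N) :
    LC κ s (fun x t => u x t - v x t) (M + N) := by
  have e := fun x hx t => (hu.c2At hs (x := x) hx t).sub (hv.c2At hs hx t)
  refine ⟨fun x hx t => ?_, fun x hx t => ?_, fun x hx t => ?_, fun x hx t => ?_, fun x hx t => ?_,
    fun x hx y hy t => ?_, fun x hx t t' => ?_, fun x hx t ht => ?_⟩
  · exact (e x hx t).1.d1.self_of_nhds
  · exact (e x hx t).1.d2
  · exact (abs_sub _ _).trans (add_le_add (hu.b0 x hx t) (hv.b0 x hx t))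
  · rw [(e x hx t).2.1]
    exact (norm_sub_le _ _).trans (add_le_add (hu.b1 x hx t) (hv.b1 x hx t))
  · rw [(e x hx t).2.2]
    exact (norm_sub_le _ _).trans (add_le_add (hu.b2 x hx t) (hv.b2 x hx t))
  · rw [(e x hx t).2.2, (e y hy t).2.2, sub_sub_sub_comm, add_mul]
    exact (norm_sub_le _ _).trans (add_le_add (hu.h2 x hx y hy t) (hv.h2 x hx y hy t))
  · rw [sub_sub_sub_comm, add_mul]
    exact (abs_sub _ _).trans (add_le_add (hu.lip x hx t t') (hv.lip x hx t t'))
  · simp only [hu.zero x hx t ht, hv.zero x hx t ht, sub_zero]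

lemma LC.continuousAt (h : LC κ s u M) (hs : IsOpen s) {x : E} (hx : x ∈ s) (t : ℝ) :
    ContinuousAt (fun q : E × ℝ => u q.1 q.2) (x, t) := by
  rw [ContinuousAt, tendsto_iff_norm_sub_tendsto_zero]
  have h1 : Tendsto (fun q : E × ℝ => M * |q.2 - t| + |u q.1 t - u x t|) (𝓝 (x, t)) (𝓝 0) := by
    have h2 : Tendsto (fun q : E × ℝ => M * |q.2 - t|) (𝓝 (x, t)) (𝓝 0) := by
      have : Continuous fun q : E × ℝ => M * |q.2 - t| := by fun_prop
      simpa using this.tendsto (x, t)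
    have h3 : Tendsto (fun q : E × ℝ => u q.1 t) (𝓝 (x, t)) (𝓝 (u x t)) :=
      (h.d1 x hx t).continuousAt.tendsto.comp (continuous_fst.tendsto (x, t))
    simpa using h2.add (h3.sub_const (u x t)).abs
  refine squeeze_zero' (Eventually.of_forall fun q => norm_nonneg _) ?_ h1
  filter_upwards [(hs.preimage continuous_fst).mem_nhds (show (x, t) ∈ Prod.fst ⁻¹' s from hx)]
    with q hq
  have := h.lip q.1 hq q.2 t
  rw [Real.norm_eq_abs]
  calc |u q.1 q.2 - u x t| = |(u q.1 q.2 - u q.1 t) + (u q.1 t - u x t)| := by congr 1; ring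
    _ ≤ _ := (abs_add_le _ _).trans (add_le_add this le_rfl)

lemma LC.nonneg (h : LC κ s u M) {x : E} (hx : x ∈ s) : 0 ≤ M := (abs_nonneg _).trans (h.b0 x hx 0)

lemma LC.D_time_le (h : LC κ s u M) (hκ : 0 ≤ κ) {x : E} {ρ : ℝ} (hρ : 0 < ρ)
    (hx : Metric.closedBall x ρ ⊆ s) (t t' : ℝ) :
    ‖D1 u x t - D1 u x t'‖ ≤ M * |t - t'| / ρ + 2 * M * ρ ^ κ * ρ ∧
    ‖D2 u x t - D2 u x t'‖ ≤ 4 * (M * |t - t'|) / ρ ^ 2 + 4 * (M * ρ ^ κ) := by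
  have hM : 0 ≤ M := h.nonneg (hx (Metric.mem_closedBall_self hρ.le))
  have k0 : ∀ y ∈ Metric.closedBall x ρ,
      HasFDerivAt (fun y => u y t - u y t') (D1 u y t - D1 u y t') y :=
    fun y hy => (h.d1 y (hx hy) t).sub (h.d1 y (hx hy) t')
  have k1 : ∀ y ∈ Metric.closedBall x ρ,
      HasFDerivAt (fun y => D1 u y t - D1 u y t') (D2 u y t - D2 u y t') y :=
    fun y hy => (h.d2 y (hx hy) t).sub (h.d2 y (hx hy) t')
  have k2 : ∀ y ∈ Metric.closedBall x ρ, ∀ z ∈ Metric.closedBall x ρ,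
      ‖(D2 u y t - D2 u y t') - (D2 u z t - D2 u z t')‖ ≤ 2 * M * ‖y - z‖ ^ κ := fun y hy z hz => by
    rw [sub_sub_sub_comm, mul_assoc, two_mul]
    exact (norm_sub_le _ _).trans
      (add_le_add (h.h2 y (hx hy) z (hx hz) t) (h.h2 y (hx hy) z (hx hz) t'))
  have k3 : ∀ y ∈ Metric.closedBall x ρ, |u y t - u y t'| ≤ M * |t - t'| :=
    fun y hy => h.lip y (hx hy) t t'
  refine ⟨norm_fderiv_le_interp (convex_closedBall x ρ) hκ (by positivity) k0 k1 k2 k3 hρ le_rfl,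
    (norm_fderiv_fderiv_le_interp (convex_closedBall x ρ) hκ (by positivity) k0 k1 k2 k3 hρ
      le_rfl).trans_eq (by ring)⟩

/-- Equicontinuity in time of the spatial derivatives. -/
lemma exists_D_time_modulus (hs : IsOpen s) (hκ : 0 < κ) (M : ℝ) {x : E} (hx : x ∈ s) {ε : ℝ}
    (hε : 0 < ε) : ∃ δ > 0, ∀ u, LC κ s u M → ∀ t t', |t - t'| < δ →
      ‖D1 u x t - D1 u x t'‖ < ε ∧ ‖D2 u x t - D2 u x t'‖ < ε := by
  obtain ⟨r, hr, hrs⟩ := Metric.nhds_basis_closedBall.mem_iff.1 (hs.mem_nhds hx)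
  have e1 : Tendsto (fun ρ : ℝ => 2 * M * ρ ^ κ * ρ) (𝓝[>] 0) (𝓝 0) := by
    have : Continuous fun ρ : ℝ => 2 * M * ρ ^ κ * ρ :=
      ((continuous_id.rpow_const fun _ => Or.inr hκ.le).const_mul _).mul continuous_id
    simpa using (this.tendsto 0).mono_left nhdsWithin_le_nhds
  have e2 : Tendsto (fun ρ : ℝ => 4 * (M * ρ ^ κ)) (𝓝[>] 0) (𝓝 0) := by
    have : Continuous fun ρ : ℝ => 4 * (M * ρ ^ κ) :=
      ((continuous_id.rpow_const fun _ => Or.inr hκ.le).const_mul _).const_mul _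
    simpa [Real.zero_rpow hκ.ne'] using (this.tendsto 0).mono_left nhdsWithin_le_nhds
  obtain ⟨ρ, h1, h2, hρ, hρr⟩ := ((e1.eventually (gt_mem_nhds (half_pos hε))).and
    ((e2.eventually (gt_mem_nhds (half_pos hε))).and (Ioo_mem_nhdsGT hr))).exists
  have f1 : Tendsto (fun δ : ℝ => M * δ / ρ) (𝓝[>] 0) (𝓝 0) := by
    have : Continuous fun δ : ℝ => M * δ / ρ := by fun_prop
    simpa using (this.tendsto 0).mono_left nhdsWithin_le_nhds
  have f2 : Tendsto (fun δ : ℝ => 4 * (M * δ) / ρ ^ 2) (𝓝[>] 0) (𝓝 0) := by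
    have : Continuous fun δ : ℝ => 4 * (M * δ) / ρ ^ 2 := by fun_prop
    simpa using (this.tendsto 0).mono_left nhdsWithin_le_nhds
  obtain ⟨δ, g1, g2, hδ⟩ := ((f1.eventually (gt_mem_nhds (half_pos hε))).and
    ((f2.eventually (gt_mem_nhds (half_pos hε))).and self_mem_nhdsWithin)).exists
  refine ⟨δ, hδ, fun u hu t t' ht => ?_⟩
  have hM : 0 ≤ M := hu.nonneg hx
  obtain ⟨k1, k2⟩ := hu.D_time_le hκ.le hρ
    ((Metric.closedBall_subset_closedBall hρr.le).trans hrs) t t'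
  have l1 : M * |t - t'| / ρ ≤ M * δ / ρ := by gcongr
  have l2 : 4 * (M * |t - t'|) / ρ ^ 2 ≤ 4 * (M * δ) / ρ ^ 2 := by gcongr
  exact ⟨by linarith, by linarith⟩

lemma LC.continuous_D (h : LC κ s u M) (hs : IsOpen s) (hκ : 0 < κ) {x : E} (hx : x ∈ s) :
    Continuous (D1 u x) ∧ Continuous (D2 u x) := by
  constructor <;>
  · refine Metric.continuous_iff.2 fun t ε hε => ?_
    obtain ⟨δ, hδ, hd⟩ := exists_D_time_modulus hs hκ M hx hε
    refine ⟨δ, hδ, fun t' ht' => ?_⟩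
    rw [dist_eq_norm]
    first | exact (hd u h t' t ht').1 | exact (hd u h t' t ht').2

end LocalClass

section Global

set_option linter.unusedSectionVars false
set_option maxSynthPendingDepth 3

variable {E : Type*} [NormedAddCommGroup E] [InnerProductSpace ℝ E] [FiniteDimensional ℝ E]
  {κ Λ : ℝ} {s : Set E} {A : E → (E →L[ℝ] E →L[ℝ] ℝ) →L[ℝ] ℝ} {B : E → (E →L[ℝ] ℝ) →L[ℝ] ℝ}

lemma C2At.const (a : ℝ) (x : E) (t : ℝ) : C2At (fun _ _ => a) x t ∧ D1 (fun _ _ => a) x t = 0 ∧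
    D2 (fun _ _ => a) x t = 0 :=
  D2_congr (w := fun _ => 0) (Eventually.of_forall fun y => hasFDerivAt_const a y)
    (hasFDerivAt_const _ x)

/-- Space derivatives of `a t + b t * ‖x - c‖ ^ 2`. -/
lemma C2At.quad (a b : ℝ → ℝ) (c x : E) (t : ℝ) :
    C2At (fun x t => a t + b t * ‖x - c‖ ^ 2) x t ∧
    D1 (fun x t => a t + b t * ‖x - c‖ ^ 2) x t = (2 * b t) • inS E (x - c) ∧
    D2 (fun x t => a t + b t * ‖x - c‖ ^ 2) x t = (2 * b t) • inS E := by
  have := D2_radial (g := fun q t => a t + b t * q) (g1 := fun _ t => b t) (g2 := 0) (c := c)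
    (x := x) (t := t) (Eventually.of_forall fun q => by
      simpa using ((hasDerivAt_id q).const_mul (b t)).const_add (a t)) (hasDerivAt_const _ _)
  simpa using this

/-- A bounded function with nonnegative initial data that is a supersolution is nonnegative. -/
theorem global_nonneg (hA : Coef κ Λ univ A B) {u : E → ℝ → ℝ} {N l : ℝ} (hl : 0 ≤ l)
    (hc : Continuous fun q : E × ℝ => u q.1 q.2) (hb : ∀ x t, |u x t| ≤ N)
    (h0 : ∀ x t, t ≤ 0 → 0 ≤ u x t)
    (hs : ∀ x t, 0 < t → SuperAt A B (fun _ _ a => -l * a) u x t) (x : E) (t : ℝ) : 0 ≤ u x t := by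
  rcases le_or_gt t 0 with ht | ht
  · exact h0 x t ht
  have hΛ := hA.one
  set φ : E → ℝ → ℝ := fun x t =>
    Real.exp (4 * Λ * t) + Real.exp (4 * Λ * t) * ‖x - 0‖ ^ 2 with hφ
  have hφ1 : ∀ x t, 0 ≤ t → 1 + ‖x‖ ^ 2 ≤ φ x t := fun x t ht => by
    have : 1 ≤ Real.exp (4 * Λ * t) := Real.one_le_exp (by positivity)
    simp only [hφ, sub_zero]
    nlinarith [sq_nonneg ‖x‖]
  have hφc : Continuous fun q : E × ℝ => φ q.1 q.2 := by simp only [hφ]; fun_prop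
  have key : ∀ ε : ℝ, 0 < ε → 0 ≤ u x t + ε * φ x t := by
    intro ε hε
    have hN : 0 ≤ N := (abs_nonneg _).trans (hb 0 0)
    set R := ‖x‖ + N / ε + 1 with hR
    have hRN : N ≤ ε * (1 + R ^ 2) := by
      have h1 : N / ε ≤ R := by rw [hR]; have := norm_nonneg x; linarith
      have h2 : 1 ≤ R := by
        have := norm_nonneg x
        have : 0 ≤ N / ε := by positivity
        linarith
      have h3 : R ≤ R ^ 2 := by nlinarith
      rw [div_le_iff₀ hε] at h1
      nlinarith
    have hle : ∀ y s, ‖y‖ = R → 0 ≤ s → 0 ≤ u y s + ε * φ y s := fun y s hy hs => by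
      have h1 := hφ1 y s hs
      have h2 := neg_le_of_abs_le (hb y s)
      rw [hy] at h1
      nlinarith
    refine comparison (A := A) (B := B) (F := fun _ _ a => -l * a) (u := fun _ _ => 0)
      (v := fun x t => u x t + ε * φ x t) (c := 0) (R := R) (T := t) (M := -l)
      (fun y _ T hT => hA.nonneg (mem_univ y) hT) (fun y _ s _ _ _ => by ring_nf; rfl)
      continuousOn_const (by fun_prop) (fun y _ => ?_) (fun y hy s hs => ?_) (fun y _ s _ _ => ?_)
      (fun y _ s hs0 _ => ?_) x ?_ t ⟨ht.le, le_rfl⟩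
    · have h1 := hφ1 y 0 le_rfl
      have h2 := h0 y 0 le_rfl
      have h3 : 0 ≤ φ y 0 := by linarith [sq_nonneg ‖y‖]
      positivity
    · exact hle y s (by simpa using hy) hs.1
    · obtain ⟨k1, k2, k3⟩ := C2At.const (0 : ℝ) y s
      exact ⟨k1, 0, hasDerivAt_const _ _, by rw [k2, k3]; simp⟩
    · obtain ⟨k1, u', k2, k3⟩ := hs y s hs0
      obtain ⟨q1, q2, q3⟩ := C2At.quad (fun t => Real.exp (4 * Λ * t))
        (fun t => Real.exp (4 * Λ * t)) (0 : E) y s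
      obtain ⟨r1, r2, r3⟩ := k1.add_smul q1 ε
      have hd : HasDerivAt (φ y) (4 * Λ * φ y s) s := by
        have h1 : HasDerivAt (fun t => Real.exp (4 * Λ * t)) (Real.exp (4 * Λ * s) * (4 * Λ)) s := by
          simpa using ((hasDerivAt_id s).const_mul (4 * Λ)).exp
        refine (h1.add (h1.mul_const (‖y - 0‖ ^ 2))).congr_deriv ?_
        simp only [hφ]; ring
      refine ⟨r1, _, k2.add (hd.const_mul ε), ?_⟩
      rw [r2, r3, q2, q3]
      simp only [map_add, map_smul, smul_eq_mul, sub_zero]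
      have hAi : A y (inS E) ≤ Λ := by
        refine (le_abs_self _).trans (((A y).le_opNorm _).trans ?_)
        calc _ ≤ Λ * 1 := mul_le_mul (hA.bA y trivial) norm_inS_le (norm_nonneg _) (by linarith)
          _ = Λ := mul_one _
      have hBi : B y (inS E y) ≤ Λ * ‖y‖ := by
        refine (le_abs_self _).trans (((B y).le_opNorm _).trans ?_)
        exact mul_le_mul (hA.bB y trivial) (norm_inS_apply_le y) (norm_nonneg _) (by linarith)
      set e := Real.exp (4 * Λ * s) with he
      have he0 : 0 < e := Real.exp_pos _
      have hφe : φ y s = e + e * ‖y‖ ^ 2 := by simp only [hφ, sub_zero, he]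
      have h5 : 2 * e * A y (inS E) + 2 * e * B y (inS E y) ≤ 4 * Λ * φ y s := by
        rw [hφe]
        have h6 : A y (inS E) + B y (inS E y) ≤ 2 * Λ * (1 + ‖y‖ ^ 2) := by
          nlinarith [sq_nonneg (‖y‖ - 1), norm_nonneg y]
        nlinarith
      have h7 : 0 ≤ l * (ε * φ y s) := by
        have : 0 ≤ φ y s := by rw [hφe]; positivity
        positivity
      have h8 := mul_le_mul_of_nonneg_left h5 hε.le
      nlinarith
    · simp only [Metric.mem_closedBall, dist_zero_right]
      have : 0 ≤ N / ε := by positivity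
      linarith
  have hφ0 : 0 < φ x t := by have := hφ1 x t ht.le; nlinarith [sq_nonneg ‖x‖]
  refine le_of_forall_pos_le_add fun δ hδ => ?_
  have := key (δ / φ x t) (by positivity)
  rwa [div_mul_cancel₀ _ hφ0.ne'] at this

/-- The equation `u_t = A D²u + B Du + f` on `s × ℝ`. -/
def IsSol (s : Set E) (A : E → (E →L[ℝ] E →L[ℝ] ℝ) →L[ℝ] ℝ) (B : E → (E →L[ℝ] ℝ) →L[ℝ] ℝ)
    (f u : E → ℝ → ℝ) : Prop :=
  ∀ x ∈ s, ∀ t, HasDerivAt (u x) (A x (D2 u x t) + B x (D1 u x t) + f x t) t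

lemma LC.continuous {u : E → ℝ → ℝ} {M : ℝ} (h : LC κ univ u M) :
    Continuous fun q : E × ℝ => u q.1 q.2 :=
  continuous_iff_continuousAt.2 fun q => h.continuousAt isOpen_univ (mem_univ q.1) q.2

theorem IsSol.abs_le_bound (hA : Coef κ Λ univ A B) {u f : E → ℝ → ℝ} {M N l : ℝ} (hl : 1 ≤ l)
    (hu : LC κ univ u N) (hf : ∀ x t, |f x t| ≤ M)
    (hs : IsSol univ A B (fun x t => f x t - l * u x t) u) (x : E) (t : ℝ) : |u x t| ≤ M := by
  have hM : 0 ≤ M := (abs_nonneg _).trans (hf 0 0)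
  have key : ∀ a : ℝ, |a| = 1 → 0 ≤ M + a * u x t := by
    intro a ha
    refine global_nonneg hA (u := fun x t => M + a * u x t) (N := M + N) (l := l) (by linarith)
      (hu.continuous.const_mul a |>.const_add M) (fun y s => ?_) (fun y s hs => ?_)
      (fun y s _ => ?_) x t
    · refine (abs_add_le _ _).trans ?_
      rw [abs_mul, ha, one_mul, abs_of_nonneg hM]
      exact add_le_add le_rfl (hu.b0 y trivial s)
    · simp only [hu.zero y trivial s hs, mul_zero, add_zero]; exact hM
    · obtain ⟨k1, k2, k3⟩ := C2At.const M y s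
      obtain ⟨r1, r2, r3⟩ := k1.add_smul (hu.c2At isOpen_univ (mem_univ y) s) a
      refine ⟨r1, _, ((hs y trivial s).const_mul a).const_add M, ?_⟩
      rw [r2, r3, k2, k3]
      simp only [map_add, map_smul, smul_eq_mul, map_zero]
      have h1 : |a * f y s| ≤ M := by rw [abs_mul, ha, one_mul]; exact hf y s
      have h2 := neg_le_of_abs_le h1
      nlinarith
  have h1 := key 1 (by simp)
  have h2 := key (-1) (by simp)
  exact abs_le.2 ⟨by linarith, by linarith⟩

end Global

section HolderBounds

set_option linter.unusedSectionVars false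
set_option maxSynthPendingDepth 3

variable {E : Type*} [NormedAddCommGroup E] [NormedSpace ℝ E]
  {F : Type*} [NormedAddCommGroup F] [NormedSpace ℝ F]
  {G : Type*} [NormedAddCommGroup G] [NormedSpace ℝ G]
  {P : Type*} [NormedAddCommGroup P] [NormedSpace ℝ P]

/-- `f` is bounded by `K` on `s` and Hölder continuous there with constant `K`. -/
structure HB (κ : ℝ) (s : Set E) (f : E → F) (K : ℝ) : Prop where
  b : ∀ x ∈ s, ‖f x‖ ≤ K
  h : ∀ x ∈ s, ∀ y ∈ s, ‖f x - f y‖ ≤ K * ‖x - y‖ ^ κ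

variable {κ K L : ℝ} {s : Set E}

lemma HB.mono {f : E → F} (hf : HB κ s f K) {s' : Set E} (hs : s' ⊆ s) (hK : K ≤ L) :
    HB κ s' f L :=
  ⟨fun x hx => (hf.b x (hs hx)).trans hK,
    fun x hx y hy => (hf.h x (hs hx) y (hs hy)).trans (by gcongr)⟩

lemma HB.add {f g : E → F} (hf : HB κ s f K) (hg : HB κ s g L) :
    HB κ s (fun x => f x + g x) (K + L) :=
  ⟨fun x hx => (norm_add_le _ _).trans (add_le_add (hf.b x hx) (hg.b x hx)),
    fun x hx y hy => by
      rw [add_sub_add_comm, add_mul]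
      exact (norm_add_le _ _).trans (add_le_add (hf.h x hx y hy) (hg.h x hx y hy))⟩

lemma HB.sub {f g : E → F} (hf : HB κ s f K) (hg : HB κ s g L) :
    HB κ s (fun x => f x - g x) (K + L) :=
  ⟨fun x hx => (norm_sub_le _ _).trans (add_le_add (hf.b x hx) (hg.b x hx)),
    fun x hx y hy => by
      rw [sub_sub_sub_comm, add_mul]
      exact (norm_sub_le _ _).trans (add_le_add (hf.h x hx y hy) (hg.h x hx y hy))⟩

lemma HB.clm (l : F →L[ℝ] G) {f : E → F} (hf : HB κ s f K) :
    HB κ s (fun x => l (f x)) (‖l‖ * K) :=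
  ⟨fun x hx => (l.le_opNorm _).trans (by gcongr; exact hf.b x hx), fun x hx y hy => by
    rw [← map_sub, mul_assoc]
    exact (l.le_opNorm _).trans (by gcongr; exact hf.h x hx y hy)⟩

lemma HB.apply {f : E → F →L[ℝ] G} {g : E → F} (hf : HB κ s f K) (hg : HB κ s g L) :
    HB κ s (fun x => f x (g x)) (2 * (K * L)) := by
  refine ⟨fun x hx => ?_, fun x hx y hy => ?_⟩
  · have hK := (norm_nonneg _).trans (hf.b x hx)
    have hL := (norm_nonneg _).trans (hg.b x hx)
    have h1 : ‖f x (g x)‖ ≤ K * L :=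
      ((f x).le_opNorm _).trans (mul_le_mul (hf.b x hx) (hg.b x hx) (norm_nonneg _) hK)
    nlinarith [mul_nonneg hK hL]
  · have hK := (norm_nonneg _).trans (hf.b x hx)
    have e : f x (g x) - f y (g y) = f x (g x - g y) + (f x - f y) (g y) := by simp
    rw [e]
    refine (norm_add_le _ _).trans ?_
    have h1 : ‖f x (g x - g y)‖ ≤ K * (L * ‖x - y‖ ^ κ) :=
      ((f x).le_opNorm _).trans (mul_le_mul (hf.b x hx) (hg.h x hx y hy) (norm_nonneg _) hK)
    have h2 : ‖(f x - f y) (g y)‖ ≤ (K * ‖x - y‖ ^ κ) * L :=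
      ((f x - f y).le_opNorm _).trans (mul_le_mul (hf.h x hx y hy) (hg.b y hy) (norm_nonneg _)
        ((norm_nonneg _).trans (hf.h x hx y hy)))
    linarith

lemma HB.bilin (l : F →L[ℝ] G →L[ℝ] P) {f : E → F} {g : E → G} (hf : HB κ s f K)
    (hg : HB κ s g L) : HB κ s (fun x => l (f x) (g x)) (2 * (‖l‖ * K * L)) :=
  (hf.clm l).apply hg

lemma HB.smul {f : E → ℝ} {g : E → F} (hf : HB κ s f K)
    (hg : HB κ s g L) : HB κ s (fun x => f x • g x) (2 * (K * L)) := by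
  have h := hf.bilin (ContinuousLinearMap.lsmul ℝ ℝ : ℝ →L[ℝ] F →L[ℝ] F) hg
  have hle : ∀ x ∈ s, 2 * (‖(ContinuousLinearMap.lsmul ℝ ℝ : ℝ →L[ℝ] F →L[ℝ] F)‖ * K * L)
      ≤ 2 * (K * L) := fun x hx => by
    have hK := (norm_nonneg _).trans (hf.b x hx)
    have hL := (norm_nonneg _).trans (hg.b x hx)
    have := ContinuousLinearMap.opNorm_lsmul_le (𝕜 := ℝ) (R := ℝ) (E := F)
    gcongr
    exact mul_le_of_le_one_left hK this
  exact ⟨fun x hx => (h.b x hx).trans (hle x hx), fun x hx y hy => (h.h x hx y hy).trans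
    (by gcongr ?_ * _; exact hle x hx)⟩

lemma le_mul_rpow_of_le {r D : ℝ} (hκ0 : 0 ≤ κ) (hκ1 : κ ≤ 1) (hr : 0 ≤ r) (hD : 1 ≤ D)
    (h : r ≤ D) : r ≤ D * r ^ κ := by
  rcases hr.eq_or_lt with rfl | hr
  · positivity
  · have e : r = r ^ (1 - κ) * r ^ κ := by rw [← Real.rpow_add hr]; simp
    conv_lhs => rw [e]
    gcongr
    calc r ^ (1 - κ) ≤ D ^ (1 - κ) := Real.rpow_le_rpow hr.le h (by linarith)
      _ ≤ D ^ (1 : ℝ) := Real.rpow_le_rpow_of_exponent_le hD (by linarith)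
      _ = D := Real.rpow_one D

lemma HB.of_fderiv {f : E → F} {f' : E → E →L[ℝ] F} {c : E} {r D : ℝ} (hκ0 : 0 ≤ κ) (hκ1 : κ ≤ 1)
    (hD : 1 ≤ D) (hr : 2 * r ≤ D) (hd : ∀ x ∈ Metric.ball c r, HasFDerivAt f (f' x) x)
    (h0 : ∀ x ∈ Metric.ball c r, ‖f x‖ ≤ K) (h1 : ∀ x ∈ Metric.ball c r, ‖f' x‖ ≤ L) :
    HB κ (Metric.ball c r) f (K + D * L) := by
  refine ⟨fun x hx => (h0 x hx).trans ?_, fun x hx y hy => ?_⟩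
  · have := (norm_nonneg _).trans (h1 x hx)
    have : 0 ≤ D * L := by positivity
    linarith
  · have hK := (norm_nonneg _).trans (h0 x hx)
    have hL := (norm_nonneg _).trans (h1 x hx)
    have k1 := (convex_ball c r).norm_image_sub_le_of_norm_hasFDerivWithin_le
      (fun z hz => (hd z hz).hasFDerivWithinAt) h1 hy hx
    have k2 : ‖x - y‖ ≤ D := by
      rw [← dist_eq_norm]
      exact (dist_triangle_right x y c).trans (by
        have := Metric.mem_ball.1 hx; have := Metric.mem_ball.1 hy; linarith)
    have k3 := le_mul_rpow_of_le hκ0 hκ1 (norm_nonneg _) hD k2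
    calc ‖f x - f y‖ ≤ L * (D * ‖x - y‖ ^ κ) := k1.trans (by gcongr)
      _ ≤ (K + D * L) * ‖x - y‖ ^ κ := by
        have : 0 ≤ K * ‖x - y‖ ^ κ := by positivity
        linarith

lemma HB.const (hK : 0 ≤ K) {c : F} (hc : ‖c‖ ≤ K) : HB κ s (fun _ => c) K :=
  ⟨fun _ _ => hc, fun _ _ _ _ => by simpa using by positivity⟩

lemma exists_HB_of_contDiff [FiniteDimensional ℝ E] {f : E → F} (hf : ContDiff ℝ 1 f) (hκ0 : 0 ≤ κ)
    (hκ1 : κ ≤ 1) (c : E) (r : ℝ) : ∃ K, 0 ≤ K ∧ HB κ (Metric.ball c r) f K := by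
  have : ProperSpace E := FiniteDimensional.proper_real E
  obtain ⟨K, hK⟩ := (isCompact_closedBall c r).exists_bound_of_continuousOn
    hf.continuous.continuousOn
  obtain ⟨L, hL⟩ := (isCompact_closedBall c r).exists_bound_of_continuousOn
    (hf.continuous_fderiv one_ne_zero).continuousOn
  have h := HB.of_fderiv (D := max 1 (2 * r)) hκ0 hκ1 (le_max_left _ _) (le_max_right _ _)
    (fun x _ => (hf.differentiable one_ne_zero x).hasFDerivAt)
    (fun x hx => hK x (Metric.ball_subset_closedBall hx))
    (fun x hx => hL x (Metric.ball_subset_closedBall hx))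
  exact ⟨_, le_max_left 0 _, h.mono le_rfl (le_max_right _ _)⟩

/-- A function supported in a ball that is Hölder on a larger ball is globally Hölder. -/
lemma HB.univ_of_support {f : E → F} (hκ0 : 0 ≤ κ) {c : E} {r : ℝ} (hK : 0 ≤ K)
    (hf : HB κ (Metric.ball c (r + 1)) f K) (h0 : ∀ x, x ∉ Metric.ball c r → f x = 0) :
    HB κ univ f K := by
  have h1 : ∀ x ∈ Metric.ball c r, ∀ y ∉ Metric.ball c (r + 1), 1 ≤ ‖x - y‖ := fun x hx y hy => by
    rw [Metric.mem_ball, not_lt] at hy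
    rw [Metric.mem_ball] at hx
    have := dist_triangle_left y c x
    rw [← dist_eq_norm]
    linarith
  have hsub : Metric.ball c r ⊆ Metric.ball c (r + 1) := Metric.ball_subset_ball (by linarith)
  refine ⟨fun x _ => ?_, fun x _ y _ => ?_⟩
  · by_cases hx : x ∈ Metric.ball c r
    · exact hf.b x (hsub hx)
    · rw [h0 x hx, norm_zero]; exact hK
  · by_cases hx : x ∈ Metric.ball c r <;> by_cases hy : y ∈ Metric.ball c r
    · exact hf.h x (hsub hx) y (hsub hy)
    · by_cases hy' : y ∈ Metric.ball c (r + 1)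
      · exact hf.h x (hsub hx) y hy'
      · rw [h0 y hy, sub_zero]
        refine (hf.b x (hsub hx)).trans (le_mul_of_one_le_right hK ?_)
        exact Real.one_le_rpow (h1 x hx y hy') hκ0
    · by_cases hx' : x ∈ Metric.ball c (r + 1)
      · exact hf.h x hx' y (hsub hy)
      · rw [h0 x hx, zero_sub, norm_neg]
        refine (hf.b y (hsub hy)).trans (le_mul_of_one_le_right hK ?_)
        rw [norm_sub_rev]
        exact Real.one_le_rpow (h1 y hy x hx') hκ0
    · rw [h0 x hx, h0 y hy, sub_zero, norm_zero]; positivity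

end HolderBounds

section Core

set_option linter.unusedSectionVars false
set_option maxSynthPendingDepth 3

variable {E : Type*} [NormedAddCommGroup E] [InnerProductSpace ℝ E] [FiniteDimensional ℝ E]

lemma coef_lapF (κ : ℝ) : Coef κ (2 + ‖lapF E‖) univ (fun _ : E => lapF E)
    (0 : E → (E →L[ℝ] ℝ) →L[ℝ] ℝ) where
  one := by linarith [norm_nonneg (lapF E)]
  bA _ _ := by linarith
  hA x _ y _ := by
    have := norm_nonneg (lapF E)
    simp only [sub_self, norm_zero]; positivity
  bB _ _ := by
    have := norm_nonneg (lapF E)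
    simp only [Pi.zero_apply, norm_zero]; positivity
  hB x _ y _ := by
    have := norm_nonneg (lapF E)
    simp only [Pi.zero_apply, sub_self, norm_zero]; positivity
  symm _ _ v w := by simp only [lapF_apply, tens_apply]; simp [mul_comm]
  ell x _ v := by
    have h := (stdOrthonormalBasis ℝ E).sum_sq_norm_inner_left v
    have e : lapF E (tens v v) = 1 / 2 * ‖v‖ ^ 2 := by
      rw [lapF_apply, ← h]
      congr 1
      refine Finset.sum_congr rfl fun i _ => ?_
      simp [sq]
    rw [e]
    nlinarith [norm_nonneg (lapF E), sq_nonneg ‖v‖, mul_nonneg (norm_nonneg (lapF E)) (sq_nonneg ‖v‖)]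

lemma global_unique {κ Λ : ℝ} {A : E → (E →L[ℝ] E →L[ℝ] ℝ) →L[ℝ] ℝ} {B : E → (E →L[ℝ] ℝ) →L[ℝ] ℝ}
    (hA : Coef κ Λ univ A B) {z : E → ℝ → ℝ} {N l : ℝ} (hl : 0 ≤ l)
    (hc : Continuous fun q : E × ℝ => z q.1 q.2) (hb : ∀ x t, |z x t| ≤ N)
    (h0 : ∀ x t, t ≤ 0 → z x t = 0) (hC : ∀ x t, C2At z x t)
    (hs : ∀ x t, HasDerivAt (z x) (A x (D2 z x t) + B x (D1 z x t) - l * z x t) t) (x : E) (t : ℝ) :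
    z x t = 0 := by
  refine le_antisymm ?_ ?_
  · have := global_nonneg hA (u := fun x t => 0 + (-1) * z x t) (N := N) hl (by fun_prop)
      (fun x t => by simpa using hb x t) (fun x t ht => by simp [h0 x t ht]) (fun x t _ => by
        obtain ⟨k1, k2, k3⟩ := C2At.const (0 : ℝ) x t
        obtain ⟨r1, r2, r3⟩ := k1.add_smul (hC x t) (-1)
        refine ⟨r1, _, ((hs x t).const_mul (-1)).const_add 0, ?_⟩
        rw [r2, r3, k2, k3]
        simp only [map_add, map_smul, smul_eq_mul, map_zero]
        linarith) x t
    linarith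
  · exact global_nonneg hA hl hc hb (fun x t ht => (h0 x t ht).ge) (fun x t _ =>
      ⟨hC x t, _, hs x t, by linarith⟩) x t

variable (E) in
lemma exists_cutoff {κ : ℝ} (hκ0 : 0 ≤ κ) (hκ1 : κ ≤ 1) : ∃ (η : E → ℝ) (η' : E → E →L[ℝ] ℝ)
    (η'' : E → E →L[ℝ] E →L[ℝ] ℝ) (K : ℝ), 0 ≤ K ∧ (∀ x, HasFDerivAt η (η' x) x) ∧
      (∀ x, HasFDerivAt η' (η'' x) x) ∧ (∀ x ∈ Metric.ball (0 : E) 1, η x = 1) ∧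
      (∀ x ∉ Metric.ball (0 : E) 2, η =ᶠ[𝓝 x] 0 ∧ η' x = 0 ∧ η'' x = 0) ∧
      HB κ (Metric.ball 0 3) η K ∧ HB κ (Metric.ball 0 3) η' K ∧ HB κ (Metric.ball 0 3) η'' K := by
  let η : ContDiffBump (0 : E) := ⟨1, 3 / 2, one_pos, by norm_num⟩
  have h0 : ContDiff ℝ 3 η := η.contDiff
  have h1 : ContDiff ℝ 2 (fderiv ℝ η) := h0.fderiv_right (by norm_num)
  have h2 : ContDiff ℝ 1 (fderiv ℝ (fderiv ℝ η)) := h1.fderiv_right (by norm_num)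
  obtain ⟨K0, p0, k0⟩ := exists_HB_of_contDiff (h0.of_le (by norm_num)) hκ0 hκ1 (0 : E) 3
  obtain ⟨K1, p1, k1⟩ := exists_HB_of_contDiff (h1.of_le (by norm_num)) hκ0 hκ1 (0 : E) 3
  obtain ⟨K2, p2, k2⟩ := exists_HB_of_contDiff h2 hκ0 hκ1 (0 : E) 3
  have hz : ∀ x ∉ Metric.ball (0 : E) 2, (η : E → ℝ) =ᶠ[𝓝 x] 0 := fun x hx => by
    rw [Metric.mem_ball, not_lt] at hx
    filter_upwards [Metric.ball_mem_nhds x (by norm_num : (0 : ℝ) < 1 / 2)] with y hy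
    refine η.zero_of_le_dist ?_
    have := dist_triangle_left x 0 y
    have := Metric.mem_ball.1 hy
    change (3 / 2 : ℝ) ≤ _
    linarith
  have hz1 : ∀ x ∉ Metric.ball (0 : E) 2, fderiv ℝ η =ᶠ[𝓝 x] 0 := fun x hx => by
    filter_upwards [(hz x hx).fderiv (𝕜 := ℝ)] with y hy
    refine hy.trans ?_
    exact (hasFDerivAt_const (0 : ℝ) y).fderiv
  refine ⟨η, fderiv ℝ η, fderiv ℝ (fderiv ℝ η), K0 + K1 + K2, by positivity,
    fun x => (h0.differentiable (by norm_num) x).hasFDerivAt,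
    fun x => (h1.differentiable (by norm_num) x).hasFDerivAt,
    fun x hx => η.one_of_mem_closedBall (Metric.ball_subset_closedBall hx),
    fun x hx => ⟨hz x hx, (hz1 x hx).self_of_nhds, ?_⟩, k0.mono le_rfl (by linarith),
    k1.mono le_rfl (by linarith), k2.mono le_rfl (by linarith)⟩
  rw [(hz1 x hx).fderiv_eq]
  exact (hasFDerivAt_const (0 : E →L[ℝ] ℝ) x).fderiv

lemma LC.D_zero {κ M : ℝ} {s : Set E} {u : E → ℝ → ℝ} (hu : LC κ s u M) (hs : IsOpen s) {x : E}
    (hx : x ∈ s) {t : ℝ} (ht : t ≤ 0) : D1 u x t = 0 ∧ D2 u x t = 0 := by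
  obtain ⟨-, h1, h2⟩ := D2_congr (u := u) (x := x) (t := t) (w := fun _ => 0) (w2 := 0) (by
    filter_upwards [hs.eventually_mem hx] with y hy
    refine (hasFDerivAt_const (0 : ℝ) y).congr_of_eventuallyEq ?_
    filter_upwards [hs.eventually_mem hy] with z hz using hu.zero z hz t ht)
    (hasFDerivAt_const _ x)
  exact ⟨h1, h2⟩

variable [MeasurableSpace E] [BorelSpace E]

set_option maxHeartbeats 2000000 in
/-- The Schauder estimate for operators close to the Laplacian, with lower order norms on the
right-hand side. -/
theorem interior_core {κ : ℝ} (hκ : 0 < κ) (hκ1 : κ < 1) : ∃ C : ℝ, 0 ≤ C ∧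
    ∀ (A : E → (E →L[ℝ] E →L[ℝ] ℝ) →L[ℝ] ℝ) (B : E → (E →L[ℝ] ℝ) →L[ℝ] ℝ) (f u : E → ℝ → ℝ)
      (δ Λ K0 K1 K2 Kf M : ℝ), LC κ (Metric.ball 0 4) u M → IsSol (Metric.ball 0 4) A B f u →
      HB κ (Metric.ball 0 3) (fun x => A x - lapF E) δ → HB κ (Metric.ball 0 3) B Λ →
      (∀ t, HB κ (Metric.ball 0 3) (fun x => f x t) Kf) →
      (∀ x ∈ Metric.ball (0 : E) 3, Continuous (f x)) →
      (∀ x ∈ Metric.ball (0 : E) 3, ∀ t ≤ 0, f x t = 0) →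
      (∀ t, HB κ (Metric.ball 0 3) (fun x => u x t) K0) →
      (∀ t, HB κ (Metric.ball 0 3) (fun x => D1 u x t) K1) →
      (∀ t, HB κ (Metric.ball 0 3) (fun x => D2 u x t) K2) →
      ∀ x ∈ Metric.ball (0 : E) 1, ∀ y ∈ Metric.ball (0 : E) 1, ∀ t,
        ‖D2 u x t - D2 u y t‖ ≤ C * (δ * K2 + Λ * K1 + K1 + K0 + Kf) * ‖x - y‖ ^ κ := by
  obtain ⟨η, η', η'', Kη, hKη, hd0, hd1, hη1, hη2, b0, b1, b2⟩ := exists_cutoff E hκ.le hκ1.le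
  have hD1 := (DuhData.duhC_parts (E := E) hκ hκ1).1
  set sR := ContinuousLinearMap.smulRightL ℝ E (E →L[ℝ] ℝ) with hsR
  have hl := norm_nonneg (lapF E)
  have hsn := norm_nonneg sR
  set C0 := 4 * Kη * (1 + ‖lapF E‖) * (1 + ‖sR‖) with hC0
  refine ⟨(‖lapF E‖ + 2) * duhC E κ * C0, by positivity, ?_⟩
  intro A B f u δ Λ K0 K1 K2 Kf M hu hsol hδ hΛ hf hfc hf0 h0 h1 h2
  have hsub : Metric.ball (0 : E) 3 ⊆ Metric.ball 0 4 := Metric.ball_subset_ball (by norm_num)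
  have hz3 : (0 : E) ∈ Metric.ball (0 : E) 3 := by simp
  have pδ : 0 ≤ δ := (norm_nonneg _).trans (hδ.b 0 hz3)
  have pΛ : 0 ≤ Λ := (norm_nonneg _).trans (hΛ.b 0 hz3)
  have pf : 0 ≤ Kf := (norm_nonneg _).trans ((hf 0).b 0 hz3)
  have p0 : 0 ≤ K0 := (norm_nonneg _).trans ((h0 0).b 0 hz3)
  have p1 : 0 ≤ K1 := (norm_nonneg _).trans ((h1 0).b 0 hz3)
  have p2 : 0 ≤ K2 := (norm_nonneg _).trans ((h2 0).b 0 hz3)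
  set S := δ * K2 + Λ * K1 + K1 + K0 + Kf with hS
  have pS : 0 ≤ S := by positivity
  set g : E → ℝ → ℝ := fun x t => η x • f x t + η x • u x t + η x • ((A x - lapF E) (D2 u x t))
    + η x • (B x (D1 u x t)) - lapF E (sR (η' x) (D1 u x t))
    - lapF E (sR (D1 u x t) (η' x)) - u x t • lapF E (η'' x) with hg
  have hη0 : ∀ x ∉ Metric.ball (0 : E) 2, η x = 0 := fun x hx => (hη2 x hx).1.self_of_nhds
  have hg0 : ∀ t, ∀ x ∉ Metric.ball (0 : E) 2, g x t = 0 := fun t x hx => by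
    simp [hg, hη0 x hx, (hη2 x hx).2.1, (hη2 x hx).2.2]
  have hgHB : ∀ t, HB κ univ (fun x => g x t) (C0 * S) := fun t => by
    refine HB.univ_of_support hκ.le (c := 0) (r := 2) (by positivity) ?_ (hg0 t)
    norm_num
    have q := ((((((b0.smul (hf t)).add (b0.smul (h0 t))).add (b0.smul (hδ.apply (h2 t)))).add
      (b0.smul (hΛ.apply (h1 t)))).sub ((b1.bilin sR (h1 t)).clm (lapF E))).sub
      (((h1 t).bilin sR b1).clm (lapF E))).sub ((h0 t).smul (b2.clm (lapF E)))
    refine q.mono le_rfl ?_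
    rw [hC0, hS]
    have m0 : 0 ≤ Kη * Kf := by positivity
    have m1 : 0 ≤ Kη * K0 := by positivity
    have m2 : 0 ≤ Kη * (δ * K2) := by positivity
    have m3 : 0 ≤ Kη * (Λ * K1) := by positivity
    have m4 : 0 ≤ Kη * K1 := by positivity
    have n1 : 0 ≤ ‖lapF E‖ * ‖sR‖ := by positivity
    have e : 4 * Kη * (1 + ‖lapF E‖) * (1 + ‖sR‖) * (δ * K2 + Λ * K1 + K1 + K0 + Kf) =
      4 * (1 + ‖lapF E‖ + ‖sR‖ + ‖lapF E‖ * ‖sR‖) *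
        (Kη * (δ * K2) + Kη * (Λ * K1) + Kη * K1 + Kη * K0 + Kη * Kf) := by ring
    rw [e]
    have e2 : 2 * (Kη * Kf) + 2 * (Kη * K0) + 2 * (Kη * (2 * (δ * K2))) + 2 * (Kη * (2 * (Λ * K1)))
      + ‖lapF E‖ * (2 * (‖sR‖ * Kη * K1)) + ‖lapF E‖ * (2 * (‖sR‖ * K1 * Kη))
      + 2 * (K0 * (‖lapF E‖ * Kη)) = 2 * (Kη * Kf) + 2 * (Kη * K0) + 4 * (Kη * (δ * K2))
      + 4 * (Kη * (Λ * K1)) + 4 * (‖lapF E‖ * ‖sR‖ * (Kη * K1)) + 2 * (‖lapF E‖ * (Kη * K0)) := by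
      ring
    rw [e2]
    set X := Kη * (δ * K2) + Kη * (Λ * K1) + Kη * K1 + Kη * K0 + Kη * Kf with hX
    have x1 : ‖lapF E‖ * ‖sR‖ * (Kη * K1) ≤ ‖lapF E‖ * ‖sR‖ * X := by gcongr; linarith
    have x2 : ‖lapF E‖ * (Kη * K0) ≤ ‖lapF E‖ * X := by gcongr; linarith
    have x3 : 0 ≤ ‖lapF E‖ * X := by positivity
    have x4 : 0 ≤ ‖sR‖ * X := by positivity
    have x5 : 4 * (1 + ‖lapF E‖ + ‖sR‖ + ‖lapF E‖ * ‖sR‖) * X = 4 * X + 4 * (‖lapF E‖ * X)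
      + 4 * (‖sR‖ * X) + 4 * (‖lapF E‖ * ‖sR‖ * X) := by ring
    rw [x5]
    linarith
  have hgX : XC κ g (C0 * S) := by
    refine ⟨fun x => ?_, fun x t => (hgHB t).b x trivial,
      fun x y t => (hgHB t).h x trivial y trivial, fun x t ht => ?_⟩
    · by_cases hx : x ∈ Metric.ball (0 : E) 3
      · obtain ⟨c1, c2⟩ := hu.continuous_D Metric.isOpen_ball hκ (hsub hx)
        have c0 : Continuous (u x) :=
          continuous_iff_continuousAt.2 fun t => (hsol x (hsub hx) t).continuousAt
        have cf := hfc x hx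
        simp only [hg]
        fun_prop
      · have : g x = fun _ => 0 := by
          ext t
          exact hg0 t x fun h => hx (Metric.ball_subset_ball (by norm_num) h)
        rw [this]; exact continuous_const
    · by_cases hx : x ∈ Metric.ball (0 : E) 3
      · obtain ⟨c1, c2⟩ := hu.D_zero Metric.isOpen_ball (hsub hx) ht
        simp [hg, hf0 x hx t ht, c1, c2, hu.zero x (hsub hx) t ht]
      · exact hg0 t x fun h => hx (Metric.ball_subset_ball (by norm_num) h)
  set w : E → ℝ → ℝ := fun x t => η x * u x t with hw
  have hwin : ∀ x ∈ Metric.ball (0 : E) 4, ∀ t, C2At w x t ∧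
      D1 w x t = η x • D1 u x t + u x t • η' x ∧
      D2 w x t = (η x • D2 u x t + (η' x).smulRight (D1 u x t)) +
        (u x t • η'' x + (D1 u x t).smulRight (η' x)) := by
    intro x hx t
    refine D2_congr (u := w) (w := fun y => η y • D1 u y t + u y t • η' y) ?_ ?_
    · filter_upwards [Metric.isOpen_ball.mem_nhds hx] with y hy
      exact (hd0 y).mul (hu.d1 y hy t)
    · exact ((hd0 x).smul (hu.d2 x hx t)).add ((hu.d1 x hx t).smul (hd1 x))
  have hwout : ∀ x ∉ Metric.ball (0 : E) 4, ∀ᶠ y in 𝓝 x, ∀ t, w y t = 0 := by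
    intro x hx
    filter_upwards [(hη2 x fun h => hx (Metric.ball_subset_ball (by norm_num) h)).1] with y hy t
    simp [hw, hy]
  have hwout' : ∀ x ∉ Metric.ball (0 : E) 4, ∀ t, C2At w x t ∧ D1 w x t = 0 ∧ D2 w x t = 0 := by
    intro x hx t
    refine D2_congr (u := w) (w := fun _ => 0) ?_ (hasFDerivAt_const _ x)
    filter_upwards [eventually_eventually_nhds.2 (hwout x hx)] with y hy
    exact (hasFDerivAt_const (0 : ℝ) y).congr_of_eventuallyEq (hy.mono fun z hz => hz t)
  have hwC : ∀ x t, C2At w x t := fun x t => by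
    by_cases hx : x ∈ Metric.ball (0 : E) 4
    · exact (hwin x hx t).1
    · exact (hwout' x hx t).1
  have hwcont : Continuous fun q : E × ℝ => w q.1 q.2 := by
    rw [continuous_iff_continuousAt]
    rintro ⟨x, t⟩
    by_cases hx : x ∈ Metric.ball (0 : E) 4
    · exact ((hd0 x).continuousAt.comp (f := Prod.fst) (x := (x, t)) continuousAt_fst).mul
        (hu.continuousAt Metric.isOpen_ball hx t)
    · refine (continuousAt_const (y := (0 : ℝ))).congr ?_
      filter_upwards [(continuous_fst.tendsto (x, t)).eventually (hwout x hx)] with q hq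
      exact (hq q.2).symm
  have hwb : ∀ x t, |w x t| ≤ Kη * K0 := fun x t => by
    by_cases hx : x ∈ Metric.ball (0 : E) 3
    · rw [hw, abs_mul]
      exact mul_le_mul (b0.b x hx) ((h0 t).b x hx) (abs_nonneg _) hKη
    · have : w x t = 0 := by
        simp [hw, hη0 x fun h => hx (Metric.ball_subset_ball (by norm_num) h)]
      rw [this, abs_zero]; positivity
  have hwt : ∀ x t, HasDerivAt (w x) (lapF E (D2 w x t) - w x t + g x t) t := fun x t => by
    by_cases hx : x ∈ Metric.ball (0 : E) 4
    · refine ((hsol x hx t).const_mul (η x)).congr_deriv ?_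
      rw [(hwin x hx t).2.2]
      have e : ∀ a b : E →L[ℝ] ℝ, sR a b = a.smulRight b := fun _ _ => rfl
      simp only [hg, hw, e, map_add, map_smul, smul_eq_mul, sub_apply]
      ring
    · have hx2 : x ∉ Metric.ball (0 : E) 2 := fun h => hx (Metric.ball_subset_ball (by norm_num) h)
      have e : w x = fun _ => 0 := by
        ext t; simp [hw, hη0 x hx2]
      rw [(hwout' x hx t).2.2, hg0 t x hx2, e]
      simpa using hasDerivAt_const t (0 : ℝ)
  have hY := duhS_YC hκ hκ1 hgX
  have hYL := hY.toLC
  have heq : ∀ x t, w x t = duhS g x t := fun x t => by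
    have := global_unique (coef_lapF (E := E) κ) (z := fun x t => w x t - duhS g x t) zero_le_one
      (hwcont.sub hYL.continuous) (fun x t => (abs_sub _ _).trans (add_le_add (hwb x t) (hY.b0 x t)))
      (fun x t ht => by
        rw [hY.zero x t ht, sub_zero]
        by_cases hx : x ∈ Metric.ball (0 : E) 4
        · simp [hw, hu.zero x hx t ht]
        · simpa using (hwout x hx).self_of_nhds t)
      (fun x t => ((hwC x t).sub (hYL.c2At isOpen_univ (mem_univ x) t)).1)
      (fun x t => by
        refine ((hwt x t).sub (hasDerivAt_duhS hκ hκ1 hgX x t)).congr_deriv ?_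
        rw [((hwC x t).sub (hYL.c2At isOpen_univ (mem_univ x) t)).2.2]
        simp only [map_sub, Pi.zero_apply, zero_apply]
        ring) x t
    linarith
  have hweq : w = duhS g := by ext x t; exact heq x t
  have hD : ∀ x ∈ Metric.ball (0 : E) 1, ∀ t, D2 u x t = D2 (duhS g) x t := fun x hx t => by
    have hx4 : x ∈ Metric.ball (0 : E) 4 := Metric.ball_subset_ball (by norm_num) hx
    obtain ⟨-, -, h⟩ := D2_congr (u := w) (x := x) (t := t) (w := fun y => D1 u y t) (by
      filter_upwards [Metric.isOpen_ball.mem_nhds hx] with y hy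
      refine (hu.d1 y (Metric.ball_subset_ball (by norm_num) hy) t).congr_of_eventuallyEq ?_
      filter_upwards [Metric.isOpen_ball.mem_nhds hy] with z hz
      simp [hw, hη1 z hz]) (hu.d2 x hx4 t)
    rw [← h, hweq]
  intro x hx y hy t
  rw [hD x hx, hD y hy]
  refine (hY.h2 x y t).trans_eq ?_
  ring

end Core

section CoreTwo

set_option linter.unusedSectionVars false
set_option maxSynthPendingDepth 3

variable {E : Type*} [NormedAddCommGroup E] [InnerProductSpace ℝ E] [FiniteDimensional ℝ E]

lemma exists_small_rpow {κ ε r : ℝ} (hκ : 0 < κ) (hε : 0 < ε) (hr : 0 < r) :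
    ∃ ρ, 0 < ρ ∧ ρ ≤ r ∧ ρ ^ κ ≤ ε := by
  refine ⟨min r (ε ^ κ⁻¹), lt_min hr (by positivity), min_le_left _ _, ?_⟩
  calc (min r (ε ^ κ⁻¹)) ^ κ ≤ (ε ^ κ⁻¹) ^ κ :=
        Real.rpow_le_rpow (le_min hr.le (by positivity)) (min_le_right _ _) hκ.le
    _ = ε := Real.rpow_inv_rpow hε.le hκ.ne'

lemma LC.interp {κ M K H ρ : ℝ} {s : Set E} {u : E → ℝ → ℝ} (hu : LC κ s u M) (hκ : 0 ≤ κ)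
    {t : ℝ} {x : E} (hρ : 0 < ρ) (hx : Metric.closedBall x ρ ⊆ s) (hH0 : 0 ≤ H)
    (hK : ∀ y ∈ Metric.closedBall x ρ, |u y t| ≤ K)
    (hH : ∀ y ∈ Metric.closedBall x ρ, ∀ z ∈ Metric.closedBall x ρ,
      ‖D2 u y t - D2 u z t‖ ≤ H * ‖y - z‖ ^ κ) :
    ‖D1 u x t‖ ≤ K / ρ + H * ρ ^ κ * ρ ∧ ‖D2 u x t‖ ≤ 4 * K / ρ ^ 2 + 2 * (H * ρ ^ κ) :=
  ⟨norm_fderiv_le_interp (convex_closedBall x ρ) hκ hH0 (fun y hy => hu.d1 y (hx hy) t)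
    (fun y hy => hu.d2 y (hx hy) t) hH hK hρ le_rfl,
   norm_fderiv_fderiv_le_interp (convex_closedBall x ρ) hκ hH0 (fun y hy => hu.d1 y (hx hy) t)
    (fun y hy => hu.d2 y (hx hy) t) hH hK hρ le_rfl⟩

variable [MeasurableSpace E] [BorelSpace E]

/-- The Schauder estimate for operators close to the Laplacian, with a small multiple of the
Hölder seminorm on the right-hand side. -/
theorem interior_core_interp {κ : ℝ} (hκ : 0 < κ) (hκ1 : κ < 1) {ε : ℝ} (hε : 0 < ε) :
    ∃ δ C : ℝ, 0 < δ ∧ 0 ≤ C ∧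
    ∀ (A : E → (E →L[ℝ] E →L[ℝ] ℝ) →L[ℝ] ℝ) (B : E → (E →L[ℝ] ℝ) →L[ℝ] ℝ) (f u : E → ℝ → ℝ)
      (K H Kf M : ℝ), LC κ (Metric.ball 0 4) u M → IsSol (Metric.ball 0 4) A B f u →
      HB κ (Metric.ball 0 3) (fun x => A x - lapF E) δ → HB κ (Metric.ball 0 3) B 1 →
      (∀ t, HB κ (Metric.ball 0 3) (fun x => f x t) Kf) →
      (∀ x ∈ Metric.ball (0 : E) 3, Continuous (f x)) →
      (∀ x ∈ Metric.ball (0 : E) 3, ∀ t ≤ 0, f x t = 0) → 0 ≤ H →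
      (∀ x ∈ Metric.ball (0 : E) 4, ∀ t, |u x t| ≤ K) →
      (∀ x ∈ Metric.ball (0 : E) 4, ∀ y ∈ Metric.ball (0 : E) 4, ∀ t,
        ‖D2 u x t - D2 u y t‖ ≤ H * ‖x - y‖ ^ κ) →
      ∀ x ∈ Metric.ball (0 : E) 1, ∀ y ∈ Metric.ball (0 : E) 1, ∀ t,
        ‖D2 u x t - D2 u y t‖ ≤ (ε * H + C * (K + Kf)) * ‖x - y‖ ^ κ := by
  obtain ⟨C, hC, key⟩ := interior_core (E := E) hκ hκ1
  obtain ⟨ρ, hρ, hρ1, hρε⟩ := exists_small_rpow hκ (ε := ε / (64 * (C + 1))) (r := 1 / 2)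
    (by positivity) (by norm_num)
  refine ⟨ε / (4 * (C + 1)), C * (16 * (ε / (4 * (C + 1))) + 8 / ρ + 48 / ρ ^ 2 + 1),
    by positivity, by positivity, ?_⟩
  intro A B f u K H Kf M hu hsol hδ hB hf hfc hf0 hH0 hK hH
  have hsub : Metric.ball (0 : E) 3 ⊆ Metric.ball 0 4 := Metric.ball_subset_ball (by norm_num)
  have hz3 : (0 : E) ∈ Metric.ball (0 : E) 3 := by simp
  have pK : 0 ≤ K := (abs_nonneg _).trans (hK 0 (hsub hz3) 0)
  have pf : 0 ≤ Kf := (norm_nonneg _).trans ((hf 0).b 0 hz3)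
  have hcb : ∀ r : ℝ, r ≤ 1 / 2 → ∀ x ∈ Metric.ball (0 : E) 3,
      Metric.closedBall x r ⊆ Metric.ball 0 4 := fun r hr x hx y hy => by
    have h1 := Metric.mem_ball.1 hx
    have h2 := Metric.mem_closedBall.1 hy
    have := dist_triangle y x 0
    exact Metric.mem_ball.2 (by linarith)
  have hitg : ∀ r : ℝ, 0 < r → r ≤ 1 / 2 → ∀ x ∈ Metric.ball (0 : E) 3, ∀ t,
      ‖D1 u x t‖ ≤ K / r + H * r ^ κ * r ∧ ‖D2 u x t‖ ≤ 4 * K / r ^ 2 + 2 * (H * r ^ κ) :=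
    fun r hr hr1 x hx t => hu.interp hκ.le hr (hcb r hr1 x hx) hH0
      (fun y hy => hK y (hcb r hr1 x hx hy) t)
      fun y hy z hz => hH y (hcb r hr1 x hx hy) z (hcb r hr1 x hx hz) t
  have hd1 : ∀ x ∈ Metric.ball (0 : E) 3, ∀ t, ‖D1 u x t‖ ≤ K / ρ + H * ρ ^ κ := fun x hx t => by
    have h := (hitg ρ hρ hρ1 x hx t).1
    have : H * ρ ^ κ * ρ ≤ H * ρ ^ κ := mul_le_of_le_one_right (by positivity) (by linarith)
    linarith
  have hd2 : ∀ x ∈ Metric.ball (0 : E) 3, ∀ t, ‖D2 u x t‖ ≤ 4 * K / ρ ^ 2 + 2 * (H * ρ ^ κ) :=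
    fun x hx t => (hitg ρ hρ hρ1 x hx t).2
  have k0 : ∀ t, HB κ (Metric.ball 0 3) (fun x => u x t) (K + 6 * (K / ρ + H * ρ ^ κ)) := fun t =>
    HB.of_fderiv (D := 6) hκ.le hκ1.le (by norm_num) (by norm_num)
      (fun x hx => hu.d1 x (hsub hx) t) (fun x hx => hK x (hsub hx) t) (fun x hx => hd1 x hx t)
  have k1 : ∀ t, HB κ (Metric.ball 0 3) (fun x => D1 u x t)
      (K / ρ + H * ρ ^ κ + 6 * (4 * K / ρ ^ 2 + 2 * (H * ρ ^ κ))) := fun t =>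
    HB.of_fderiv (D := 6) hκ.le hκ1.le (by norm_num) (by norm_num)
      (fun x hx => hu.d2 x (hsub hx) t) (fun x hx => hd1 x hx t) (fun x hx => hd2 x hx t)
  have k2 : ∀ t, HB κ (Metric.ball 0 3) (fun x => D2 u x t) (16 * K + 2 * H) := fun t => by
    refine ⟨fun x hx => ?_, fun x hx y hy => (hH x (hsub hx) y (hsub hy) t).trans ?_⟩
    · have h := (hitg (1 / 2) (by norm_num) le_rfl x hx t).2
      have h2 : ((1 : ℝ) / 2) ^ κ ≤ 1 := Real.rpow_le_one (by norm_num) (by norm_num) hκ.le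
      rw [show 4 * K / (1 / 2) ^ 2 = 16 * K by ring] at h
      have h3 := mul_le_of_le_one_right hH0 h2
      linarith
    · gcongr; linarith
  intro x hx y hy t
  refine (key A B f u _ 1 _ _ _ Kf M hu hsol hδ hB hf hfc hf0 k0 k1 k2 x hx y hy t).trans ?_
  gcongr
  have e1 : C * ρ ^ κ ≤ ε / 64 := by
    calc C * ρ ^ κ ≤ C * (ε / (64 * (C + 1))) := by gcongr
      _ = C / (C + 1) * (ε / 64) := by field_simp
      _ ≤ 1 * (ε / 64) := by
        gcongr
        exact (div_le_one (by positivity)).2 (by linarith)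
      _ = ε / 64 := one_mul _
  have e2 : C * (ε / (4 * (C + 1))) ≤ ε / 4 := by
    calc C * (ε / (4 * (C + 1))) = C / (C + 1) * (ε / 4) := by field_simp
      _ ≤ 1 * (ε / 4) := by
        gcongr
        exact (div_le_one (by positivity)).2 (by linarith)
      _ = ε / 4 := one_mul _
  have e3 := mul_le_mul_of_nonneg_right e1 hH0
  have e4 := mul_le_mul_of_nonneg_right e2 hH0
  have n1 : 0 ≤ C * (16 * (ε / (4 * (C + 1))) + 8 / ρ + 48 / ρ ^ 2) * Kf := by positivity
  have e5 : C * (ε / (4 * (C + 1)) * (16 * K + 2 * H) + 1 * (K / ρ + H * ρ ^ κ + 6 *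
      (4 * K / ρ ^ 2 + 2 * (H * ρ ^ κ))) + (K / ρ + H * ρ ^ κ + 6 * (4 * K / ρ ^ 2 +
      2 * (H * ρ ^ κ))) + (K + 6 * (K / ρ + H * ρ ^ κ)) + Kf) =
      C * (16 * (ε / (4 * (C + 1))) + 8 / ρ + 48 / ρ ^ 2 + 1) * K + C * Kf +
      2 * (C * (ε / (4 * (C + 1))) * H) + 32 * (C * ρ ^ κ * H) := by ring
  rw [e5]
  nlinarith

end CoreTwo

section Scaling

set_option linter.unusedSectionVars false
set_option maxSynthPendingDepth 3

variable {E : Type*} [NormedAddCommGroup E] [InnerProductSpace ℝ E] [FiniteDimensional ℝ E]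

lemma norm_pull_le (T : E →L[ℝ] E →L[ℝ] ℝ) (τ : E →L[ℝ] E) : ‖pull T τ‖ ≤ ‖T‖ * ‖τ‖ ^ 2 :=
  ContinuousLinearMap.opNorm_le_bound₂ _ (by positivity) fun v w => by
    rw [pull_apply]
    calc ‖T (τ v) (τ w)‖ ≤ ‖T‖ * ‖τ v‖ * ‖τ w‖ := T.le_opNorm₂ _ _
      _ ≤ ‖T‖ * (‖τ‖ * ‖v‖) * (‖τ‖ * ‖w‖) := by gcongr <;> exact τ.le_opNorm _
      _ = _ := by ring

/-- `pull` as a continuous linear map. -/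
noncomputable def pullL (τ : E →L[ℝ] E) : (E →L[ℝ] E →L[ℝ] ℝ) →L[ℝ] (E →L[ℝ] E →L[ℝ] ℝ) :=
  LinearMap.mkContinuous
    { toFun := fun T => pull T τ
      map_add' := fun S T => by ext v w; simp
      map_smul' := fun c T => by ext v w; simp } (‖τ‖ ^ 2)
    fun T => (norm_pull_le T τ).trans_eq (mul_comm _ _)

@[simp] lemma pullL_apply (τ : E →L[ℝ] E) (T : E →L[ℝ] E →L[ℝ] ℝ) : pullL τ T = pull T τ := rfl

lemma norm_pullL_le (τ : E →L[ℝ] E) : ‖pullL τ‖ ≤ ‖τ‖ ^ 2 :=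
  LinearMap.mkContinuous_norm_le _ (by positivity) _

/-- Precomposition with a linear map. -/
noncomputable def preL (τ : E →L[ℝ] E) : (E →L[ℝ] ℝ) →L[ℝ] (E →L[ℝ] ℝ) :=
  (ContinuousLinearMap.compL ℝ E E ℝ).flip τ

@[simp] lemma preL_apply (τ : E →L[ℝ] E) (T : E →L[ℝ] ℝ) : preL τ T = T.comp τ := rfl

lemma norm_preL_le (τ : E →L[ℝ] E) : ‖preL τ‖ ≤ ‖τ‖ :=
  ContinuousLinearMap.opNorm_le_bound _ (norm_nonneg _) fun T => by
    rw [preL_apply, mul_comm]; exact T.opNorm_comp_le τ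

lemma D2_affine {u : E → ℝ → ℝ} {x0 y : E} (τ : E →L[ℝ] E) {c t : ℝ}
    (h : C2At u (x0 + τ y) (c * t)) : C2At (fun y t => u (x0 + τ y) (c * t)) y t ∧
      D1 (fun y t => u (x0 + τ y) (c * t)) y t = (D1 u (x0 + τ y) (c * t)).comp τ ∧
      D2 (fun y t => u (x0 + τ y) (c * t)) y t = pull (D2 u (x0 + τ y) (c * t)) τ := by
  have ha : ∀ z, HasFDerivAt (fun y => x0 + τ y) τ z := fun z => τ.hasFDerivAt.const_add x0
  refine D2_congr (u := fun y t => u (x0 + τ y) (c * t))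
    (w := fun z => (D1 u (x0 + τ z) (c * t)).comp τ) ?_ ?_
  · filter_upwards [(ha y).continuousAt.eventually h.d1] with z hz
    exact hz.comp z (ha z)
  · have := ((preL τ).hasFDerivAt.comp _ h.d2).comp y (ha y)
    refine this.congr_fderiv ?_
    ext v w
    simp

end Scaling

section ScalingTwo

set_option linter.unusedSectionVars false
set_option maxSynthPendingDepth 3

variable {E : Type*} [NormedAddCommGroup E] [InnerProductSpace ℝ E] [FiniteDimensional ℝ E]

lemma LC.affine {κ M r R c : ℝ} {x0 : E} {u : E → ℝ → ℝ} (hκ : 0 ≤ κ) {τ : E →L[ℝ] E}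
    (hu : LC κ (Metric.ball x0 R) u M)
    (hτ : ‖τ‖ ≤ 1) (hm : ∀ y ∈ Metric.ball (0 : E) r, x0 + τ y ∈ Metric.ball x0 R)
    (hc : 0 ≤ c) (hc1 : c ≤ 1) :
    LC κ (Metric.ball 0 r) (fun y t => u (x0 + τ y) (c * t)) M := by
  have e := fun y (hy : y ∈ Metric.ball (0 : E) r) t =>
    D2_affine (y := y) (t := t) τ (hu.c2At Metric.isOpen_ball (hm y hy) (c * t))
  refine ⟨fun y hy t => (e y hy t).1.d1.self_of_nhds, fun y hy t => (e y hy t).1.d2,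
    fun y hy t => hu.b0 _ (hm y hy) _, fun y hy t => ?_, fun y hy t => ?_, fun y hy z hz t => ?_,
    fun y hy t t' => ?_, fun y hy t ht => hu.zero _ (hm y hy) _ (mul_nonpos_of_nonneg_of_nonpos hc ht)⟩
  · have hM := hu.nonneg (hm y hy)
    rw [(e y hy t).2.1]
    calc _ ≤ ‖D1 u (x0 + τ y) (c * t)‖ * ‖τ‖ := ContinuousLinearMap.opNorm_comp_le _ _
      _ ≤ M * 1 := by gcongr; exact hu.b1 _ (hm y hy) _
      _ = M := mul_one M
  · have hM := hu.nonneg (hm y hy)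
    rw [(e y hy t).2.2]
    calc _ ≤ ‖D2 u (x0 + τ y) (c * t)‖ * ‖τ‖ ^ 2 := norm_pull_le _ _
      _ ≤ M * 1 ^ 2 := by gcongr; exact hu.b2 _ (hm y hy) _
      _ = M := by ring
  · have hM := hu.nonneg (hm y hy)
    rw [(e y hy t).2.2, (e z hz t).2.2, ← pullL_apply, ← pullL_apply, ← map_sub, pullL_apply]
    have h1 : ‖τ y - τ z‖ ≤ ‖y - z‖ := by
      rw [← map_sub]
      exact (τ.le_opNorm _).trans (mul_le_of_le_one_left (norm_nonneg _) hτ)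
    calc _ ≤ _ := norm_pull_le _ _
      _ ≤ (M * ‖(x0 + τ y) - (x0 + τ z)‖ ^ κ) * 1 ^ 2 := by
        gcongr; exact hu.h2 _ (hm y hy) _ (hm z hz) _
      _ ≤ M * ‖y - z‖ ^ κ := by
        rw [add_sub_add_left_eq_sub, one_pow, mul_one]; gcongr
  · have hM := hu.nonneg (hm y hy)
    refine (hu.lip _ (hm y hy) _ _).trans ?_
    rw [← mul_sub, abs_mul, abs_of_nonneg hc]
    gcongr
    exact mul_le_of_le_one_left (abs_nonneg _) hc1

lemma HB.affine {F : Type*} [NormedAddCommGroup F] [NormedSpace ℝ F] {κ K q r R : ℝ} {x0 : E}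
    {f : E → F} (hκ : 0 ≤ κ) {τ : E →L[ℝ] E} (hK : 0 ≤ K)
    (hf : HB κ (Metric.ball x0 R) f K)
    (hq : ‖τ‖ ≤ q) (hq1 : q ≤ 1) (hm : ∀ y ∈ Metric.ball (0 : E) r, x0 + τ y ∈ Metric.ball x0 R) :
    HB κ (Metric.ball 0 r) (fun y => f (x0 + τ y)) K := by
  refine ⟨fun y hy => hf.b _ (hm y hy), fun y hy z hz => (hf.h _ (hm y hy) _ (hm z hz)).trans ?_⟩
  rw [add_sub_add_left_eq_sub, ← map_sub]
  gcongr
  exact (τ.le_opNorm _).trans (mul_le_of_le_one_left (norm_nonneg _) (hq.trans hq1))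

variable [MeasurableSpace E] [BorelSpace E]

set_option maxHeartbeats 1000000 in
/-- A local Schauder estimate on small balls, with explicit dependence on the radius. -/
theorem interior_scaled {κ Λ ε : ℝ} (hκ : 0 < κ) (hκ1 : κ < 1) (hΛ : 1 ≤ Λ) (hε : 0 < ε) :
    ∃ s0 C : ℝ, 0 < s0 ∧ s0 ≤ 1 ∧ 0 ≤ C ∧
    ∀ (A : E → (E →L[ℝ] E →L[ℝ] ℝ) →L[ℝ] ℝ) (B : E → (E →L[ℝ] ℝ) →L[ℝ] ℝ) (f u : E → ℝ → ℝ)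
      (x0 : E) (s K H Kf M : ℝ), 0 < s → s ≤ s0 → Coef κ Λ (Metric.ball x0 s) A B →
      LC κ (Metric.ball x0 s) u M → IsSol (Metric.ball x0 s) A B f u →
      (∀ t, HB κ (Metric.ball x0 s) (fun x => f x t) Kf) →
      (∀ x ∈ Metric.ball x0 s, Continuous (f x)) →
      (∀ x ∈ Metric.ball x0 s, ∀ t ≤ 0, f x t = 0) → 0 ≤ H →
      (∀ x ∈ Metric.ball x0 s, ∀ t, |u x t| ≤ K) →
      (∀ x ∈ Metric.ball x0 s, ∀ y ∈ Metric.ball x0 s, ∀ t,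
        ‖D2 u x t - D2 u y t‖ ≤ H * ‖x - y‖ ^ κ) →
      ∀ x ∈ Metric.ball x0 (s / (16 * Λ ^ 2)), ∀ y ∈ Metric.ball x0 (s / (16 * Λ ^ 2)), ∀ t,
        ‖D2 u x t - D2 u y t‖ ≤ (ε * H + C * (K / s ^ 3 + Kf / s)) * ‖x - y‖ ^ κ := by
  have hΛ0 : 0 < Λ := by linarith
  obtain ⟨δ, C, hδ, hC, key⟩ := interior_core_interp (E := E) hκ hκ1
    (ε := ε / (4 * Λ ^ 2) ^ 3) (by positivity)
  obtain ⟨s0, hs0, hs1, hsδ⟩ := exists_small_rpow hκ (ε := δ / (4 * Λ ^ 3)) (r := 1 / Λ)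
    (by positivity) (by positivity)
  have h1Λ : 1 / Λ ≤ 1 := (div_le_one hΛ0).2 hΛ
  refine ⟨s0, C * (16 * Λ ^ 2) ^ 3, hs0, hs1.trans h1Λ, by positivity, ?_⟩
  intro A B f u x0 s K H Kf M hs hss hA hu hsol hf hfc hf0 hH0 hK hH
  have hsΛ : s ≤ 1 / Λ := hss.trans hs1
  have hs1' : s ≤ 1 := hsΛ.trans h1Λ
  have hsΛ' : Λ * s ≤ 1 := by rw [le_div_iff₀ hΛ0] at hsΛ; linarith
  have hsδ' : 4 * Λ ^ 3 * s ^ κ ≤ δ := by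
    have : s ^ κ ≤ δ / (4 * Λ ^ 3) := (Real.rpow_le_rpow hs.le hss hκ.le).trans hsδ
    rwa [le_div_iff₀ (by positivity), mul_comm] at this
  have hx0 : x0 ∈ Metric.ball x0 s := Metric.mem_ball_self hs
  have pK : 0 ≤ K := (abs_nonneg _).trans (hK x0 hx0 0)
  have pf : 0 ≤ Kf := (norm_nonneg _).trans ((hf 0).b x0 hx0)
  obtain ⟨σ, hσ, hσ', hσA⟩ := hA.exists_normalization hx0
  set c := s / (8 * Λ) with hc
  have hc0 : 0 < c := by positivity
  have hc1 : c ≤ 1 := by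
    rw [hc, div_le_one (by positivity)]; nlinarith
  have hcs : c * (8 * Λ) = s := by rw [hc]; field_simp
  have hc2 : c ^ 2 ≤ 1 := pow_le_one₀ hc0.le hc1
  set τ : E →L[ℝ] E := c • (σ : E →L[ℝ] E) with hτ
  set τi : E →L[ℝ] E := c⁻¹ • (σ.symm : E →L[ℝ] E) with hτi
  have hττi : ∀ v, τ (τi v) = v := fun v => by simp [hτ, hτi, hc0.ne']
  have hτn : ‖τ‖ ≤ s / 4 := by
    rw [hτ, norm_smul, Real.norm_of_nonneg hc0.le]
    calc c * ‖(σ : E →L[ℝ] E)‖ ≤ c * (2 * Λ) := by gcongr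
      _ = s / 4 := by linarith
  have hτin : ‖τi‖ ≤ 16 * Λ ^ 2 / s := by
    rw [hτi, norm_smul, norm_inv, Real.norm_of_nonneg hc0.le]
    calc c⁻¹ * ‖(σ.symm : E →L[ℝ] E)‖ ≤ c⁻¹ * (2 * Λ) := by gcongr
      _ = 16 * Λ ^ 2 / s := by rw [← hcs]; field_simp; ring
  have hτ1 : ‖τ‖ ≤ 1 := by linarith
  have hcτ : c ^ 2 * ‖τi‖ ^ 2 ≤ 4 * Λ ^ 2 := by
    have h : c * ‖τi‖ ≤ 2 * Λ := by
      rw [hτi, norm_smul, norm_inv, Real.norm_of_nonneg hc0.le, mul_inv_cancel_left₀ hc0.ne']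
      exact hσ'
    calc c ^ 2 * ‖τi‖ ^ 2 = (c * ‖τi‖) ^ 2 := by ring
      _ ≤ (2 * Λ) ^ 2 := by gcongr
      _ = 4 * Λ ^ 2 := by ring
  have hcτ1 : c ^ 2 * ‖τi‖ ≤ s / 4 := by
    have h : c * ‖τi‖ ≤ 2 * Λ := by
      rw [hτi, norm_smul, norm_inv, Real.norm_of_nonneg hc0.le, mul_inv_cancel_left₀ hc0.ne']
      exact hσ'
    calc c ^ 2 * ‖τi‖ = c * (c * ‖τi‖) := by ring
      _ ≤ c * (2 * Λ) := by gcongr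
      _ = s / 4 := by linarith
  have hm4 : ∀ y ∈ Metric.ball (0 : E) 4, x0 + τ y ∈ Metric.ball x0 s := fun y hy => by
    rw [mem_ball_zero_iff] at hy
    rw [mem_ball_iff_norm, add_sub_cancel_left]
    calc ‖τ y‖ ≤ ‖τ‖ * ‖y‖ := τ.le_opNorm y
      _ ≤ s / 4 * ‖y‖ := by gcongr
      _ < s / 4 * 4 := by gcongr
      _ = s := by ring
  have hm3 : ∀ y ∈ Metric.ball (0 : E) 3, x0 + τ y ∈ Metric.ball x0 s := fun y hy =>
    hm4 y (Metric.ball_subset_ball (by norm_num) hy)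
  set v : E → ℝ → ℝ := fun y t => u (x0 + τ y) (c ^ 2 * t) with hv
  have e := fun y (hy : y ∈ Metric.ball (0 : E) 4) t =>
    D2_affine (y := y) (t := t) τ (hu.c2At Metric.isOpen_ball (hm4 y hy) (c ^ 2 * t))
  have hvL : LC κ (Metric.ball 0 4) v M := hu.affine hκ.le hτ1 hm4 (by positivity) hc2
  set A' : E → (E →L[ℝ] E →L[ℝ] ℝ) →L[ℝ] ℝ := fun y => c ^ 2 • (A (x0 + τ y)).comp (pullL τi)
    with hA'
  set B' : E → (E →L[ℝ] ℝ) →L[ℝ] ℝ := fun y => c ^ 2 • (B (x0 + τ y)).comp (preL τi) with hB'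
  set f' : E → ℝ → ℝ := fun y t => c ^ 2 * f (x0 + τ y) (c ^ 2 * t) with hf'
  have hpp : ∀ T, pull (pull T τ) τi = T := fun T => by ext v w; simp [hττi]
  have hcp : ∀ T : E →L[ℝ] ℝ, (T.comp τ).comp τi = T := fun T => by ext v; simp [hττi]
  have hsol' : IsSol (Metric.ball 0 4) A' B' f' v := fun y hy t => by
    have h1 := (hsol _ (hm4 y hy) (c ^ 2 * t)).comp t ((hasDerivAt_id t).const_mul (c ^ 2))
    refine h1.congr_deriv ?_
    rw [(e y hy t).2.1, (e y hy t).2.2]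
    simp only [hA', hB', hf', smul_apply, ContinuousLinearMap.comp_apply, pullL_apply, preL_apply,
      hpp, hcp, smul_eq_mul]
    ring
  have hA0 : A' 0 = lapF E := by
    ext T
    simp only [hA', map_zero, add_zero, smul_apply, ContinuousLinearMap.comp_apply, pullL_apply,
      smul_eq_mul]
    rw [hσA, ← smul_eq_mul, ← map_smul]
    congr 1
    ext v w
    simp only [smul_apply, pull_apply, hτi, map_smul, smul_eq_mul,
      ContinuousLinearEquiv.coe_coe, ContinuousLinearEquiv.symm_apply_apply]
    field_simp
  have hτsub : ∀ y z : E, ‖(x0 + τ y) - (x0 + τ z)‖ ≤ s / 4 * ‖y - z‖ := fun y z => by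
    rw [add_sub_add_left_eq_sub, ← map_sub]
    exact (τ.le_opNorm _).trans (by gcongr)
  have hAd : ∀ y ∈ Metric.ball (0 : E) 3, ∀ z ∈ Metric.ball (0 : E) 3,
      ‖A' y - A' z‖ ≤ 4 * Λ ^ 3 * (s / 4 * ‖y - z‖) ^ κ := fun y hy z hz => by
    have hd : A' y - A' z = c ^ 2 • (A (x0 + τ y) - A (x0 + τ z)).comp (pullL τi) := by
      ext T
      simp only [hA', sub_apply, smul_apply, ContinuousLinearMap.comp_apply, smul_eq_mul]
      ring
    rw [hd, norm_smul, Real.norm_of_nonneg (by positivity)]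
    calc _ ≤ c ^ 2 * (‖A (x0 + τ y) - A (x0 + τ z)‖ * ‖pullL τi‖) := by
          gcongr; exact ContinuousLinearMap.opNorm_comp_le _ _
      _ ≤ c ^ 2 * ((Λ * (s / 4 * ‖y - z‖) ^ κ) * ‖τi‖ ^ 2) := by
          gcongr
          · exact (hA.hA _ (hm3 y hy) _ (hm3 z hz)).trans (by gcongr; exact hτsub y z)
          · exact norm_pullL_le τi
      _ = (c ^ 2 * ‖τi‖ ^ 2) * (Λ * (s / 4 * ‖y - z‖) ^ κ) := by ring
      _ ≤ 4 * Λ ^ 2 * (Λ * (s / 4 * ‖y - z‖) ^ κ) := by gcongr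
      _ = _ := by ring
  have hHA : HB κ (Metric.ball 0 3) (fun x => A' x - lapF E) δ := by
    refine ⟨fun y hy => ?_, fun y hy z hz => ?_⟩
    · rw [← hA0]
      refine (hAd y hy 0 (by simp)).trans (le_trans ?_ hsδ')
      rw [mem_ball_zero_iff] at hy
      rw [sub_zero]
      gcongr
      nlinarith
    · rw [sub_sub_sub_cancel_right]
      refine (hAd y hy z hz).trans ?_
      calc 4 * Λ ^ 3 * (s / 4 * ‖y - z‖) ^ κ ≤ 4 * Λ ^ 3 * (s * ‖y - z‖) ^ κ := by
            gcongr; linarith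
        _ = 4 * Λ ^ 3 * s ^ κ * ‖y - z‖ ^ κ := by
            rw [Real.mul_rpow hs.le (norm_nonneg _)]; ring
        _ ≤ _ := by gcongr
  have hHB : HB κ (Metric.ball 0 3) B' 1 := by
    have hb := HB.affine (q := 1) hκ.le (by linarith : 0 ≤ Λ) ⟨hA.bB, hA.hB⟩ hτ1 le_rfl hm3
    have hcb : ∀ T : (E →L[ℝ] ℝ) →L[ℝ] ℝ, ∀ r : ℝ, 0 ≤ r → ‖T‖ ≤ Λ * r →
        ‖c ^ 2 • T.comp (preL τi)‖ ≤ 1 * r := fun T r hr hT => by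
      rw [norm_smul, Real.norm_of_nonneg (by positivity)]
      calc _ ≤ c ^ 2 * (‖T‖ * ‖preL τi‖) := by
            gcongr; exact ContinuousLinearMap.opNorm_comp_le _ _
        _ ≤ c ^ 2 * ((Λ * r) * ‖τi‖) := by gcongr; exact norm_preL_le τi
        _ = (c ^ 2 * ‖τi‖) * Λ * r := by ring
        _ ≤ (s / 4) * Λ * r := by gcongr
        _ ≤ 1 * r := by gcongr; nlinarith
    refine ⟨fun y hy => ?_, fun y hy z hz => ?_⟩
    · simpa using hcb _ 1 zero_le_one (by simpa using hb.b y hy)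
    · simp only [hB']
      rw [← smul_sub, ← ContinuousLinearMap.sub_comp]
      exact hcb _ _ (by positivity) (hb.h y hy z hz)
  have hcs2 : c ^ 2 ≤ s ^ 2 := by
    have : c ≤ s := by nlinarith
    gcongr
  have hHf : ∀ t, HB κ (Metric.ball 0 3) (fun y => f' y t) (s ^ 2 * Kf) := fun t => by
    have hb := HB.affine (q := 1) hκ.le pf (hf (c ^ 2 * t)) hτ1 le_rfl hm3
    refine ⟨fun y hy => ?_, fun y hy z hz => ?_⟩
    · rw [hf', norm_mul, Real.norm_of_nonneg (by positivity)]
      gcongr; exact hb.b y hy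
    · rw [hf', ← mul_sub, norm_mul, Real.norm_of_nonneg (by positivity), mul_assoc]
      gcongr; exact hb.h y hy z hz
  have hHv : ∀ y ∈ Metric.ball (0 : E) 4, ∀ z ∈ Metric.ball (0 : E) 4, ∀ t,
      ‖D2 v y t - D2 v z t‖ ≤ (H * (s / 4) ^ 3 * (s / 4) ^ κ / (s / 4)) * ‖y - z‖ ^ κ :=
    fun y hy z hz t => by
      rw [hv, (e y hy t).2.2, (e z hz t).2.2, ← pullL_apply, ← pullL_apply, ← map_sub, pullL_apply]
      calc _ ≤ _ := norm_pull_le _ _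
        _ ≤ (H * ‖(x0 + τ y) - (x0 + τ z)‖ ^ κ) * (s / 4) ^ 2 := by
          gcongr; exact hH _ (hm4 y hy) _ (hm4 z hz) _
        _ ≤ (H * (s / 4 * ‖y - z‖) ^ κ) * (s / 4) ^ 2 := by gcongr; exact hτsub y z
        _ = _ := by
          rw [Real.mul_rpow (by positivity) (norm_nonneg _)]; field_simp
  have hfin := key A' B' f' v K _ _ M hvL hsol' hHA hHB hHf
    (fun y hy => continuous_const.mul ((hfc _ (hm3 y hy)).comp (continuous_const.mul continuous_id)))
    (fun y hy t ht => by
      change c ^ 2 * _ = 0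
      rw [hf0 _ (hm3 y hy) _ (mul_nonpos_of_nonneg_of_nonpos (by positivity) ht), mul_zero])
    (by positivity) (fun y hy t => hK _ (hm4 y hy) _) hHv
  set P := 16 * Λ ^ 2 / s with hP
  have hP1 : 1 ≤ P := by
    rw [hP, one_le_div hs]; nlinarith
  have hmi : ∀ x ∈ Metric.ball x0 (s / (16 * Λ ^ 2)), τi (x - x0) ∈ Metric.ball (0 : E) 1 :=
    fun x hx => by
      rw [mem_ball_iff_norm] at hx
      rw [mem_ball_zero_iff]
      calc _ ≤ ‖τi‖ * ‖x - x0‖ := τi.le_opNorm _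
        _ ≤ P * ‖x - x0‖ := by gcongr
        _ < P * (s / (16 * Λ ^ 2)) := by gcongr
        _ = 1 := by rw [hP]; field_simp
  have hD : ∀ x ∈ Metric.ball x0 (s / (16 * Λ ^ 2)), ∀ t,
      D2 u x t = pull (D2 v (τi (x - x0)) (t / c ^ 2)) τi := fun x hx t => by
    rw [hv, (e _ (Metric.ball_subset_ball (by norm_num) (hmi x hx)) _).2.2, hpp, hττi,
      mul_div_cancel₀ _ (by positivity)]
    simp
  intro x hx y hy t
  rw [hD x hx, hD y hy, ← pullL_apply, ← pullL_apply, ← map_sub, pullL_apply]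
  have hPκ : P ^ κ ≤ P := Real.rpow_le_self_of_one_le hP1 hκ1.le
  have hPs : P * (s / 4) = 4 * Λ ^ 2 := by rw [hP]; field_simp; ring
  have h4Λ : 1 ≤ 4 * Λ ^ 2 := by nlinarith
  calc _ ≤ _ := norm_pull_le _ _
    _ ≤ ((ε / (4 * Λ ^ 2) ^ 3 * (H * (s / 4) ^ 3 * (s / 4) ^ κ / (s / 4)) + C * (K + s ^ 2 * Kf)) *
        ‖τi (x - x0) - τi (y - x0)‖ ^ κ) * P ^ 2 := by
      gcongr; exact hfin _ (hmi x hx) _ (hmi y hy) _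
    _ ≤ ((ε / (4 * Λ ^ 2) ^ 3 * (H * (s / 4) ^ 3 * (s / 4) ^ κ / (s / 4)) + C * (K + s ^ 2 * Kf)) *
        (P * ‖x - y‖) ^ κ) * P ^ 2 := by
      gcongr
      rw [← map_sub, sub_sub_sub_cancel_right]
      exact (τi.le_opNorm _).trans (by gcongr)
    _ = (ε * H * ((P * (s / 4)) ^ 2 * (P * (s / 4)) ^ κ / (4 * Λ ^ 2) ^ 3) +
          C * (K + s ^ 2 * Kf) * (P ^ 2 * P ^ κ)) * ‖x - y‖ ^ κ := by
      rw [Real.mul_rpow (by positivity) (norm_nonneg _), Real.mul_rpow (by positivity)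
        (by positivity)]
      field_simp
    _ ≤ (ε * H * 1 + C * (K + s ^ 2 * Kf) * P ^ 3) * ‖x - y‖ ^ κ := by
      gcongr
      · rw [hPs, div_le_one (by positivity)]
        have := Real.rpow_le_self_of_one_le h4Λ hκ1.le
        calc _ ≤ (4 * Λ ^ 2) ^ 2 * (4 * Λ ^ 2) := by gcongr
          _ = _ := by ring
      · calc P ^ 2 * P ^ κ ≤ P ^ 2 * P := by gcongr
          _ = P ^ 3 := by ring
    _ = _ := by rw [hP]; field_simp

end ScalingTwo

section Interior

set_option linter.unusedSectionVars false
set_option maxSynthPendingDepth 3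

variable {E : Type*} [NormedAddCommGroup E] [InnerProductSpace ℝ E] [FiniteDimensional ℝ E]

lemma closedBall_subset_ball_of_mem {x0 z : E} {r ρ R : ℝ} (hz : z ∈ Metric.ball x0 r)
    (h : r + ρ ≤ R) : Metric.closedBall z ρ ⊆ Metric.ball x0 R := fun y hy => by
  have h1 := Metric.mem_ball.1 hz
  have h2 := Metric.mem_closedBall.1 hy
  have := dist_triangle y z x0
  exact Metric.mem_ball.2 (by linarith)

lemma abs_sub_le_of_hasDerivAt {f f' : ℝ → ℝ} {L : ℝ} (h : ∀ t, HasDerivAt f (f' t) t)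
    (hb : ∀ t, |f' t| ≤ L) (t t' : ℝ) : |f t - f t'| ≤ L * |t - t'| := by
  simpa using convex_univ.norm_image_sub_le_of_norm_hasDerivWithin_le
    (fun x _ => (h x).hasDerivWithinAt) (fun x _ => hb x) (mem_univ t') (mem_univ t)

variable [MeasurableSpace E] [BorelSpace E]

set_option maxHeartbeats 1000000 in
lemma interior_improve {κ Λ K1 : ℝ} (hκ : 0 < κ) (hκ1 : κ < 1) (hΛ : 1 ≤ Λ) (hK1 : 0 ≤ K1) :
    ∃ C : ℝ, 0 ≤ C ∧
    ∀ (A : E → (E →L[ℝ] E →L[ℝ] ℝ) →L[ℝ] ℝ) (B : E → (E →L[ℝ] ℝ) →L[ℝ] ℝ) (f u : E → ℝ → ℝ)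
      (x0 : E) (K M Φ : ℝ), Coef κ Λ (Metric.ball x0 1) A B →
      LC κ (Metric.ball x0 1) u M → IsSol (Metric.ball x0 1) A B f u →
      (∀ x ∈ Metric.ball x0 1, Continuous (f x)) →
      (∀ x ∈ Metric.ball x0 1, ∀ t ≤ 0, f x t = 0) →
      (∀ x ∈ Metric.ball x0 1, ∀ t, |u x t| ≤ K) →
      (∀ x ∈ Metric.ball x0 1, ∀ t, |f x t| ≤ K) →
      (∀ r, 0 < r → r < 1 → ∀ G, 0 ≤ G → (∀ x ∈ Metric.ball x0 r, ∀ t, ‖D1 u x t‖ ≤ G) →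
        ∀ x ∈ Metric.ball x0 r, ∀ y ∈ Metric.ball x0 r, ∀ t,
          |f x t - f y t| ≤ (K + K1 * G) * ‖x - y‖ ^ κ) → 0 ≤ Φ →
      (∀ r, 0 < r → r < 1 → ∀ x ∈ Metric.ball x0 r, ∀ y ∈ Metric.ball x0 r, ∀ t,
        ‖D2 u x t - D2 u y t‖ ≤ Φ / (1 - r) ^ 3 * ‖x - y‖ ^ κ) →
      (∀ r, 0 < r → r < 1 → ∀ x ∈ Metric.ball x0 r, ∀ y ∈ Metric.ball x0 r, ∀ t,
        ‖D2 u x t - D2 u y t‖ ≤ (Φ / 2 + C * K) / (1 - r) ^ 3 * ‖x - y‖ ^ κ) := by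
  have hΛ0 : 0 < Λ := by linarith
  obtain ⟨s0, C, hs0, hs01, hC, key⟩ := interior_scaled (E := E) (ε := 1 / 32) hκ hκ1 hΛ (by norm_num)
  set θ := 1 / (16 * Λ ^ 2) with hθ
  have hθ0 : 0 < θ := by positivity
  have hθ1 : θ ≤ 1 := by rw [hθ, div_le_one (by positivity)]; nlinarith
  set μ := s0 / 4 with hμ
  have hμ0 : 0 < μ := by positivity
  obtain ⟨ρ, hρ, hρ1, hρκ⟩ := exists_small_rpow hκ (ε := 1 / 64) (r := 1 / (32 * C * K1 + 1))
    (by norm_num) (by positivity)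
  have hρ1' : ρ * (32 * C * K1 + 1) ≤ 1 := by rwa [le_div_iff₀ (by positivity)] at hρ1
  have hρle : ρ ≤ 1 := by
    have : 0 ≤ ρ * (32 * C * K1) := by positivity
    linarith
  set ν := μ * θ * ρ with hν
  have hν0 : 0 < ν := by positivity
  have hνμ : ν ≤ μ := by
    rw [hν, mul_assoc]; exact mul_le_of_le_one_right hμ0.le (mul_le_one₀ hθ1 hρ.le hρle)
  have hμ4 : μ ≤ 1 / 4 := by rw [hμ]; linarith
  have hν4 : ν ≤ 1 / 4 := hνμ.trans hμ4
  refine ⟨C / μ ^ 3 + C / μ + C * K1 / (μ * ν) + 8 / (ν ^ 2 * (μ * θ)), by positivity, ?_⟩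
  intro A B f u x0 K M Φ hA hu hsol hfc hf0 huK hfK hfH hΦ hP r hr hr1 x hx y hy t
  have hx1 : x ∈ Metric.ball x0 1 := Metric.ball_subset_ball hr1.le hx
  have pK : 0 ≤ K := (abs_nonneg _).trans (huK x hx1 0)
  set g := 1 - r with hg
  have hg0 : 0 < g := by linarith
  have hg1 : g ≤ 1 := by linarith
  set H := 8 * (Φ / g ^ 3) with hH
  have hH0 : 0 ≤ H := by positivity
  have hPH : ∀ x ∈ Metric.ball x0 (r + g / 2), ∀ y ∈ Metric.ball x0 (r + g / 2), ∀ t,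
      ‖D2 u x t - D2 u y t‖ ≤ H * ‖x - y‖ ^ κ := fun x hx y hy t => by
    refine (hP (r + g / 2) (by linarith) (by linarith) x hx y hy t).trans_eq ?_
    rw [show 1 - (r + g / 2) = g / 2 by rw [hg]; ring, hH]
    field_simp; ring
  have hsub2 : Metric.ball x0 (r + g / 2) ⊆ Metric.ball x0 1 := Metric.ball_subset_ball (by linarith)
  have hsub4 : Metric.ball x0 (r + g / 4) ⊆ Metric.ball x0 1 := Metric.ball_subset_ball (by linarith)
  have hν' : ν * g ≤ g / 4 := by nlinarith
  have hcb : ∀ z ∈ Metric.ball x0 (r + g / 4), Metric.closedBall z (ν * g) ⊆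
      Metric.ball x0 (r + g / 2) := fun z hz =>
    closedBall_subset_ball_of_mem hz (by linarith)
  have hitg : ∀ z ∈ Metric.ball x0 (r + g / 4), ∀ t, ‖D1 u z t‖ ≤ K / (ν * g) + H * (ν * g) ^ κ *
      (ν * g) ∧ ‖D2 u z t‖ ≤ 4 * K / (ν * g) ^ 2 + 2 * (H * (ν * g) ^ κ) := fun z hz t =>
    hu.interp hκ.le (by positivity) ((hcb z hz).trans hsub2) hH0
      (fun y hy => huK y (hsub2 (hcb z hz hy)) t)
      fun y hy w hw => hPH y (hcb z hz hy) w (hcb z hz hw) t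
  set G := K / (ν * g) + H * ν * g with hG
  have hνκ : (ν * g) ^ κ ≤ 1 := Real.rpow_le_one (by positivity) (by nlinarith) hκ.le
  have hG0 : 0 ≤ G := by positivity
  have hd1 : ∀ z ∈ Metric.ball x0 (r + g / 4), ∀ t, ‖D1 u z t‖ ≤ G := fun z hz t => by
    refine (hitg z hz t).1.trans ?_
    rw [hG]
    gcongr K / (ν * g) + ?_
    calc H * (ν * g) ^ κ * (ν * g) ≤ H * 1 * (ν * g) := by gcongr
      _ = H * ν * g := by ring
  have hs : 0 < μ * g := by positivity
  have hxsub : Metric.ball x (μ * g) ⊆ Metric.ball x0 (r + g / 4) :=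
    Metric.ball_subset_closedBall.trans (closedBall_subset_ball_of_mem hx (by nlinarith))
  have hf' := hfH (r + g / 4) (by linarith) (by linarith) G hG0 hd1
  have hg3 : g ^ 3 ≤ g := by
    have := pow_le_one₀ (n := 2) hg0.le hg1
    nlinarith
  have hg32 : g ^ 3 ≤ g ^ 2 := by nlinarith [sq_nonneg g]
  by_cases hxy : ‖x - y‖ < μ * g / (16 * Λ ^ 2)
  · have h := key A B f u x (μ * g) K H (K + K1 * G) M hs (by rw [hμ]; nlinarith)
      ⟨hA.one, fun z hz => hA.bA z (hsub4 (hxsub hz)),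
        fun z hz w hw => hA.hA z (hsub4 (hxsub hz)) w (hsub4 (hxsub hw)),
        fun z hz => hA.bB z (hsub4 (hxsub hz)),
        fun z hz w hw => hA.hB z (hsub4 (hxsub hz)) w (hsub4 (hxsub hw)),
        fun z hz => hA.symm z (hsub4 (hxsub hz)), fun z hz => hA.ell z (hsub4 (hxsub hz))⟩
      (hu.mono (hxsub.trans hsub4) le_rfl) (fun z hz => hsol z (hsub4 (hxsub hz)))
      (fun t => ⟨fun z hz => (hfK z (hsub4 (hxsub hz)) t).trans
        (le_add_of_nonneg_right (by positivity)),
        fun z hz w hw => hf' z (hxsub hz) w (hxsub hw) t⟩)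
      (fun z hz => hfc z (hsub4 (hxsub hz))) (fun z hz => hf0 z (hsub4 (hxsub hz))) hH0
      (fun z hz => huK z (hsub4 (hxsub hz)))
      (fun z hz w hw => hPH z (Metric.ball_subset_ball (by linarith) (hxsub hz)) w
        (Metric.ball_subset_ball (by linarith) (hxsub hw)))
      x (Metric.mem_ball_self (by positivity)) y (by rwa [mem_ball_iff_norm']) t
    refine h.trans ?_
    gcongr
    have e1 : (K + K1 * G) / (μ * g) = K / μ / g + K1 / (μ * ν) * (K / g ^ 2) +
        K1 * ν / μ * H := by
      rw [hG]; field_simp; ring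
    have e2 : K / μ / g ≤ K / μ / g ^ 3 := by gcongr
    have e3 : K1 / (μ * ν) * (K / g ^ 2) ≤ K1 / (μ * ν) * (K / g ^ 3) := by gcongr
    have e4 : C * (K1 * ν / μ) * 32 ≤ 1 := by
      have : C * (K1 * ν / μ) * 32 = θ * (ρ * (32 * C * K1)) := by rw [hν]; field_simp
      rw [this]
      have h0 : 0 ≤ ρ * (32 * C * K1) := by positivity
      nlinarith
    have e5 : C * (K1 * ν / μ * H) ≤ H / 32 := by nlinarith
    have e6 : C * (K / (μ * g) ^ 3) = C / μ ^ 3 * K / g ^ 3 := by rw [mul_pow]; field_simp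
    have e7 : C * ((K + K1 * G) / (μ * g)) ≤ C * (K / μ / g ^ 3 + K1 / (μ * ν) * (K / g ^ 3)) +
        H / 32 := by
      rw [e1, mul_add]
      gcongr
    have e8 : 0 ≤ 8 / (ν ^ 2 * (μ * θ)) * K / g ^ 3 := by positivity
    rw [mul_add, e6]
    have e9 : (Φ / 2 + (C / μ ^ 3 + C / μ + C * K1 / (μ * ν) + 8 / (ν ^ 2 * (μ * θ))) * K) / g ^ 3 =
        2 * (H / 32) + (C / μ ^ 3 * K / g ^ 3 + C * (K / μ / g ^ 3 + K1 / (μ * ν) * (K / g ^ 3)) +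
        8 / (ν ^ 2 * (μ * θ)) * K / g ^ 3) := by
      rw [hH]; field_simp; ring
    rw [e9]
    linarith
  · have hxy' : μ * θ * g ≤ ‖x - y‖ := by
      rw [not_lt] at hxy
      refine le_trans (le_of_eq ?_) hxy
      rw [hθ]; field_simp
    have hx4 : x ∈ Metric.ball x0 (r + g / 4) := Metric.ball_subset_ball (by linarith) hx
    have hy4 : y ∈ Metric.ball x0 (r + g / 4) := Metric.ball_subset_ball (by linarith) hy
    have h := (norm_sub_le (D2 u x t) (D2 u y t)).trans
      (add_le_add (hitg x hx4 t).2 (hitg y hy4 t).2)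
    have hm : μ * θ * g ≤ 1 := by
      have : μ * θ ≤ 1 * 1 := by gcongr; linarith
      nlinarith
    have hm0 : 0 < μ * θ * g := by positivity
    set X := (μ * θ * g) ^ κ with hX
    have hX0 : 0 < X := by positivity
    have k1 : μ * θ * g ≤ X := Real.self_le_rpow_of_le_one hm0.le hm hκ1.le
    have k2 : (ν * g) ^ κ ≤ X * (1 / 64) := by
      rw [show ν * g = μ * θ * g * ρ by rw [hν]; ring, Real.mul_rpow hm0.le hρ.le]
      gcongr
    have k3 : X ≤ ‖x - y‖ ^ κ := by rw [hX]; gcongr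
    have k4 : 4 * K / (ν * g) ^ 2 ≤ 4 * K / (ν * g) ^ 2 / (μ * θ * g) * X := by
      rw [div_mul_eq_mul_div, le_div_iff₀ hm0]
      gcongr
    have k5 : 2 * (H * (ν * g) ^ κ) ≤ H / 32 * X := by
      calc _ ≤ 2 * (H * (X * (1 / 64))) := by gcongr
        _ = _ := by ring
    have k6 : (Φ / 2 + 8 / (ν ^ 2 * (μ * θ)) * K) / g ^ 3 =
        2 * (4 * K / (ν * g) ^ 2 / (μ * θ * g) + H / 32) := by
      rw [hH]; field_simp; ring
    have k7 : (Φ / 2 + 8 / (ν ^ 2 * (μ * θ)) * K) / g ^ 3 ≤ (Φ / 2 + (C / μ ^ 3 + C / μ +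
        C * K1 / (μ * ν) + 8 / (ν ^ 2 * (μ * θ))) * K) / g ^ 3 := by
      gcongr
      have : 0 ≤ C / μ ^ 3 + C / μ + C * K1 / (μ * ν) := by positivity
      linarith
    calc _ ≤ _ := h
      _ ≤ (Φ / 2 + 8 / (ν ^ 2 * (μ * θ)) * K) / g ^ 3 * X := by rw [k6]; linarith
      _ ≤ _ := by gcongr

end Interior

section InteriorTwo

set_option linter.unusedSectionVars false
set_option maxSynthPendingDepth 3

variable {E : Type*} [NormedAddCommGroup E] [InnerProductSpace ℝ E] [FiniteDimensional ℝ E]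
  [MeasurableSpace E] [BorelSpace E]

/-- The interior Schauder estimate; the Hölder norm of the right-hand side may be controlled by
the gradient of the solution. -/
theorem interior_estimate {κ Λ K1 : ℝ} (hκ : 0 < κ) (hκ1 : κ < 1) (hΛ : 1 ≤ Λ) (hK1 : 0 ≤ K1) :
    ∃ C : ℝ, 1 ≤ C ∧
    ∀ (A : E → (E →L[ℝ] E →L[ℝ] ℝ) →L[ℝ] ℝ) (B : E → (E →L[ℝ] ℝ) →L[ℝ] ℝ) (f u : E → ℝ → ℝ)
      (x0 : E) (K M : ℝ), Coef κ Λ (Metric.ball x0 1) A B →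
      LC κ (Metric.ball x0 1) u M → IsSol (Metric.ball x0 1) A B f u →
      (∀ x ∈ Metric.ball x0 1, Continuous (f x)) →
      (∀ x ∈ Metric.ball x0 1, ∀ t ≤ 0, f x t = 0) →
      (∀ x ∈ Metric.ball x0 1, ∀ t, |u x t| ≤ K) →
      (∀ x ∈ Metric.ball x0 1, ∀ t, |f x t| ≤ K) →
      (∀ r, 0 < r → r < 1 → ∀ G, 0 ≤ G → (∀ x ∈ Metric.ball x0 r, ∀ t, ‖D1 u x t‖ ≤ G) →
        ∀ x ∈ Metric.ball x0 r, ∀ y ∈ Metric.ball x0 r, ∀ t,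
          |f x t - f y t| ≤ (K + K1 * G) * ‖x - y‖ ^ κ) →
      LC κ (Metric.ball x0 (1 / 2)) u (C * K) := by
  obtain ⟨C, hC, key⟩ := interior_improve (E := E) hκ hκ1 hΛ hK1
  refine ⟨Λ * (400 + 400 * C), by nlinarith, ?_⟩
  intro A B f u x0 K M hA hu hsol hfc hf0 huK hfK hfH
  have hx0 : x0 ∈ Metric.ball x0 1 := Metric.mem_ball_self one_pos
  have pK : 0 ≤ K := (abs_nonneg _).trans (huK x0 hx0 0)
  have pM : 0 ≤ M := hu.nonneg hx0
  have hit : ∀ k : ℕ, ∀ r, 0 < r → r < 1 → ∀ x ∈ Metric.ball x0 r, ∀ y ∈ Metric.ball x0 r, ∀ t,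
        ‖D2 u x t - D2 u y t‖ ≤ (2 * C * K + M / 2 ^ k) / (1 - r) ^ 3 * ‖x - y‖ ^ κ := by
    intro k
    induction k with
    | zero =>
      intro r hr hr1 x hx y hy t
      have hs : Metric.ball x0 r ⊆ Metric.ball x0 1 := Metric.ball_subset_ball hr1.le
      refine (hu.h2 x (hs hx) y (hs hy) t).trans ?_
      gcongr
      have h1 : 0 < (1 - r) ^ 3 := pow_pos (by linarith) 3
      have h2 : (1 - r) ^ 3 ≤ 1 := pow_le_one₀ (by linarith) (by linarith)
      rw [le_div_iff₀ h1, pow_zero, div_one]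
      have : 0 ≤ 2 * C * K := by positivity
      nlinarith
    | succ k ih =>
      have := key A B f u x0 K M _ hA hu hsol hfc hf0 huK hfK hfH (by positivity) ih
      rwa [show (2 * C * K + M / 2 ^ k) / 2 + C * K = 2 * C * K + M / 2 ^ (k + 1) by
        rw [pow_succ]; field_simp; ring] at this
  have hH : ∀ x ∈ Metric.ball x0 (3 / 4), ∀ y ∈ Metric.ball x0 (3 / 4), ∀ t,
      ‖D2 u x t - D2 u y t‖ ≤ 128 * C * K * ‖x - y‖ ^ κ := fun x hx y hy t => by
    have hl : Tendsto (fun k : ℕ => (2 * C * K + M / 2 ^ k) / (1 - 3 / 4) ^ 3 * ‖x - y‖ ^ κ) atTop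
        (𝓝 ((2 * C * K + 0) / (1 - 3 / 4) ^ 3 * ‖x - y‖ ^ κ)) := by
      refine ((tendsto_const_nhds.add ?_).div_const _).mul_const _
      exact tendsto_const_nhds.div_atTop (tendsto_pow_atTop_atTop_of_one_lt one_lt_two)
    have := ge_of_tendsto' hl fun k => hit k (3 / 4) (by norm_num) (by norm_num) x hx y hy t
    refine this.trans_eq ?_
    ring
  have hs34 : Metric.ball x0 (3 / 4) ⊆ Metric.ball x0 1 := Metric.ball_subset_ball (by norm_num)
  have hs12 : Metric.ball x0 (1 / 2) ⊆ Metric.ball x0 (3 / 4) := Metric.ball_subset_ball (by norm_num)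
  have hitg : ∀ z ∈ Metric.ball x0 (1 / 2), ∀ t, ‖D1 u z t‖ ≤ 5 * K + 128 * C * K ∧
      ‖D2 u z t‖ ≤ 100 * K + 256 * C * K := fun z hz t => by
    have hc : Metric.closedBall z (1 / 5) ⊆ Metric.ball x0 (3 / 4) :=
      closedBall_subset_ball_of_mem hz (by norm_num)
    obtain ⟨h1, h2⟩ := hu.interp hκ.le (t := t) (by norm_num : (0 : ℝ) < 1 / 5) (hc.trans hs34)
      (by positivity : 0 ≤ 128 * C * K) (fun y hy => huK y (hs34 (hc hy)) t)
      fun y hy w hw => hH y (hc hy) w (hc hw) t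
    have p : ((1 : ℝ) / 5) ^ κ ≤ 1 := Real.rpow_le_one (by norm_num) (by norm_num) hκ.le
    have p0 : 0 ≤ ((1 : ℝ) / 5) ^ κ := by positivity
    have q : 128 * C * K * ((1 : ℝ) / 5) ^ κ ≤ 128 * C * K :=
      mul_le_of_le_one_right (by positivity) p
    have q0 : 0 ≤ 128 * C * K * ((1 : ℝ) / 5) ^ κ := by positivity
    rw [show K / (1 / 5) = 5 * K by ring] at h1
    rw [show 4 * K / (1 / 5) ^ 2 = 100 * K by ring] at h2
    exact ⟨by linarith, by linarith⟩
  have hCK : 0 ≤ C * K := by positivity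
  have hbig : ∀ a b : ℝ, 0 ≤ a → 0 ≤ b → a ≤ 400 → b ≤ 400 →
      a * K + b * C * K ≤ Λ * (400 + 400 * C) * K := fun a b ha hb ha4 hb4 => by
    calc a * K + b * C * K ≤ 400 * K + 400 * C * K := by gcongr
      _ = 1 * (400 + 400 * C) * K := by ring
      _ ≤ _ := by gcongr
  have hs1 := hs12.trans hs34
  refine ⟨fun x hx => hu.d1 x (hs1 hx), fun x hx => hu.d2 x (hs1 hx), fun x hx t =>
    (huK x (hs1 hx) t).trans ?_, fun x hx t => (hitg x hx t).1.trans
    (hbig 5 128 (by norm_num) (by norm_num) (by norm_num) (by norm_num)), fun x hx t =>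
    (hitg x hx t).2.trans (hbig 100 256 (by norm_num) (by norm_num) (by norm_num) (by norm_num)),
    fun x hx y hy t => (hH x (hs12 hx) y (hs12 hy) t).trans ?_, fun x hx => ?_,
    fun x hx => hu.zero x (hs1 hx)⟩
  · simpa using hbig 1 0 (by norm_num) le_rfl (by norm_num) (by norm_num)
  · refine mul_le_mul_of_nonneg_right ?_ (by positivity)
    simpa using hbig 0 128 le_rfl (by norm_num) (by norm_num) (by norm_num)
  · refine abs_sub_le_of_hasDerivAt (hsol x (hs1 hx)) fun t => ?_
    have a1 : |A x (D2 u x t)| ≤ Λ * (100 * K + 256 * C * K) :=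
      ((A x).le_opNorm _).trans (by gcongr; exacts [hA.bA x (hs1 hx), (hitg x hx t).2])
    have a2 : |B x (D1 u x t)| ≤ Λ * (5 * K + 128 * C * K) :=
      ((B x).le_opNorm _).trans (by gcongr; exacts [hA.bB x (hs1 hx), (hitg x hx t).1])
    have a3 : |f x t| ≤ Λ * K := (hfK x (hs1 hx) t).trans (le_mul_of_one_le_left pK hΛ)
    have a4 := abs_add_three (A x (D2 u x t)) (B x (D1 u x t)) (f x t)
    have hΛ0 : 0 ≤ Λ := by linarith
    have b1 : 0 ≤ Λ * K := by positivity
    have b2 : 0 ≤ Λ * (C * K) := by positivity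
    linarith

end InteriorTwo

section Limits

set_option linter.unusedSectionVars false
set_option maxSynthPendingDepth 3

lemma hasFDerivAt_of_norm_le {E F : Type*} [NormedAddCommGroup E] [NormedSpace ℝ E]
    [NormedAddCommGroup F] [NormedSpace ℝ F] {f : E → F} {f' : E →L[ℝ] F} {x : E} {ω : E → ℝ}
    (hω : Tendsto ω (𝓝 0) (𝓝 0))
    (h : ∀ᶠ v in 𝓝 (0 : E), ‖f (x + v) - f x - f' v‖ ≤ ω v * ‖v‖) : HasFDerivAt f f' x := by
  rw [hasFDerivAt_iff_isLittleO_nhds_zero, Asymptotics.isLittleO_iff]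
  intro c hc
  filter_upwards [h, hω.eventually (gt_mem_nhds hc)] with v hv hv2
  exact hv.trans (by gcongr)

lemma tendsto_clm_apply {E F ι : Type*} [NormedAddCommGroup E] [NormedSpace ℝ E]
    [NormedAddCommGroup F] [NormedSpace ℝ F] {l : Filter ι} {T : ι → E →L[ℝ] F} {T' : E →L[ℝ] F}
    (h : Tendsto T l (𝓝 T')) (v : E) : Tendsto (fun k => T k v) l (𝓝 (T' v)) :=
  ((ContinuousLinearMap.apply ℝ F v).continuous.tendsto T').comp h

lemma Ultrafilter.exists_tendsto_of_norm_le {F ι : Type*} [NormedAddCommGroup F] [ProperSpace F]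
    (l : Ultrafilter ι) {f : ι → F} {M : ℝ} (h : ∀ᶠ k in l, ‖f k‖ ≤ M) :
    ∃ a, Tendsto f l (𝓝 a) := by
  have h1 : ↑(l.map f) ≤ 𝓟 (Metric.closedBall (0 : F) M) := by
    rw [le_principal_iff]
    change ∀ᶠ k in l, f k ∈ Metric.closedBall (0 : F) M
    filter_upwards [h] with k hk
    simpa using hk
  obtain ⟨a, -, ha⟩ := (isCompact_closedBall (0 : F) M).ultrafilter_le_nhds _ h1
  exact ⟨a, ha⟩

variable {E : Type*} [NormedAddCommGroup E] [InnerProductSpace ℝ E] [FiniteDimensional ℝ E]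

lemma LC.taylor {κ M : ℝ} {s : Set E} {u : E → ℝ → ℝ} (hu : LC κ s u M) (hκ : 0 < κ) {x : E}
    {ρ : ℝ} (hρ : 0 < ρ) (hs : Metric.ball x ρ ⊆ s) {v : E} (hv : ‖v‖ < ρ) (t : ℝ) :
    |u (x + v) t - u x t - D1 u x t v| ≤ (M * ‖v‖ ^ κ * ‖v‖ + M * ‖v‖) * ‖v‖ ∧
    ‖D1 u (x + v) t - D1 u x t - D2 u x t v‖ ≤ M * ‖v‖ ^ κ * ‖v‖ := by
  have hx := Metric.mem_ball_self (x := x) hρ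
  have hxv : x + v ∈ Metric.ball x ρ := by simpa using hv
  have hM : 0 ≤ M := hu.nonneg (hs hx)
  constructor
  · have h1 := taylor_second (convex_ball x ρ) hκ.le hM (fun y hy => hu.d1 y (hs hy) t)
      (fun y hy => hu.d2 y (hs hy) t) (fun y hy z hz => hu.h2 y (hs hy) z (hs hz) t) hx hxv
    have h2 : |D2 u x t v v| ≤ M * ‖v‖ * ‖v‖ :=
      ((D2 u x t).le_opNorm₂ v v).trans (by gcongr; exact hu.b2 x (hs hx) t)
    rw [abs_le] at h1 h2 ⊢
    have h3 : 0 ≤ M * ‖v‖ * ‖v‖ := by positivity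
    constructor <;> nlinarith
  · simpa using taylor_first (g := fun y => D1 u y t) (convex_ball x ρ) hκ.le hM
      (fun y hy => hu.d2 y (hs hy) t) (fun y hy z hz => hu.h2 y (hs hy) z (hs hz) t) hx hxv

/-- Locally bounded sequences in `LC` converge together with their derivatives. -/
theorem LC.of_tendsto {ι : Type*} (l : Ultrafilter ι) {κ M : ℝ} (hκ : 0 < κ) {s : Set E}
    (hs : IsOpen s) {U : ι → E → ℝ → ℝ} {u : E → ℝ → ℝ} (hU : ∀ᶠ k in l, LC κ s (U k) M)
    (hlim : ∀ x ∈ s, ∀ t, Tendsto (fun k => U k x t) l (𝓝 (u x t))) :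
    LC κ s u M ∧ ∀ x ∈ s, ∀ t, Tendsto (fun k => D1 (U k) x t) l (𝓝 (D1 u x t)) ∧
      Tendsto (fun k => D2 (U k) x t) l (𝓝 (D2 u x t)) := by
  have i1 : ProperSpace (E →L[ℝ] ℝ) := FiniteDimensional.proper_real _
  have i2 : ProperSpace (E →L[ℝ] E →L[ℝ] ℝ) := FiniteDimensional.proper_real _
  have e1 : ∀ x t, ∃ a, x ∈ s → Tendsto (fun k => D1 (U k) x t) l (𝓝 a) := fun x t => by
    by_cases hx : x ∈ s
    · obtain ⟨a, ha⟩ := l.exists_tendsto_of_norm_le (hU.mono fun k hk => hk.b1 x hx t)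
      exact ⟨a, fun _ => ha⟩
    · exact ⟨0, fun h => absurd h hx⟩
  have e2 : ∀ x t, ∃ a, x ∈ s → Tendsto (fun k => D2 (U k) x t) l (𝓝 a) := fun x t => by
    by_cases hx : x ∈ s
    · obtain ⟨a, ha⟩ := l.exists_tendsto_of_norm_le (hU.mono fun k hk => hk.b2 x hx t)
      exact ⟨a, fun _ => ha⟩
    · exact ⟨0, fun h => absurd h hx⟩
  choose w1 hw1 using e1
  choose w2 hw2 using e2
  have hpow : Tendsto (fun v : E => M * ‖v‖ ^ κ) (𝓝 0) (𝓝 0) := by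
    have : Continuous fun v : E => M * ‖v‖ ^ κ :=
      (continuous_norm.rpow_const fun _ => Or.inr hκ.le).const_mul _
    simpa [Real.zero_rpow hκ.ne'] using this.tendsto 0
  have hpow2 : Tendsto (fun v : E => M * ‖v‖ ^ κ * ‖v‖ + M * ‖v‖) (𝓝 0) (𝓝 0) := by
    have : Continuous fun v : E => M * ‖v‖ ^ κ * ‖v‖ + M * ‖v‖ :=
      ((((continuous_norm.rpow_const fun _ => Or.inr hκ.le).const_mul _).mul continuous_norm)).add
        (continuous_norm.const_mul _)
    simpa [Real.zero_rpow hκ.ne'] using this.tendsto 0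
  have d1 : ∀ x ∈ s, ∀ t, HasFDerivAt (fun y => u y t) (w1 x t) x := fun x hx t => by
    obtain ⟨ρ, hρ, hρs⟩ := Metric.isOpen_iff.1 hs x hx
    refine hasFDerivAt_of_norm_le hpow2 ?_
    filter_upwards [Metric.ball_mem_nhds (0 : E) hρ] with v hv
    have hv' : ‖v‖ < ρ := by simpa using hv
    have hxv : x + v ∈ s := hρs (by simpa using hv')
    refine le_of_tendsto (x := (l : Filter ι))
      (((hlim _ hxv t).sub (hlim x hx t)).sub (tendsto_clm_apply (hw1 x t hx) v)).norm ?_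
    filter_upwards [hU] with k hk using (hk.taylor hκ hρ hρs hv' t).1
  have d2 : ∀ x ∈ s, ∀ t, HasFDerivAt (fun y => w1 y t) (w2 x t) x := fun x hx t => by
    obtain ⟨ρ, hρ, hρs⟩ := Metric.isOpen_iff.1 hs x hx
    refine hasFDerivAt_of_norm_le hpow ?_
    filter_upwards [Metric.ball_mem_nhds (0 : E) hρ] with v hv
    have hv' : ‖v‖ < ρ := by simpa using hv
    have hxv : x + v ∈ s := hρs (by simpa using hv')
    refine le_of_tendsto (x := (l : Filter ι))
      (((hw1 _ t hxv).sub (hw1 x t hx)).sub (tendsto_clm_apply (hw2 x t hx) v)).norm ?_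
    filter_upwards [hU] with k hk using (hk.taylor hκ hρ hρs hv' t).2
  have h := fun x hx t => D2_congr (u := u) (x := x) (t := t)
    (by filter_upwards [hs.mem_nhds hx] with y hy using d1 y hy t) (d2 x hx t)
  have q1 : ∀ x ∈ s, ∀ t, Tendsto (fun k => D1 (U k) x t) l (𝓝 (D1 u x t)) := fun x hx t => by
    rw [(h x hx t).2.1]; exact hw1 x t hx
  have q2 : ∀ x ∈ s, ∀ t, Tendsto (fun k => D2 (U k) x t) l (𝓝 (D2 u x t)) := fun x hx t => by
    rw [(h x hx t).2.2]; exact hw2 x t hx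
  refine ⟨⟨fun x hx t => (h x hx t).1.d1.self_of_nhds, fun x hx t => (h x hx t).1.d2,
    fun x hx t => le_of_tendsto (hlim x hx t).abs (hU.mono fun k hk => hk.b0 x hx t),
    fun x hx t => le_of_tendsto (q1 x hx t).norm (hU.mono fun k hk => hk.b1 x hx t),
    fun x hx t => le_of_tendsto (q2 x hx t).norm (hU.mono fun k hk => hk.b2 x hx t),
    fun x hx y hy t => le_of_tendsto ((q2 x hx t).sub (q2 y hy t)).norm
      (hU.mono fun k hk => hk.h2 x hx y hy t),
    fun x hx t t' => le_of_tendsto ((hlim x hx t).sub (hlim x hx t')).abs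
      (hU.mono fun k hk => hk.lip x hx t t'),
    fun x hx t ht => tendsto_nhds_unique_of_eventuallyEq (hlim x hx t) tendsto_const_nhds
      (hU.mono fun k hk => hk.zero x hx t ht)⟩, fun x hx t => ⟨q1 x hx t, q2 x hx t⟩⟩

/-- Pointwise limits of differentiable functions with equicontinuous derivatives. -/
lemma hasDerivAt_of_tendsto_of_equicontinuous {ι : Type*} (l : Filter ι) [l.NeBot]
    {φ g : ι → ℝ → ℝ} {φ' g' : ℝ → ℝ} (hφ : ∀ᶠ k in l, ∀ t, HasDerivAt (φ k) (g k t) t)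
    (h1 : ∀ t, Tendsto (fun k => φ k t) l (𝓝 (φ' t)))
    {t : ℝ} (h2 : Tendsto (fun k => g k t) l (𝓝 (g' t)))
    (hg : ∀ ε > 0, ∃ δ > 0, ∀ᶠ k in l, ∀ t', |t - t'| < δ → |g k t - g k t'| ≤ ε) :
    HasDerivAt φ' (g' t) t := by
  rw [hasDerivAt_iff_isLittleO_nhds_zero, Asymptotics.isLittleO_iff]
  intro c hc
  obtain ⟨δ, hδ, hd⟩ := hg c hc
  filter_upwards [Metric.ball_mem_nhds (0 : ℝ) hδ] with h hh
  have hh' : |h| < δ := by simpa using hh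
  refine le_of_tendsto (x := l) (((h1 (t + h)).sub (h1 t)).sub (h2.const_mul h)).norm ?_
  filter_upwards [hφ, hd] with k hk hkd
  have := (convex_ball t δ).norm_image_sub_le_of_norm_hasDerivWithin_le
    (f := fun r => φ k r - r * g k t) (f' := fun r => g k r - 1 * g k t) (C := c) (x := t)
    (y := t + h) (fun r _ => ((hk r).sub ((hasDerivAt_id r).mul_const _)).hasDerivWithinAt)
    (fun r hr => by
      rw [one_mul, norm_sub_rev]
      exact hkd r (by rw [abs_sub_comm]; simpa [Real.dist_eq] using hr))
    (Metric.mem_ball_self hδ) (by simpa using hh')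
  refine (le_of_eq ?_).trans (this.trans_eq ?_)
  · congr 1; ring
  · simp

end Limits

section Apriori

set_option linter.unusedSectionVars false
set_option maxSynthPendingDepth 3

variable {E : Type*} [NormedAddCommGroup E] [InnerProductSpace ℝ E] [FiniteDimensional ℝ E]
  {κ M N Λ : ℝ} {s : Set E} {u : E → ℝ → ℝ}

lemma HB.of_lipschitz {F : Type*} [NormedAddCommGroup F] [NormedSpace ℝ F] {f : E → F}
    (hκ0 : 0 ≤ κ) (hκ1 : κ ≤ 1) (hb : ∀ x ∈ s, ‖f x‖ ≤ M) (hN : 0 ≤ N)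
    (hl : ∀ x ∈ s, ∀ y ∈ s, ‖f x - f y‖ ≤ N * ‖x - y‖) : HB κ s f (2 * M + N) := by
  refine ⟨fun x hx => ?_, fun x hx y hy => ?_⟩
  · have h1 := hb x hx
    have := norm_nonneg (f x)
    linarith
  · have hM : 0 ≤ M := (norm_nonneg _).trans (hb x hx)
    have hp : 0 ≤ ‖x - y‖ ^ κ := by positivity
    rcases le_total ‖x - y‖ 1 with h | h
    · have h1 := Real.self_le_rpow_of_le_one (norm_nonneg (x - y)) h hκ1
      have h2 := mul_le_mul_of_nonneg_left h1 hN
      have h3 := hl x hx y hy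
      have h4 : 0 ≤ M * ‖x - y‖ ^ κ := by positivity
      linarith
    · have h1 := Real.one_le_rpow h hκ0
      have h3 := (norm_sub_le (f x) (f y)).trans (add_le_add (hb x hx) (hb y hy))
      have h4 := mul_le_mul_of_nonneg_left h1 hM
      have h5 : 0 ≤ N * ‖x - y‖ ^ κ := by positivity
      linarith

lemma LC.lipschitz (h : LC κ s u M) (hs : Convex ℝ s) {x y : E} (hx : x ∈ s) (hy : y ∈ s) (t : ℝ) :
    |u x t - u y t| ≤ M * ‖x - y‖ ∧ ‖D1 u x t - D1 u y t‖ ≤ M * ‖x - y‖ :=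
  ⟨hs.norm_image_sub_le_of_norm_hasFDerivWithin_le (f := fun y => u y t)
    (fun z hz => (h.d1 z hz t).hasFDerivWithinAt) (fun z hz => h.b1 z hz t) hy hx,
  hs.norm_image_sub_le_of_norm_hasFDerivWithin_le (f := fun y => D1 u y t)
    (fun z hz => (h.d2 z hz t).hasFDerivWithinAt) (fun z hz => h.b2 z hz t) hy hx⟩

lemma LC.hb (h : LC κ s u M) (hκ0 : 0 ≤ κ) (hκ1 : κ ≤ 1) (hs : Convex ℝ s) (t : ℝ) :
    HB κ s (fun x => u x t) (3 * M) ∧ HB κ s (fun x => D1 u x t) (3 * M) ∧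
      HB κ s (fun x => D2 u x t) M := by
  rcases s.eq_empty_or_nonempty with rfl | ⟨z, hz⟩
  · exact ⟨⟨by simp, by simp⟩, ⟨by simp, by simp⟩, ⟨by simp, by simp⟩⟩
  have hM := h.nonneg hz
  have e : 2 * M + M = 3 * M := by ring
  refine ⟨e ▸ HB.of_lipschitz hκ0 hκ1 (fun x hx => h.b0 x hx t) hM fun x hx y hy =>
    (h.lipschitz hs hx hy t).1, e ▸ HB.of_lipschitz hκ0 hκ1 (fun x hx => h.b1 x hx t) hM
    fun x hx y hy => (h.lipschitz hs hx hy t).2, fun x hx => h.b2 x hx t,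
    fun x hx y hy => h.h2 x hx y hy t⟩

lemma LC.of_balls (hκ0 : 0 ≤ κ) (hκ1 : κ ≤ 1)
    (h : ∀ x0, LC κ (Metric.ball x0 (1 / 2)) u M) : LC κ univ u (4 * M) := by
  have hm : ∀ x : E, x ∈ Metric.ball x (1 / 2) := fun x => Metric.mem_ball_self (by norm_num)
  have hM : 0 ≤ M := (h 0).nonneg (hm 0)
  have h4 : M ≤ 4 * M := by linarith
  refine ⟨fun x _ => (h x).d1 x (hm x), fun x _ => (h x).d2 x (hm x),
    fun x _ t => ((h x).b0 x (hm x) t).trans h4, fun x _ t => ((h x).b1 x (hm x) t).trans h4,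
    fun x _ t => ((h x).b2 x (hm x) t).trans h4, fun x _ y _ t => ?_,
    fun x _ t t' => ((h x).lip x (hm x) t t').trans (by gcongr), fun x _ => (h x).zero x (hm x)⟩
  rcases lt_or_ge ‖x - y‖ (1 / 2) with hd | hd
  · have hy : y ∈ Metric.ball x (1 / 2) := by rwa [Metric.mem_ball, dist_comm, dist_eq_norm]
    exact ((h x).h2 x (hm x) y hy t).trans (by gcongr)
  · have h1 := (norm_sub_le (D2 u x t) (D2 u y t)).trans
      (add_le_add ((h x).b2 x (hm x) t) ((h y).b2 y (hm y) t))
    have h2 : (1 : ℝ) / 2 ≤ ‖x - y‖ ^ κ := by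
      calc (1 : ℝ) / 2 ≤ (1 / 2) ^ κ := Real.self_le_rpow_of_le_one (by norm_num) (by norm_num) hκ1
        _ ≤ _ := by gcongr
    nlinarith

variable [MeasurableSpace E] [BorelSpace E]

/-- The global Schauder estimate. -/
theorem global_estimate (hκ : 0 < κ) (hκ1 : κ < 1) (hΛ : 1 ≤ Λ) : ∃ C : ℝ, 1 ≤ C ∧
    ∀ (A : E → (E →L[ℝ] E →L[ℝ] ℝ) →L[ℝ] ℝ) (B : E → (E →L[ℝ] ℝ) →L[ℝ] ℝ) (f u : E → ℝ → ℝ)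
      (l M N : ℝ), Coef κ Λ univ A B → 1 ≤ l → l ≤ Λ → XC κ f M → LC κ univ u N →
      IsSol univ A B (fun x t => f x t - l * u x t) u → LC κ univ u (C * M) := by
  obtain ⟨C, hC, key⟩ := interior_estimate (E := E) (K1 := 2 * Λ) hκ hκ1 hΛ (by linarith)
  refine ⟨4 * (C * (1 + Λ)), by nlinarith, ?_⟩
  intro A B f u l M N hA hl hlΛ hf hu hsol
  have hub := hsol.abs_le_bound hA hl hu hf.bdd
  have hM : 0 ≤ M := (abs_nonneg _).trans (hf.bdd 0 0)
  have hmono : M ≤ (1 + Λ) * M := by nlinarith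
  have := LC.of_balls (κ := κ) (u := u) (M := C * ((1 + Λ) * M)) hκ.le hκ1.le fun x0 => by
    refine key A B (fun x t => f x t - l * u x t) u x0 ((1 + Λ) * M) N
      ⟨hA.one, fun x _ => hA.bA x trivial, fun x _ y _ => hA.hA x trivial y trivial,
        fun x _ => hA.bB x trivial, fun x _ y _ => hA.hB x trivial y trivial,
        fun x _ => hA.symm x trivial, fun x _ => hA.ell x trivial⟩
      (hu.mono (subset_univ _) le_rfl) (fun x _ => hsol x trivial) (fun x _ => ?_)
      (fun x _ t ht => ?_) (fun x _ t => (hub x t).trans hmono) (fun x _ t => ?_)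
      fun r hr hr1 G hG hD x hx y hy t => ?_
    · exact (hf.cont x).sub ((continuous_iff_continuousAt.2 fun t =>
        (hsol x trivial t).continuousAt).const_mul l)
    · rw [hf.zero x t ht, hu.zero x trivial t ht]; ring
    · refine (abs_sub _ _).trans ?_
      rw [abs_mul, abs_of_nonneg (by linarith : 0 ≤ l), add_mul, one_mul]
      exact add_le_add (hf.bdd x t) (by gcongr; exact hub x t)
    · have h1 : |u x t - u y t| ≤ G * ‖x - y‖ :=
        (convex_ball x0 r).norm_image_sub_le_of_norm_hasFDerivWithin_le (f := fun y => u y t)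
          (fun z _ => (hu.d1 z trivial t).hasFDerivWithinAt) (fun z hz => hD z hz t) hy hx
      have h2 : ‖x - y‖ ≤ 2 * ‖x - y‖ ^ κ := by
        refine le_mul_rpow_of_le hκ.le hκ1.le (norm_nonneg _) one_le_two ?_
        have a1 := Metric.mem_ball.1 hx
        have a2 := Metric.mem_ball.1 hy
        have := dist_triangle_right x y x0
        rw [← dist_eq_norm]; linarith
      have h3 := hf.hol x y t
      have hp : 0 ≤ ‖x - y‖ ^ κ := by positivity
      have h4 : |l * (u x t - u y t)| ≤ Λ * (G * (2 * ‖x - y‖ ^ κ)) := by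
        rw [abs_mul, abs_of_nonneg (by linarith : 0 ≤ l)]
        exact mul_le_mul hlΛ (h1.trans (by gcongr)) (abs_nonneg _) (by linarith)
      calc |f x t - l * u x t - (f y t - l * u y t)|
          = |(f x t - f y t) - l * (u x t - u y t)| := by congr 1; ring
        _ ≤ M * ‖x - y‖ ^ κ + Λ * (G * (2 * ‖x - y‖ ^ κ)) := (abs_sub _ _).trans (add_le_add h3 h4)
        _ ≤ (1 + Λ) * M * ‖x - y‖ ^ κ + Λ * (G * (2 * ‖x - y‖ ^ κ)) := by gcongr
        _ = _ := by ring
  exact this.mono le_rfl (by linarith)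

end Apriori

section Equicontinuity

set_option linter.unusedSectionVars false
set_option maxSynthPendingDepth 3

variable {ι F G : Type*} [NormedAddCommGroup F] [NormedSpace ℝ F] [NormedAddCommGroup G]
  [NormedSpace ℝ G] {l : Filter ι} {t : ℝ}

/-- Equicontinuity at `t`, eventually along `l`. -/
def EqcAt (l : Filter ι) (g : ι → ℝ → F) (t : ℝ) : Prop :=
  ∀ ε > 0, ∃ δ > 0, ∀ᶠ k in l, ∀ t', |t - t'| < δ → ‖g k t - g k t'‖ ≤ ε

lemma EqcAt.add {g h : ι → ℝ → F} (hg : EqcAt l g t) (hh : EqcAt l h t) :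
    EqcAt l (fun k t => g k t + h k t) t := fun ε hε => by
  obtain ⟨δ, hδ, h1⟩ := hg (ε / 2) (half_pos hε)
  obtain ⟨δ', hδ', h2⟩ := hh (ε / 2) (half_pos hε)
  refine ⟨min δ δ', lt_min hδ hδ', ?_⟩
  filter_upwards [h1, h2] with k k1 k2 t' ht'
  rw [lt_min_iff] at ht'
  rw [add_sub_add_comm]
  have := norm_add_le (g k t - g k t') (h k t - h k t')
  have := k1 t' ht'.1
  have := k2 t' ht'.2
  linarith

lemma EqcAt.of_le {g : ι → ℝ → F} {h : ι → ℝ → G} (hh : EqcAt l h t) {L : ℝ}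
    (hle : ∀ᶠ k in l, ∀ t', ‖g k t - g k t'‖ ≤ L * ‖h k t - h k t'‖) : EqcAt l g t := fun ε hε => by
  obtain ⟨δ, hδ, h1⟩ := hh (ε / (|L| + 1)) (by positivity)
  refine ⟨δ, hδ, ?_⟩
  filter_upwards [h1, hle] with k k1 k2 t' ht'
  have h3 := k1 t' ht'
  rw [le_div_iff₀ (by positivity)] at h3
  have h4 := k2 t'
  have h5 := mul_le_mul_of_nonneg_right (le_abs_self L) (norm_nonneg (h k t - h k t'))
  have h6 := norm_nonneg (h k t - h k t')
  linarith

lemma EqcAt.clm (T : F →L[ℝ] G) {g : ι → ℝ → F} (hg : EqcAt l g t) :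
    EqcAt l (fun k t => T (g k t)) t :=
  hg.of_le (L := ‖T‖) (Eventually.of_forall fun k t' => by
    rw [← map_sub]; exact T.le_opNorm _)

lemma EqcAt.const {g : ℝ → F} (hg : Continuous g) : EqcAt l (fun _ => g) t := fun ε hε => by
  obtain ⟨δ, hδ, h⟩ := Metric.continuous_iff.1 hg t ε hε
  refine ⟨δ, hδ, Eventually.of_forall fun _ t' ht' => ?_⟩
  have := h t' (by rwa [Real.dist_eq, abs_sub_comm])
  rw [dist_comm, dist_eq_norm] at this
  exact this.le

variable {E : Type*} [NormedAddCommGroup E] [InnerProductSpace ℝ E] [FiniteDimensional ℝ E]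

lemma EqcAt.of_LC {κ M : ℝ} {s : Set E} (hκ : 0 < κ) (hs : IsOpen s) {U : ι → E → ℝ → ℝ}
    (hU : ∀ᶠ k in l, LC κ s (U k) M) {x : E} (hx : x ∈ s) (t : ℝ) :
    EqcAt l (fun k => U k x) t ∧ EqcAt l (fun k => D1 (U k) x) t ∧
      EqcAt l (fun k => D2 (U k) x) t := by
  refine ⟨?_, fun ε hε => ?_, fun ε hε => ?_⟩
  · have h1 : EqcAt l (fun (_ : ι) (t : ℝ) => t) t := EqcAt.const continuous_id
    exact h1.of_le (hU.mono fun k hk t' => hk.lip x hx t t')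
  all_goals
    obtain ⟨δ, hδ, h⟩ := exists_D_time_modulus hs hκ M hx hε
    refine ⟨δ, hδ, hU.mono fun k hk t' ht' => ?_⟩
    first | exact (h _ hk t t' ht').1.le | exact (h _ hk t t' ht').2.le

/-- Limits of solutions are solutions. -/
theorem IsSol.of_tendsto {κ M : ℝ} {s : Set E} {A : E → (E →L[ℝ] E →L[ℝ] ℝ) →L[ℝ] ℝ}
    {B : E → (E →L[ℝ] ℝ) →L[ℝ] ℝ} (l : Ultrafilter ι) (hκ : 0 < κ)
    (hs : IsOpen s) {U f : ι → E → ℝ → ℝ} {u f' : E → ℝ → ℝ} (hU : ∀ᶠ k in l, LC κ s (U k) M)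
    (hlim : ∀ x ∈ s, ∀ t, Tendsto (fun k => U k x t) l (𝓝 (u x t)))
    (hsol : ∀ᶠ k in l, IsSol s A B (f k) (U k))
    (hf : ∀ x ∈ s, ∀ t, Tendsto (fun k => f k x t) l (𝓝 (f' x t)))
    (hfe : ∀ x ∈ s, ∀ t, EqcAt l (fun k => f k x) t) : IsSol s A B f' u := fun x hx t => by
  obtain ⟨hu, hD⟩ := LC.of_tendsto l hκ hs hU hlim
  obtain ⟨-, e1, e2⟩ := EqcAt.of_LC hκ hs hU hx t
  refine hasDerivAt_of_tendsto_of_equicontinuous (l : Filter ι) (φ := fun k => U k x)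
    (g' := fun t => A x (D2 u x t) + B x (D1 u x t) + f' x t)
    (hsol.mono fun k hk t => hk x hx t) (hlim x hx)
    (((((A x).continuous.tendsto _).comp (hD x hx t).2).add
      (((B x).continuous.tendsto _).comp (hD x hx t).1)).add (hf x hx t))
    (((e2.clm (A x)).add (e1.clm (B x))).add (hfe x hx t))

end Equicontinuity

section LinearSolver

set_option linter.unusedSectionVars false
set_option maxSynthPendingDepth 3

variable {E : Type*} [NormedAddCommGroup E] [InnerProductSpace ℝ E] [FiniteDimensional ℝ E]
  {κ M N Λ : ℝ} {s : Set E} {u : E → ℝ → ℝ}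

lemma XC.add {f g : E → ℝ → ℝ} (hf : XC κ f M) (hg : XC κ g N) :
    XC κ (fun x t => f x t + g x t) (M + N) where
  cont x := (hf.cont x).add (hg.cont x)
  bdd x t := (abs_add_le _ _).trans (add_le_add (hf.bdd x t) (hg.bdd x t))
  hol x y t := by
    rw [add_sub_add_comm, add_mul]
    exact (abs_add_le _ _).trans (add_le_add (hf.hol x y t) (hg.hol x y t))
  zero x t ht := by rw [hf.zero x t ht, hg.zero x t ht, add_zero]

/-- A second-order operator with coefficients `P`, `Q`, `c`. -/
noncomputable def pert (P : E → (E →L[ℝ] E →L[ℝ] ℝ) →L[ℝ] ℝ) (Q : E → (E →L[ℝ] ℝ) →L[ℝ] ℝ)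
    (c : ℝ) (u : E → ℝ → ℝ) (x : E) (t : ℝ) : ℝ := P x (D2 u x t) + Q x (D1 u x t) + c * u x t

lemma XC.pert {P : E → (E →L[ℝ] E →L[ℝ] ℝ) →L[ℝ] ℝ} {Q : E → (E →L[ℝ] ℝ) →L[ℝ] ℝ} {c η : ℝ}
    (hκ : 0 < κ) (hκ1 : κ ≤ 1) (hP : HB κ univ P η) (hQ : HB κ univ Q η) (hc : |c| ≤ η)
    (hu : LC κ univ u N) : XC κ (pert P Q c u) (14 * η * N) := by
  have hb : ∀ t, HB κ univ (fun x => _root_.pert P Q c u x t) (14 * η * N) := fun t => by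
    obtain ⟨h0, h1, h2⟩ := hu.hb hκ.le hκ1 convex_univ t
    have h3 : HB κ univ (fun _ : E => c) η := HB.const ((abs_nonneg c).trans hc) hc
    have := ((hP.apply h2).add (hQ.apply h1)).add (h3.smul h0)
    refine ⟨fun x hx => (this.b x hx).trans_eq ?_, fun x hx y hy => (this.h x hx y hy).trans_eq ?_⟩
      <;> ring
  refine ⟨fun x => ?_, fun x t => (hb t).b x trivial, fun x y t => (hb t).h x trivial y trivial,
    fun x t ht => ?_⟩
  · obtain ⟨c1, c2⟩ := hu.continuous_D isOpen_univ hκ (mem_univ x)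
    have c3 : Continuous (u x) := hu.continuous.comp (by fun_prop : Continuous fun t : ℝ => (x, t))
    exact (((P x).continuous.comp c2).add ((Q x).continuous.comp c1)).add (c3.const_mul c)
  · obtain ⟨c1, c2⟩ := hu.D_zero isOpen_univ (mem_univ x) ht
    simp [_root_.pert, c1, c2, hu.zero x trivial t ht]

/-- The equation `u_t = A D²u + B Du - l u + f` is solvable for all admissible `f`. -/
def Solvable (κ : ℝ) (A : E → (E →L[ℝ] E →L[ℝ] ℝ) →L[ℝ] ℝ) (B : E → (E →L[ℝ] ℝ) →L[ℝ] ℝ)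
    (l : ℝ) : Prop :=
  ∀ f M, XC κ f M → ∃ u N, LC κ univ u N ∧ IsSol univ A B (fun x t => f x t - l * u x t) u

lemma pert_sub {P : E → (E →L[ℝ] E →L[ℝ] ℝ) →L[ℝ] ℝ} {Q : E → (E →L[ℝ] ℝ) →L[ℝ] ℝ} {c : ℝ}
    {v : E → ℝ → ℝ} (hu : LC κ univ u M) (hv : LC κ univ v N) (x : E) (t : ℝ) :
    pert P Q c (fun x t => u x t - v x t) x t = pert P Q c u x t - pert P Q c v x t := by
  obtain ⟨-, h1, h2⟩ := (hu.c2At isOpen_univ (mem_univ x) t).sub (hv.c2At isOpen_univ (mem_univ x) t)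
  simp only [pert, h1, h2, map_sub]
  ring

set_option maxHeartbeats 1000000 in
/-- Solvability is stable under small perturbations of the coefficients. -/
lemma Solvable.perturb {A P : E → (E →L[ℝ] E →L[ℝ] ℝ) →L[ℝ] ℝ} {B Q : E → (E →L[ℝ] ℝ) →L[ℝ] ℝ}
    {C η l c : ℝ} (hκ : 0 < κ) (hκ1 : κ ≤ 1) (h : Solvable κ A B l)
    (hest : ∀ (f u : E → ℝ → ℝ) (M N : ℝ), XC κ f M → LC κ univ u N →
      IsSol univ A B (fun x t => f x t - l * u x t) u → LC κ univ u (C * M))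
    (hP : HB κ univ P η) (hQ : HB κ univ Q η) (hc : |c| ≤ η) (hCη : 28 * η * C ≤ 1) (hC : 0 ≤ C) :
    Solvable κ (fun x => A x + P x) (fun x => B x + Q x) (l - c) := by
  intro f M hf
  have hM : 0 ≤ M := (abs_nonneg _).trans (hf.bdd 0 0)
  have hstep : ∀ u : {u : E → ℝ → ℝ // LC κ univ u (2 * (C * M))},
      ∃ v : {u : E → ℝ → ℝ // LC κ univ u (2 * (C * M))},
        IsSol univ A B (fun x t => (f x t + pert P Q c u.1 x t) - l * v.1 x t) v.1 := fun u => by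
    have hX := hf.add (XC.pert hκ hκ1 hP hQ hc u.2)
    obtain ⟨v, N, hv, hs⟩ := h _ _ hX
    refine ⟨⟨v, (hest _ _ _ _ hX hv hs).mono le_rfl ?_⟩, hs⟩
    have : 0 ≤ C * M := by positivity
    nlinarith
  choose S hS using hstep
  have h0 : LC κ univ (fun (_ : E) (_ : ℝ) => (0 : ℝ)) (2 * (C * M)) := by
    have e := fun x t => C2At.const (E := E) 0 x t
    have hp : 0 ≤ 2 * (C * M) := by positivity
    refine ⟨fun x _ t => (e x t).1.d1.self_of_nhds, fun x _ t => (e x t).1.d2, fun x _ t => ?_,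
      fun x _ t => ?_, fun x _ t => ?_, fun x _ y _ t => ?_, fun x _ t t' => ?_, fun x _ t _ => rfl⟩
    · simpa using hp
    · rw [(e x t).2.1, norm_zero]; exact hp
    · rw [(e x t).2.2, norm_zero]; exact hp
    · rw [(e x t).2.2, (e y t).2.2, sub_zero, norm_zero]; positivity
    · rw [sub_zero, abs_zero]; positivity
  set U : ℕ → {u : E → ℝ → ℝ // LC κ univ u (2 * (C * M))} := fun n => S^[n] ⟨_, h0⟩ with hU
  have hUS : ∀ n, U (n + 1) = S (U n) := fun n => Function.iterate_succ_apply' _ _ _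
  have hUsol : ∀ n, IsSol univ A B
      (fun x t => (f x t + pert P Q c (U n).1 x t) - l * (U (n + 1)).1 x t) (U (n + 1)).1 :=
    fun n => by rw [hUS]; exact hS _
  have hd : ∀ n, LC κ univ (fun x t => (U (n + 1)).1 x t - (U n).1 x t) (4 * (C * M) * (1 / 2) ^ n) := by
    intro n
    induction n with
    | zero => exact (LC.sub isOpen_univ (U 1).2 (U 0).2).mono le_rfl (by linarith)
    | succ n ih =>
      have hX := XC.pert hκ hκ1 hP hQ hc ih
      refine (hest _ _ _ _ hX (LC.sub isOpen_univ (U (n + 2)).2 (U (n + 1)).2)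
        fun x hx t => ?_).mono le_rfl ?_
      · obtain ⟨-, e1, e2⟩ := ((U (n + 2)).2.c2At isOpen_univ hx t).sub
          ((U (n + 1)).2.c2At isOpen_univ hx t)
        refine ((hUsol (n + 1) x hx t).sub (hUsol n x hx t)).congr_deriv ?_
        rw [e1, e2]
        beta_reduce
        rw [pert_sub (U (n + 1)).2 (U n).2]
        simp only [map_sub]
        ring
      · have : 0 ≤ 4 * (C * M) * (1 / 2) ^ n := by positivity
        rw [pow_succ]
        nlinarith
  have hUb : ∀ x t n, ‖(U n).1 x t‖ ≤ 2 * (C * M) := fun x t n => (U n).2.b0 x trivial t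
  choose u hu using fun x t => (hyperfilter ℕ).exists_tendsto_of_norm_le
    (Eventually.of_forall (hUb x t))
  have hu' : ∀ x t, Tendsto (fun n => (U (n + 1)).1 x t) (hyperfilter ℕ) (𝓝 (u x t)) := fun x t => by
    have h1 : Tendsto (fun n => (U (n + 1)).1 x t - (U n).1 x t) (hyperfilter ℕ) (𝓝 0) := by
      refine Tendsto.mono_left (squeeze_zero_norm (fun n => (hd n).b0 x trivial t) ?_)
        Nat.hyperfilter_le_atTop
      simpa using (tendsto_pow_atTop_nhds_zero_of_lt_one (by norm_num : (0 : ℝ) ≤ 1 / 2)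
        (by norm_num)).const_mul (4 * (C * M))
    simpa using h1.add (hu x t)
  obtain ⟨hLC, hD⟩ := LC.of_tendsto (hyperfilter ℕ) hκ isOpen_univ
    (Eventually.of_forall fun n => (U n).2) (fun x _ t => hu x t)
  have hsol := IsSol.of_tendsto (f' := fun x t => (f x t + pert P Q c u x t) - l * u x t)
    (hyperfilter ℕ) hκ isOpen_univ
    (Eventually.of_forall fun n => (U (n + 1)).2) (fun x _ t => hu' x t)
    (Eventually.of_forall hUsol) (fun x hx t => ?_) (fun x hx t => ?_)
  · refine ⟨u, _, hLC, fun x hx t => (hsol x hx t).congr_deriv ?_⟩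
    simp only [pert, add_apply]
    ring
  · refine (Tendsto.const_add _ ?_).sub ((hu' x t).const_mul l)
    exact ((((P x).continuous.tendsto _).comp (hD x hx t).2).add
      (((Q x).continuous.tendsto _).comp (hD x hx t).1)).add ((hu x t).const_mul c)
  · obtain ⟨a0, a1, a2⟩ := EqcAt.of_LC (l := (hyperfilter ℕ : Filter ℕ)) hκ isOpen_univ
      (Eventually.of_forall fun n => (U n).2) hx t
    obtain ⟨b0, -, -⟩ := EqcAt.of_LC (l := (hyperfilter ℕ : Filter ℕ)) hκ isOpen_univ
      (Eventually.of_forall fun n => (U (n + 1)).2) hx t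
    have c0 := a0.clm (ContinuousLinearMap.lsmul ℝ ℝ c)
    have d0 := b0.clm (ContinuousLinearMap.lsmul ℝ ℝ (-l))
    have := ((EqcAt.const (l := (hyperfilter ℕ : Filter ℕ)) (t := t) (hf.cont x)).add
      (((a2.clm (P x)).add (a1.clm (Q x))).add c0)).add d0
    refine this.of_le (L := 1) (Eventually.of_forall fun n t' => le_of_eq ?_)
    rw [one_mul]
    congr 1
    simp only [pert, ContinuousLinearMap.lsmul_apply, smul_eq_mul]
    ring

end LinearSolver

section LinearSolverTwo

set_option linter.unusedSectionVars false
set_option maxSynthPendingDepth 3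

variable {E : Type*} [NormedAddCommGroup E] [InnerProductSpace ℝ E] [FiniteDimensional ℝ E]
  {κ Λ : ℝ} {s : Set E} {A A' : E → (E →L[ℝ] E →L[ℝ] ℝ) →L[ℝ] ℝ} {B B' : E → (E →L[ℝ] ℝ) →L[ℝ] ℝ}

lemma clm_smul_sub (a : ℝ) (S T : (E →L[ℝ] E →L[ℝ] ℝ) →L[ℝ] ℝ) : a • S - a • T = a • (S - T) := by
  ext v
  simp only [sub_apply, smul_apply, smul_eq_mul]
  ring

lemma Coef.mono (hA : Coef κ Λ s A B) {Λ' : ℝ} (h : Λ ≤ Λ') : Coef κ Λ' s A B where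
  one := hA.one.trans h
  bA x hx := (hA.bA x hx).trans h
  hA x hx y hy := (hA.hA x hx y hy).trans (by gcongr)
  bB x hx := (hA.bB x hx).trans h
  hB x hx y hy := (hA.hB x hx y hy).trans (by gcongr)
  symm := hA.symm
  ell x hx v := (hA.ell x hx v).trans (by
    gcongr
    refine hA.nonneg hx fun w => ?_
    rw [tens_apply]
    exact mul_self_nonneg _)

lemma Coef.convex (hA : Coef κ Λ s A B) (hA' : Coef κ Λ s A' B') {a b : ℝ} (ha : 0 ≤ a)
    (hb : 0 ≤ b) (hab : a + b = 1) :
    Coef κ Λ s (fun x => a • A x + b • A' x) (fun x => a • B x + b • B' x) where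
  one := hA.one
  bA x hx := by
    have := convex_closedBall (0 : (E →L[ℝ] E →L[ℝ] ℝ) →L[ℝ] ℝ) Λ (x := A x) (y := A' x)
      (by simpa using hA.bA x hx) (by simpa using hA'.bA x hx) ha hb hab
    simpa using this
  hA x hx y hy := by
    have := convex_closedBall (0 : (E →L[ℝ] E →L[ℝ] ℝ) →L[ℝ] ℝ) (Λ * ‖x - y‖ ^ κ) (x := A x - A y)
      (y := A' x - A' y) (by simpa using hA.hA x hx y hy) (by simpa using hA'.hA x hx y hy) ha hb hab
    rw [mem_closedBall_zero_iff] at this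
    rwa [add_sub_add_comm, clm_smul_sub, clm_smul_sub]
  bB x hx := by
    have := convex_closedBall (0 : (E →L[ℝ] ℝ) →L[ℝ] ℝ) Λ (x := B x) (y := B' x)
      (by simpa using hA.bB x hx) (by simpa using hA'.bB x hx) ha hb hab
    simpa using this
  hB x hx y hy := by
    have := convex_closedBall (0 : (E →L[ℝ] ℝ) →L[ℝ] ℝ) (Λ * ‖x - y‖ ^ κ) (x := B x - B y)
      (y := B' x - B' y) (by simpa using hA.hB x hx y hy) (by simpa using hA'.hB x hx y hy) ha hb hab
    rw [mem_closedBall_zero_iff] at this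
    rwa [add_sub_add_comm, ← smul_sub, ← smul_sub]
  symm x hx v w := by
    simp only [add_apply, smul_apply, hA.symm x hx v w, hA'.symm x hx v w]
  ell x hx v := by
    have h1 := mul_le_mul_of_nonneg_left (hA.ell x hx v) ha
    have h2 := mul_le_mul_of_nonneg_left (hA'.ell x hx v) hb
    simp only [add_apply, smul_apply, smul_eq_mul]
    have e : ‖v‖ ^ 2 = a * ‖v‖ ^ 2 + b * ‖v‖ ^ 2 := by rw [← add_mul, hab, one_mul]
    linarith

variable [MeasurableSpace E] [BorelSpace E]

lemma solvable_lapF (hκ : 0 < κ) (hκ1 : κ < 1) :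
    Solvable κ (fun _ : E => lapF E) (0 : E → (E →L[ℝ] ℝ) →L[ℝ] ℝ) 1 := fun f M hf =>
  ⟨duhS f, _, (duhS_YC hκ hκ1 hf).toLC, fun x _ t => (hasDerivAt_duhS hκ hκ1 hf x t).congr_deriv (by
    simp only [Pi.zero_apply, zero_apply]
    ring)⟩

/-- Solvability of linear equations on the whole space. -/
theorem solvable (hκ : 0 < κ) (hκ1 : κ < 1) (hA : Coef κ Λ univ A B) {l : ℝ} (hl : 1 ≤ l) :
    Solvable κ A B l := by
  set Λ' := Λ + (2 + ‖lapF E‖) + l with hΛ'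
  have hlap := norm_nonneg (lapF E)
  have hΛ1 := hA.one
  have hA1 : Coef κ Λ' univ A B := hA.mono (by linarith)
  have hA0 : Coef κ Λ' univ (fun _ : E => lapF E) 0 := (coef_lapF κ).mono (by linarith)
  obtain ⟨C, hC, hest⟩ := global_estimate (E := E) (Λ := Λ') hκ hκ1 hA1.one
  obtain ⟨n, hn⟩ := exists_nat_gt (28 * (2 * Λ') * C)
  have hn0 : (0 : ℝ) < n := lt_of_le_of_lt (by positivity) hn
  have key : ∀ k : ℕ, k ≤ n → Solvable κ
      (fun x => (1 - k / n : ℝ) • lapF E + (k / n : ℝ) • A x)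
      (fun x => (1 - k / n : ℝ) • (0 : E → (E →L[ℝ] ℝ) →L[ℝ] ℝ) x + (k / n : ℝ) • B x)
      (1 + k / n * (l - 1)) := by
    intro k
    induction k with
    | zero => intro _; simpa [Pi.zero_def] using solvable_lapF (E := E) hκ hκ1
    | succ k ih =>
      intro hk
      have hk' : (k : ℝ) / n ≤ 1 := by
        rw [div_le_one hn0]; exact_mod_cast (Nat.le_succ k).trans hk
      have hk0 : (0 : ℝ) ≤ k / n := by positivity
      have hAk := hA0.convex hA1 (sub_nonneg.2 hk') hk0 (by ring)
      have hP : HB κ univ (fun x => (1 / n : ℝ) • (A x - lapF E)) (1 / n * (2 * Λ')) := by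
        have e : ‖(1 / n : ℝ)‖ = 1 / n := by rw [Real.norm_eq_abs, abs_of_pos (by positivity)]
        refine ⟨fun x _ => ?_, fun x _ y _ => ?_⟩
        · rw [norm_smul, e]
          gcongr
          have := norm_sub_le (A x) (lapF E)
          have := hA1.bA x trivial
          have := hA0.bA x trivial
          linarith
        · rw [clm_smul_sub, norm_smul, e, sub_sub_sub_cancel_right, mul_assoc]
          gcongr
          refine (hA1.hA x trivial y trivial).trans ?_
          gcongr
          linarith
      have hQ : HB κ univ (fun x => (1 / n : ℝ) • B x) (1 / n * (2 * Λ')) := by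
        have e : ‖(1 / n : ℝ)‖ = 1 / n := by rw [Real.norm_eq_abs, abs_of_pos (by positivity)]
        refine ⟨fun x _ => ?_, fun x _ y _ => ?_⟩
        · rw [norm_smul, e]
          gcongr
          have := hA1.bB x trivial
          linarith
        · rw [← smul_sub, norm_smul, e, mul_assoc]
          gcongr
          refine (hA1.hB x trivial y trivial).trans ?_
          gcongr
          linarith
      have := (ih ((Nat.le_succ k).trans hk)).perturb (C := C) (c := -(1 / n * (l - 1))) hκ hκ1.le
        (fun f u M N hf hu hs => hest _ _ f u _ M N hAk (by nlinarith) (by nlinarith) hf hu hs)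
        hP hQ (by
          rw [abs_neg, abs_mul, abs_of_pos (by positivity : (0 : ℝ) < 1 / n),
            abs_of_nonneg (by linarith : 0 ≤ l - 1)]
          gcongr
          linarith) (by
          have : 28 * (1 / n * (2 * Λ')) * C = 28 * (2 * Λ') * C / n := by ring
          rw [this, div_le_one hn0]
          exact hn.le) (by linarith)
      have ec : ((k + 1 : ℕ) : ℝ) / n = k / n + 1 / n := by push_cast; ring
      rw [ec]
      convert this using 1
      · ext x T
        simp only [add_apply, smul_apply, sub_apply, smul_eq_mul]
        ring
      · ext x T
        simp only [add_apply, smul_apply, smul_eq_mul, Pi.zero_apply, zero_apply]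
        ring
      · ring
  have := key n le_rfl
  rw [div_self hn0.ne'] at this
  simpa using this

end LinearSolverTwo

section Semilinear

set_option linter.unusedSectionVars false
set_option maxSynthPendingDepth 3

variable {E : Type*} [NormedAddCommGroup E] [InnerProductSpace ℝ E] [FiniteDimensional ℝ E]
  {κ M N Λ K l : ℝ} {A : E → (E →L[ℝ] E →L[ℝ] ℝ) →L[ℝ] ℝ} {B : E → (E →L[ℝ] ℝ) →L[ℝ] ℝ}
  {u v f g : E → ℝ → ℝ}

lemma LC.of_zero (κ : ℝ) (hM : 0 ≤ M) : LC κ univ (fun (_ : E) (_ : ℝ) => (0 : ℝ)) M := by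
  have e := fun x t => C2At.const (E := E) 0 x t
  refine ⟨fun x _ t => (e x t).1.d1.self_of_nhds, fun x _ t => (e x t).1.d2, fun x _ t => ?_,
    fun x _ t => ?_, fun x _ t => ?_, fun x _ y _ t => ?_, fun x _ t t' => ?_, fun x _ t _ => rfl⟩
  · simpa using hM
  · rw [(e x t).2.1, norm_zero]; exact hM
  · rw [(e x t).2.2, norm_zero]; exact hM
  · rw [(e x t).2.2, (e y t).2.2, sub_zero, norm_zero]; positivity
  · rw [sub_zero, abs_zero]; positivity

lemma IsSol.nonneg_of_source (hA : Coef κ Λ univ A B) (hl : 0 ≤ l) (hu : LC κ univ u N)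
    (hs : IsSol univ A B (fun x t => f x t - l * u x t) u) (hf : ∀ x t, 0 ≤ f x t) (x : E) (t : ℝ) :
    0 ≤ u x t :=
  global_nonneg hA hl hu.continuous (fun x t => hu.b0 x trivial t)
    (fun x t ht => (hu.zero x trivial t ht).ge) (fun x t _ =>
      ⟨hu.c2At isOpen_univ trivial t, _, hs x trivial t, by linarith [hf x t]⟩) x t

lemma IsSol.le_of_source_le (hA : Coef κ Λ univ A B) (hl : 0 ≤ l) (hu : LC κ univ u N)
    (hs : IsSol univ A B (fun x t => f x t - l * u x t) u) (hM : 0 ≤ M) (hf : ∀ x t, f x t ≤ l * M)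
    (x : E) (t : ℝ) : u x t ≤ M := by
  have hc := hu.continuous
  have := global_nonneg hA (u := fun x t => M + (-1) * u x t) (N := M + N) hl (by fun_prop)
    (fun x t => by
      have h1 := abs_add_le M (-1 * u x t)
      rw [abs_mul, abs_neg, abs_one, one_mul, abs_of_nonneg hM] at h1
      linarith [hu.b0 x trivial t])
    (fun x t ht => by simpa [hu.zero x trivial t ht] using hM) (fun x t _ => by
      obtain ⟨k1, k2, k3⟩ := C2At.const M x t
      obtain ⟨r1, r2, r3⟩ := k1.add_smul (hu.c2At isOpen_univ (mem_univ x) t) (-1)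
      refine ⟨r1, _, ((hs x trivial t).const_mul (-1)).const_add M, ?_⟩
      rw [r2, r3, k2, k3]
      simp only [map_add, map_smul, smul_eq_mul, map_zero]
      linarith [hf x t]) x t
  linarith

lemma IsSol.mono_of_source (hA : Coef κ Λ univ A B) (hl : 0 ≤ l) (hu : LC κ univ u M)
    (hv : LC κ univ v N) (hsu : IsSol univ A B (fun x t => f x t - l * u x t) u)
    (hsv : IsSol univ A B (fun x t => g x t - l * v x t) v) (hfg : ∀ x t, f x t ≤ g x t) (x : E)
    (t : ℝ) : u x t ≤ v x t := by
  have := IsSol.nonneg_of_source (f := fun x t => g x t - f x t) hA hl (LC.sub isOpen_univ hv hu)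
    (fun x hx t => by
      obtain ⟨-, e1, e2⟩ := (hv.c2At isOpen_univ hx t).sub (hu.c2At isOpen_univ hx t)
      refine ((hsv x hx t).sub (hsu x hx t)).congr_deriv ?_
      rw [e1, e2]
      simp only [map_sub]
      ring) (fun x t => sub_nonneg.2 (hfg x t)) x t
  linarith

variable [MeasurableSpace E] [BorelSpace E]

set_option maxHeartbeats 1000000 in
/-- Existence of a solution between the ordered sub- and supersolutions `0` and `N`. -/
theorem exists_semilinear (hκ : 0 < κ) (hκ1 : κ < 1) (hA : Coef κ Λ univ A B) {F : E → ℝ → ℝ}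
    (hF0 : ∀ x, F x 0 = 0) (hN : 0 ≤ N) (hK : 0 ≤ K)
    (hF : ∀ x y, ∀ z ∈ Icc 0 N, ∀ w ∈ Icc 0 N, |F x z - F y w| ≤ K * (‖x - y‖ ^ κ + |z - w|))
    (hg : XC κ g M) (hg0 : ∀ x t, 0 ≤ g x t) (hFN : ∀ x t, F x N + g x t ≤ 0) :
    ∃ v M', LC κ univ v M' ∧ (∀ x t, v x t ∈ Icc 0 N) ∧
      IsSol univ A B (fun x t => F x (v x t) + g x t) v := by
  have hM : 0 ≤ M := (abs_nonneg _).trans (hg.bdd 0 0)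
  have hF' : ∀ x, ∀ z ∈ Icc 0 N, ∀ w ∈ Icc 0 N, |F x z - F x w| ≤ K * |z - w| := fun x z hz w hw => by
    have := hF x x z hz w hw
    rwa [sub_self, norm_zero, Real.zero_rpow hκ.ne', zero_add] at this
  set l := K + 1 with hl
  have hl1 : 1 ≤ l := by linarith
  have hl0 : 0 ≤ l := by linarith
  have hA1 : Coef κ (Λ + l) univ A B := hA.mono (by linarith)
  have hΛ1 := hA.one
  obtain ⟨C, hC, hest⟩ := global_estimate (E := E) (Λ := Λ + l) hκ hκ1 hA1.one
  have hCl : 0 < 2 * C * (l + K) := by positivity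
  obtain ⟨ρ, hρ, hρ1, hρκ⟩ := exists_small_rpow (κ := κ) hκ one_pos
    (lt_min one_pos (one_div_pos.2 hCl))
  have hρ2 : C * (l + K) * ρ ≤ 1 / 2 := by
    have := hρ1.trans (min_le_right _ _)
    rw [le_div_iff₀ hCl] at this
    linarith
  set P := (l + K) * (2 * N + N / ρ) + K + M with hP
  have hP0 : 0 ≤ P := by positivity
  set Q := 2 * C * P with hQ
  have hQ0 : 0 ≤ Q := by positivity
  have hsrc : ∀ v : E → ℝ → ℝ, LC κ univ v Q → (∀ x t, v x t ∈ Icc 0 N) →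
      XC κ (fun x t => l * v x t + F x (v x t) + g x t) (P + (l + K) * (Q * ρ)) := by
    intro v hv hv0
    have h0N : (0 : ℝ) ∈ Icc 0 N := ⟨le_rfl, hN⟩
    have hb1 : ∀ x t, ‖D1 v x t‖ ≤ N / ρ + Q * ρ := fun x t => by
      refine (hv.interp (t := t) (K := N) hκ.le hρ (subset_univ (Metric.closedBall x ρ)) hQ0
        (fun y _ => abs_le.2 ⟨by linarith [(hv0 y t).1], (hv0 y t).2⟩)
        (fun y _ z _ => hv.h2 y trivial z trivial t)).1.trans ?_
      gcongr
      exact mul_le_of_le_one_right hQ0 hρκ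
    have hbH : ∀ t, HB κ univ (fun x => v x t) (2 * N + (N / ρ + Q * ρ)) := fun t =>
      HB.of_lipschitz hκ.le hκ1.le (fun y _ => abs_le.2 ⟨by linarith [(hv0 y t).1], (hv0 y t).2⟩)
        (by positivity) fun x hx y hy => convex_univ.norm_image_sub_le_of_norm_hasFDerivWithin_le
          (f := fun y => v y t) (fun z hz => (hv.d1 z hz t).hasFDerivWithinAt)
          (fun z hz => hb1 z t) hy hx
    have hNρ : 0 ≤ N / ρ := by positivity
    have hQρ : 0 ≤ Q * ρ := by positivity
    refine ⟨fun x => ?_, fun x t => ?_, fun x y t => ?_, fun x t ht => ?_⟩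
    · have c1 : Continuous (v x) := hv.continuous.comp (by fun_prop : Continuous fun t : ℝ => (x, t))
      have c2 : Continuous fun t => F x (v x t) := by
        have : ContinuousOn (F x) (Icc 0 N) := by
          refine LipschitzOnWith.continuousOn (K := ⟨K, hK⟩) (LipschitzOnWith.of_dist_le_mul ?_)
          exact fun z hz w hw => hF' x z hz w hw
        exact this.comp_continuous c1 (hv0 x)
      exact ((c1.const_mul l).add c2).add (hg.cont x)
    · have h1 := hF' x _ (hv0 x t) 0 h0N
      rw [hF0, sub_zero, sub_zero] at h1
      have h2 : |v x t| ≤ N := abs_le.2 ⟨by linarith [(hv0 x t).1], (hv0 x t).2⟩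
      have h3 := abs_add_three (l * v x t) (F x (v x t)) (g x t)
      rw [abs_mul, abs_of_nonneg hl0] at h3
      have h4 := hg.bdd x t
      have h5 : (l + K) * |v x t| ≤ (l + K) * N := by gcongr
      have h6 : 0 ≤ (l + K) * (N + N / ρ + Q * ρ) := by positivity
      rw [hP]
      linarith
    · have h1 := hF x y _ (hv0 x t) _ (hv0 y t)
      have h2 := (hbH t).h x trivial y trivial
      rw [Real.norm_eq_abs] at h2
      have h3 := abs_add_three (l * (v x t - v y t)) (F x (v x t) - F y (v y t)) (g x t - g y t)
      rw [abs_mul, abs_of_nonneg hl0] at h3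
      have h4 := hg.hol x y t
      have h5 := mul_le_mul_of_nonneg_left h2 (by positivity : 0 ≤ l + K)
      have e : l * v x t + F x (v x t) + g x t - (l * v y t + F y (v y t) + g y t) =
        l * (v x t - v y t) + (F x (v x t) - F y (v y t)) + (g x t - g y t) := by ring
      rw [e, hP]
      linarith
    · rw [hv.zero x trivial t ht, hF0, hg.zero x t ht]; ring
  have hstep : ∀ w : {w : E → ℝ → ℝ // LC κ univ w Q ∧ ∀ x t, w x t ∈ Icc 0 N},
      ∃ w' : {w : E → ℝ → ℝ // LC κ univ w Q ∧ ∀ x t, w x t ∈ Icc 0 N},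
        IsSol univ A B (fun x t => (l * w.1 x t + F x (w.1 x t) + g x t) - l * w'.1 x t) w'.1 := by
    intro w
    have hX := hsrc w.1 w.2.1 w.2.2
    obtain ⟨w', R, hw', hs⟩ := solvable hκ hκ1 hA1 hl1 _ _ hX
    refine ⟨⟨w', (hest _ _ _ _ l _ _ hA1 hl1 (by linarith) hX hw' hs).mono le_rfl ?_,
      fun x t => ⟨hs.nonneg_of_source hA1 hl0 hw' (fun x t => ?_) x t,
      hs.le_of_source_le hA1 hl0 hw' hN (fun x t => ?_) x t⟩⟩, hs⟩
    · have := mul_le_mul_of_nonneg_right hρ2 hQ0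
      rw [hQ] at this ⊢
      linarith
    · have h1 := hF' x _ (w.2.2 x t) 0 ⟨le_rfl, hN⟩
      have h2 := (w.2.2 x t).1
      rw [hF0, sub_zero, sub_zero, abs_of_nonneg h2] at h1
      have h3 := (abs_le.1 h1).1
      have := hg0 x t
      rw [hl]
      linarith
    · have h1 := hF' x _ (w.2.2 x t) N ⟨hN, le_rfl⟩
      have h2 := (w.2.2 x t).2
      rw [abs_sub_comm (w.1 x t), abs_of_nonneg (sub_nonneg.2 h2)] at h1
      have h3 := (abs_le.1 h1).2
      have := hFN x t
      rw [hl]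
      linarith
  choose S hS using hstep
  have hmono : ∀ w w', (∀ x t, w.1 x t ≤ w'.1 x t) → ∀ x t, (S w).1 x t ≤ (S w').1 x t := by
    intro w w' h
    refine IsSol.mono_of_source hA1 hl0 (S w).2.1 (S w').2.1 (hS w) (hS w') fun x t => ?_
    have h1 := hF' x _ (w.2.2 x t) _ (w'.2.2 x t)
    rw [abs_sub_comm (w.1 x t), abs_of_nonneg (sub_nonneg.2 (h x t))] at h1
    have h3 := (abs_le.1 h1).2
    have := h x t
    rw [hl]
    linarith
  set U : ℕ → {w : E → ℝ → ℝ // LC κ univ w Q ∧ ∀ x t, w x t ∈ Icc 0 N} :=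
    fun n => S^[n] ⟨_, LC.of_zero κ hQ0, fun _ _ => ⟨le_rfl, hN⟩⟩ with hU
  have hUS : ∀ n, U (n + 1) = S (U n) := fun n => Function.iterate_succ_apply' _ _ _
  have hUsol : ∀ n, IsSol univ A B
      (fun x t => (l * (U n).1 x t + F x ((U n).1 x t) + g x t) - l * (U (n + 1)).1 x t)
      (U (n + 1)).1 := fun n => by rw [hUS]; exact hS _
  have hUm : ∀ n x t, (U n).1 x t ≤ (U (n + 1)).1 x t := by
    intro n
    induction n with
    | zero => exact fun x t => ((U 1).2.2 x t).1
    | succ n ih => rw [hUS, hUS (n + 1)]; exact hmono _ _ ih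
  have hconv : ∀ x t, Tendsto (fun n => (U n).1 x t) atTop (𝓝 (⨆ n, (U n).1 x t)) := fun x t =>
    tendsto_atTop_ciSup (monotone_nat_of_le_succ fun n => hUm n x t)
      ⟨N, by rintro _ ⟨n, rfl⟩; exact ((U n).2.2 x t).2⟩
  set v : E → ℝ → ℝ := fun x t => ⨆ n, (U n).1 x t with hv
  have hlim : ∀ x t, Tendsto (fun n => (U n).1 x t) (hyperfilter ℕ) (𝓝 (v x t)) := fun x t =>
    (hconv x t).mono_left Nat.hyperfilter_le_atTop
  have hlim' : ∀ x t, Tendsto (fun n => (U (n + 1)).1 x t) (hyperfilter ℕ) (𝓝 (v x t)) :=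
    fun x t => ((tendsto_add_atTop_iff_nat 1).2 (hconv x t)).mono_left Nat.hyperfilter_le_atTop
  have hv0 : ∀ x t, v x t ∈ Icc 0 N := fun x t =>
    isClosed_Icc.mem_of_tendsto (hconv x t) (Eventually.of_forall fun n => (U n).2.2 x t)
  obtain ⟨hLC, -⟩ := LC.of_tendsto (hyperfilter ℕ) hκ isOpen_univ
    (Eventually.of_forall fun n => (U n).2.1) (fun x _ t => hlim x t)
  have hsol := IsSol.of_tendsto (f' := fun x t => (l * v x t + F x (v x t) + g x t) - l * v x t)
    (hyperfilter ℕ) hκ isOpen_univ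
    (Eventually.of_forall fun n => (U (n + 1)).2.1) (fun x _ t => hlim' x t)
    (Eventually.of_forall hUsol) (fun x hx t => ?_) (fun x hx t => ?_)
  · refine ⟨v, Q, hLC, hv0, fun x hx t => (hsol x hx t).congr_deriv ?_⟩
    ring
  · refine ((((hlim x t).const_mul l).add ?_).add_const _).sub ((hlim' x t).const_mul l)
    rw [tendsto_iff_norm_sub_tendsto_zero]
    have h1 := ((tendsto_iff_norm_sub_tendsto_zero.1 (hlim x t)).const_mul K)
    rw [mul_zero] at h1
    exact squeeze_zero (fun _ => norm_nonneg _)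
      (fun n => hF' x _ ((U n).2.2 x t) _ (hv0 x t)) h1
  · obtain ⟨a0, -, -⟩ := EqcAt.of_LC (l := (hyperfilter ℕ : Filter ℕ)) hκ isOpen_univ
      (Eventually.of_forall fun n => (U n).2.1) hx t
    obtain ⟨b0, -, -⟩ := EqcAt.of_LC (l := (hyperfilter ℕ : Filter ℕ)) hκ isOpen_univ
      (Eventually.of_forall fun n => (U (n + 1)).2.1) hx t
    have c0 := a0.clm (ContinuousLinearMap.lsmul ℝ ℝ l)
    have d0 := b0.clm (ContinuousLinearMap.lsmul ℝ ℝ (-l))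
    have f0 : EqcAt (hyperfilter ℕ : Filter ℕ) (fun n t => F x ((U n).1 x t)) t :=
      a0.of_le (L := K) (Eventually.of_forall fun n t' =>
        hF' x _ ((U n).2.2 x t) _ ((U n).2.2 x t'))
    refine (((c0.add f0).add (EqcAt.const (hg.cont x))).add d0).of_le (L := 1)
      (Eventually.of_forall fun n t' => le_of_eq ?_)
    rw [one_mul]
    congr 1
    simp only [ContinuousLinearMap.lsmul_apply, smul_eq_mul]
    ring

end Semilinear

section Upgrade

set_option linter.unusedSectionVars false
set_option maxSynthPendingDepth 3

variable {E : Type*} [NormedAddCommGroup E] [InnerProductSpace ℝ E] [FiniteDimensional ℝ E]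
  {κ κ0 M N Λ K l : ℝ} {A : E → (E →L[ℝ] E →L[ℝ] ℝ) →L[ℝ] ℝ} {B : E → (E →L[ℝ] ℝ) →L[ℝ] ℝ}
  {u v f : E → ℝ → ℝ}

lemma LC.congr {s : Set E} (hs : IsOpen s) (h : LC κ s u M) (he : ∀ x ∈ s, ∀ t, v x t = u x t) :
    LC κ s v M := by
  have e : ∀ x ∈ s, ∀ t, C2At v x t ∧ D1 v x t = D1 u x t ∧ D2 v x t = D2 u x t := fun x hx t => by
    refine D2_congr (u := v) (w := fun y => D1 u y t) ?_ (h.d2 x hx t)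
    filter_upwards [hs.eventually_mem hx] with y hy
    refine (h.d1 y hy t).congr_of_eventuallyEq ?_
    filter_upwards [hs.eventually_mem hy] with z hz using he z hz t
  refine ⟨fun x hx t => (e x hx t).1.d1.self_of_nhds, fun x hx t => (e x hx t).1.d2,
    fun x hx t => ?_, fun x hx t => ?_, fun x hx t => ?_, fun x hx y hy t => ?_,
    fun x hx t t' => ?_, fun x hx t ht => ?_⟩
  · rw [he x hx]; exact h.b0 x hx t
  · rw [(e x hx t).2.1]; exact h.b1 x hx t
  · rw [(e x hx t).2.2]; exact h.b2 x hx t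
  · rw [(e x hx t).2.2, (e y hy t).2.2]; exact h.h2 x hx y hy t
  · rw [he x hx, he x hx]; exact h.lip x hx t t'
  · rw [he x hx]; exact h.zero x hx t ht

lemma HB.translate {F : Type*} [NormedAddCommGroup F] {f : E → F} {r : ℝ} (x0 : E)
    (h : HB κ (Metric.ball 0 r) f K) : HB κ (Metric.ball x0 r) (fun x => f (x - x0)) K := by
  have e : ∀ x ∈ Metric.ball x0 r, x - x0 ∈ Metric.ball (0 : E) r := fun x hx => by
    rwa [mem_ball_zero_iff, ← mem_ball_iff_norm]
  refine ⟨fun x hx => h.b _ (e x hx), fun x hx y hy => ?_⟩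
  have := h.h _ (e x hx) _ (e y hy)
  rwa [sub_sub_sub_cancel_right] at this

variable [MeasurableSpace E] [BorelSpace E]

set_option maxHeartbeats 2000000 in
/-- Improvement of the Hölder exponent of a solution. -/
theorem LC.upgrade (hκ0 : 0 < κ0) (hκ : 0 < κ) (hκ1 : κ < 1) (hA : Coef κ Λ univ A B)
    (hu : LC κ0 univ u M) {x0 : E} (hsol : IsSol (Metric.ball x0 3) A B f u)
    (hfc : ∀ x ∈ Metric.ball x0 3, Continuous (f x))
    (hf0 : ∀ x ∈ Metric.ball x0 3, ∀ t ≤ 0, f x t = 0)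
    (hf : ∀ t, HB κ (Metric.ball x0 3) (fun x => f x t) K) :
    ∃ M', LC κ (Metric.ball x0 1) u M' := by
  obtain ⟨ζ, ζ', ζ'', Kη, hKη, hζd0, hζd1, hζ1, hζ2, ζb0, ζb1, ζb2⟩ := exists_cutoff E hκ.le hκ1.le
  set η : E → ℝ := fun x => ζ (x - x0) with hη
  set η' : E → E →L[ℝ] ℝ := fun x => ζ' (x - x0) with hη'
  set η'' : E → E →L[ℝ] E →L[ℝ] ℝ := fun x => ζ'' (x - x0) with hη''
  have hd0 : ∀ x, HasFDerivAt η (η' x) x := fun x => by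
    exact ((hζd0 (x - x0)).comp x ((hasFDerivAt_id x).sub_const x0)).congr_fderiv
      (ContinuousLinearMap.comp_id _)
  have hd1 : ∀ x, HasFDerivAt η' (η'' x) x := fun x => by
    exact ((hζd1 (x - x0)).comp x ((hasFDerivAt_id x).sub_const x0)).congr_fderiv
      (ContinuousLinearMap.comp_id _)
  have b0 : HB κ (Metric.ball x0 3) η Kη := ζb0.translate x0
  have b1 : HB κ (Metric.ball x0 3) η' Kη := ζb1.translate x0
  have b2 : HB κ (Metric.ball x0 3) η'' Kη := ζb2.translate x0
  have hz3 : x0 ∈ Metric.ball x0 3 := by simp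
  have hη2 : ∀ x ∉ Metric.ball x0 2, η x = 0 ∧ η' x = 0 ∧ η'' x = 0 := fun x hx => by
    have := hζ2 (x - x0) (by rwa [mem_ball_zero_iff, ← mem_ball_iff_norm])
    exact ⟨this.1.self_of_nhds, this.2⟩
  have hη1 : ∀ x ∈ Metric.ball x0 1, η x = 1 := fun x hx =>
    hζ1 _ (by rwa [mem_ball_zero_iff, ← mem_ball_iff_norm])
  have hM := hu.nonneg (mem_univ x0)
  have hK : 0 ≤ K := (norm_nonneg _).trans ((hf 0).b x0 hz3)
  have hΛ1 := hA.one
  set sR := ContinuousLinearMap.smulRightL ℝ E (E →L[ℝ] ℝ) with hsR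
  have hHA : HB κ (Metric.ball x0 3) A Λ := ⟨fun x _ => hA.bA x trivial,
    fun x _ y _ => hA.hA x trivial y trivial⟩
  have hHB : HB κ (Metric.ball x0 3) B Λ := ⟨fun x _ => hA.bB x trivial,
    fun x _ y _ => hA.hB x trivial y trivial⟩
  have h0 : ∀ t, HB κ (Metric.ball x0 3) (fun x => u x t) (2 * M + M) := fun t =>
    HB.of_lipschitz hκ.le hκ1.le (fun x _ => hu.b0 x trivial t) hM fun x _ y _ =>
      (hu.lipschitz convex_univ trivial trivial t).1
  have h1 : ∀ t, HB κ (Metric.ball x0 3) (fun x => D1 u x t) (2 * M + M) := fun t =>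
    HB.of_lipschitz hκ.le hκ1.le (fun x _ => hu.b1 x trivial t) hM fun x _ y _ =>
      (hu.lipschitz convex_univ trivial trivial t).2
  set g : E → ℝ → ℝ := fun x t => η x • f x t + η x • u x t - A x (sR (η' x) (D1 u x t))
    - A x (sR (D1 u x t) (η' x)) - u x t • A x (η'' x) - u x t • B x (η' x) with hg
  have hg0 : ∀ t, ∀ x ∉ Metric.ball x0 2, g x t = 0 := fun t x hx => by
    simp [hg, hη2 x hx]
  obtain ⟨P, hP3⟩ : ∃ P, ∀ t, HB κ (Metric.ball x0 3) (fun x => g x t) P :=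
    ⟨_, fun t => (((((b0.smul (hf t)).add (b0.smul (h0 t))).sub
      (hHA.apply (b1.bilin sR (h1 t)))).sub
      (hHA.apply ((h1 t).bilin sR b1))).sub ((h0 t).smul (hHA.apply b2))).sub
      ((h0 t).smul (hHB.apply b1))⟩
  have hP : 0 ≤ P := (norm_nonneg _).trans ((hP3 0).b x0 hz3)
  have hgHB : ∀ t, HB κ univ (fun x => g x t) P := fun t =>
    HB.univ_of_support (r := 2) hκ.le (c := x0) hP (by norm_num; exact hP3 t) (hg0 t)
  have hgX : XC κ g P := by
    refine ⟨fun x => ?_, fun x t => (hgHB t).b x trivial,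
      fun x y t => (hgHB t).h x trivial y trivial, fun x t ht => ?_⟩
    · by_cases hx : x ∈ Metric.ball x0 3
      · obtain ⟨c1, c2⟩ := hu.continuous_D isOpen_univ hκ0 (mem_univ x)
        have c0 : Continuous (u x) :=
          continuous_iff_continuousAt.2 fun t => (hsol x hx t).continuousAt
        have cf := hfc x hx
        simp only [hg]
        fun_prop
      · have : g x = fun _ => 0 := by
          ext t
          exact hg0 t x fun h => hx (Metric.ball_subset_ball (by norm_num) h)
        rw [this]; exact continuous_const
    · by_cases hx : x ∈ Metric.ball x0 3
      · obtain ⟨c1, c2⟩ := hu.D_zero isOpen_univ (mem_univ x) ht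
        simp [hg, hf0 x hx t ht, c1, hu.zero x (mem_univ x) t ht]
      · exact hg0 t x fun h => hx (Metric.ball_subset_ball (by norm_num) h)
  set w : E → ℝ → ℝ := fun x t => η x * u x t with hw
  have hwD : ∀ x t, C2At w x t ∧
      D1 w x t = η x • D1 u x t + u x t • η' x ∧
      D2 w x t = (η x • D2 u x t + (η' x).smulRight (D1 u x t)) +
        (u x t • η'' x + (D1 u x t).smulRight (η' x)) := by
    intro x t
    refine D2_congr (u := w) (w := fun y => η y • D1 u y t + u y t • η' y) ?_ ?_
    · exact Eventually.of_forall fun y => (hd0 y).mul (hu.d1 y trivial t)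
    · exact ((hd0 x).smul (hu.d2 x trivial t)).add ((hu.d1 x trivial t).smul (hd1 x))
  have hηc : Continuous η := continuous_iff_continuousAt.2 fun x => (hd0 x).continuousAt
  have hwcont : Continuous fun q : E × ℝ => w q.1 q.2 :=
    (hηc.comp continuous_fst).mul hu.continuous
  have hwb : ∀ x t, |w x t| ≤ Kη * M := fun x t => by
    by_cases hx : x ∈ Metric.ball x0 3
    · rw [hw, abs_mul]
      exact mul_le_mul (b0.b x hx) (hu.b0 x trivial t) (abs_nonneg _) hKη
    · have : w x t = 0 := by
        simp [hw, hη2 x fun h => hx (Metric.ball_subset_ball (by norm_num) h)]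
      rw [this, abs_zero]; positivity
  have hwt : ∀ x t, HasDerivAt (w x) (A x (D2 w x t) + B x (D1 w x t) + (g x t - 1 * w x t)) t := by
    intro x t
    rw [(hwD x t).2.1, (hwD x t).2.2]
    by_cases hx : x ∈ Metric.ball x0 3
    · refine ((hsol x hx t).const_mul (η x)).congr_deriv ?_
      have e : ∀ a b : E →L[ℝ] ℝ, sR a b = a.smulRight b := fun _ _ => rfl
      simp only [hg, hw, e, map_add, map_smul, smul_eq_mul]
      ring
    · have hx2 := hη2 x fun h => hx (Metric.ball_subset_ball (by norm_num) h)
      have e : w x = fun _ => 0 := by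
        ext t; simp [hw, hx2]
      rw [hg0 t x fun h => hx (Metric.ball_subset_ball (by norm_num) h), e, hx2.1, hx2.2.1, hx2.2.2]
      simpa using hasDerivAt_const t (0 : ℝ)
  obtain ⟨z, Q, hz, hzs⟩ := solvable hκ hκ1 hA le_rfl g P hgX
  have heq : ∀ x t, z x t = w x t := fun x t => by
    have := global_unique hA (z := fun x t => w x t - z x t) zero_le_one
      (hwcont.sub hz.continuous)
      (fun x t => (abs_sub _ _).trans (add_le_add (hwb x t) (hz.b0 x trivial t)))
      (fun x t ht => by simp [hz.zero x trivial t ht, hw, hu.zero x trivial t ht])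
      (fun x t => ((hwD x t).1.sub (hz.c2At isOpen_univ (mem_univ x) t)).1)
      (fun x t => by
        obtain ⟨-, e1, e2⟩ := (hwD x t).1.sub (hz.c2At isOpen_univ (mem_univ x) t)
        refine ((hwt x t).sub (hzs x trivial t)).congr_deriv ?_
        rw [e1, e2]
        simp only [map_sub]
        ring) x t
    linarith
  refine ⟨Q, (hz.mono (subset_univ _) le_rfl).congr Metric.isOpen_ball fun x hx t => ?_⟩
  rw [heq]
  simp [hw, hη1 x hx]

end Upgrade

section Retraction

set_option linter.unusedSectionVars false
set_option maxSynthPendingDepth 3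

variable {E : Type*} [NormedAddCommGroup E] [InnerProductSpace ℝ E] [FiniteDimensional ℝ E]
  {κ M N Λ K R : ℝ} {A : E → (E →L[ℝ] E →L[ℝ] ℝ) →L[ℝ] ℝ} {B : E → (E →L[ℝ] ℝ) →L[ℝ] ℝ}
  {α β : E → ℝ} {p : ℝ}

/-- The radial retraction onto a ball. -/
noncomputable def retr (R : ℝ) (x : E) : E := (R / max R ‖x‖) • x

lemma retr_of_mem (hR : 0 < R) {x : E} (hx : x ∈ Metric.closedBall (0 : E) R) : retr R x = x := by
  rw [mem_closedBall_zero_iff] at hx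
  rw [retr, max_eq_left hx, div_self hR.ne', one_smul]

lemma retr_mem (hR : 0 < R) (x : E) : retr R x ∈ Metric.closedBall (0 : E) R := by
  have h : 0 < max R ‖x‖ := lt_max_of_lt_left hR
  rw [mem_closedBall_zero_iff, retr, norm_smul, Real.norm_of_nonneg (by positivity),
    div_mul_eq_mul_div, div_le_iff₀ h]
  gcongr
  exact le_max_right _ _

lemma norm_retr_sub_le (hR : 0 < R) (x y : E) : ‖retr R x - retr R y‖ ≤ 2 * ‖x - y‖ := by
  have ha : 0 < max R ‖x‖ := lt_max_of_lt_left hR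
  have hb : 0 < max R ‖y‖ := lt_max_of_lt_left hR
  have e : retr R x - retr R y = (R / max R ‖x‖) • (x - y)
      + (R / max R ‖x‖ * ((max R ‖y‖ - max R ‖x‖) / max R ‖y‖)) • y := by
    have : R / max R ‖x‖ * ((max R ‖y‖ - max R ‖x‖) / max R ‖y‖)
        = R / max R ‖x‖ - R / max R ‖y‖ := by
      field_simp
    rw [this, retr, retr, smul_sub, sub_smul]
    abel
  have h1 : R / max R ‖x‖ ≤ 1 := (div_le_one ha).2 (le_max_left _ _)
  have h2 : |max R ‖y‖ - max R ‖x‖| ≤ ‖x - y‖ := by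
    rw [max_comm R, max_comm R]
    refine (abs_max_sub_max_le_abs _ _ _).trans ?_
    rw [norm_sub_rev]
    exact abs_norm_sub_norm_le y x
  rw [e]
  refine (norm_add_le _ _).trans ?_
  rw [norm_smul, norm_smul, norm_mul, Real.norm_of_nonneg (by positivity : 0 ≤ R / max R ‖x‖),
    norm_div, Real.norm_of_nonneg hb.le, Real.norm_eq_abs]
  have h3 : |max R ‖y‖ - max R ‖x‖| / max R ‖y‖ * ‖y‖ ≤ ‖x - y‖ := by
    rw [div_mul_eq_mul_div, div_le_iff₀ hb]
    exact mul_le_mul h2 (le_max_right _ _) (norm_nonneg _) (norm_nonneg _)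
  calc R / max R ‖x‖ * ‖x - y‖ + R / max R ‖x‖ * (|max R ‖y‖ - max R ‖x‖| / max R ‖y‖) * ‖y‖
      ≤ 1 * ‖x - y‖ + 1 * (|max R ‖y‖ - max R ‖x‖| / max R ‖y‖ * ‖y‖) := by
        rw [mul_assoc]; gcongr
    _ ≤ 2 * ‖x - y‖ := by linarith

lemma retr_rpow_le (hR : 0 < R) (hκ0 : 0 ≤ κ) (hκ1 : κ ≤ 1) (x y : E) :
    ‖retr R x - retr R y‖ ^ κ ≤ 2 * ‖x - y‖ ^ κ := by
  calc ‖retr R x - retr R y‖ ^ κ ≤ (2 * ‖x - y‖) ^ κ := by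
        gcongr; exact norm_retr_sub_le hR x y
    _ = 2 ^ κ * ‖x - y‖ ^ κ := Real.mul_rpow (by norm_num) (norm_nonneg _)
    _ ≤ 2 * ‖x - y‖ ^ κ := by
        gcongr; exact Real.rpow_le_self_of_one_le (by norm_num) hκ1

lemma HB.retr {F : Type*} [NormedAddCommGroup F] {f : E → F} (hR : 0 < R) (hκ0 : 0 ≤ κ)
    (hκ1 : κ ≤ 1) (h : HB κ (Metric.closedBall 0 R) f K) :
    HB κ univ (fun x => f (retr R x)) (2 * K) := by
  have hK : 0 ≤ K := (norm_nonneg _).trans (h.b 0 (by simp [hR.le]))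
  refine ⟨fun x _ => (h.b _ (retr_mem hR x)).trans (by linarith), fun x _ y _ => ?_⟩
  refine (h.h _ (retr_mem hR x) _ (retr_mem hR y)).trans ?_
  have := retr_rpow_le hR hκ0 hκ1 x y
  nlinarith

lemma Coef.retr (hR : 0 < R) (hκ0 : 0 ≤ κ) (hκ1 : κ ≤ 1)
    (h : Coef κ Λ (Metric.closedBall 0 R) A B) :
    Coef κ (2 * Λ) univ (fun x => A (retr R x)) (fun x => B (retr R x)) := by
  have hA : HB κ (Metric.closedBall 0 R) A Λ := ⟨h.bA, h.hA⟩
  have hB : HB κ (Metric.closedBall 0 R) B Λ := ⟨h.bB, h.hB⟩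
  have hA' := hA.retr hR hκ0 hκ1
  have hB' := hB.retr hR hκ0 hκ1
  have h1 := h.one
  refine ⟨by linarith, hA'.b, hA'.h, hB'.b, hB'.h, fun x _ => h.symm _ (retr_mem hR x),
    fun x _ v => ?_⟩
  have := h.ell _ (retr_mem hR x) v
  nlinarith [sq_nonneg ‖v‖]

end Retraction

section Approx

set_option linter.unusedSectionVars false
set_option maxSynthPendingDepth 3

variable {E : Type*} [NormedAddCommGroup E] [InnerProductSpace ℝ E] [FiniteDimensional ℝ E]
  {κ M N Λ K R : ℝ} {A : E → (E →L[ℝ] E →L[ℝ] ℝ) →L[ℝ] ℝ} {B : E → (E →L[ℝ] ℝ) →L[ℝ] ℝ}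
  {α β : E → ℝ} {p : ℝ}

/-- Regular coefficients of the equation `u_t = A D²u + B Du + β u - α u ^ p` on a ball. -/
structure BallData (κ Λ R : ℝ) (A : E → (E →L[ℝ] E →L[ℝ] ℝ) →L[ℝ] ℝ) (B : E → (E →L[ℝ] ℝ) →L[ℝ] ℝ)
    (β α : E → ℝ) : Prop where
  pos : 0 < κ
  lt : κ < 1
  coef : Coef κ Λ (Metric.closedBall 0 R) A B
  hβ : HB κ (Metric.closedBall 0 R) β Λ
  hα : HB κ (Metric.closedBall 0 R) α Λ
  ell : ∀ x ∈ Metric.closedBall (0 : E) R, 1 ≤ Λ * α x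

lemma BallData.α_pos (D : BallData κ Λ R A B β α) {x : E} (hx : x ∈ Metric.closedBall (0 : E) R) :
    0 < α x := by
  have := D.ell x hx
  have := D.coef.one
  by_contra! h
  nlinarith

lemma abs_rpow_sub_rpow_le (hp : 1 ≤ p) {z w : ℝ} (hz : z ∈ Icc 0 N) (hw : w ∈ Icc 0 N) :
    |z ^ p - w ^ p| ≤ p * N ^ (p - 1) * |z - w| := by
  refine (convex_Icc (0 : ℝ) N).norm_image_sub_le_of_norm_hasDerivWithin_le
    (f' := fun x => p * x ^ (p - 1)) (fun x _ =>
      (Real.hasDerivAt_rpow_const (Or.inr hp)).hasDerivWithinAt) (fun x hx => ?_) hw hz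
  rw [Real.norm_of_nonneg (mul_nonneg (by linarith) (Real.rpow_nonneg hx.1 _))]
  have := Real.rpow_le_rpow hx.1 hx.2 (by linarith : 0 ≤ p - 1)
  gcongr

lemma exists_rpow_ge (hp : 1 < p) (Q : ℝ) : ∃ N : ℝ, 1 ≤ N ∧ Q ≤ N ^ (p - 1) := by
  refine ⟨max 1 Q ^ (p - 1)⁻¹, Real.one_le_rpow (le_max_left _ _) (by
    have : 0 < p - 1 := by linarith
    positivity), ?_⟩
  rw [← Real.rpow_mul (by positivity), inv_mul_cancel₀ (by linarith), Real.rpow_one]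
  exact le_max_right _ _

lemma reaction_lipschitz (hp : 1 ≤ p) {b b' a a' r z w : ℝ} (hb : |b - b'| ≤ K * r)
    (hb' : |b'| ≤ K) (ha : |a - a'| ≤ K * r) (ha' : |a'| ≤ K) (hr : 0 ≤ r)
    (hz : z ∈ Icc 0 N) (hw : w ∈ Icc 0 N) :
    |(b * z - a * z ^ p) - (b' * w - a' * w ^ p)|
      ≤ (K * N + K * N ^ p + K + K * (p * N ^ (p - 1))) * (r + |z - w|) := by
  have hK : 0 ≤ K := (abs_nonneg _).trans hb'
  have hN : 0 ≤ N := hz.1.trans hz.2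
  have e : (b * z - a * z ^ p) - (b' * w - a' * w ^ p)
      = (b - b') * z + b' * (z - w) - (a - a') * z ^ p - a' * (z ^ p - w ^ p) := by ring
  have h1 : |(b - b') * z| ≤ K * r * N := by
    rw [abs_mul, abs_of_nonneg hz.1]
    exact mul_le_mul hb hz.2 hz.1 (by positivity)
  have h2 : |b' * (z - w)| ≤ K * |z - w| := by
    rw [abs_mul]; gcongr
  have h3 : |(a - a') * z ^ p| ≤ K * r * N ^ p := by
    rw [abs_mul, abs_of_nonneg (Real.rpow_nonneg hz.1 _)]
    exact mul_le_mul ha (Real.rpow_le_rpow hz.1 hz.2 (by linarith)) (Real.rpow_nonneg hz.1 _)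
      (by positivity)
  have h4 : |a' * (z ^ p - w ^ p)| ≤ K * (p * N ^ (p - 1) * |z - w|) := by
    rw [abs_mul]
    exact mul_le_mul ha' (abs_rpow_sub_rpow_le hp hz hw) (abs_nonneg _) hK
  rw [e]
  have h5 : |(b - b') * z + b' * (z - w) - (a - a') * z ^ p - a' * (z ^ p - w ^ p)|
      ≤ |(b - b') * z| + |b' * (z - w)| + |(a - a') * z ^ p| + |a' * (z ^ p - w ^ p)| :=
    (abs_sub _ _).trans (add_le_add_left ((abs_sub _ _).trans
      (add_le_add_left (abs_add_le _ _) _)) _)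
  have q1 : 0 ≤ (K * N + K * N ^ p) * |z - w| := by positivity
  have q2 : 0 ≤ (K + K * (p * N ^ (p - 1))) * r := by positivity
  linarith

variable [MeasurableSpace E] [BorelSpace E]

/-- Solvability of the equation with a large source near the boundary of a ball. -/
theorem exists_approx (hp : 1 < p) {n G : ℝ} (hn : 0 ≤ n) (hG : 0 ≤ G)
    (D : BallData κ Λ (n + 3) A B β α) :
    ∃ v M, LC κ univ v M ∧ (∀ x t, 0 ≤ v x t) ∧
      IsSol (Metric.closedBall 0 (n + 3)) A B (fun x t => β x * v x t - α x * v x t ^ p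
        + G * max 0 (min n t) * max 0 (min 1 (‖x‖ - n))) v := by
  have hR : 0 < n + 3 := by linarith
  have hκ := D.pos
  have hΛ1 := D.coef.one
  have hA := D.coef.retr hR D.pos.le D.lt.le
  have hβ := D.hβ.retr hR D.pos.le D.lt.le
  have hα := D.hα.retr hR D.pos.le D.lt.le
  obtain ⟨N, hN1, hN⟩ := exists_rpow_ge hp (Λ * (Λ + G * n))
  have hτ : ∀ t, max 0 (min n t) ∈ Icc 0 n := fun t =>
    ⟨le_max_left _ _, max_le hn (min_le_left _ _)⟩
  have hψ : ∀ x : E, max 0 (min 1 (‖x‖ - n)) ∈ Icc 0 1 := fun x =>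
    ⟨le_max_left _ _, max_le zero_le_one (min_le_left _ _)⟩
  have hψl : ∀ x y : E, |max 0 (min 1 (‖x‖ - n)) - max 0 (min 1 (‖y‖ - n))| ≤ ‖x - y‖ ^ κ := by
    intro x y
    have h1 : |max 0 (min 1 (‖x‖ - n)) - max 0 (min 1 (‖y‖ - n))| ≤ ‖x - y‖ := by
      have k1 := abs_max_sub_max_le_abs (min 1 (‖x‖ - n)) (min 1 (‖y‖ - n)) 0
      have k2 := abs_min_sub_min_le_max 1 (‖x‖ - n) 1 (‖y‖ - n)
      rw [max_comm _ 0, max_comm _ 0] at k1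
      refine k1.trans (k2.trans ?_)
      simp only [sub_self, abs_zero, sub_sub_sub_cancel_right]
      exact max_le (norm_nonneg _) (abs_norm_sub_norm_le x y)
    have h2 : |max 0 (min 1 (‖x‖ - n)) - max 0 (min 1 (‖y‖ - n))| ≤ 1 := by
      have := hψ x; have := hψ y
      rw [abs_le]; constructor <;> linarith [(hψ x).1, (hψ y).1, (hψ x).2, (hψ y).2]
    have h3 := le_mul_rpow_of_le hκ.le D.lt.le (abs_nonneg _) le_rfl h2
    rw [one_mul] at h3
    exact h3.trans (by gcongr)
  have hgX : XC κ (fun (x : E) t => G * max 0 (min n t) * max 0 (min 1 (‖x‖ - n))) (G * n) := by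
    refine ⟨fun x => by fun_prop, fun x t => ?_, fun x y t => ?_, fun x t ht => ?_⟩
    · rw [abs_of_nonneg (mul_nonneg (mul_nonneg hG (hτ t).1) (hψ x).1)]
      calc _ ≤ G * n * 1 := by
            gcongr
            · exact (hτ t).2
            · exact (hψ x).2
        _ = G * n := mul_one _
    · rw [← mul_sub, abs_mul, abs_of_nonneg (mul_nonneg hG (hτ t).1)]
      gcongr
      · exact (hτ t).2
      · exact hψl x y
    · rw [max_eq_left ((min_le_right _ _).trans ht)]; ring
  obtain ⟨v, M, hv, hvN, hs⟩ := exists_semilinear (N := N)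
    (F := fun x z => β (retr (n + 3) x) * z - α (retr (n + 3) x) * z ^ p)
    hκ D.lt hA (fun x => by simp [Real.zero_rpow (by linarith : p ≠ 0)]) (by linarith)
    (K := 2 * Λ * N + 2 * Λ * N ^ p + 2 * Λ + 2 * Λ * (p * N ^ (p - 1))) (by positivity)
    (fun x y z hz w hw => reaction_lipschitz hp.le (hβ.h x trivial y trivial) (hβ.b y trivial)
      (hα.h x trivial y trivial) (hα.b y trivial) (by positivity) hz hw) hgX
    (fun x t => mul_nonneg (mul_nonneg hG (hτ t).1) (hψ x).1)
    (fun x t => by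
      have h1 := (le_abs_self _).trans (hgX.bdd x t)
      have hx := retr_mem hR x
      have h2 : β (retr (n + 3) x) ≤ Λ := (le_abs_self _).trans (D.hβ.b _ hx)
      have h3 := D.ell _ hx
      have h4 := D.α_pos hx
      have e : N ^ p = N ^ (p - 1) * N := by
        rw [← Real.rpow_add_one (by linarith)]; simp
      rw [e]
      have h5 : Λ + G * n ≤ α (retr (n + 3) x) * N ^ (p - 1) := by
        calc Λ + G * n ≤ (Λ * α (retr (n + 3) x)) * (Λ + G * n) :=
              le_mul_of_one_le_left (by positivity) h3
          _ = α (retr (n + 3) x) * (Λ * (Λ + G * n)) := by ring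
          _ ≤ _ := by gcongr
      have h6 : 0 ≤ G * n := by positivity
      nlinarith)
  refine ⟨v, M, hv, fun x t => (hvN x t).1, fun x hx t => ?_⟩
  have := hs x trivial t
  simpa only [retr_of_mem hR hx] using this

end Approx

section Lower

set_option linter.unusedSectionVars false
set_option maxSynthPendingDepth 3

variable {E : Type*} [NormedAddCommGroup E] [InnerProductSpace ℝ E] [FiniteDimensional ℝ E]
  {κ M N Λ K R : ℝ} {A : E → (E →L[ℝ] E →L[ℝ] ℝ) →L[ℝ] ℝ} {B : E → (E →L[ℝ] ℝ) →L[ℝ] ℝ}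
  {α β : E → ℝ} {p : ℝ}

lemma reaction_sub_le (hp : 0 ≤ p) {b a z w : ℝ} (hb : b ≤ M) (ha : 0 ≤ a) (hz : 0 ≤ z)
    (hzw : z ≤ w) : (b * w - a * w ^ p) - (b * z - a * z ^ p) ≤ M * (w - z) := by
  have h1 := Real.rpow_le_rpow hz hzw hp
  nlinarith [mul_le_mul_of_nonneg_left h1 ha]

set_option maxHeartbeats 1000000 in
/-- A large source near the boundary makes supersolutions large there. -/
lemma exists_source_lower_bound (hp : 1 < p) {n K : ℝ} (hn : 1 ≤ n) (hK : 0 ≤ K)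
    (D : BallData κ Λ (n + 3) A B β α) : ∃ G, 0 ≤ G ∧ ∀ v M, LC κ univ v M →
      (∀ x t, 0 ≤ v x t) → IsSol (Metric.closedBall 0 (n + 3)) A B (fun x t =>
        β x * v x t - α x * v x t ^ p + G * max 0 (min n t) * max 0 (min 1 (‖x‖ - n))) v →
      ∀ y : E, ‖y‖ = n + 2 → ∀ t ∈ Icc (1 / n) n, K ≤ v y t := by
  have hΛ := D.coef.one
  have hn0 : 0 < n := by linarith
  set c := K * n ^ 2 with hc
  have hc0 : 0 ≤ c := by positivity
  set P := (c * n ^ 2) ^ (p - 1) with hP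
  have hP0 : 0 ≤ P := by positivity
  refine ⟨2 * c + 5 * Λ * c * n + Λ * c * n * P, by positivity, fun v M hv hv0 hs y hy => ?_⟩
  set G := 2 * c + 5 * Λ * c * n + Λ * c * n * P with hG
  have hsub : Metric.closedBall y 1 ⊆ Metric.closedBall 0 (n + 3) :=
    Metric.closedBall_subset_closedBall' (by rw [dist_zero_right, hy]; linarith)
  have hsub' : ∀ x ∈ Metric.ball y 1, x ∈ Metric.closedBall (0 : E) (n + 3) := fun x hx =>
    hsub (Metric.ball_subset_closedBall hx)
  have hψ : ∀ x ∈ Metric.ball y 1, max 0 (min 1 (‖x‖ - n)) = 1 := fun x hx => by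
    have h1 : ‖y‖ ≤ ‖x‖ + ‖x - y‖ := by
      have := norm_sub_le x (x - y)
      rwa [sub_sub_cancel] at this
    have h2 := mem_ball_iff_norm.1 hx
    rw [min_eq_left (by linarith), max_eq_right zero_le_one]
  have hτ : ∀ t, 0 < t → t ≤ n → max 0 (min n t) = t := fun t h1 h2 => by
    rw [min_eq_right h2, max_eq_right h1.le]
  have key := comparison (A := A) (B := B) (c := y) (R := 1) (T := n) (M := Λ)
    (F := fun x t z => β x * z - α x * z ^ p + G * t)
    (u := fun x t => c * t ^ 2 + (-(c * t ^ 2)) * ‖x - y‖ ^ 2) (v := v)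
    (fun x hx T hT => D.coef.nonneg (hsub' x hx) hT)
    (fun x hx t _ _ h => by
      have := reaction_sub_le (p := p) (by linarith) ((le_abs_self _).trans (D.hβ.b x (hsub' x hx)))
        (D.α_pos (hsub' x hx)).le (hv0 x t) h
      linarith)
    (by fun_prop) hv.continuous.continuousOn
    (fun x _ => by simpa using hv0 x 0)
    (fun x hx t _ => by
      have : ‖x - y‖ = 1 := mem_sphere_iff_norm.1 hx
      simp only [this]
      have := hv0 x t
      linarith)
    (fun x hx t ht htn => by
      have hx' := hsub' x hx
      obtain ⟨q0, q1, q2⟩ := C2At.quad (fun t => c * t ^ 2) (fun t => -(c * t ^ 2)) y x t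
      have hd : HasDerivAt (fun t => c * t ^ 2 + (-(c * t ^ 2)) * ‖x - y‖ ^ 2)
          (2 * c * t * (1 - ‖x - y‖ ^ 2)) t := by
        have h := ((hasDerivAt_pow 2 t).const_mul c)
        exact (h.add (h.neg.mul_const (‖x - y‖ ^ 2))).congr_deriv (by simp; ring)
      refine ⟨q0, _, hd, ?_⟩
      rw [q1, q2]
      have hr : ‖x - y‖ < 1 := mem_ball_iff_norm.1 hx
      have hr0 := norm_nonneg (x - y)
      have hr2 : ‖x - y‖ ^ 2 ≤ 1 := by nlinarith
      have hr20 : 0 ≤ ‖x - y‖ ^ 2 := by positivity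
      have hct : 0 ≤ c * t ^ 2 := by positivity
      have habs : ‖2 * -(c * t ^ 2)‖ = 2 * (c * t ^ 2) := by
        rw [Real.norm_eq_abs, abs_mul, abs_neg, abs_of_nonneg hct]; norm_num
      have hA : -(2 * Λ * (c * t ^ 2)) ≤ A x ((2 * -(c * t ^ 2)) • inS E) := by
        have h1 := (A x).le_opNorm ((2 * -(c * t ^ 2)) • inS E)
        have h2 : ‖(2 * -(c * t ^ 2)) • inS E‖ ≤ 2 * (c * t ^ 2) * 1 := by
          rw [norm_smul, habs]; gcongr; exact norm_inS_le
        have h3 := h1.trans (mul_le_mul (D.coef.bA x hx') h2 (norm_nonneg _) (by linarith))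
        have := (abs_le.1 h3).1
        linarith
      have hB : -(2 * Λ * (c * t ^ 2)) ≤ B x ((2 * -(c * t ^ 2)) • inS E (x - y)) := by
        have h1 := (B x).le_opNorm ((2 * -(c * t ^ 2)) • inS E (x - y))
        have h2 : ‖(2 * -(c * t ^ 2)) • inS E (x - y)‖ ≤ 2 * (c * t ^ 2) * 1 := by
          rw [norm_smul, habs]; gcongr; exact (norm_inS_apply_le _).trans hr.le
        have h3 := h1.trans (mul_le_mul (D.coef.bB x hx') h2 (norm_nonneg _) (by linarith))
        have := (abs_le.1 h3).1
        linarith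
      set w := c * t ^ 2 + (-(c * t ^ 2)) * ‖x - y‖ ^ 2 with hw
      have hw0 : 0 ≤ w := by nlinarith
      have hw1 : w ≤ c * t ^ 2 := by nlinarith
      have hw2 : w ≤ c * n ^ 2 := hw1.trans (by gcongr)
      have hwp : w ^ p ≤ P * (c * t ^ 2) := by
        have e : w ^ p = w ^ (p - 1) * w := by
          rw [← Real.rpow_add_one' hw0 (by linarith)]; simp
        rw [e]
        exact mul_le_mul (Real.rpow_le_rpow hw0 hw2 (by linarith)) hw1 hw0 hP0
      have hβ : -(Λ * (c * t ^ 2)) ≤ β x * w := by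
        have := (abs_le.1 (D.hβ.b x hx')).1
        nlinarith
      have hα : α x * w ^ p ≤ Λ * (P * (c * t ^ 2)) :=
        mul_le_mul ((le_abs_self _).trans (D.hα.b x hx')) hwp (Real.rpow_nonneg hw0 _) (by linarith)
      have hct2 : c * t ^ 2 ≤ c * n * t := by
        have : t ^ 2 ≤ n * t := by nlinarith
        nlinarith
      have hd2 : 2 * c * t * (1 - ‖x - y‖ ^ 2) ≤ 2 * c * t := by
        have : 0 ≤ 2 * c * t * ‖x - y‖ ^ 2 := by positivity
        linarith
      have hGt : G * t = 2 * c * t + 5 * Λ * (c * n * t) + Λ * (P * (c * n * t)) := by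
        rw [hG]; ring
      have k1 : 5 * Λ * (c * t ^ 2) ≤ 5 * Λ * (c * n * t) := by gcongr
      have k2 : Λ * (P * (c * t ^ 2)) ≤ Λ * (P * (c * n * t)) := by gcongr
      rw [hGt]
      linarith)
    (fun x hx t ht htn => by
      refine ⟨hv.c2At isOpen_univ (mem_univ x) t, _, hs x (hsub' x hx) t, ?_⟩
      beta_reduce
      rw [hψ x hx, hτ t ht htn, mul_one])
  intro t ht
  have := key y (by simp) t ⟨(by positivity : 0 ≤ 1 / n).trans ht.1, ht.2⟩
  simp only [sub_self, norm_zero] at this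
  have h1 : 1 ≤ n * t := by
    have := ht.1
    rwa [div_le_iff₀ hn0, mul_comm] at this
  have h2 : K ≤ c * t ^ 2 := by
    have e : c * t ^ 2 = K * (n * t) ^ 2 := by rw [hc]; ring
    rw [e]
    exact le_mul_of_one_le_right hK (one_le_pow₀ h1)
  linarith

variable [MeasurableSpace E] [BorelSpace E]

/-- Approximate solutions dominating a given subsolution. -/
theorem exists_approx_ge (hp : 1 < p) {n : ℝ} (hn : 1 ≤ n) (D : BallData κ Λ (n + 3) A B β α)
    {u : E → ℝ → ℝ} (huc : ContinuousOn (fun q : E × ℝ => u q.1 q.2) (univ ×ˢ Ici 0))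
    (hu0 : ∀ x, u x 0 = 0)
    (hu : ∀ x t, 0 < t → SubAt A B (fun x _ z => β x * z - α x * z ^ p) u x t) :
    ∃ v M, LC κ univ v M ∧ (∀ x t, 0 ≤ v x t) ∧
      (∃ g : E → ℝ → ℝ, (∀ x t, 0 ≤ g x t) ∧ (∀ x t, ‖x‖ ≤ n → g x t = 0) ∧
      IsSol (Metric.closedBall 0 (n + 3)) A B (fun x t =>
        β x * v x t - α x * v x t ^ p + g x t) v) ∧
      ∀ x ∈ Metric.closedBall (0 : E) (n + 2), ∀ t ∈ Icc (1 / n) n, u x (t - 1 / n) ≤ v x t := by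
  have : ProperSpace E := FiniteDimensional.proper_real E
  have hn0 : 0 < n := by linarith
  have hcpt : IsCompact (Metric.closedBall (0 : E) (n + 2) ×ˢ Icc (0 : ℝ) n) :=
    (isCompact_closedBall _ _).prod isCompact_Icc
  obtain ⟨K, hK⟩ := hcpt.exists_bound_of_continuousOn
    (huc.mono (prod_mono (subset_univ _) Icc_subset_Ici_self))
  have hK0 : 0 ≤ K := (norm_nonneg _).trans (hK (0, 0) ⟨by simp; linarith, by simp; linarith⟩)
  obtain ⟨G, hG, hlow⟩ := exists_source_lower_bound hp hn hK0 D
  obtain ⟨v, M, hv, hv0, hs⟩ := exists_approx hp hn0.le hG D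
  have hl := hlow v M hv hv0 hs
  have hin : ∀ x ∈ Metric.ball (0 : E) (n + 2), x ∈ Metric.closedBall (0 : E) (n + 3) := fun x hx =>
    Metric.ball_subset_closedBall (Metric.ball_subset_ball (by linarith) hx)
  have hg0 : ∀ (x : E) t, 0 ≤ G * max 0 (min n t) * max 0 (min 1 (‖x‖ - n)) := fun x t => by
    positivity
  refine ⟨v, M, hv, hv0, ⟨_, hg0, fun x t hx => ?_, hs⟩, fun x hx t ht => ?_⟩
  · have : max 0 (min 1 (‖x‖ - n)) = 0 := max_eq_left ((min_le_right _ _).trans (by linarith))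
    simp only [this, mul_zero]
  have hnn : 0 ≤ 1 / n := by positivity
  have key := comparison (A := A) (B := B) (c := 0) (R := n + 2) (T := n - 1 / n) (M := Λ)
    (F := fun x t z => β x * z - α x * z ^ p) (u := u) (v := fun x t => v x (t + 1 / n))
    (fun x hx T hT => D.coef.nonneg (hin x hx) hT)
    (fun x hx t _ _ h => reaction_sub_le (p := p) (by linarith)
      ((le_abs_self _).trans (D.hβ.b x (hin x hx))) (D.α_pos (hin x hx)).le (hv0 x _) h)
    (huc.mono (prod_mono (subset_univ _) Icc_subset_Ici_self))
    (hv.continuous.comp (by fun_prop :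
      Continuous fun q : E × ℝ => (q.1, q.2 + 1 / n))).continuousOn
    (fun x _ => by rw [hu0]; exact hv0 _ _)
    (fun x hx t ht => by
      have h1 := (le_abs_self _).trans (hK (x, t) ⟨Metric.sphere_subset_closedBall hx, ht.1,
        by linarith [ht.2]⟩)
      exact h1.trans (hl x (mem_sphere_zero_iff_norm.1 hx) _ ⟨by linarith [ht.1],
        by linarith [ht.2]⟩))
    (fun x hx t ht _ => hu x t ht)
    (fun x hx t ht _ => by
      refine ⟨?_, _, (hs x (hin x hx) (t + 1 / n)).comp_add_const t (1 / n), ?_⟩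
      · have := hv.c2At isOpen_univ (mem_univ x) (t + 1 / n)
        exact ⟨this.d1, this.d2⟩
      · have := hg0 x (t + 1 / n)
        change A x (D2 v x (t + 1 / n)) + B x (D1 v x (t + 1 / n)) + _ ≤ _
        linarith)
  have := key x hx (t - 1 / n) ⟨by linarith [ht.1], by linarith [ht.2]⟩
  simpa using this

end Lower

section Upper

set_option linter.unusedSectionVars false
set_option maxSynthPendingDepth 3

variable {E : Type*} [NormedAddCommGroup E] [InnerProductSpace ℝ E] [FiniteDimensional ℝ E]
  {κ M N Λ K R : ℝ} {A : E → (E →L[ℝ] E →L[ℝ] ℝ) →L[ℝ] ℝ} {B : E → (E →L[ℝ] ℝ) →L[ℝ] ℝ}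
  {α β : E → ℝ} {p : ℝ}

lemma hasDerivAt_barrier {c k r q : ℝ} (h : q < r) :
    HasDerivAt (fun q => c * (r - q) ^ (-k)) (c * k * (r - q) ^ (-k - 1)) q := by
  have h1 := ((hasDerivAt_id q).const_sub r).rpow_const (p := -k) (Or.inl (by simp; linarith))
  exact (h1.const_mul c).congr_deriv (by simp; ring)

set_option maxHeartbeats 1000000 in
/-- Stationary supersolutions that blow up at the boundary of a ball. -/
lemma exists_blowup_super (hp : 1 < p) (hR : 0 < R) (D : BallData κ Λ R A B β α) :
    ∃ c : ℝ, 1 ≤ c ∧ ∀ x ∈ Metric.ball (0 : E) R, ∀ t, SuperAt A B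
      (fun x _ z => β x * z - α x * z ^ p)
      (fun x _ => c * (R ^ 2 - ‖x - 0‖ ^ 2) ^ (-(2 / (p - 1)))) x t := by
  have hΛ := D.coef.one
  have hp0 : 0 < p - 1 := by linarith
  set k := 2 / (p - 1) with hk
  have hk0 : 0 < k := by positivity
  set C := 2 * k * R ^ 2 + 4 * (k * (k + 1)) * R ^ 2 + 2 * k * R ^ 2 * R + R ^ 4 with hC
  obtain ⟨c, hc1, hc⟩ := exists_rpow_ge hp (Λ ^ 2 * C)
  refine ⟨c, hc1, fun x hx t => ?_⟩
  have hc0 : 0 < c := by linarith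
  have hxR : ‖x‖ < R := mem_ball_zero_iff.1 hx
  have hx' := Metric.ball_subset_closedBall hx
  have hx0 := norm_nonneg x
  have hq0 : ‖x - 0‖ ^ 2 < R ^ 2 := by
    rw [sub_zero]; gcongr
  obtain ⟨q0, q1, q2⟩ := D2_radial (g := fun q _ => c * (R ^ 2 - q) ^ (-k))
    (g1 := fun q _ => c * k * (R ^ 2 - q) ^ (-k - 1))
    (g2 := c * k * (k + 1) * (R ^ 2 - ‖x - 0‖ ^ 2) ^ (-k - 2)) (c := (0 : E)) (x := x) (t := t)
    (by
      filter_upwards [gt_mem_nhds hq0] with q hq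
      exact hasDerivAt_barrier hq)
    (by
      have h := hasDerivAt_barrier (c := c * k) (k := k + 1) hq0
      have e1 : -(k + 1) = -k - 1 := by ring
      have e2 : -k - 1 - 1 = -k - 2 := by ring
      rwa [e1, e2] at h)
  refine ⟨q0, 0, hasDerivAt_const _ _, ?_⟩
  rw [q1, q2, sub_zero]
  rw [sub_zero] at hq0
  set q := R ^ 2 - ‖x‖ ^ 2 with hq
  have hqp : 0 < q := by linarith
  have hqR : q ≤ R ^ 2 := by linarith [sq_nonneg ‖x‖]
  set Q := c * q ^ (-k - 2) with hQ
  have hQ0 : 0 < Q := by positivity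
  have e1 : c * k * q ^ (-k - 1) = k * Q * q := by
    have : q ^ (-k - 1) = q ^ (-k - 2) * q := by
      rw [← Real.rpow_add_one hqp.ne']; ring_nf
    rw [this, hQ]; ring
  have e2 : c * q ^ (-k) = Q * q ^ 2 := by
    have : q ^ (-k) = q ^ (-k - 2) * q ^ 2 := by
      rw [← Real.rpow_natCast, ← Real.rpow_add hqp]; norm_num
    rw [this, hQ]; ring
  have e3 : (c * q ^ (-k)) ^ p = c ^ (p - 1) * Q := by
    have h1 : -k * p = -k - 2 := by
      have : k * (p - 1) = 2 := by rw [hk]; field_simp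
      linarith
    rw [Real.mul_rpow hc0.le (by positivity), ← Real.rpow_mul hqp.le, h1, hQ, ← mul_assoc,
      ← Real.rpow_add_one hc0.ne']
    simp
  have e4 : c * k * (k + 1) * q ^ (-k - 2) = k * (k + 1) * Q := by rw [hQ]; ring
  rw [e3, e1, e2, e4]
  have nI := norm_inS_apply_le x
  have hA : A x ((2 * (k * Q * q)) • inS E + (4 * (k * (k + 1) * Q)) •
      (inS E x).smulRight (inS E x)) ≤ Λ * (2 * (k * Q * R ^ 2) + 4 * (k * (k + 1) * Q) * R ^ 2) := by
    refine (le_abs_self _).trans (((A x).le_opNorm _).trans (mul_le_mul (D.coef.bA x hx') ?_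
      (norm_nonneg _) (by linarith)))
    refine (norm_add_le _ _).trans ?_
    rw [norm_smul, norm_smul, ContinuousLinearMap.norm_smulRight_apply,
      Real.norm_of_nonneg (by positivity), Real.norm_of_nonneg (by positivity)]
    have h1 : ‖inS E‖ ≤ 1 := norm_inS_le
    have h2 : ‖inS E x‖ * ‖inS E x‖ ≤ R ^ 2 := by
      nlinarith [norm_nonneg (inS E x)]
    calc 2 * (k * Q * q) * ‖inS E‖ + 4 * (k * (k + 1) * Q) * (‖inS E x‖ * ‖inS E x‖)
        ≤ 2 * (k * Q * R ^ 2) * 1 + 4 * (k * (k + 1) * Q) * R ^ 2 := by gcongr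
      _ = _ := by ring
  have hB : B x ((2 * (k * Q * q)) • inS E x) ≤ Λ * (2 * (k * Q * R ^ 2) * R) := by
    refine (le_abs_self _).trans (((B x).le_opNorm _).trans (mul_le_mul (D.coef.bB x hx') ?_
      (norm_nonneg _) (by linarith)))
    rw [norm_smul, Real.norm_of_nonneg (by positivity)]
    gcongr
    exact nI.trans hxR.le
  have hβ : β x * (Q * q ^ 2) ≤ Λ * (Q * R ^ 4) := by
    have h1 : β x ≤ Λ := (le_abs_self _).trans (D.hβ.b x hx')
    have h2 : q ^ 2 ≤ R ^ 4 := by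
      calc q ^ 2 ≤ (R ^ 2) ^ 2 := by gcongr
        _ = R ^ 4 := by ring
    calc β x * (Q * q ^ 2) ≤ Λ * (Q * q ^ 2) := by gcongr
      _ ≤ _ := by gcongr
  have hα : Λ * C ≤ α x * c ^ (p - 1) := by
    have hαp := D.α_pos hx'
    have hC0 : 0 ≤ C := by positivity
    calc Λ * C ≤ Λ * C * (Λ * α x) := le_mul_of_one_le_right (by positivity) (D.ell x hx')
      _ = α x * (Λ ^ 2 * C) := by ring
      _ ≤ _ := by gcongr
  have hα' := mul_le_mul_of_nonneg_right hα hQ0.le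
  have e5 : Λ * C * Q = Λ * (2 * (k * Q * R ^ 2) + 4 * (k * (k + 1) * Q) * R ^ 2)
      + Λ * (2 * (k * Q * R ^ 2) * R) + Λ * (Q * R ^ 4) := by
    rw [hC]; ring
  rw [mul_assoc] at hα'
  linarith

/-- Interior bounds independent of the solution. -/
theorem exists_interior_bound (hp : 1 < p) (hp2 : p ≤ 2) (hR : 0 < R)
    (D : BallData κ Λ R A B β α) : ∃ C, ∀ v κ' M, LC κ' univ v M → (∀ x t, 0 ≤ v x t) →
      IsSol (Metric.ball 0 R) A B (fun x t => β x * v x t - α x * v x t ^ p) v →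
      ∀ x ∈ Metric.closedBall (0 : E) (R / 2), ∀ t, v x t ≤ C := by
  obtain ⟨c, hc1, hc⟩ := exists_blowup_super hp hR D
  set k := 2 / (p - 1) with hk
  have hk1 : 1 ≤ k := by
    rw [hk, le_div_iff₀ (by linarith)]; linarith
  refine ⟨c * (R ^ 2 * (3 / 4)) ^ (-k), fun v κ' M hv hv0 hs x hx t => ?_⟩
  rcases le_total t 0 with ht | ht
  · rw [hv.zero x trivial t ht]; positivity
  set ε := min (1 / max 1 M) (R ^ 2 / 2) with hε
  have hM1 : 0 < max 1 M := by positivity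
  have hε0 : 0 < ε := lt_min (by positivity) (by positivity)
  have hεR : ε ≤ R ^ 2 / 2 := min_le_right _ _
  have hεM : M ≤ ε ^ (-k) := by
    have h1 : ε ≤ 1 / max 1 M := min_le_left _ _
    have h2 : ε ≤ 1 := h1.trans ((div_le_one hM1).2 (le_max_left _ _))
    calc M ≤ max 1 M := le_max_right _ _
      _ ≤ ε⁻¹ := by rw [le_inv_comm₀ hM1 hε0, ← one_div]; exact h1
      _ = ε ^ (-1 : ℝ) := (Real.rpow_neg_one ε).symm
      _ ≤ ε ^ (-k) := Real.rpow_le_rpow_of_exponent_ge hε0 h2 (by linarith)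
  set R' := √(R ^ 2 - ε) with hR'
  have hRs : R' ^ 2 = R ^ 2 - ε := Real.sq_sqrt (by nlinarith)
  have hR'0 : 0 ≤ R' := Real.sqrt_nonneg _
  have hR'R : R' < R := by nlinarith
  have hR'2 : R / 2 ≤ R' := by nlinarith
  have hsub : Metric.ball (0 : E) R' ⊆ Metric.ball 0 R := Metric.ball_subset_ball hR'R.le
  have key := comparison (A := A) (B := B) (c := 0) (R := R') (T := t) (M := Λ)
    (F := fun x _ z => β x * z - α x * z ^ p) (u := v)
    (v := fun x _ => c * (R ^ 2 - ‖x - 0‖ ^ 2) ^ (-k))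
    (fun x hx T hT => D.coef.nonneg (Metric.ball_subset_closedBall (hsub hx)) hT)
    (fun x hx s _ _ h => by
      have hx' := Metric.ball_subset_closedBall (hsub hx)
      refine reaction_sub_le (p := p) (by linarith)
        ((le_abs_self _).trans (D.hβ.b x hx')) (D.α_pos hx').le ?_ h
      have := mem_ball_iff_norm.1 (hsub hx)
      have h2 : ‖x - 0‖ ^ 2 ≤ R ^ 2 := by gcongr
      have := Real.rpow_nonneg (sub_nonneg.2 h2) (-k)
      positivity)
    hv.continuous.continuousOn
    (by
      refine continuousOn_const.mul (ContinuousOn.rpow_const (by fun_prop) fun q hq => Or.inl ?_)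
      have := mem_closedBall_iff_norm.1 hq.1
      have h2 : ‖q.1 - 0‖ ^ 2 ≤ R' ^ 2 := by gcongr
      exact (by linarith : 0 < R ^ 2 - ‖q.1 - 0‖ ^ 2).ne')
    (fun x hx => by
      rw [hv.zero x trivial 0 le_rfl]
      have := mem_closedBall_iff_norm.1 hx
      have h2 : ‖x - 0‖ ^ 2 ≤ R' ^ 2 := by gcongr
      have := Real.rpow_nonneg (by linarith : 0 ≤ R ^ 2 - ‖x - 0‖ ^ 2) (-k)
      positivity)
    (fun x hx s _ => by
      have : ‖x - 0‖ = R' := mem_sphere_iff_norm.1 hx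
      rw [this, hRs, sub_sub_cancel]
      have h1 := (le_abs_self _).trans (hv.b0 x trivial s)
      have h2 : 0 < ε ^ (-k) := by positivity
      nlinarith)
    (fun x hx s _ _ => ⟨hv.c2At isOpen_univ (mem_univ x) s, _, hs x (hsub hx) s, le_rfl⟩)
    (fun x hx s _ _ => hc x (hsub hx) s)
  refine (key x (Metric.closedBall_subset_closedBall hR'2 hx) t ⟨ht, le_rfl⟩).trans ?_
  have h1 : ‖x - 0‖ ≤ R / 2 := mem_closedBall_iff_norm.1 hx
  have h2 : ‖x - 0‖ ^ 2 ≤ (R / 2) ^ 2 := by gcongr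
  have h3 : R ^ 2 * (3 / 4) ≤ R ^ 2 - ‖x - 0‖ ^ 2 := by linarith
  have := Real.rpow_le_rpow_of_nonpos (by positivity) h3 (by linarith : -k ≤ 0)
  gcongr

end Upper

section Interior

set_option linter.unusedSectionVars false
set_option maxSynthPendingDepth 3

variable {E : Type*} [NormedAddCommGroup E] [InnerProductSpace ℝ E] [FiniteDimensional ℝ E]
  {κ M N Λ K R : ℝ} {A : E → (E →L[ℝ] E →L[ℝ] ℝ) →L[ℝ] ℝ} {B : E → (E →L[ℝ] ℝ) →L[ℝ] ℝ}
  {α β : E → ℝ} {p : ℝ}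

lemma reaction_abs_le (hp : 0 ≤ p) {b a z : ℝ} (hb : |b| ≤ K) (ha : |a| ≤ K) (hz : z ∈ Icc 0 N) :
    |b * z - a * z ^ p| ≤ K * N + K * N ^ p := by
  have hK : 0 ≤ K := (abs_nonneg _).trans hb
  have hz' := Real.rpow_nonneg hz.1 p
  refine (abs_sub _ _).trans (add_le_add ?_ ?_)
  · rw [abs_mul, abs_of_nonneg hz.1]
    exact mul_le_mul hb hz.2 hz.1 hK
  · rw [abs_mul, abs_of_nonneg hz']
    exact mul_le_mul ha (Real.rpow_le_rpow hz.1 hz.2 hp) hz' hK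

variable [MeasurableSpace E] [BorelSpace E]

set_option maxHeartbeats 1000000 in
/-- Interior regularity estimates independent of the solution. -/
theorem exists_interior_LC (hp : 1 < p) (hp2 : p ≤ 2) (x0 : E) (hR : R = 2 * (‖x0‖ + 3))
    (D : BallData κ Λ R A B β α) : ∃ P, ∀ v κ' M, 0 < κ' → LC κ' univ v M →
      (∀ x t, 0 ≤ v x t) →
      IsSol (Metric.ball 0 R) A B (fun x t => β x * v x t - α x * v x t ^ p) v →
      LC κ (Metric.ball x0 (1 / 2)) v P ∧ ∀ x ∈ Metric.ball x0 (1 / 2), ∀ t, v x t ≤ P := by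
  have hx0 := norm_nonneg x0
  have hR0 : 0 < R := by linarith
  have hΛ := D.coef.one
  have hκ := D.pos
  obtain ⟨C, hC⟩ := exists_interior_bound hp hp2 hR0 D
  set N := max C 0 with hN
  have hN0 : 0 ≤ N := le_max_right _ _
  set Kf := Λ * N + Λ * N ^ p + Λ + Λ * (p * N ^ (p - 1)) with hKf
  have hKf0 : 0 ≤ Kf := by positivity
  obtain ⟨C', hC'1, hC'⟩ := interior_estimate (E := E) (K1 := 2 * Kf) hκ D.lt
    (by linarith : 1 ≤ 2 * Λ) (by positivity)
  set K := N + Kf + (Λ * N + Λ * N ^ p) with hK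
  have hNp : 0 ≤ Λ * N + Λ * N ^ p := by positivity
  have hKN : N ≤ C' * K := by
    have : N ≤ K := by linarith
    nlinarith
  refine ⟨C' * K, fun v κ' M hκ' hv hv0 hs => ?_⟩
  have h3R : ∀ x ∈ Metric.ball x0 3, x ∈ Metric.ball (0 : E) R ∧
      x ∈ Metric.closedBall (0 : E) (R / 2) ∧ x ∈ Metric.closedBall (0 : E) R := fun x hx => by
    have h1 := mem_ball_iff_norm.1 hx
    have h2 := norm_add_le x0 (x - x0)
    rw [add_sub_cancel] at h2
    rw [mem_ball_zero_iff, mem_closedBall_zero_iff, mem_closedBall_zero_iff]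
    exact ⟨by linarith, by linarith, by linarith⟩
  have hvN : ∀ x ∈ Metric.ball x0 3, ∀ t, v x t ∈ Icc 0 N := fun x hx t =>
    ⟨hv0 x t, (hC v κ' M hv hv0 hs x (h3R x hx).2.1 t).trans (le_max_left _ _)⟩
  set f : E → ℝ → ℝ := fun x t => β x * v x t - α x * v x t ^ p with hf
  have hfl : ∀ x ∈ Metric.ball x0 3, ∀ y ∈ Metric.ball x0 3, ∀ t,
      |f x t - f y t| ≤ Kf * (‖x - y‖ ^ κ + |v x t - v y t|) := fun x hx y hy t => by
    have hx' := (h3R x hx).2.2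
    have hy' := (h3R y hy).2.2
    exact reaction_lipschitz hp.le (D.hβ.h x hx' y hy') (D.hβ.b y hy')
      (D.hα.h x hx' y hy') (D.hα.b y hy') (by positivity) (hvN x hx t) (hvN y hy t)
  have hfb : ∀ x ∈ Metric.ball x0 3, ∀ t, |f x t| ≤ Λ * N + Λ * N ^ p := fun x hx t =>
    reaction_abs_le (by linarith) (D.hβ.b x (h3R x hx).2.2) (D.hα.b x (h3R x hx).2.2) (hvN x hx t)
  have hfc : ∀ x, Continuous (f x) := fun x => by
    have h1 : Continuous (v x) := hv.continuous.comp (by fun_prop : Continuous fun t => (x, t))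
    have h2 : Continuous fun t => v x t ^ p :=
      h1.rpow_const fun t => Or.inr (by linarith)
    simp only [hf]
    fun_prop
  have hf0 : ∀ x, ∀ t ≤ 0, f x t = 0 := fun x t ht => by
    simp [hf, hv.zero x trivial t ht, Real.zero_rpow (by linarith : p ≠ 0)]
  have hM := hv.nonneg (mem_univ x0)
  have hA := D.coef.retr hR0 hκ.le D.lt.le
  have hs' : IsSol (Metric.ball x0 3) (fun x => A (retr R x)) (fun x => B (retr R x)) f v :=
    fun x hx t => by
      simp only [retr_of_mem hR0 (h3R x hx).2.2]
      exact hs x (h3R x hx).1 t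
  obtain ⟨M', hM'⟩ := LC.upgrade (K := (Λ * N + Λ * N ^ p) + Kf * (1 + M * 6)) hκ' hκ D.lt hA hv hs'
    (fun x _ => hfc x) (fun x _ => hf0 x) (fun t => by
      have hnn : 0 ≤ Kf * (1 + M * 6) := by positivity
      refine ⟨fun x hx => (hfb x hx t).trans (by linarith), fun x hx y hy => ?_⟩
      have h1 := (hv.lipschitz convex_univ (mem_univ x) (mem_univ y) t).1
      have h2 : ‖x - y‖ ≤ 6 * ‖x - y‖ ^ κ := by
        refine le_mul_rpow_of_le hκ.le D.lt.le (norm_nonneg _) (by norm_num) ?_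
        rw [← dist_eq_norm]
        have := dist_triangle_right x y x0
        have := Metric.mem_ball.1 hx
        have := Metric.mem_ball.1 hy
        linarith
      have h3 : 0 ≤ ‖x - y‖ ^ κ := by positivity
      calc ‖f x t - f y t‖ ≤ Kf * (‖x - y‖ ^ κ + |v x t - v y t|) := hfl x hx y hy t
        _ ≤ Kf * (‖x - y‖ ^ κ + M * (6 * ‖x - y‖ ^ κ)) := by gcongr; exact h1.trans (by gcongr)
        _ = (Kf * (1 + M * 6)) * ‖x - y‖ ^ κ := by ring
        _ ≤ _ := by gcongr; linarith)
  have h13 : Metric.ball x0 1 ⊆ Metric.ball x0 3 := Metric.ball_subset_ball (by norm_num)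
  have hA1 : Coef κ (2 * Λ) (Metric.ball x0 1) (fun x => A (retr R x)) (fun x => B (retr R x)) :=
    ⟨hA.one, fun x _ => hA.bA x trivial, fun x _ y _ => hA.hA x trivial y trivial,
      fun x _ => hA.bB x trivial, fun x _ y _ => hA.hB x trivial y trivial,
      fun x _ => hA.symm x trivial, fun x _ => hA.ell x trivial⟩
  refine ⟨hC' _ _ f v x0 K M' hA1 hM' (fun x hx => hs' x (h13 hx)) (fun x _ => hfc x)
    (fun x _ => hf0 x) (fun x hx t => ?_) (fun x hx t => (hfb x (h13 hx) t).trans (by linarith))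
    (fun r hr hr1 G hG hGb x hx y hy t => ?_), fun x hx t => ?_⟩
  · have := hvN x (h13 hx) t
    rw [abs_of_nonneg this.1]
    linarith [this.2]
  · have hr3 : Metric.ball x0 r ⊆ Metric.ball x0 3 := Metric.ball_subset_ball (by linarith)
    have h1 : |v x t - v y t| ≤ G * ‖x - y‖ :=
      (convex_ball x0 r).norm_image_sub_le_of_norm_hasFDerivWithin_le (f := fun y => v y t)
        (fun z _ => (hv.d1 z trivial t).hasFDerivWithinAt) (fun z hz => hGb z hz t) hy hx
    have h2 : ‖x - y‖ ≤ 2 * ‖x - y‖ ^ κ := by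
      refine le_mul_rpow_of_le hκ.le D.lt.le (norm_nonneg _) (by norm_num) ?_
      rw [← dist_eq_norm]
      have := dist_triangle_right x y x0
      have := Metric.mem_ball.1 hx
      have := Metric.mem_ball.1 hy
      linarith
    have h3 : 0 ≤ ‖x - y‖ ^ κ := by positivity
    calc |f x t - f y t| ≤ Kf * (‖x - y‖ ^ κ + |v x t - v y t|) := hfl x (hr3 hx) y (hr3 hy) t
      _ ≤ Kf * (‖x - y‖ ^ κ + G * (2 * ‖x - y‖ ^ κ)) := by gcongr; exact h1.trans (by gcongr)
      _ = (Kf + 2 * Kf * G) * ‖x - y‖ ^ κ := by ring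
      _ ≤ _ := by gcongr; linarith
  · exact (hvN x (Metric.ball_subset_ball (by norm_num) hx) t).2.trans hKN

set_option maxHeartbeats 1000000 in
/-- A subsolution vanishing initially is dominated by a solution vanishing initially. -/
theorem exists_solution_ge (hp : 1 < p) (hp2 : p ≤ 2)
    (hD : ∀ R, 0 < R → ∃ κ Λ, BallData κ Λ R A B β α)
    {u : E → ℝ → ℝ} (huc : ContinuousOn (fun q : E × ℝ => u q.1 q.2) (univ ×ˢ Ici 0))
    (hu0 : ∀ x, u x 0 = 0)
    (hu : ∀ x t, 0 < t → SubAt A B (fun x _ z => β x * z - α x * z ^ p) u x t) :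
    ∃ U : E → ℝ → ℝ, (∀ x0, ∃ κ M, 0 < κ ∧ LC κ (Metric.ball x0 (1 / 2)) U M) ∧
      IsSol univ A B (fun x t => β x * U x t - α x * U x t ^ p) U ∧ (∀ x t, 0 ≤ U x t) ∧
      ∀ x t, 0 ≤ t → u x t ≤ U x t := by
  have hn1 : ∀ n : ℕ, (1 : ℝ) ≤ n + 1 := fun n => by
    have : (0 : ℝ) ≤ n := n.cast_nonneg
    linarith
  have hex : ∀ n : ℕ, ∃ v : E → ℝ → ℝ, ∃ κ M, 0 < κ ∧ LC κ univ v M ∧ (∀ x t, 0 ≤ v x t) ∧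
      (∃ g : E → ℝ → ℝ, (∀ x t, 0 ≤ g x t) ∧ (∀ x t, ‖x‖ ≤ (n + 1 : ℝ) → g x t = 0) ∧
      IsSol (Metric.closedBall 0 (n + 1 + 3)) A B (fun x t =>
        β x * v x t - α x * v x t ^ p + g x t) v) ∧
      ∀ x ∈ Metric.closedBall (0 : E) (n + 1 + 2), ∀ t ∈ Icc (1 / (n + 1 : ℝ)) (n + 1),
        u x (t - 1 / (n + 1)) ≤ v x t := fun n => by
    obtain ⟨κ, Λ, D⟩ := hD (n + 1 + 3) (by linarith [hn1 n])
    obtain ⟨v, M, h⟩ := exists_approx_ge hp (hn1 n) D huc hu0 hu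
    exact ⟨v, κ, M, D.pos, h⟩
  choose v k M hk hv hv0 hg hge using hex
  have hsol : ∀ n : ℕ, ∀ R : ℝ, R ≤ n + 1 → IsSol (Metric.ball 0 R) A B
      (fun x t => β x * v n x t - α x * v n x t ^ p) (v n) := fun n R hR x hx t => by
    obtain ⟨g, -, g0, gs⟩ := hg n
    have hx' := mem_ball_zero_iff.1 hx
    have := gs x (mem_closedBall_zero_iff.2 (by linarith)) t
    simpa only [g0 x t (by linarith), add_zero] using this
  set l : Ultrafilter ℕ := hyperfilter ℕ with hl
  have hlt : (l : Filter ℕ) ≤ atTop := Nat.hyperfilter_le_atTop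
  have hev : ∀ R : ℝ, ∀ᶠ n : ℕ in l, R ≤ n + 1 := fun R => by
    refine hlt ?_
    filter_upwards [tendsto_natCast_atTop_atTop.eventually_ge_atTop R] with n hn
    linarith
  have hloc : ∀ x0 : E, ∃ κ P, 0 < κ ∧ ∀ᶠ n in l, LC κ (Metric.ball x0 (1 / 2)) (v n) P ∧
      (∀ x ∈ Metric.ball x0 (1 / 2), ∀ t, v n x t ≤ P) ∧
      IsSol (Metric.ball x0 (1 / 2)) A B
        (fun x t => β x * v n x t - α x * v n x t ^ p) (v n) := fun x0 => by
    obtain ⟨κ, Λ, D⟩ := hD (2 * (‖x0‖ + 3)) (by positivity)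
    obtain ⟨P, hP⟩ := exists_interior_LC hp hp2 x0 rfl D
    refine ⟨κ, P, D.pos, ?_⟩
    filter_upwards [hev (2 * (‖x0‖ + 3))] with n hn
    obtain ⟨h1, h2⟩ := hP (v n) (k n) (M n) (hk n) (hv n) (hv0 n) (hsol n _ hn)
    refine ⟨h1, h2, fun x hx t => hsol n _ hn x ?_ t⟩
    have q1 := mem_ball_iff_norm.1 hx
    have q2 := norm_add_le x0 (x - x0)
    rw [add_sub_cancel] at q2
    have := norm_nonneg x0
    exact mem_ball_zero_iff.2 (by linarith)
  have hlim : ∀ x t, ∃ z, Tendsto (fun n => v n x t) l (𝓝 z) := fun x t => by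
    obtain ⟨κ, P, -, h⟩ := hloc x
    exact l.exists_tendsto_of_norm_le (M := P)
      (h.mono fun n hn => hn.1.b0 x (Metric.mem_ball_self (by norm_num)) t)
  choose U hU using hlim
  have hU0 : ∀ x t, 0 ≤ U x t := fun x t => ge_of_tendsto' (hU x t) fun n => hv0 n x t
  refine ⟨U, fun x0 => ?_, fun x _ t => ?_, hU0, fun x t ht => ?_⟩
  · obtain ⟨κ, P, hκ, h⟩ := hloc x0
    exact ⟨κ, P, hκ, (LC.of_tendsto l hκ Metric.isOpen_ball (h.mono fun n hn => hn.1)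
      fun x _ t => hU x t).1⟩
  · obtain ⟨κ, P, hκ, h⟩ := hloc x
    have hI : IsSol (Metric.ball x (1 / 2)) A B
        (fun x t => β x * U x t - α x * U x t ^ p) U → HasDerivAt (U x) (A x (D2 U x t)
          + B x (D1 U x t) + (β x * U x t - α x * U x t ^ p)) t := fun hI =>
      hI x (Metric.mem_ball_self (by norm_num)) t
    refine hI (IsSol.of_tendsto l hκ Metric.isOpen_ball (h.mono fun n hn => hn.1)
      (fun x _ t => hU x t) (h.mono fun n hn => hn.2.2) (fun y _ t => ?_) (fun y hy t => ?_))
    · exact ((hU y t).const_mul _).sub (((hU y t).rpow_const (Or.inr (by linarith))).const_mul _)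
    · refine (EqcAt.of_LC hκ Metric.isOpen_ball (h.mono fun n hn => hn.1) hy t).1.of_le
        (L := |β y| + |α y| * (p * P ^ (p - 1))) ?_
      filter_upwards [h] with n hn t'
      have h1 : |v n y t ^ p - v n y t' ^ p| ≤ p * P ^ (p - 1) * |v n y t - v n y t'| :=
        abs_rpow_sub_rpow_le hp.le ⟨hv0 n y t, hn.2.1 y hy t⟩ ⟨hv0 n y t', hn.2.1 y hy t'⟩
      have e : (β y * v n y t - α y * v n y t ^ p) - (β y * v n y t' - α y * v n y t' ^ p)
          = β y * (v n y t - v n y t') - α y * (v n y t ^ p - v n y t' ^ p) := by ring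
      rw [e, Real.norm_eq_abs, Real.norm_eq_abs]
      refine (abs_sub _ _).trans ?_
      rw [abs_mul, abs_mul]
      have := mul_le_mul_of_nonneg_left h1 (abs_nonneg (α y))
      linarith
  · rcases ht.eq_or_lt with rfl | ht
    · rw [hu0]; exact hU0 x 0
    have hc : ContinuousAt (fun s => u x s) t := by
      have h1 : ContinuousAt (fun q : E × ℝ => u q.1 q.2) (x, t) :=
        huc.continuousAt (prod_mem_nhds univ_mem (Ici_mem_nhds ht))
      exact h1.comp (by fun_prop : ContinuousAt (fun s : ℝ => (x, s)) t)
    have h0 : Tendsto (fun n : ℕ => t - 1 / ((n : ℝ) + 1)) l (𝓝 t) := by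
      have := (tendsto_one_div_add_atTop_nhds_zero_nat (𝕜 := ℝ)).const_sub t
      rw [sub_zero] at this
      exact this.mono_left hlt
    refine le_of_tendsto_of_tendsto (hc.tendsto.comp h0) (hU x t) ?_
    filter_upwards [hev ‖x‖, hev t, hev (1 / t)] with n h1 h2 h3
    refine hge n x (mem_closedBall_zero_iff.2 (by linarith)) t ⟨?_, h2⟩
    rw [one_div_le (by linarith [hn1 n]) ht]
    exact h3

end Interior

section Concrete

set_option linter.unusedSectionVars false
set_option maxSynthPendingDepth 3

variable {d : ℕ} {κ R K : ℝ}

lemma LocHolder.continuous {f : EuclideanSpace ℝ (Fin d) → ℝ} (hf : LocHolder f) :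
    Continuous f := by
  refine continuous_iff_continuousAt.2 fun x => ?_
  obtain ⟨κ, C, hκ, -, -, h⟩ := hf _ (isCompact_closedBall x 1)
  have h0 : Tendsto (fun y => C * ‖y - x‖ ^ κ) (𝓝 x) (𝓝 0) := by
    have : Continuous fun y => C * ‖y - x‖ ^ κ :=
      continuous_const.mul ((continuous_id.sub continuous_const).norm.rpow_const
        fun _ => Or.inr hκ.le)
    simpa [Real.zero_rpow hκ.ne'] using this.tendsto x
  rw [ContinuousAt, tendsto_iff_norm_sub_tendsto_zero]
  refine squeeze_zero' (Eventually.of_forall fun _ => norm_nonneg _) ?_ h0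
  filter_upwards [Metric.closedBall_mem_nhds x one_pos] with y hy
  exact h y hy x (Metric.mem_closedBall_self zero_le_one)

lemma LocHolder.eventually_HB {f : EuclideanSpace ℝ (Fin d) → ℝ} (hf : LocHolder f) (R : ℝ) :
    ∀ᶠ κ in 𝓝[>] (0 : ℝ), ∃ K, HB κ (Metric.closedBall 0 R) f K := by
  obtain ⟨κ₀, C, hκ₀, -, hC, h⟩ := hf _ (isCompact_closedBall 0 R)
  obtain ⟨N, hN⟩ := (isCompact_closedBall (0 : EuclideanSpace ℝ (Fin d)) R).exists_bound_of_continuousOn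
    hf.continuous.continuousOn
  filter_upwards [Ioo_mem_nhdsGT hκ₀] with κ hκ
  refine ⟨max N (C * (2 * R) ^ (κ₀ - κ)), fun x hx => (hN x hx).trans (le_max_left _ _),
    fun x hx y hy => (h x hx y hy).trans ?_⟩
  refine le_trans ?_ (mul_le_mul_of_nonneg_right (le_max_right _ _) (by positivity))
  rw [mul_assoc]
  refine mul_le_mul_of_nonneg_left ?_ hC
  have hxy : ‖x - y‖ ≤ 2 * R := by
    rw [mem_closedBall_zero_iff] at hx hy
    linarith [norm_sub_le x y]
  rcases (norm_nonneg (x - y)).eq_or_lt with h0 | h0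
  · rw [← h0, Real.zero_rpow hκ₀.ne', Real.zero_rpow hκ.1.ne', mul_zero]
  · calc ‖x - y‖ ^ κ₀ = ‖x - y‖ ^ (κ₀ - κ) * ‖x - y‖ ^ κ := by
          rw [← Real.rpow_add h0, sub_add_cancel]
      _ ≤ _ := by
          gcongr
          linarith [hκ.2]

lemma exists_HB_sum {E F ι : Type*} [NormedAddCommGroup E] [NormedAddCommGroup F] [NormedSpace ℝ E]
    [NormedSpace ℝ F] {s : Set E} (t : Finset ι) {f : ι → E → F} (h : ∀ i, ∃ K, HB κ s (f i) K) :
    ∃ K, HB κ s (fun x => ∑ i ∈ t, f i x) K := by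
  classical
  induction t using Finset.induction_on with
  | empty => exact ⟨0, by simpa using HB.const le_rfl (c := (0 : F)) (by simp)⟩
  | insert i t hi ih =>
    obtain ⟨K, hK⟩ := ih
    obtain ⟨L, hL⟩ := h i
    exact ⟨L + K, by simpa only [Finset.sum_insert hi] using hL.add hK⟩

/-- The second order part of the operator, acting on Hessians. -/
noncomputable def opA (a : Fin d → Fin d → EuclideanSpace ℝ (Fin d) → ℝ)
    (x : EuclideanSpace ℝ (Fin d)) :
    (EuclideanSpace ℝ (Fin d) →L[ℝ] EuclideanSpace ℝ (Fin d) →L[ℝ] ℝ) →L[ℝ] ℝ :=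
  ∑ i, ∑ j, a i j x • ((1 / 2 : ℝ) •
    (ContinuousLinearMap.apply ℝ ℝ (EuclideanSpace.single j 1)).comp
      (ContinuousLinearMap.apply ℝ (EuclideanSpace ℝ (Fin d) →L[ℝ] ℝ) (EuclideanSpace.single i 1)))

/-- The first order part of the operator, acting on gradients. -/
noncomputable def opB (b : Fin d → EuclideanSpace ℝ (Fin d) → ℝ)
    (x : EuclideanSpace ℝ (Fin d)) : (EuclideanSpace ℝ (Fin d) →L[ℝ] ℝ) →L[ℝ] ℝ :=
  ∑ i, b i x • ContinuousLinearMap.apply ℝ ℝ (EuclideanSpace.single i 1)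

variable {a : Fin d → Fin d → EuclideanSpace ℝ (Fin d) → ℝ}
  {b : Fin d → EuclideanSpace ℝ (Fin d) → ℝ} {α β : EuclideanSpace ℝ (Fin d) → ℝ} {p : ℝ}

lemma opA_apply (x : EuclideanSpace ℝ (Fin d))
    (T : EuclideanSpace ℝ (Fin d) →L[ℝ] EuclideanSpace ℝ (Fin d) →L[ℝ] ℝ) :
    opA a x T = (1 / 2) * ∑ i, ∑ j,
      a i j x * T (EuclideanSpace.single i 1) (EuclideanSpace.single j 1) := by
  simp only [opA, sum_apply, smul_apply, smul_eq_mul, Finset.mul_sum,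
    ContinuousLinearMap.comp_apply, ContinuousLinearMap.apply_apply]
  refine Finset.sum_congr rfl fun i _ => Finset.sum_congr rfl fun j _ => ?_
  ring

lemma opB_apply (x : EuclideanSpace ℝ (Fin d)) (S : EuclideanSpace ℝ (Fin d) →L[ℝ] ℝ) :
    opB b x S = ∑ i, b i x * S (EuclideanSpace.single i 1) := by
  simp only [opB, sum_apply, smul_apply, smul_eq_mul,
    ContinuousLinearMap.apply_apply]

lemma opA_tens (x v w : EuclideanSpace ℝ (Fin d)) :
    opA a x (tens v w) = (1 / 2) * ∑ i, ∑ j, a i j x * v i * w j := by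
  rw [opA_apply]
  simp only [tens_apply, EuclideanSpace.inner_single_right]
  simp [mul_assoc]

lemma exists_elliptic_const (ha : ∀ i j, Continuous (a i j))
    (ha_ell : ∀ (x ν : EuclideanSpace ℝ (Fin d)), ν ≠ 0 → 0 < ∑ i, ∑ j, a i j x * ν i * ν j)
    (R : ℝ) : ∃ Λ, 0 < Λ ∧ ∀ x ∈ Metric.closedBall (0 : EuclideanSpace ℝ (Fin d)) R, ∀ v,
      ‖v‖ ^ 2 ≤ Λ * opA a x (tens v v) := by
  have hc : Continuous fun q : EuclideanSpace ℝ (Fin d) × EuclideanSpace ℝ (Fin d) =>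
      ∑ i, ∑ j, a i j q.1 * q.2 i * q.2 j := by
    refine continuous_finsetSum _ fun i _ => continuous_finsetSum _ fun j _ => ?_
    have := (ha i j).comp (continuous_fst (X := EuclideanSpace ℝ (Fin d))
      (Y := EuclideanSpace ℝ (Fin d)))
    exact (this.mul (by fun_prop)).mul (by fun_prop)
  obtain ⟨c, hc0, h⟩ := ((isCompact_closedBall (0 : EuclideanSpace ℝ (Fin d)) R).prod
    (isCompact_sphere (0 : EuclideanSpace ℝ (Fin d)) 1)).exists_forall_le' hc.continuousOn
    (a := 0) fun q hq => ha_ell q.1 q.2 (ne_zero_of_mem_unit_sphere ⟨q.2, hq.2⟩)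
  refine ⟨2 / c, by positivity, fun x hx v => ?_⟩
  rw [opA_tens]
  rcases eq_or_ne v 0 with rfl | hv
  · simp
  have hn : 0 < ‖v‖ := norm_pos_iff.2 hv
  have h1 := h (x, ‖v‖⁻¹ • v) ⟨hx, by simp [norm_smul, hn.ne']⟩
  have h2 : ∑ i, ∑ j, a i j x * (‖v‖⁻¹ • v) i * (‖v‖⁻¹ • v) j
      = (‖v‖ ^ 2)⁻¹ * ∑ i, ∑ j, a i j x * v i * v j := by
    simp only [Finset.mul_sum, PiLp.smul_apply, smul_eq_mul]
    refine Finset.sum_congr rfl fun i _ => Finset.sum_congr rfl fun j _ => ?_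
    ring
  simp only [h2] at h1
  rw [le_inv_mul_iff₀ (by positivity)] at h1
  rw [← mul_assoc, show 2 / c * (1 / 2) = 1 / c by ring, one_div, le_inv_mul_iff₀ hc0, mul_comm]
  exact h1

lemma exists_ballData (ha_holder : ∀ i j, LocHolder (a i j)) (hb_holder : ∀ i, LocHolder (b i))
    (ha_symm : ∀ i j x, a i j x = a j i x)
    (ha_ell : ∀ (x ν : EuclideanSpace ℝ (Fin d)), ν ≠ 0 → 0 < ∑ i, ∑ j, a i j x * ν i * ν j)
    (hα_holder : LocHolder α) (hβ_holder : LocHolder β) (hα : ∀ x, 0 < α x) (R : ℝ) :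
    ∃ κ Λ, BallData κ Λ R (opA a) (opB b) β α := by
  have h1 : ∀ᶠ κ in 𝓝[>] (0 : ℝ), ∀ i j, ∃ K, HB κ (Metric.closedBall 0 R) (a i j) K :=
    eventually_all.2 fun i => eventually_all.2 fun j => (ha_holder i j).eventually_HB R
  have h2 : ∀ᶠ κ in 𝓝[>] (0 : ℝ), ∀ i, ∃ K, HB κ (Metric.closedBall 0 R) (b i) K :=
    eventually_all.2 fun i => (hb_holder i).eventually_HB R
  have h0 : ∀ᶠ κ in 𝓝[>] (0 : ℝ), κ ∈ Ioo (0 : ℝ) 1 := Ioo_mem_nhdsGT one_pos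
  obtain ⟨κ, ⟨hκ0, hκ1⟩, hA, hB, ⟨K₁, hK₁⟩, K₂, hK₂⟩ := (h0.and
    (h1.and (h2.and ((hα_holder.eventually_HB R).and (hβ_holder.eventually_HB R))))).exists
  have hsm : ∀ {F : Type} [NormedAddCommGroup F] [NormedSpace ℝ F] (c : F)
      {f : EuclideanSpace ℝ (Fin d) → ℝ}, (∃ K, HB κ (Metric.closedBall 0 R) f K) →
      ∃ K, HB κ (Metric.closedBall 0 R) (fun x => f x • c) K := fun c f ⟨K, hK⟩ =>
    ⟨_, hK.smul (HB.const (norm_nonneg c) le_rfl)⟩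
  obtain ⟨K₃, hK₃⟩ : ∃ K, HB κ (Metric.closedBall 0 R) (opA a) K :=
    exists_HB_sum _ fun i => exists_HB_sum _ fun j => hsm _ (hA i j)
  obtain ⟨K₄, hK₄⟩ : ∃ K, HB κ (Metric.closedBall 0 R) (opB b) K :=
    exists_HB_sum _ fun i => hsm _ (hB i)
  obtain ⟨K₅, hK₅0, hK₅⟩ := exists_elliptic_const (fun i j => (ha_holder i j).continuous) ha_ell R
  obtain ⟨c, hc0, hc⟩ := (isCompact_closedBall (0 : EuclideanSpace ℝ (Fin d)) R).exists_forall_le'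
    hα_holder.continuous.continuousOn (a := 0) fun x _ => hα x
  obtain ⟨Λ, hΛ⟩ : ∃ Λ : ℝ, ∀ z ∈ ({1, K₁, K₂, K₃, K₄, K₅, c⁻¹} : Finset ℝ), z ≤ Λ :=
    ({1, K₁, K₂, K₃, K₄, K₅, c⁻¹} : Finset ℝ).bddAbove
  simp only [Finset.mem_insert, Finset.mem_singleton, forall_eq_or_imp, forall_eq] at hΛ
  obtain ⟨l0, l1, l2, l3, l4, l5, l6⟩ := hΛ
  have hA' := hK₃.mono subset_rfl l3
  have hB' := hK₄.mono subset_rfl l4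
  refine ⟨κ, Λ, hκ0, hκ1, ⟨l0, hA'.b, hA'.h, hB'.b, hB'.h, fun x _ v w => ?_, fun x hx v => ?_⟩,
    hK₂.mono subset_rfl l2, hK₁.mono subset_rfl l1, fun x hx => ?_⟩
  · rw [opA_tens, opA_tens, Finset.sum_comm]
    congr 1
    refine Finset.sum_congr rfl fun i _ => Finset.sum_congr rfl fun j _ => ?_
    rw [ha_symm]
    ring
  · have h3 := hK₅ x hx v
    have h4 : 0 ≤ opA a x (tens v v) := by
      by_contra! h
      nlinarith [sq_nonneg ‖v‖]
    exact h3.trans (by gcongr)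
  · calc 1 = c⁻¹ * c := (inv_mul_cancel₀ hc0.ne').symm
      _ ≤ Λ * α x := mul_le_mul l6 (hc x hx) hc0.le (by linarith)

lemma C2At.pd_pd {u : EuclideanSpace ℝ (Fin d) → ℝ → ℝ} {x : EuclideanSpace ℝ (Fin d)} {t : ℝ}
    (h : C2At u x t) (i j : Fin d) : pd i (pd j fun y => u y t) x
      = D2 u x t (EuclideanSpace.single i 1) (EuclideanSpace.single j 1) := by
  have := (ContinuousLinearMap.apply ℝ ℝ (EuclideanSpace.single j (1 : ℝ))).hasFDerivAt.comp x h.d2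
  exact congrArg (fun l => l (EuclideanSpace.single i 1)) this.fderiv

lemma C2At.opA_add_opB {u : EuclideanSpace ℝ (Fin d) → ℝ → ℝ} {x : EuclideanSpace ℝ (Fin d)}
    {t : ℝ} (h : C2At u x t) : opA a x (D2 u x t) + opB b x (D1 u x t)
      = (1 / 2) * ∑ i, ∑ j, a i j x * pd i (pd j fun y => u y t) x
        + ∑ i, b i x * pd i (fun y => u y t) x := by
  simp only [opA_apply, opB_apply, h.pd_pd]
  rfl

lemma ContDiff.c2At {u : EuclideanSpace ℝ (Fin d) → ℝ → ℝ} {t : ℝ}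
    (h : ContDiff ℝ 2 fun y => u y t) (x : EuclideanSpace ℝ (Fin d)) : C2At u x t := by
  have h1 : ContDiff ℝ 1 fun y => D1 u y t := h.fderiv_right (by norm_num)
  exact ⟨Eventually.of_forall fun y => (h.differentiable two_ne_zero y).hasFDerivAt,
    (h1.differentiable one_ne_zero x).hasFDerivAt⟩

lemma LC.continuousOn_D2 {E : Type*} [NormedAddCommGroup E] [InnerProductSpace ℝ E]
    [FiniteDimensional ℝ E] {s : Set E} {u : E → ℝ → ℝ} {M t : ℝ} (hκ : 0 < κ) (h : LC κ s u M) :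
    ContinuousOn (fun y => D2 u y t) s := fun x hx => by
  have h0 : Tendsto (fun y => M * ‖y - x‖ ^ κ) (𝓝[s] x) (𝓝 0) := by
    have : Continuous fun y => M * ‖y - x‖ ^ κ :=
      continuous_const.mul ((continuous_id.sub continuous_const).norm.rpow_const
        fun _ => Or.inr hκ.le)
    simpa [Real.zero_rpow hκ.ne'] using (this.tendsto x).mono_left nhdsWithin_le_nhds
  rw [ContinuousWithinAt, tendsto_iff_norm_sub_tendsto_zero]
  refine squeeze_zero' (Eventually.of_forall fun _ => norm_nonneg _) ?_ h0
  filter_upwards [self_mem_nhdsWithin] with y hy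
  exact h.h2 y hy x hx t

lemma contDiff_two_of_LC {u : EuclideanSpace ℝ (Fin d) → ℝ → ℝ}
    (h : ∀ x, ∃ κ M, 0 < κ ∧ LC κ (Metric.ball x (1 / 2)) u M) (t : ℝ) :
    ContDiff ℝ 2 fun y => u y t := by
  have h1 : ∀ x, HasFDerivAt (fun y => u y t) (D1 u x t) x := fun x => by
    obtain ⟨κ, M, -, hL⟩ := h x
    exact hL.d1 x (Metric.mem_ball_self (by norm_num)) t
  have h2 : ∀ x, HasFDerivAt (fun y => D1 u y t) (D2 u x t) x := fun x => by
    obtain ⟨κ, M, -, hL⟩ := h x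
    exact hL.d2 x (Metric.mem_ball_self (by norm_num)) t
  have h3 : Continuous fun y => D2 u y t := continuous_iff_continuousAt.2 fun x => by
    obtain ⟨κ, M, hκ, hL⟩ := h x
    exact (hL.continuousOn_D2 hκ).continuousAt (Metric.ball_mem_nhds x (by norm_num))
  have h4 : ContDiff ℝ 1 fun y => D1 u y t :=
    contDiff_one_iff_fderiv.2 ⟨fun x => (h2 x).differentiableAt, h3⟩
  exact (contDiff_succ_iff_hasFDerivAt (n := 1)).2 ⟨fun y => D1 u y t, h4, h1⟩

end Concrete

/-- Comparison result: if uniqueness holds for `β₂, α₂`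
with `β₁ ≤ β₂` and `0 < α₂ ≤ α₁`, then it holds for `β₁, α₁`. -/
theorem stmt_7 {d : ℕ} (hd : 1 ≤ d) (p : ℝ) (hp1 : 1 < p) (hp2 : p ≤ 2)
    (a : Fin d → Fin d → EuclideanSpace ℝ (Fin d) → ℝ)
    (b : Fin d → EuclideanSpace ℝ (Fin d) → ℝ)
    (ha_holder : ∀ i j, LocHolder (a i j))
    (hb_holder : ∀ i, LocHolder (b i))
    (ha_symm : ∀ i j x, a i j x = a j i x)
    (ha_ell : ∀ (x ν : EuclideanSpace ℝ (Fin d)), ν ≠ 0 →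
      0 < ∑ i, ∑ j, a i j x * ν i * ν j)
    (α₁ α₂ β₁ β₂ : EuclideanSpace ℝ (Fin d) → ℝ)
    (hα₁_holder : LocHolder α₁) (hα₂_holder : LocHolder α₂)
    (hβ₁_holder : LocHolder β₁) (hβ₂_holder : LocHolder β₂)
    (hβ_le : ∀ x, β₁ x ≤ β₂ x)
    (hβ₂_bdd : ∃ M : ℝ, ∀ x, β₂ x ≤ M)
    (hα : ∀ x, 0 < α₂ x ∧ α₂ x ≤ α₁ x)
    (huniq : UniqueZeroSol a b β₂ α₂ p) :
    UniqueZeroSol a b β₁ α₁ p := by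
  intro u huc hu_nonneg hux hut hu_eq hu0
  have hsub : ∀ x t, 0 < t → SubAt (opA a) (opB b) (fun x _ z => β₂ x * z - α₂ x * z ^ p) u x t :=
      fun x t ht => by
    have hc := (hux t ht).c2At x
    have hd := (((hut x).differentiableOn one_ne_zero).differentiableAt (Ioi_mem_nhds ht)).hasDerivAt
    refine ⟨hc, _, hd, ?_⟩
    rw [hu_eq x t ht, hc.opA_add_opB]
    have h0 := hu_nonneg x t ht.le
    have h1 := mul_le_mul_of_nonneg_right (hβ_le x) h0
    have h2 := mul_le_mul_of_nonneg_right (hα x).2 (Real.rpow_nonneg h0 p)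
    linarith
  obtain ⟨U, hL, hU, hU0, hle⟩ := exists_solution_ge hp1 hp2 (fun R _ => exists_ballData ha_holder
    hb_holder ha_symm ha_ell hα₂_holder hβ₂_holder (fun x => (hα x).1) R) huc hu0 hsub
  have hcd := contDiff_two_of_LC hL
  have hU_zero := huniq U ?_ (fun x t _ => hU0 x t) (fun t _ => hcd t) (fun x => ?_)
    (fun x t _ => ?_) fun x => ?_
  · exact fun x t ht => le_antisymm ((hle x t ht).trans (hU_zero x t ht).le) (hu_nonneg x t ht)
  · refine Continuous.continuousOn (continuous_iff_continuousAt.2 fun q => ?_)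
    obtain ⟨κ, M, -, h⟩ := hL q.1
    exact h.continuousAt Metric.isOpen_ball (Metric.mem_ball_self (by norm_num)) q.2
  · obtain ⟨κ, M, hκ, h⟩ := hL x
    obtain ⟨h1, h2⟩ := h.continuous_D Metric.isOpen_ball hκ (Metric.mem_ball_self (by norm_num))
    have hd := fun t => hU x (mem_univ x) t
    have hcU : Continuous (U x) := continuous_iff_continuousAt.2 fun t => (hd t).continuousAt
    refine (contDiff_one_iff_deriv.2 ⟨fun t => (hd t).differentiableAt, ?_⟩).contDiffOn
    rw [funext fun t => (hd t).deriv]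
    have := hcU.rpow_const (p := p) fun _ => Or.inr (by linarith)
    fun_prop
  · rw [← (hcd t).c2At x |>.opA_add_opB, add_sub_assoc]
    exact (hU x (mem_univ x) t).deriv
  · obtain ⟨κ, M, -, h⟩ := hL x
    exact h.zero x (Metric.mem_ball_self (by norm_num)) 0 le_rfl
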